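/- Let f:[0,1]→[0,1] be a C^∞ map with h_top(f) > 0. Then f has only finitely many maximum measures, and its periodic points satisfy a multiplicative lower bound. -/

import Mathlib

open Set Filter Topology MeasureTheory
open scoped Manifold ENNReal NNReal RealInnerProductSpace

noncomputable section

/-! ### Euclidean spaces and unit cubes -/

abbrev Euc (n : ℕ) : Type := EuclideanSpace ℝ (Fin n)

def unitCube (k : ℕ) : Set (Euc k) := {t | ∀ i, |t i| ≤ 1}

/-! ### Bowen–Dinaburg covering numbers and topological entropies -/

section MetricDyn

variable {X : Type*} [MetricSpace X]

/-- The `(ε,n)`-dynamical ball centered at `x`. -/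
def dynBall (f : X → X) (ε : ℝ) (n : ℕ) (x : X) : Set X :=
  {y | ∀ m, m < n → dist (f^[m] y) (f^[m] x) < ε}

/-- The `(ε,n)`-covering number of `S`: minimal number of `(ε,n)`-dynamical balls
centered at points of `S` needed to cover `S` (`⊤` if there is no finite cover). -/
def coverNum (f : X → X) (ε : ℝ) (n : ℕ) (S : Set X) : ℕ∞ :=
  sInf {m : ℕ∞ | ∃ F : Finset X, ↑F ⊆ S ∧ (S ⊆ ⋃ x ∈ F, dynBall f ε n x) ∧ m = F.card}

/-- Logarithm on `ℕ∞`. -/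
def elog : ℕ∞ → EReal := WithTop.recTopCoe ⊤ (fun k : ℕ => ((Real.log k : ℝ) : EReal))

/-- Topological entropy of the subset `S` (Bowen–Dinaburg):
`lim_{ε→0} limsup_n (1/n) log r_f(ε,n,S)`, the limit being a supremum by monotonicity. -/
def entSet (f : X → X) (S : Set X) : EReal :=
  ⨆ ε : {ε : ℝ // 0 < ε},
    Filter.atTop.limsup fun n : ℕ => (((n : ℝ)⁻¹ : ℝ) : EReal) * elog (coverNum f (ε : ℝ) n S)

/-- Topological entropy of `f`. -/
def htop (f : X → X) : EReal := entSet f Set.univ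

/-- Topological entropy of a collection of subsets: `sup_{D ∈ 𝓓} h_top(f,D)`. -/
def entColl (f : X → X) (D : Set (Set X)) : EReal := ⨆ S ∈ D, entSet f S

def supCoverNum (f : X → X) (ε : ℝ) (n : ℕ) (D : Set (Set X)) : ℕ∞ :=
  ⨆ S ∈ D, coverNum f ε n S

/-- Uniform topological entropy of a collection of subsets. -/
def unifEntColl (f : X → X) (D : Set (Set X)) : EReal :=
  ⨆ ε : {ε : ℝ // 0 < ε},
    Filter.atTop.limsup fun n : ℕ =>
      (((n : ℝ)⁻¹ : ℝ) : EReal) * elog (supCoverNum f (ε : ℝ) n D)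

/-- Lipschitz constant of `f` (as an extended nonnegative real). -/
def lipConst (f : X → X) : ℝ≥0∞ := ⨆ (x : X) (y : X), edist (f x) (f y) / edist x y

/-- `log Lip(f)`. -/
def logLip (f : X → X) : EReal := ENNReal.log (lipConst f)

/-- `lip(f) = max (log Lip f) 0`. -/
def lipPlus (f : X → X) : EReal := max (logLip f) 0

/-- Number of fixed points of `f^n`. -/
def periodicCount (f : X → X) (n : ℕ) : ℕ∞ := ENat.card {x : X // f^[n] x = x}

/-- The periodic points of `f` satisfy a multiplicative lower bound:
for some `p ≥ 1`, `liminf_{n→∞, p∣n} e^{-n h_top(f)} #{x : f^n x = x} > 0`. -/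
def MultLowerBound (f : X → X) : Prop :=
  ∃ p : ℕ, 1 ≤ p ∧
    0 < Filter.liminf
      (fun n : ℕ => ENNReal.ofReal (Real.exp (-(n : ℝ) * (htop f).toReal)) *
        (periodicCount f n : ℝ≥0∞))
      (Filter.atTop ⊓ Filter.principal {n : ℕ | p ∣ n})

end MetricDyn

/-! ### Measure-theoretic (Kolmogorov–Sinai) entropy -/

section MeasDyn

variable {X : Type*} [MeasurableSpace X]

/-- A finite measurable partition of `X`, indexed by `Fin N`. -/
def IsMeasPartition {N : ℕ} (P : Fin N → Set X) : Prop :=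
  (∀ i, MeasurableSet (P i)) ∧ Pairwise (Function.onFun Disjoint P) ∧ (⋃ i, P i) = Set.univ

/-- Entropy of the `n`-th dynamical refinement of the partition `P`. -/
def dynHn (f : X → X) (μ : Measure X) {N : ℕ} (P : Fin N → Set X) (n : ℕ) : ℝ :=
  ∑ a : Fin n → Fin N,
    Real.negMulLog (μ (⋂ i : Fin n, f^[(i : ℕ)] ⁻¹' P (a i))).toReal

/-- Kolmogorov–Sinai entropy of `μ`:
`sup_P lim_n (1/n) H(⋁_{i<n} f^{-i} P) = sup_P inf_{n>0} (1/n) H_n(P)`. -/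
def ksEntropy (f : X → X) (μ : Measure X) : EReal :=
  ⨆ (N : ℕ) (P : Fin N → Set X) (_ : IsMeasPartition P),
    ((⨅ n : {n : ℕ // 0 < n}, dynHn f μ P (n : ℕ) / (n : ℝ) : ℝ) : EReal)

/-- An invariant Borel probability measure. -/
def IsInvariantProb (f : X → X) (μ : Measure X) : Prop :=
  IsProbabilityMeasure μ ∧ MeasurePreserving f μ μ

/-- A maximum measure : an ergodic invariant probability measure whose entropy
realizes the supremum of the entropies of all invariant probability measures. -/
def IsMaxMeasure (f : X → X) (μ : Measure X) : Prop :=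
  IsInvariantProb f μ ∧ Ergodic f μ ∧
    ∀ ν : Measure X, IsInvariantProb f ν → ksEntropy f ν ≤ ksEntropy f μ

end MeasDyn

/-! ### C^r sizes on a manifold, singular disks, dimensional entropies -/

/-- A `C^r` size on `M`, given by a finite atlas of `C^r`-compatible charts. -/
structure CrAtlasSize (r : ℕ∞) (d : ℕ) (M : Type*) [TopologicalSpace M]
    [ChartedSpace (Euc d) M] : Type _ where
  num : ℕ
  chart : Fin num → PartialHomeomorph M (Euc d)
  covers : ∀ x : M, ∃ i, x ∈ (chart i).source
  smooth_to : ∀ i, ContMDiffOn (𝓡 d) (𝓡 d) r (chart i) (chart i).source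
  smooth_symm : ∀ i, ContMDiffOn (𝓡 d) (𝓡 d) r (chart i).symm (chart i).target

section ManifoldDefs

variable {d : ℕ} {M : Type*} [TopologicalSpace M] [ChartedSpace (Euc d) M] {ρ : ℕ∞}

/-- The `C^s` size (finite `s`) of a parametrized disk `φ : Q^k → M`:
sup over points of the cube, inf over charts containing the image point, of the
maximal norm of the derivatives of order `≤ s` of the coordinate expressions. -/
def sizeNat (A : CrAtlasSize ρ d M) (s : ℕ) {k : ℕ} (φ : Euc k → M) : ℝ≥0∞ :=
  ⨆ t ∈ unitCube k,
    ⨅ i ∈ {i | φ t ∈ (A.chart i).source},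
      ⨆ j ∈ Finset.range (s + 1),
        (‖iteratedFDeriv ℝ j (fun u => A.chart i (φ u)) t‖₊ : ℝ≥0∞)

/-- The `C^s` size for `s ∈ ℕ∞`; for `s = ∞` it is the supremum of the finite sizes. -/
def diskSize (A : CrAtlasSize ρ d M) (s : ℕ∞) {k : ℕ} (φ : Euc k → M) : ℝ≥0∞ :=
  ⨆ j : {j : ℕ // (j : ℕ∞) ≤ s}, sizeNat A (j : ℕ) φ

/-- A `C^r` singular `k`-disk: a map `Q^k → M` which is `C^r` on a neighborhood
of the cube. -/
def IsCrDisk (d : ℕ) {M : Type*} [TopologicalSpace M] [ChartedSpace (Euc d) M]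
    (rr : ℕ∞) (k : ℕ) (φ : Euc k → M) : Prop :=
  ∃ U : Set (Euc k), IsOpen U ∧ unitCube k ⊆ U ∧ ContMDiffOn (𝓡 k) (𝓡 d) rr φ U

/-- The standard uniform family: all `C^r` singular `k`-disks of `C^r` size `≤ 1`. -/
def uniformDiskMaps (A : CrAtlasSize ρ d M) (rr : ℕ∞) (k : ℕ) : Set (Euc k → M) :=
  {φ | IsCrDisk d rr k φ ∧ diskSize A rr φ ≤ 1}

/-- The images `φ(Q^k)` of a family of parametrized disks. -/
def diskImages {k : ℕ} (D : Set (Euc k → M)) : Set (Set M) :=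
  (fun φ => φ '' unitCube k) '' D

end ManifoldDefs

section ManifoldEnt

variable {d : ℕ} {M : Type*} [MetricSpace M] [ChartedSpace (Euc d) M] {ρ : ℕ∞}

/-- `H^{k,C^r}_top(f)`: the uniform `C^r` `k`-dimensional entropy of `f`
(w.r.t. the `C^r` size `A`). For `rr = ⊤` this is `H^k_top(f)`. -/
def Hknt (A : CrAtlasSize ρ d M) (rr : ℕ∞) (k : ℕ) (f : M → M) : EReal :=
  unifEntColl f (diskImages (uniformDiskMaps A rr k))

/-- `h^{k,C^r}_top(f)`: the `C^r` `k`-dimensional entropy of `f`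
(supremum of the entropies of all `C^r` singular `k`-disks). -/
def hknt (rr : ℕ∞) (k : ℕ) (f : M → M) : EReal :=
  entColl f (diskImages {φ : Euc k → M | IsCrDisk d rr k φ})

/-- The unstable (entropy) dimension `d_u(f) = min {k : H^k_top(f) = h_top(f)}`. -/
def duDim (A : CrAtlasSize ρ d M) (f : M → M) : ℕ :=
  sInf {k : ℕ | Hknt A ⊤ k f = htop f}

/-- The stable dimension `d_s(f) = d_u(f⁻¹)` if `f` is a `C^r` diffeomorphism, `0` else. -/
def dsDim (A : CrAtlasSize ρ d M) (rr : ℕ∞) (f : M → M) : ℕ :=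
  letI : ∀ p : Prop, Decidable p := Classical.propDecidable
  if h : ∃ g : M → M, ContMDiff (𝓡 d) (𝓡 d) rr g ∧
      Function.LeftInverse g f ∧ Function.RightInverse g f
  then duDim A h.choose else 0

/-- `f` is entropy-expanding: `H^{d-1}_top(f) < h_top(f)`. -/
def EntropyExpanding (A : CrAtlasSize ρ d M) (f : M → M) : Prop :=
  Hknt A ⊤ (d - 1) f < htop f

/-- `f` is entropy-hyperbolic: `d_u(f) + d_s(f) = d`. -/
def EntropyHyperbolic (A : CrAtlasSize ρ d M) (rr : ℕ∞) (f : M → M) : Prop :=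
  duDim A f + dsDim A rr f = d

end ManifoldEnt

/-! ### Resolutions and resolution entropies -/

/-- `C^r` size of a self-map of `Q^k` (Euclidean version). -/
def eucMapSize (r : ℕ) {k : ℕ} (ψ : Euc k → Euc k) : ℝ≥0∞ :=
  ⨆ t ∈ unitCube k, ⨆ j ∈ Finset.range (r + 1), (‖iteratedFDeriv ℝ j ψ t‖₊ : ℝ≥0∞)

/-- `Ψ_ω = ψ_{σ^{|ω|-1}ω} ∘ ⋯ ∘ ψ_ω` where `σ` is the shift (tail) on words. -/
def bigPsi {k : ℕ} (ψ : List ℕ → Euc k → Euc k) : List ℕ → Euc k → Euc k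
  | [] => id
  | a :: w => bigPsi ψ w ∘ ψ (a :: w)

/-- The data of a candidate resolution: a finite set of words and maps `Q^k → Q^k`. -/
structure ResolutionData (k : ℕ) where
  words : Finset (List ℕ)
  map : List ℕ → Euc k → Euc k

section Resolutions

variable {d : ℕ} {M : Type*} [TopologicalSpace M] [ChartedSpace (Euc d) M] {ρ : ℕ∞}

/-- `R` is a `C^r`-resolution of order `n` of the singular disk `φ` (for the map `f`). -/
def IsResolution (A : CrAtlasSize ρ d M) (rr : ℕ) (f : M → M) {k : ℕ}
    (φ : Euc k → M) (n : ℕ) (R : ResolutionData k) : Prop :=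
  (∀ ω ∈ R.words, ω ≠ [] ∧ ω.length ≤ n) ∧
  (∀ ω ∈ R.words, ω.tail ≠ [] → ω.tail ∈ R.words) ∧
  (∀ ω ∈ R.words, ContDiff ℝ (rr : ℕ∞) (R.map ω) ∧
      Set.MapsTo (R.map ω) (unitCube k) (unitCube k) ∧ eucMapSize rr (R.map ω) ≤ 1) ∧
  (∀ ω ∈ R.words, diskSize A (rr : ℕ∞) (f^[ω.length] ∘ φ ∘ bigPsi R.map ω) ≤ 1) ∧
  unitCube k ⊆ ⋃ ω ∈ R.words.filter (fun ω => ω.length = n), bigPsi R.map ω '' unitCube k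

/-- The size of a resolution: the number of words of length `n`. -/
def resSize (n : ℕ) {k : ℕ} (R : ResolutionData k) : ℕ :=
  (R.words.filter fun ω => ω.length = n).card

/-- `R_f(C^r, n, φ)`: minimal size of a `C^r`-resolution of order `n` of `φ`. -/
def resNum (A : CrAtlasSize ρ d M) (rr : ℕ) (f : M → M) (n : ℕ) {k : ℕ}
    (φ : Euc k → M) : ℕ∞ :=
  sInf {m : ℕ∞ | ∃ R : ResolutionData k, IsResolution A rr f φ n R ∧ m = resSize n R}

/-- `R_f(C^r, n, D)` for a family `D` of disks. -/
def supResNum (A : CrAtlasSize ρ d M) (rr : ℕ) (f : M → M) (n : ℕ) {k : ℕ}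
    (D : Set (Euc k → M)) : ℕ∞ :=
  ⨆ φ ∈ D, resNum A rr f n φ

/-- Resolution entropy of a single disk. -/
def hResDisk (A : CrAtlasSize ρ d M) (rr : ℕ) (f : M → M) {k : ℕ} (φ : Euc k → M) : EReal :=
  Filter.atTop.limsup fun n : ℕ => (((n : ℝ)⁻¹ : ℝ) : EReal) * elog (resNum A rr f n φ)

/-- `h_{R,C^r}(f,D)`: resolution entropy of a family of disks. -/
def hResColl (A : CrAtlasSize ρ d M) (rr : ℕ) (f : M → M) {k : ℕ}
    (D : Set (Euc k → M)) : EReal :=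
  ⨆ φ ∈ D, hResDisk A rr f φ

/-- `H_{R,C^r}(f,D)`: uniform resolution entropy of a family of disks. -/
def HResColl (A : CrAtlasSize ρ d M) (rr : ℕ) (f : M → M) {k : ℕ}
    (D : Set (Euc k → M)) : EReal :=
  Filter.atTop.limsup fun n : ℕ => (((n : ℝ)⁻¹ : ℝ) : EReal) * elog (supResNum A rr f n D)

end Resolutions

/-! ### C^N closeness of maps (basis of the C^r topologies) -/

section Closeness

variable {d : ℕ} {M : Type*} [MetricSpace M] [ChartedSpace (Euc d) M] {ρ : ℕ∞}

/-- `g` is `δ`-close to `f` in the `C^N` sense, w.r.t. the finite atlas of `A`: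
uniformly `δ`-close, and with all derivatives of order `≤ N` of the coordinate
expressions `δ`-close wherever both are defined. -/
def CrClose (A : CrAtlasSize ρ d M) (N : ℕ) (δ : ℝ) (f g : M → M) : Prop :=
  (∀ x : M, dist (f x) (g x) < δ) ∧
  ∀ i j, ∀ t ∈ (A.chart i).target,
    f ((A.chart i).symm t) ∈ (A.chart j).source →
    g ((A.chart i).symm t) ∈ (A.chart j).source →
    ∀ s ≤ N,
      ‖iteratedFDeriv ℝ s (fun u => A.chart j (f ((A.chart i).symm u))) t
        - iteratedFDeriv ℝ s (fun u => A.chart j (g ((A.chart i).symm u))) t‖ < δ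

end Closeness

/-! ### Horseshoes -/

/-- The full two-sided shift on `N` symbols. -/
def fullShift (N : ℕ) : (ℤ → Fin N) → (ℤ → Fin N) := fun x i => x (i + 1)

/-- `Λ` is a horseshoe for `f`: a compact invariant set on which some iterate of `f`
is topologically conjugate to a full shift on finitely many symbols. -/
def IsHorseshoe {X : Type*} [MetricSpace X] (f : X → X) (Λ : Set X) : Prop :=
  IsCompact Λ ∧ f '' Λ = Λ ∧
  ∃ (m N : ℕ), 1 ≤ m ∧ 1 ≤ N ∧
    ∃ e : Λ ≃ₜ (ℤ → Fin N),
      ∀ x y : Λ, (y : X) = f^[m] (x : X) → e y = fullShift N (e x)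

/-- Identification of tangent vectors with Euclidean vectors. -/
def tanEuc {d : ℕ} {M : Type*} [TopologicalSpace M] [ChartedSpace (Euc d) M] {x : M}
    (v : TangentSpace (𝓡 d) x) : Euc d := v

end

namespace IntervalEnt

lemma rolle_zeros (u : ℝ → ℝ) (hu : Differentiable ℝ u) (Z : Finset ℝ) :
    (∀ z ∈ Z, u z = 0) → ∃ Z' : Finset ℝ, Z.card ≤ Z'.card + 1 ∧
      ∀ w ∈ Z', deriv u w = 0 ∧ ∃ z ∈ Z, ∃ z' ∈ Z, z < w ∧ w < z' := by
  induction Z using Finset.induction_on_max with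
  | empty => intro _; exact ⟨∅, by simp, by simp⟩
  | insert m Z hm ih =>
    intro hz
    obtain ⟨Z', hc, hZ'⟩ := ih (fun z hz' => hz z (Finset.mem_insert_of_mem hz'))
    have hmn : m ∉ Z := fun h => lt_irrefl _ (hm m h)
    rcases Z.eq_empty_or_nonempty with rfl | hne
    · exact ⟨∅, by simp, by simp⟩
    · set m0 := Z.max' hne with hm0
      have hm0Z : m0 ∈ Z := Z.max'_mem hne
      obtain ⟨ξ, hξ, hd⟩ := exists_deriv_eq_zero (hm m0 hm0Z) (hu.continuous.continuousOn)
        (show u m0 = u m by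
          rw [hz m0 (Finset.mem_insert_of_mem hm0Z), hz m (Finset.mem_insert_self _ _)])
      have hξn : ξ ∉ Z' := by
        intro h
        obtain ⟨_, z, _, z', hz', _, h2⟩ := hZ' ξ h
        have := Z.le_max' z' hz'
        have := hξ.1
        linarith
      refine ⟨insert ξ Z', ?_, ?_⟩
      · rw [Finset.card_insert_of_notMem hmn, Finset.card_insert_of_notMem hξn]; omega
      · intro w hw
        rcases Finset.mem_insert.1 hw with rfl | hw
        · exact ⟨hd, m0, Finset.mem_insert_of_mem hm0Z, m, Finset.mem_insert_self _ _, hξ.1, hξ.2⟩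
        · obtain ⟨h1, z, hz1, z', hz2, h3⟩ := hZ' w hw
          exact ⟨h1, z, Finset.mem_insert_of_mem hz1, z', Finset.mem_insert_of_mem hz2, h3⟩

lemma small_of_zeros (j : ℕ) : ∀ (u : ℝ → ℝ), ContDiff ℝ (⊤ : ℕ∞) u → ∀ (a b B : ℝ), 
    0 ≤ B → ∀ (Z : Finset ℝ), (∀ z ∈ Z, z ∈ Icc a b ∧ u z = 0) → j ≤ Z.card →
    (∀ x ∈ Icc a b, |iteratedDeriv j u x| ≤ B) → ∀ x ∈ Icc a b, |u x| ≤ B * (b - a) ^ j := by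
  induction j with
  | zero =>
    intro u hu a b B hB0 Z hZ hc hB x hx
    simpa using hB x hx
  | succ j ih =>
    intro u hu a b B hB0 Z hZ hc hB x hx
    have hd : Differentiable ℝ u := hu.differentiable (by simp)
    obtain ⟨Z', hc', hZ'⟩ := rolle_zeros u hd Z (fun z hz => (hZ z hz).2)
    have hu' : ContDiff ℝ (⊤ : ℕ∞) (deriv u) := by
      have : ContDiff ℝ ((⊤ : ℕ∞) + 1) u := by simpa using hu
      exact (contDiff_succ_iff_deriv.1 this).2.2
    have key := ih (deriv u) hu' a b B hB0 Z' (by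
      intro w hw
      obtain ⟨h1, z, hz1, z', hz2, h3, h4⟩ := hZ' w hw
      exact ⟨⟨(hZ z hz1).1.1.trans h3.le, h4.le.trans (hZ z' hz2).1.2⟩, h1⟩) (by omega)
      (by intro y hy; rw [← iteratedDeriv_succ']; exact hB y hy)
    obtain ⟨z, hz⟩ : Z.Nonempty := Finset.card_pos.1 (by omega)
    have := (convex_Icc a b).norm_image_sub_le_of_norm_deriv_le (f := u)
      (fun y _ => hd y) (fun y hy => by simpa [Real.norm_eq_abs] using key y hy) (hZ z hz).1 hx
    rw [(hZ z hz).2, sub_zero, Real.norm_eq_abs, Real.norm_eq_abs] at this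
    have hz1 := (hZ z hz).1
    have hab : |x - z| ≤ b - a := by
      rw [abs_le]; constructor <;> linarith [hx.1, hx.2, hz1.1, hz1.2]
    calc |u x| ≤ B * (b - a) ^ j * |x - z| := this
      _ ≤ B * (b - a) ^ j * (b - a) := by
        apply mul_le_mul_of_nonneg_left hab
        have : 0 ≤ b - a := (abs_nonneg _).trans hab
        positivity
      _ = _ := by ring

lemma sum_sq_le {ι : Type*} [DecidableEq ι] (z : ι → ℝ) (a : ℕ) (c Z : ℝ) (hc : 0 ≤ c) :
    ∀ (n : ℕ) (F : Finset ι), F.card = n → (∀ i ∈ F, 0 ≤ z i ∧ z i ≤ Z) →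
      (∀ s > 0, ((F.filter (fun i => s ≤ z i)).card : ℝ) ≤ a + c / s) →
      ∑ i ∈ F, z i ^ 2 ≤ (a + 1) * Z ^ 2 + c ^ 2 * (1 - 1 / ((n - (a + 1) : ℕ) + 1)) := by
  intro n
  induction n with
  | zero =>
    intro F hF h1 h2
    rw [Finset.card_eq_zero] at hF
    subst hF
    simp
    positivity
  | succ n ih =>
    intro F hF h1 h2
    by_cases hn : n + 1 ≤ a + 1
    · have h3 : n + 1 - (a + 1) = 0 := by omega
      rw [h3]
      have : ∑ i ∈ F, z i ^ 2 ≤ ∑ i ∈ F, Z ^ 2 :=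
        Finset.sum_le_sum (fun i hi => pow_le_pow_left₀ (h1 i hi).1 (h1 i hi).2 2)
      rw [Finset.sum_const, hF, nsmul_eq_mul] at this
      have h4 : ((n + 1 : ℕ) : ℝ) ≤ a + 1 := by exact_mod_cast hn
      have := mul_le_mul_of_nonneg_right h4 (sq_nonneg Z)
      simp
      linarith
    · obtain ⟨i0, hi0, hmin⟩ := F.exists_min_image z (Finset.card_pos.1 (by omega))
      have hF' : (F.erase i0).card = n := by rw [Finset.card_erase_of_mem hi0]; omega
      have := ih (F.erase i0) hF' (fun i hi => h1 i (Finset.mem_of_mem_erase hi)) (by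
        intro s hs
        refine le_trans ?_ (h2 s hs)
        exact_mod_cast Finset.card_le_card
          (Finset.filter_subset_filter _ (Finset.erase_subset _ _)))
      rw [← Finset.add_sum_erase F _ hi0]
      obtain ⟨j, hj⟩ : ∃ j, n = a + 1 + j := ⟨n - (a+1), by omega⟩
      have e1 : n - (a + 1) = j := by omega
      have e2 : n + 1 - (a + 1) = j + 1 := by omega
      rw [e1] at this
      rw [e2]
      have hz2 : z i0 * (j + 2) ≤ c := by
        rcases (h1 i0 hi0).1.eq_or_lt with h | h
        · rw [← h]; simpa using hc
        · have := h2 (z i0) h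
          rw [Finset.filter_true_of_mem (fun i hi => hmin i hi), hF, hj] at this
          have h5 : ((j : ℝ) + 2) ≤ c / z i0 := by push_cast at this; linarith
          rw [le_div_iff₀ h] at h5
          linarith
      have hz3 : z i0 ^ 2 ≤ c ^ 2 / (j + 2) ^ 2 := by
        rw [le_div_iff₀ (by positivity), ← mul_pow]
        exact pow_le_pow_left₀ (mul_nonneg (h1 i0 hi0).1 (by positivity)) hz2 2
      have h6 : (1 : ℝ) / (j + 2) ^ 2 ≤ 1 / (j + 1) - 1 / (j + 2) := by
        rw [div_sub_div _ _ (by positivity) (by positivity), div_le_div_iff₀ (by positivity) (by positivity)]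
        nlinarith [(Nat.cast_nonneg j : (0:ℝ) ≤ j)]
      have h7 : c ^ 2 / (j + 2) ^ 2 ≤ c ^ 2 * (1 / (j + 1) - 1 / (j + 2)) := by
        rw [div_eq_mul_one_div]; exact mul_le_mul_of_nonneg_left h6 (sq_nonneg c)
      push_cast
      have e3 : (j : ℝ) + 1 + 1 = j + 2 := by ring
      rw [e3]
      linarith

lemma sum_sq_le' {ι : Type*} (z : ι → ℝ) (a : ℕ) (c Z : ℝ) (hc : 0 ≤ c)
    (F : Finset ι) (h1 : ∀ i ∈ F, 0 ≤ z i ∧ z i ≤ Z)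
      (h2 : ∀ s > 0, ((F.filter (fun i => s ≤ z i)).card : ℝ) ≤ a + c / s) :
      ∑ i ∈ F, z i ^ 2 ≤ (a + 1) * Z ^ 2 + c ^ 2 := by
  classical
  have := sum_sq_le z a c Z hc _ F rfl h1 h2
  have h3 : c ^ 2 * (1 - 1 / (((F.card - (a + 1) : ℕ) : ℝ) + 1)) ≤ c ^ 2 := by
    have : (0:ℝ) ≤ 1 / (((F.card - (a + 1) : ℕ) : ℝ) + 1) := by positivity
    nlinarith [sq_nonneg c]
  linarith

/-- disjoint intervals: order facts -/
lemma ioo_disj {a b a' b' : ℝ} (h : a < b) (h' : a' < b') (hd : Disjoint (Ioo a b) (Ioo a' b'))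
    (hle : a ≤ a') : b ≤ a' := by
  by_contra hlt
  push Not at hlt
  obtain ⟨x, hx1, hx2⟩ := exists_between (lt_min hlt h')
  exact Set.disjoint_left.1 hd ⟨hle.trans_lt hx1, hx2.trans_le (min_le_left _ _)⟩
    ⟨hx1, hx2.trans_le (min_le_right _ _)⟩

lemma window_card (g : ℝ → ℝ) (hg : ContDiff ℝ (⊤ : ℕ∞) g) (r : ℕ) (hr : 1 ≤ r) (B w lam t : ℝ)
    (hB0 : 0 ≤ B) (hB : ∀ x ∈ Icc w (w + lam), |iteratedDeriv r g x| ≤ B) (G : Finset (ℝ × ℝ))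
    (hlt : ∀ p ∈ G, p.1 < p.2)
    (hd : ∀ p ∈ G, ∀ p' ∈ G, p ≠ p' → Disjoint (Ioo p.1 p.2) (Ioo p'.1 p'.2))
    (hw : ∀ p ∈ G, p.1 ∈ Icc w (w + lam))
    (hz : ∀ p ∈ G, deriv g p.1 = 0 ∨ deriv g p.2 = 0)
    (ht : ∀ p ∈ G, t ≤ |g p.2 - g p.1|) (hBt : B * lam ^ r < t) : G.card ≤ 2 * r := by
  classical
  by_contra hcard
  push Not at hcard
  obtain ⟨m, hmG, hmax⟩ := G.exists_max_image (fun p => p.1) (Finset.card_pos.1 (by omega))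
  set G' := G.erase m with hG'
  have hcG' : 2 * r ≤ G'.card := by rw [hG', Finset.card_erase_of_mem hmG]; omega
  have hG'G : ∀ p ∈ G', p ∈ G := fun p hp => Finset.mem_of_mem_erase hp
  have hin : ∀ p ∈ G', p.2 ≤ w + lam := by
    intro p hp
    have := ioo_disj (hlt p (hG'G p hp)) (hlt m hmG)
      (hd p (hG'G p hp) m hmG (Finset.ne_of_mem_erase hp)) (hmax p (hG'G p hp))
    exact this.trans (hw m hmG).2
  let ζ : ℝ × ℝ → ℝ := fun p => if deriv g p.1 = 0 then p.1 else p.2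
  have hζ : ∀ p ∈ G', ζ p ∈ Icc w (w + lam) ∧ deriv g (ζ p) = 0 := by
    intro p hp
    have h1 := hw p (hG'G p hp)
    have h2 := hlt p (hG'G p hp)
    have h3 := hin p hp
    by_cases h : deriv g p.1 = 0
    · simp only [ζ, h, if_true]; exact ⟨h1, trivial⟩
    · have h4 := (hz p (hG'G p hp)).resolve_left h
      simp only [ζ, h, if_false]; exact ⟨⟨h1.1.trans h2.le, h3⟩, h4⟩
  have hfib : ∀ x ∈ G'.image ζ, (G'.filter (fun p => ζ p = x)).card ≤ 2 := by
    intro x _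
    have hsub : G'.filter (fun p => ζ p = x) ⊆
        G'.filter (fun p => p.1 = x) ∪ G'.filter (fun p => p.2 = x) := by
      intro p hp
      simp only [Finset.mem_filter, Finset.mem_union] at hp ⊢
      by_cases h : deriv g p.1 = 0
      · left; refine ⟨hp.1, ?_⟩; simpa [ζ, h] using hp.2
      · right; refine ⟨hp.1, ?_⟩; simpa [ζ, h] using hp.2
    have ha : (G'.filter (fun p => p.1 = x)).card ≤ 1 := by
      rw [Finset.card_le_one]
      intro p hp p' hp'
      simp only [Finset.mem_filter] at hp hp'
      by_contra hne
      have h1 := hd p (hG'G p hp.1) p' (hG'G p' hp'.1) hne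
      have := ioo_disj (hlt p (hG'G p hp.1)) (hlt p' (hG'G p' hp'.1)) h1 (by rw [hp.2, hp'.2])
      have := hlt p (hG'G p hp.1)
      linarith [hp.2, hp'.2]
    have hb : (G'.filter (fun p => p.2 = x)).card ≤ 1 := by
      rw [Finset.card_le_one]
      intro p hp p' hp'
      simp only [Finset.mem_filter] at hp hp'
      by_contra hne
      have h1 := hd p (hG'G p hp.1) p' (hG'G p' hp'.1) hne
      have l1 := hlt p (hG'G p hp.1)
      have l2 := hlt p' (hG'G p' hp'.1)
      rcases le_total p.1 p'.1 with h | h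
      · have := ioo_disj l1 l2 h1 h
        linarith [hp.2, hp'.2]
      · have := ioo_disj l2 l1 h1.symm h
        linarith [hp.2, hp'.2]
    calc _ ≤ _ := Finset.card_le_card hsub
      _ ≤ _ := Finset.card_union_le _ _
      _ ≤ 2 := by omega
  have hcz := Finset.card_le_mul_card_image (f := ζ) G' 2 hfib
  have hdd : ContDiff ℝ (⊤ : ℕ∞) (deriv g) := by
    have : ContDiff ℝ ((⊤ : ℕ∞) + 1) g := by simpa using hg
    exact (contDiff_succ_iff_deriv.1 this).2.2
  have key := small_of_zeros (r - 1) (deriv g) hdd w (w + lam) B hB0 (G'.image ζ)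
    (by
      intro z hz'
      obtain ⟨p, hp, rfl⟩ := Finset.mem_image.1 hz'
      exact hζ p hp) (by omega)
    (by intro x hx; rw [← iteratedDeriv_succ', Nat.sub_add_cancel hr]; exact hB x hx)
  obtain ⟨p, hp⟩ : G'.Nonempty := Finset.card_pos.1 (by omega)
  have h1 := hw p (hG'G p hp)
  have h2 := hlt p (hG'G p hp)
  have h3 := hin p hp
  have hd' : Differentiable ℝ g := hg.differentiable (by simp)
  have hmv := (convex_Icc w (w+lam)).norm_image_sub_le_of_norm_deriv_le (f := g)
      (fun y _ => hd' y) (fun y hy => by simpa [Real.norm_eq_abs] using key y hy) h1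
      (⟨h1.1.trans h2.le, h3⟩ : p.2 ∈ Icc w (w+lam))
  rw [Real.norm_eq_abs, Real.norm_eq_abs] at hmv
  have hl0 : 0 ≤ lam := by linarith [h1.1, h1.2]
  have hpl : |p.2 - p.1| ≤ lam := by rw [abs_of_pos (by linarith)]; linarith [h1.1]
  have : |g p.2 - g p.1| ≤ B * lam ^ r := by
    calc _ ≤ _ := hmv
      _ ≤ B * lam ^ (r - 1) * lam := by
        apply mul_le_mul_of_nonneg_left hpl
        positivity
      _ = B * lam ^ r := by
        rw [mul_assoc, ← pow_succ, Nat.sub_add_cancel hr]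
  linarith [ht p (hG'G p hp)]

lemma count_large (g : ℝ → ℝ) (hg : ContDiff ℝ (⊤ : ℕ∞) g) (r : ℕ) (hr : 1 ≤ r) (B α β t : ℝ)
    (hαβ : α < β) (hα : 0 ≤ α) (hβ : β ≤ 1)
    (hB0 : 0 < B) (hB : ∀ x ∈ Icc (0:ℝ) 1, |iteratedDeriv r g x| ≤ B) (F : Finset (ℝ × ℝ))
    (h : ∀ p ∈ F, α ≤ p.1 ∧ p.1 < p.2 ∧ p.2 ≤ β)
    (hd : ∀ p ∈ F, ∀ p' ∈ F, p ≠ p' → Disjoint (Ioo p.1 p.2) (Ioo p'.1 p'.2))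
    (hz : ∀ p ∈ F, p.1 = α ∨ p.2 = β ∨ deriv g p.1 = 0 ∨ deriv g p.2 = 0)
    (ht0 : 0 < t) (ht : ∀ p ∈ F, t ≤ |g p.2 - g p.1|) :
    (F.card : ℝ) ≤ ((2 * r + 2 : ℕ) : ℝ) + 2 * r * (β - α) * ((2 * B) / t) ^ (1 / (r:ℝ)) := by
  classical
  have hr0 : (0:ℝ) < r := by exact_mod_cast hr
  have hl : 0 < β - α := by linarith
  set c := (β - α) * ((2 * B) / t) ^ (1 / (r:ℝ)) with hc
  have hc0 : 0 < c := by positivity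
  set M := ⌈c⌉₊ with hM
  have hM1 : 1 ≤ M := Nat.one_le_iff_ne_zero.2 (by rw [hM]; exact (Nat.ceil_pos.2 hc0).ne')
  have hM0 : (0:ℝ) < M := by exact_mod_cast hM1
  have hMc : (M:ℝ) < c + 1 := Nat.ceil_lt_add_one hc0.le
  have hcM : c ≤ M := Nat.le_ceil c
  set lam := (β - α) / M with hlam
  have hlam0 : 0 < lam := by positivity
  have hBt : B * lam ^ r < t := by
    have h1 : lam ≤ (t / (2 * B)) ^ (1 / (r:ℝ)) := by
      rw [hlam, div_le_iff₀ hM0]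
      have : (β - α) = (t / (2 * B)) ^ (1 / (r:ℝ)) * c := by
        rw [hc, mul_left_comm, ← Real.mul_rpow (by positivity) (by positivity)]
        rw [div_mul_div_comm, mul_comm t, div_self (by positivity), Real.one_rpow, mul_one]
      calc β - α = _ := this
        _ ≤ _ := by gcongr
    have h2 : lam ^ r ≤ t / (2 * B) := by
      calc lam ^ r ≤ ((t / (2 * B)) ^ (1 / (r:ℝ))) ^ r := pow_le_pow_left₀ hlam0.le h1 r
        _ = t / (2 * B) := by
          rw [← Real.rpow_natCast, ← Real.rpow_mul (by positivity)]
          rw [one_div_mul_cancel hr0.ne', Real.rpow_one]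
    calc B * lam ^ r ≤ B * (t / (2 * B)) := by gcongr
      _ = t / 2 := by field_simp
      _ < t := by linarith
  -- split
  set F1 := F.filter (fun p => p.1 = α) with hF1
  set F2 := F.filter (fun p => p.2 = β) with hF2
  set G := F.filter (fun p => p.1 ≠ α ∧ p.2 ≠ β) with hG
  have hsub : F ⊆ (F1 ∪ F2) ∪ G := by
    intro p hp
    simp only [hF1, hF2, hG, Finset.mem_union, Finset.mem_filter]
    tauto
  have ha : F1.card ≤ 1 := by
    rw [Finset.card_le_one]
    intro p hp p' hp'
    simp only [hF1, Finset.mem_filter] at hp hp'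
    by_contra hne
    have := ioo_disj (h p hp.1).2.1 (h p' hp'.1).2.1 (hd p hp.1 p' hp'.1 hne) (by rw [hp.2, hp'.2])
    have := (h p hp.1).2.1
    linarith [hp.2, hp'.2]
  have hb : F2.card ≤ 1 := by
    rw [Finset.card_le_one]
    intro p hp p' hp'
    simp only [hF2, Finset.mem_filter] at hp hp'
    by_contra hne
    have h1 := hd p hp.1 p' hp'.1 hne
    have l1 := (h p hp.1).2.1
    have l2 := (h p' hp'.1).2.1
    rcases le_total p.1 p'.1 with h | h
    · have := ioo_disj l1 l2 h1 h
      linarith [hp.2, hp'.2]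
    · have := ioo_disj l2 l1 h1.symm h
      linarith [hp.2, hp'.2]
  let idx : ℝ × ℝ → ℕ := fun p => ⌊(p.1 - α) / lam⌋₊
  have hmaps : ∀ p ∈ G, idx p ∈ Finset.range M := by
    intro p hp
    have hp := (Finset.mem_filter.1 hp).1
    rw [Finset.mem_range, Nat.floor_lt (div_nonneg (by linarith [(h p hp).1]) hlam0.le), div_lt_iff₀ hlam0]
    rw [hlam, mul_div_cancel₀ _ hM0.ne']
    linarith [(h p hp).2.1, (h p hp).2.2]
  have hGc : G.card ≤ 2 * r * (Finset.range M).card := by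
    apply Finset.card_le_mul_card_image_of_maps_to hmaps
    intro k hk
    have hGF : ∀ p ∈ G.filter (fun p => idx p = k), p ∈ F := fun p hp =>
      (Finset.mem_filter.1 (Finset.mem_filter.1 hp).1).1
    have hk' : ((k:ℝ) + 1) ≤ M := by
      have := Finset.mem_range.1 hk
      exact_mod_cast this
    have hlM : lam * M = β - α := by rw [hlam]; field_simp
    apply window_card g hg r hr B (α + k * lam) lam t hB0.le ?_ _ (fun p hp => (h p (hGF p hp)).2.1)
      (fun p hp p' hp' => hd p (hGF p hp) p' (hGF p' hp')) ?_ ?_ (fun p hp => ht p (hGF p hp)) hBt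
    · intro x hx
      apply hB x
      refine ⟨?_, ?_⟩
      · have := hx.1
        have : 0 ≤ (k:ℝ) * lam := by positivity
        linarith
      · have h1 := hx.2
        have : ((k:ℝ) + 1) * lam ≤ M * lam := by gcongr
        nlinarith
    · intro p hp
      have hk2 : ⌊(p.1 - α) / lam⌋₊ = k := (Finset.mem_filter.1 hp).2
      have hpF := hGF p hp
      have h0 : 0 ≤ (p.1 - α) / lam := div_nonneg (by linarith [(h p hpF).1]) hlam0.le
      have := (Nat.floor_eq_iff h0).1 hk2
      rw [le_div_iff₀ hlam0, div_lt_iff₀ hlam0] at this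
      constructor <;> linarith
    · intro p hp
      have h1 := (Finset.mem_filter.1 (Finset.mem_filter.1 hp).1).2
      have := hz p (hGF p hp)
      tauto
  rw [Finset.card_range] at hGc
  have htot : F.card ≤ 2 + 2 * r * M := by
    calc F.card ≤ _ := Finset.card_le_card hsub
      _ ≤ (F1 ∪ F2).card + G.card := Finset.card_union_le _ _
      _ ≤ (F1.card + F2.card) + G.card := by gcongr; exact Finset.card_union_le _ _
      _ ≤ _ := by omega
  have : (F.card : ℝ) ≤ 2 + 2 * r * M := by exact_mod_cast htot
  push_cast
  have h2 : (2 * r * (M:ℝ)) ≤ 2 * r * (c + 1) := by gcongr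
  rw [mul_assoc (2 * (r:ℝ)) (β - α), ← hc]
  linarith

/-- The one-step key estimate. -/
theorem one_step (g : ℝ → ℝ) (hg : ContDiff ℝ (⊤ : ℕ∞) g) (r : ℕ) (hr : 1 ≤ r) (B Lam α β : ℝ)
    (hαβ : α < β) (hα : 0 ≤ α) (hβ : β ≤ 1)
    (hB0 : 0 < B) (hB : ∀ x ∈ Icc (0:ℝ) 1, |iteratedDeriv r g x| ≤ B)
    (hLam : ∀ x ∈ Icc (0:ℝ) 1, |deriv g x| ≤ Lam) (F : Finset (ℝ × ℝ))
    (h : ∀ p ∈ F, α ≤ p.1 ∧ p.1 < p.2 ∧ p.2 ≤ β)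
    (hd : ∀ p ∈ F, ∀ p' ∈ F, p ≠ p' → Disjoint (Ioo p.1 p.2) (Ioo p'.1 p'.2))
    (hz : ∀ p ∈ F, p.1 = α ∨ p.2 = β ∨ deriv g p.1 = 0 ∨ deriv g p.2 = 0) :
    ∑ p ∈ F, |g p.2 - g p.1| ^ (2 / (r:ℝ)) ≤
      (2 * r + 3) * (Lam * (β - α)) ^ (2 / (r:ℝ)) +
        (2 * r * (β - α) * (2 * B) ^ (1 / (r:ℝ))) ^ 2 := by
  classical
  have hr0 : (0:ℝ) < r := by exact_mod_cast hr
  have hl : 0 < β - α := by linarith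
  have hL0 : 0 ≤ Lam := (abs_nonneg _).trans (hLam 0 (by simp))
  have hd' : Differentiable ℝ g := hg.differentiable (by simp)
  have hsq : ∀ y : ℝ, 0 ≤ y → (y ^ (1 / (r:ℝ))) ^ 2 = y ^ (2 / (r:ℝ)) := by
    intro y hy
    rw [← Real.rpow_natCast, ← Real.rpow_mul hy]
    congr 1; push_cast; ring
  have := sum_sq_le' (fun p : ℝ × ℝ => |g p.2 - g p.1| ^ (1 / (r:ℝ))) (2 * r + 2)
    (2 * r * (β - α) * (2 * B) ^ (1 / (r:ℝ))) ((Lam * (β - α)) ^ (1 / (r:ℝ))) (by positivity) F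
    (by
      intro p hp
      refine ⟨by positivity, ?_⟩
      apply Real.rpow_le_rpow (abs_nonneg _) _ (by positivity)
      obtain ⟨h1, h2, h3⟩ := h p hp
      have hmv := (convex_Icc (0:ℝ) 1).norm_image_sub_le_of_norm_deriv_le (f := g)
        (fun y _ => hd' y) (fun y hy => by simpa [Real.norm_eq_abs] using hLam y hy)
        (⟨by linarith, by linarith⟩ : p.1 ∈ Icc (0:ℝ) 1) (⟨by linarith, by linarith⟩ : p.2 ∈ Icc (0:ℝ) 1)
      rw [Real.norm_eq_abs, Real.norm_eq_abs] at hmv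
      refine hmv.trans (mul_le_mul_of_nonneg_left ?_ hL0)
      rw [abs_of_pos (by linarith)]; linarith)
    (by
      intro s hs
      have hcl := count_large g hg r hr B α β (s ^ r) hαβ hα hβ hB0 hB
        (F.filter (fun p => s ≤ |g p.2 - g p.1| ^ (1 / (r:ℝ))))
        (fun p hp => h p (Finset.mem_filter.1 hp).1)
        (fun p hp p' hp' => hd p (Finset.mem_filter.1 hp).1 p' (Finset.mem_filter.1 hp').1)
        (fun p hp => hz p (Finset.mem_filter.1 hp).1) (by positivity)
        (by
          intro p hp
          have := pow_le_pow_left₀ hs.le (Finset.mem_filter.1 hp).2 r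
          rwa [← Real.rpow_natCast (|g p.2 - g p.1| ^ (1 / (r:ℝ))), ← Real.rpow_mul (abs_nonneg _),
            one_div_mul_cancel hr0.ne', Real.rpow_one] at this)
      refine hcl.trans (le_of_eq ?_)
      rw [Real.div_rpow (by positivity) (by positivity), ← Real.rpow_natCast s, ← Real.rpow_mul hs.le,
        mul_one_div_cancel hr0.ne', Real.rpow_one]
      ring)
  simp only [hsq _ (abs_nonneg _)] at this
  rw [hsq _ (by positivity)] at this
  push_cast at this
  convert this using 2
  ring

end IntervalEnt

namespace IntervalEnt

/-- The standing data: a smooth interval map together with a grid of mesh `1/d` for which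
the one-step estimate holds with constant `Gam`. -/
structure Sys where
  g : ℝ → ℝ
  d : ℕ
  Lam : ℝ
  Gam : ℝ
  sig : ℝ
  hg : ContDiff ℝ (⊤ : ℕ∞) g
  maps : MapsTo g (Icc (0:ℝ) 1) (Icc (0:ℝ) 1)
  hd : 1 ≤ d
  hLam1 : 1 ≤ Lam
  hLam : ∀ x ∈ Icc (0:ℝ) 1, |deriv g x| ≤ Lam
  hGam : 1 ≤ Gam
  hsig0 : 0 < sig
  hsig1 : sig ≤ 1
  hstep : ∀ α β : ℝ, α < β → 0 ≤ α → β ≤ 1 → β - α ≤ 1 / d → ∀ F : Finset (ℝ × ℝ),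
    (∀ p ∈ F, α ≤ p.1 ∧ p.1 < p.2 ∧ p.2 ≤ β) →
    (∀ p ∈ F, ∀ p' ∈ F, p ≠ p' → Disjoint (Ioo p.1 p.2) (Ioo p'.1 p'.2)) →
    (∀ p ∈ F, p.1 = α ∨ p.2 = β ∨ deriv g p.1 = 0 ∨ deriv g p.2 = 0) →
    ∑ p ∈ F, |g p.2 - g p.1| ^ sig ≤ Gam * (β - α) ^ sig

lemma deriv_ne_mono (φ : ℝ → ℝ) (hφ : ContDiff ℝ (⊤ : ℕ∞) φ) (a b : ℝ) (hab : a < b)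
    (hne : ∀ x ∈ Ioo a b, deriv φ x ≠ 0) :
    (StrictMonoOn φ (Icc a b) ∧ φ '' Ioo a b = Ioo (φ a) (φ b)) ∨
    (StrictAntiOn φ (Icc a b) ∧ φ '' Ioo a b = Ioo (φ b) (φ a)) := by
  have hd : Differentiable ℝ φ := hφ.differentiable (by simp)
  have hcont : Continuous (deriv φ) := hφ.continuous_deriv (by simp)
  have hc : Continuous φ := hd.continuous
  have hsign : (∀ x ∈ Ioo a b, 0 < deriv φ x) ∨ (∀ x ∈ Ioo a b, deriv φ x < 0) := by
    by_contra hcon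
    push Not at hcon
    obtain ⟨⟨x, hx, hx'⟩, ⟨y, hy, hy'⟩⟩ := hcon
    have := isPreconnected_Ioo.intermediate_value hx hy hcont.continuousOn
    obtain ⟨z, hz, hz'⟩ := this (⟨hx', hy'⟩ : (0:ℝ) ∈ Icc _ _)
    exact hne z hz hz'
  rcases hsign with h | h
  · left
    have hm : StrictMonoOn φ (Icc a b) := strictMonoOn_of_deriv_pos (convex_Icc a b) hc.continuousOn
      (by rwa [interior_Icc])
    refine ⟨hm, Subset.antisymm ?_ (intermediate_value_Ioo hab.le hc.continuousOn)⟩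
    rintro _ ⟨x, hx, rfl⟩
    exact ⟨hm (left_mem_Icc.2 hab.le) (Ioo_subset_Icc_self hx) hx.1,
      hm (Ioo_subset_Icc_self hx) (right_mem_Icc.2 hab.le) hx.2⟩
  · right
    have hm : StrictAntiOn φ (Icc a b) := strictAntiOn_of_deriv_neg (convex_Icc a b) hc.continuousOn
      (by rwa [interior_Icc])
    refine ⟨hm, Subset.antisymm ?_ (intermediate_value_Ioo' hab.le hc.continuousOn)⟩
    rintro _ ⟨x, hx, rfl⟩
    exact ⟨hm (Ioo_subset_Icc_self hx) (right_mem_Icc.2 hab.le) hx.2,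
      hm (left_mem_Icc.2 hab.le) (Ioo_subset_Icc_self hx) hx.1⟩

lemma comp_Ioo (U : Set ℝ) (hU : IsOpen U) (hb : U ⊆ Icc 0 1) (y : ℝ) (hy : y ∈ U) :
    ∃ a b, connectedComponentIn U y = Ioo a b ∧ a ∉ U ∧ b ∉ U ∧ a < y ∧ y < b ∧ 0 ≤ a ∧ b ≤ 1 ∧
      Ioo a b ⊆ U := by
  have h0 : (0:ℝ) ∉ U := by
    intro h
    have := interior_maximal hb hU h
    rw [interior_Icc] at this
    exact lt_irrefl _ this.1
  have h1 : (1:ℝ) ∉ U := by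
    intro h
    have := interior_maximal hb hU h
    rw [interior_Icc] at this
    exact lt_irrefl _ this.2
  have hyb := hb hy
  -- left endpoint
  have hclA : IsClosed (Iic y ∩ Uᶜ) := isClosed_Iic.inter hU.isClosed_compl
  have hA := hclA.csSup_mem ⟨0, hyb.1, h0⟩ ⟨y, fun z hz => hz.1⟩
  have hclB : IsClosed (Ici y ∩ Uᶜ) := isClosed_Ici.inter hU.isClosed_compl
  have hB := hclB.csInf_mem ⟨1, hyb.2, h1⟩ ⟨y, fun z hz => hz.1⟩
  set a := sSup (Iic y ∩ Uᶜ)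
  set b := sInf (Ici y ∩ Uᶜ)
  have hay : a < y := lt_of_le_of_ne hA.1 (fun h => hA.2 (h ▸ hy))
  have hyb' : y < b := lt_of_le_of_ne hB.1 (fun h => hB.2 (h ▸ hy))
  have hsub : Ioo a b ⊆ U := by
    intro z hz
    by_contra hzU
    rcases le_total z y with h | h
    · exact absurd (le_csSup ⟨y, fun w hw => hw.1⟩ (⟨h, hzU⟩ : z ∈ Iic y ∩ Uᶜ)) (not_le.2 hz.1)
    · exact absurd (csInf_le ⟨y, fun w hw => hw.1⟩ (⟨h, hzU⟩ : z ∈ Ici y ∩ Uᶜ)) (not_le.2 hz.2)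
  refine ⟨a, b, ?_, hA.2, hB.2, hay, hyb', ?_, ?_, hsub⟩
  · apply Subset.antisymm
    · intro z hz
      have hoc : OrdConnected (connectedComponentIn U y) :=
        isPreconnected_iff_ordConnected.1 isPreconnected_connectedComponentIn
      have hyc := mem_connectedComponentIn hy
      constructor
      · by_contra h
        push Not at h
        exact hA.2 (connectedComponentIn_subset _ _ (hoc.out hz hyc ⟨h, hay.le⟩))
      · by_contra h
        push Not at h
        exact hB.2 (connectedComponentIn_subset _ _ (hoc.out hyc hz ⟨hyb'.le, h⟩))
    · exact isPreconnected_Ioo.subset_connectedComponentIn ⟨hay, hyb'⟩ hsub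
  · exact le_csSup ⟨y, fun w hw => hw.1⟩ ⟨hyb.1, h0⟩
  · exact csInf_le ⟨y, fun w hw => hw.1⟩ ⟨hyb.2, h1⟩

namespace Sys

variable (S : Sys)

def Q : Set ℝ := {x | ∃ k : ℤ, x = (k:ℝ) / S.d}

def cell (A : Fin S.d) : Set ℝ := Ioo ((A:ℕ) / (S.d:ℝ)) (((A:ℕ) + 1) / (S.d:ℝ))

def O (n : ℕ) : Set ℝ :=
  {x | x ∈ Ioo (0:ℝ) 1 ∧ (∀ i ≤ n, S.g^[i] x ∉ S.Q) ∧ ∀ i < n, deriv S.g (S.g^[i] x) ≠ 0}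

def Pc (n : ℕ) (x : ℝ) : Set ℝ := connectedComponentIn (S.O n) x

def Gd (n : ℕ) (x : ℝ) : Prop := x ∈ S.O n ∧ ∃ A, S.g^[n] '' S.Pc n x = S.cell A

def Bd (n : ℕ) (x : ℝ) : Prop := x ∈ S.O n ∧ ∀ s, 0 < s → s ≤ n → ¬ S.Gd s x

def Prime (n : ℕ) (x : ℝ) : Prop := 0 < n ∧ S.Gd n x ∧ ∀ s, 0 < s → s < n → ¬ S.Gd s x

lemma d0 : (0:ℝ) < S.d := by exact_mod_cast S.hd

lemma isClosed_Q : IsClosed S.Q := by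
  have : S.Q = (fun x : ℝ => x * S.d) ⁻¹' (range ((↑) : ℤ → ℝ)) := by
    ext x
    simp only [Q, Set.mem_ofPred_eq, mem_preimage, mem_range]
    constructor
    · rintro ⟨k, rfl⟩; exact ⟨k, by have := S.d0; field_simp⟩
    · rintro ⟨k, hk⟩; exact ⟨k, by rw [hk]; have := S.d0; field_simp⟩
  rw [this]
  exact Int.isClosedEmbedding_coe_real.isClosed_range.preimage (by fun_prop)

lemma cont : Continuous S.g := S.hg.continuous

lemma cont_it (n : ℕ) : Continuous S.g^[n] := S.cont.iterate n

lemma contDiff_it (n : ℕ) : ContDiff ℝ (⊤ : ℕ∞) S.g^[n] := by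
  induction n with
  | zero => simpa using contDiff_id
  | succ n ih => rw [Function.iterate_succ']; exact S.hg.comp ih

lemma cont_deriv : Continuous (deriv S.g) := S.hg.continuous_deriv (by simp)

lemma maps_it (n : ℕ) : MapsTo S.g^[n] (Icc (0:ℝ) 1) (Icc (0:ℝ) 1) := S.maps.iterate n

lemma zero_mem_Q : (0:ℝ) ∈ S.Q := ⟨0, by simp⟩
lemma one_mem_Q : (1:ℝ) ∈ S.Q := ⟨S.d, by have := S.d0; push_cast; field_simp⟩

lemma mem_Ioo_of_notMem_Q {x : ℝ} (hx : x ∈ Icc (0:ℝ) 1) (h : x ∉ S.Q) : x ∈ Ioo (0:ℝ) 1 :=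
  ⟨lt_of_le_of_ne hx.1 (fun h' => h (h' ▸ S.zero_mem_Q)),
    lt_of_le_of_ne hx.2 (fun h' => h (h' ▸ S.one_mem_Q))⟩

lemma isOpen_O (n : ℕ) : IsOpen (S.O n) := by
  have h1 : S.O n = Ioo (0:ℝ) 1 ∩ ((⋂ i ∈ Finset.range (n+1), {x | S.g^[i] x ∉ S.Q}) ∩
      ⋂ i ∈ Finset.range n, {x | deriv S.g (S.g^[i] x) ≠ 0}) := by
    ext x
    simp [O, Nat.lt_succ_iff]
  rw [h1]
  refine isOpen_Ioo.inter ((isOpen_biInter_finset ?_).inter (isOpen_biInter_finset ?_))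
  · intro i _
    exact S.isClosed_Q.isOpen_compl.preimage (S.cont_it i)
  · intro i _
    exact isOpen_ne.preimage (S.cont_deriv.comp (S.cont_it i))

lemma O_sub (n : ℕ) : S.O n ⊆ Ioo 0 1 := fun _ h => h.1
lemma O_sub' (n : ℕ) : S.O n ⊆ Icc 0 1 := fun _ h => Ioo_subset_Icc_self h.1

lemma O_add (n m : ℕ) (x : ℝ) : x ∈ S.O (n + m) ↔ x ∈ S.O n ∧ S.g^[n] x ∈ S.O m := by
  constructor
  · rintro ⟨h1, h2, h3⟩
    refine ⟨⟨h1, fun i hi => h2 i (by omega), fun i hi => h3 i (by omega)⟩, ?_, ?_, ?_⟩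
    · exact S.mem_Ioo_of_notMem_Q (S.maps_it n (Ioo_subset_Icc_self h1)) (h2 n (by omega))
    · intro i hi
      rw [← Function.iterate_add_apply]
      exact h2 _ (by omega)
    · intro i hi
      rw [← Function.iterate_add_apply]
      exact h3 _ (by omega)
  · rintro ⟨⟨h1, h2, h3⟩, ⟨-, h5, h6⟩⟩
    refine ⟨h1, ?_, ?_⟩
    · intro i hi
      rcases le_total i n with h | h
      · exact h2 i h
      · obtain ⟨j, rfl⟩ := Nat.exists_eq_add_of_le' h
        rw [Function.iterate_add_apply]
        exact h5 j (by omega)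
    · intro i hi
      rcases lt_or_ge i n with h | h
      · exact h3 i h
      · obtain ⟨j, rfl⟩ := Nat.exists_eq_add_of_le' h
        rw [Function.iterate_add_apply]
        exact h6 j (by omega)

lemma O_anti {n m : ℕ} (h : n ≤ m) : S.O m ⊆ S.O n := by
  intro x hx
  obtain ⟨j, rfl⟩ := Nat.exists_eq_add_of_le h
  exact ((S.O_add n j x).1 hx).1

lemma mem_Pc {n : ℕ} {x : ℝ} (h : x ∈ S.O n) : x ∈ S.Pc n x := mem_connectedComponentIn h

lemma Pc_sub (n : ℕ) (x : ℝ) : S.Pc n x ⊆ S.O n := connectedComponentIn_subset _ _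

lemma Pc_eq {n : ℕ} {x y : ℝ} (h : y ∈ S.Pc n x) : S.Pc n x = S.Pc n y :=
  connectedComponentIn_eq h

lemma Pc_anti {n m : ℕ} (h : n ≤ m) (x : ℝ) : S.Pc m x ⊆ S.Pc n x :=
  connectedComponentIn_mono x (S.O_anti h)

lemma Pc_Ioo {n : ℕ} {x : ℝ} (h : x ∈ S.O n) :
    ∃ a b, S.Pc n x = Ioo a b ∧ a ∉ S.O n ∧ b ∉ S.O n ∧ a < x ∧ x < b ∧ 0 ≤ a ∧ b ≤ 1 ∧
      Ioo a b ⊆ S.O n :=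
  comp_Ioo _ (S.isOpen_O n) (S.O_sub' n) x h

lemma isOpen_Pc (n : ℕ) (x : ℝ) : IsOpen (S.Pc n x) := (S.isOpen_O n).connectedComponentIn

lemma deriv_it_ne (n : ℕ) : ∀ x, x ∈ S.O n → deriv S.g^[n] x ≠ 0 := by
  induction n with
  | zero => intro x _; simp
  | succ n ih =>
    intro x hx
    have h1 := (S.O_add n 1 x).1 hx
    have hd : Differentiable ℝ S.g := S.hg.differentiable (by simp)
    have hdn : Differentiable ℝ S.g^[n] := (S.contDiff_it n).differentiable (by simp)
    rw [Function.iterate_succ', deriv_comp x (hd _) (hdn x)]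
    exact mul_ne_zero (by simpa using h1.2.2.2 0 (by omega)) (ih x h1.1)

lemma mono_Pc {n : ℕ} {x : ℝ} (h : x ∈ S.O n) :
    StrictMonoOn S.g^[n] (S.Pc n x) ∨ StrictAntiOn S.g^[n] (S.Pc n x) := by
  obtain ⟨a, b, h1, -, -, h2, h3, -, -, h4⟩ := S.Pc_Ioo h
  rw [h1]
  rcases deriv_ne_mono S.g^[n] (S.contDiff_it n) a b (h2.trans h3)
    (fun y hy => S.deriv_it_ne n y (h4 hy)) with h | h
  · exact Or.inl (h.1.mono Ioo_subset_Icc_self)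
  · exact Or.inr (h.1.mono Ioo_subset_Icc_self)

lemma inj_Pc {n : ℕ} {x : ℝ} (h : x ∈ S.O n) : InjOn S.g^[n] (S.Pc n x) := by
  rcases S.mono_Pc h with h | h
  · exact h.injOn
  · exact h.injOn

/-- transfer of components. -/
lemma transfer (s j : ℕ) (x : ℝ) (hx : x ∈ S.O (s + j)) :
    S.g^[s] '' S.Pc (s + j) x =
      connectedComponentIn (S.g^[s] '' S.Pc s x ∩ S.O j) (S.g^[s] x) := by
  have hxs := (S.O_add s j x).1 hx
  apply Subset.antisymm
  · apply IsPreconnected.subset_connectedComponentIn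
    · exact isPreconnected_connectedComponentIn.image _ (S.cont_it s).continuousOn
    · exact mem_image_of_mem _ (S.mem_Pc hx)
    · rintro _ ⟨y, hy, rfl⟩
      exact ⟨mem_image_of_mem _ (S.Pc_anti (Nat.le_add_right s j) x hy),
        ((S.O_add s j y).1 (S.Pc_sub _ _ hy)).2⟩
  · set T := connectedComponentIn (S.g^[s] '' S.Pc s x ∩ S.O j) (S.g^[s] x) with hT
    have hTs : T ⊆ S.g^[s] '' S.Pc s x ∩ S.O j := connectedComponentIn_subset _ _
    have hToc : OrdConnected T :=
      isPreconnected_iff_ordConnected.1 isPreconnected_connectedComponentIn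
    have hPoc : OrdConnected (S.Pc s x) :=
      isPreconnected_iff_ordConnected.1 isPreconnected_connectedComponentIn
    have hpre : IsPreconnected (S.Pc s x ∩ S.g^[s] ⁻¹' T) := by
      rw [isPreconnected_iff_ordConnected]
      constructor
      intro y hy z hz w hw
      have hwP := hPoc.out hy.1 hz.1 hw
      refine ⟨hwP, ?_⟩
      rcases S.mono_Pc hxs.1 with h | h
      · exact hToc.out hy.2 hz.2 ⟨h.monotoneOn hy.1 hwP hw.1, h.monotoneOn hwP hz.1 hw.2⟩
      · exact hToc.out hz.2 hy.2 ⟨h.antitoneOn hwP hz.1 hw.2, h.antitoneOn hy.1 hwP hw.1⟩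
    have hxT : S.g^[s] x ∈ T := mem_connectedComponentIn
      ⟨mem_image_of_mem _ (S.mem_Pc hxs.1), hxs.2⟩
    have hsub := hpre.subset_connectedComponentIn (F := S.O (s + j))
      ⟨S.mem_Pc hxs.1, hxT⟩ (by
        intro y hy
        exact (S.O_add s j y).2 ⟨S.Pc_sub _ _ hy.1, (hTs hy.2).2⟩)
    intro y hy
    obtain ⟨z, hz, rfl⟩ := (hTs hy).1
    exact ⟨z, hsub ⟨hz, hy⟩, rfl⟩

lemma cell_sub_Icc (A : Fin S.d) : S.cell A ⊆ Icc 0 1 := by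
  intro x hx
  have h1 := hx.1
  have h2 := hx.2
  have := S.d0
  refine ⟨le_trans (by positivity) h1.le, h2.le.trans ?_⟩
  rw [div_le_one this]
  exact_mod_cast A.2

lemma cell_notMem_Q {A : Fin S.d} {x : ℝ} (hx : x ∈ S.cell A) : x ∉ S.Q := by
  rintro ⟨k, rfl⟩
  have := S.d0
  have h1 := hx.1
  have h2 := hx.2
  rw [div_lt_div_iff_of_pos_right this] at h1 h2
  have h1' : ((A:ℕ):ℤ) < k := by exact_mod_cast h1
  have h2' : k < ((A:ℕ):ℤ) + 1 := by exact_mod_cast h2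
  omega

lemma cell_sub_O (A : Fin S.d) : S.cell A ⊆ S.O 0 := by
  intro x hx
  refine ⟨S.mem_Ioo_of_notMem_Q (S.cell_sub_Icc A hx) (S.cell_notMem_Q hx), ?_, ?_⟩
  · intro i hi
    obtain rfl : i = 0 := by omega
    exact S.cell_notMem_Q hx
  · intro i hi; omega

lemma exists_cell {x : ℝ} (hx : x ∈ Icc (0:ℝ) 1) (h : x ∉ S.Q) : ∃ A, x ∈ S.cell A := by
  have hd := S.d0
  have h01 := S.mem_Ioo_of_notMem_Q hx h
  have h0 : 0 ≤ x * S.d := by have := h01.1; positivity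
  have hlt : ⌊x * S.d⌋₊ < S.d := by
    rw [Nat.floor_lt h0]
    nlinarith [h01.2]
  refine ⟨⟨⌊x * S.d⌋₊, hlt⟩, ?_, ?_⟩
  · rw [div_lt_iff₀ hd]
    refine lt_of_le_of_ne (Nat.floor_le h0) ?_
    intro h'
    exact h ⟨⌊x * S.d⌋₊, by rw [eq_div_iff hd.ne']; simpa using h'.symm⟩
  · rw [lt_div_iff₀ hd]
    exact Nat.lt_floor_add_one _

lemma O_exists_cell {n : ℕ} {x : ℝ} (hx : x ∈ S.O n) : ∃ A, x ∈ S.cell A :=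
  S.exists_cell (S.O_sub' n hx) (by simpa using hx.2.1 0 (Nat.zero_le _))

lemma sub_cell {T : Set ℝ} (hT : IsPreconnected T) (hs : T ⊆ Icc 0 1) (hQ : ∀ x ∈ T, x ∉ S.Q)
    {y : ℝ} (hy : y ∈ T) {A : Fin S.d} (hA : y ∈ S.cell A) : T ⊆ S.cell A := by
  intro z hz
  have hoc := isPreconnected_iff_ordConnected.1 hT
  constructor
  · by_contra h
    push Not at h
    exact hQ _ (hoc.out hz hy ⟨h, hA.1.le⟩) ⟨(A:ℕ), by simp⟩
  · by_contra h
    push Not at h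
    exact hQ _ (hoc.out hy hz ⟨hA.2.le, h⟩) ⟨(A:ℕ) + 1, by simp⟩

lemma cell_disj {A B : Fin S.d} {x : ℝ} (hA : x ∈ S.cell A) (hB : x ∈ S.cell B) : A = B := by
  have hd := S.d0
  have h1 := hA.1.trans hB.2
  have h2 := hB.1.trans hA.2
  rw [div_lt_div_iff_of_pos_right hd] at h1 h2
  have h1' : (A:ℕ) < (B:ℕ) + 1 := by exact_mod_cast h1
  have h2' : (B:ℕ) < (A:ℕ) + 1 := by exact_mod_cast h2
  exact Fin.ext (by omega)

lemma cell_nonempty (A : Fin S.d) : (S.cell A).Nonempty := by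
  have hd := S.d0
  rw [cell, nonempty_Ioo]
  gcongr; linarith

lemma cell_inj {A B : Fin S.d} (h : S.cell A = S.cell B) : A = B := by
  obtain ⟨x, hx⟩ := S.cell_nonempty A
  exact S.cell_disj hx (h ▸ hx)

/-- the image of a piece of level `n` under an intermediate iterate is in a cell -/
lemma img_sub_cell {n i : ℕ} (hi : i ≤ n) {x : ℝ} (hx : x ∈ S.O n) {A : Fin S.d}
    (hA : S.g^[i] x ∈ S.cell A) : S.g^[i] '' S.Pc n x ⊆ S.cell A := by
  apply S.sub_cell (isPreconnected_connectedComponentIn.image _ (S.cont_it i).continuousOn) _ _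
    (mem_image_of_mem _ (S.mem_Pc hx)) hA
  · rintro _ ⟨y, hy, rfl⟩
    exact S.maps_it i (S.O_sub' n (S.Pc_sub _ _ hy))
  · rintro _ ⟨y, hy, rfl⟩
    exact (S.Pc_sub _ _ hy).2.1 i hi

lemma Pc_sub_cell {n : ℕ} {x : ℝ} (hx : x ∈ S.O n) {A : Fin S.d}
    (hA : x ∈ S.cell A) : S.Pc n x ⊆ S.cell A := by
  have := S.img_sub_cell (i := 0) (Nat.zero_le n) hx (A := A) hA
  simpa using this

lemma Pc_zero {x : ℝ} {A : Fin S.d} (hA : x ∈ S.cell A) : S.Pc 0 x = S.cell A :=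
  Subset.antisymm (S.Pc_sub_cell (S.cell_sub_O A hA) hA)
    (isPreconnected_Ioo.subset_connectedComponentIn hA (S.cell_sub_O A))

lemma Gd_zero {x : ℝ} {A : Fin S.d} (hA : x ∈ S.cell A) : S.Gd 0 x :=
  ⟨S.cell_sub_O A hA, A, by simpa using S.Pc_zero hA⟩

lemma Gd_img {n : ℕ} {x : ℝ} (h : S.Gd n x) {A : Fin S.d} (hA : S.g^[n] x ∈ S.cell A) :
    S.g^[n] '' S.Pc n x = S.cell A := by
  obtain ⟨hx, B, hB⟩ := h
  have : S.g^[n] x ∈ S.cell B := hB ▸ mem_image_of_mem _ (S.mem_Pc hx)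
  rw [hB, S.cell_disj this hA]

lemma Gd_cell {n : ℕ} {x : ℝ} (h : S.Gd n x) : ∃ A, S.g^[n] x ∈ S.cell A := by
  obtain ⟨hx, B, hB⟩ := h
  exact ⟨B, hB ▸ mem_image_of_mem _ (S.mem_Pc hx)⟩

lemma Gd_congr {n s : ℕ} (hs : s ≤ n) {x y : ℝ} (hy : y ∈ S.Pc n x) : S.Gd s x ↔ S.Gd s y := by
  have h1 : y ∈ S.Pc s x := S.Pc_anti hs x hy
  have h2 := S.Pc_eq h1
  unfold Gd
  rw [h2]
  have hyO : y ∈ S.O s := S.Pc_sub _ _ h1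
  have hxO : x ∈ S.O s := by
    have : (S.Pc s x).Nonempty := ⟨y, h1⟩
    exact connectedComponentIn_nonempty_iff.1 this
  simp [hyO, hxO]

/-- transfer over good pieces -/
lemma transfer_good {s j : ℕ} {x : ℝ} (hs : S.Gd s x) (hj : S.g^[s] x ∈ S.O j) :
    S.g^[s] '' S.Pc (s + j) x = S.Pc j (S.g^[s] x) := by
  have hx : x ∈ S.O (s + j) := (S.O_add s j x).2 ⟨hs.1, hj⟩
  obtain ⟨A, hA⟩ := S.Gd_cell hs
  rw [S.transfer s j x hx, S.Gd_img hs hA]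
  apply Subset.antisymm
  · exact connectedComponentIn_mono _ inter_subset_right
  · exact isPreconnected_connectedComponentIn.subset_connectedComponentIn (S.mem_Pc hj)
      (subset_inter (S.Pc_sub_cell hj hA) (S.Pc_sub _ _))

lemma Gd_concat {n m : ℕ} {x : ℝ} (h1 : S.Gd n x) (h2 : S.Gd m (S.g^[n] x)) : S.Gd (n + m) x := by
  obtain ⟨A, hA⟩ := h2.2
  refine ⟨(S.O_add n m x).2 ⟨h1.1, h2.1⟩, A, ?_⟩
  rw [← hA, ← S.transfer_good h1 h2.1, ← image_comp, ← Function.iterate_add, add_comm]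

lemma Gd_restrict {n m : ℕ} {x : ℝ} (h : S.Gd (n + m) x) : S.Gd m (S.g^[n] x) := by
  have hx := (S.O_add n m x).1 h.1
  refine ⟨hx.2, ?_⟩
  obtain ⟨A, hA⟩ := h.2
  refine ⟨A, ?_⟩
  have hmem : S.g^[m] (S.g^[n] x) ∈ S.cell A := by
    rw [← Function.iterate_add_apply, add_comm m n, ← hA]
    exact mem_image_of_mem _ (S.mem_Pc h.1)
  apply Subset.antisymm
  · exact S.img_sub_cell le_rfl hx.2 hmem
  · rw [← hA, add_comm n m, Function.iterate_add, image_comp]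
    apply image_mono
    rw [add_comm m n, S.transfer n m x h.1]
    exact connectedComponentIn_mono _ inter_subset_right

lemma isCell {u v : ℝ} (huv : u < v) (hu : u ∈ S.Q) (hv : v ∈ S.Q) (h01 : Ioo u v ⊆ Icc 0 1)
    (hQ : ∀ x ∈ Ioo u v, x ∉ S.Q) : ∃ A, Ioo u v = S.cell A := by
  obtain ⟨y, hy⟩ := nonempty_Ioo.2 huv
  obtain ⟨A, hA⟩ := S.exists_cell (h01 hy) (hQ y hy)
  have hs := S.sub_cell isPreconnected_Ioo h01 hQ hy hA
  refine ⟨A, Subset.antisymm hs ?_⟩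
  have hQ' : ∀ x ∈ S.cell A, x ∉ S.Q := fun x hx => S.cell_notMem_Q hx
  intro z hz
  constructor
  · by_contra h
    push Not at h
    exact hQ' u ⟨hz.1.trans_le h, hy.1.trans hA.2⟩ hu
  · by_contra h
    push Not at h
    exact hQ' v ⟨hA.1.trans hy.2, h.trans_lt hz.2⟩ hv

/-- inverse of the image on subpieces -/
lemma Pc_recover {s j : ℕ} {x : ℝ} (hx : x ∈ S.O (s + j)) :
    S.Pc (s + j) x = S.Pc s x ∩ S.g^[s] ⁻¹' (S.g^[s] '' S.Pc (s + j) x) := by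
  have hxs := (S.O_add s j x).1 hx
  apply Subset.antisymm
  · exact subset_inter (S.Pc_anti (Nat.le_add_right _ _) x) (subset_preimage_image _ _)
  · rintro y ⟨hy, z, hz, hzy⟩
    rwa [← S.inj_Pc hxs.1 (S.Pc_anti (Nat.le_add_right _ _) x hz) hy hzy]

end Sys

end IntervalEnt

namespace IntervalEnt
namespace Sys

variable (S : Sys)

/-- Image data of a piece of level `n`. -/
lemma img_Ioo {n : ℕ} {x : ℝ} (hx : x ∈ S.O n) :
    ∃ α β, S.g^[n] '' S.Pc n x = Ioo α β ∧ α < β ∧ 0 ≤ α ∧ β ≤ 1 ∧ β - α ≤ 1 / S.d ∧ Ioo α β ⊆ S.O 0 := by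
  obtain ⟨a, b, h1, -, -, h2, h3, -, -, h4⟩ := S.Pc_Ioo hx
  have hxn : S.g^[n] x ∈ S.O 0 := ((S.O_add n 0 x).1 hx).2
  obtain ⟨A, hA⟩ := S.O_exists_cell hxn
  have hsub := S.img_sub_cell le_rfl hx hA
  have key : ∃ α β, S.g^[n] '' S.Pc n x = Ioo α β ∧ α < β := by
    rw [h1]
    rcases deriv_ne_mono S.g^[n] (S.contDiff_it n) a b (h2.trans h3)
      (fun y hy => S.deriv_it_ne n y (h4 hy)) with h | h
    · exact ⟨_, _, h.2, h.1 (left_mem_Icc.2 (h2.trans h3).le) (right_mem_Icc.2 (h2.trans h3).le)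
        (h2.trans h3)⟩
    · exact ⟨_, _, h.2, h.1 (left_mem_Icc.2 (h2.trans h3).le) (right_mem_Icc.2 (h2.trans h3).le)
        (h2.trans h3)⟩
  obtain ⟨α, β, h5, h6⟩ := key
  refine ⟨α, β, h5, h6, ?_⟩
  rw [h5] at hsub
  have hsub' := hsub.trans (S.cell_sub_O A)
  rw [cell, Ioo_subset_Ioo_iff h6] at hsub
  have hd := S.d0
  refine ⟨?_, ?_, ?_, hsub'⟩
  · exact le_trans (by positivity) hsub.1
  · refine hsub.2.trans ?_
    rw [div_le_one hd]
    exact_mod_cast A.2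
  · have : ((A:ℕ) + 1) / (S.d:ℝ) - (A:ℕ) / (S.d:ℝ) = 1 / S.d := by field_simp; ring
    linarith [hsub.1, hsub.2]

noncomputable def len (E : Set ℝ) : ℝ := volume.real E

/-- description of a level one component inside an image interval -/
lemma one_comp {n : ℕ} {x : ℝ} (hx : x ∈ S.O (n + 1)) {α β : ℝ}
    (hI : S.g^[n] '' S.Pc n x = Ioo α β) :
    ∃ p : ℝ × ℝ, S.g^[n] '' S.Pc (n + 1) x = Ioo p.1 p.2 ∧ α ≤ p.1 ∧ p.1 < p.2 ∧ p.2 ≤ β ∧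
      volume.real (S.g^[n + 1] '' S.Pc (n + 1) x) = |S.g p.2 - S.g p.1| ∧
      (S.Gd (n + 1) x ∨ p.1 = α ∨ p.2 = β ∨ deriv S.g p.1 = 0 ∨ deriv S.g p.2 = 0) := by
  have hxs := (S.O_add n 1 x).1 hx
  obtain ⟨_, _, _, _, _, _, _, h0⟩ := S.img_Ioo hxs.1
  rename_i α' β' e1 e2 e3 e4 e5
  rw [hI] at e1
  rw [← e1] at h0
  clear e1 e2 e3 e4 e5
  have hmem : S.g^[n] x ∈ Ioo α β ∩ S.O 1 := ⟨hI ▸ mem_image_of_mem _ (S.mem_Pc hxs.1), hxs.2⟩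
  obtain ⟨a, b, h1, ha, hb, h2, h3, h4, h5, h6⟩ := comp_Ioo (Ioo α β ∩ S.O 1)
    (isOpen_Ioo.inter (S.isOpen_O 1)) (inter_subset_right.trans (S.O_sub' 1)) _ hmem
  have htr := S.transfer n 1 x hx
  rw [hI, h1] at htr
  have hab := h2.trans h3
  have hab' := h6.trans inter_subset_left
  rw [Ioo_subset_Ioo_iff hab] at hab'
  have hg2 : S.g^[n + 1] '' S.Pc (n + 1) x = S.g '' Ioo a b := by
    rw [← htr, ← image_comp, Function.iterate_succ']
  have hO1 : Ioo a b ⊆ S.O 1 := h6.trans inter_subset_right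
  have hmono := deriv_ne_mono S.g S.hg a b hab (fun y hy => by
    simpa using (hO1 hy).2.2 0 (by omega))
  have hgab : ∀ y ∈ S.g '' Ioo a b, y ∈ Icc (0:ℝ) 1 ∧ y ∉ S.Q := by
    rintro _ ⟨y, hy, rfl⟩
    exact ⟨S.maps (S.O_sub' 1 (hO1 hy)), by simpa using (hO1 hy).2.1 1 le_rfl⟩
  refine ⟨(a, b), htr, hab'.1, hab, hab'.2, ?_, ?_⟩
  · rw [hg2]
    rcases hmono with h | h
    · have := h.1 (left_mem_Icc.2 hab.le) (right_mem_Icc.2 hab.le) hab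
      rw [h.2, Real.volume_real_Ioo_of_le this.le, abs_of_pos (by linarith)]
    · have := h.1 (left_mem_Icc.2 hab.le) (right_mem_Icc.2 hab.le) hab
      rw [h.2, Real.volume_real_Ioo_of_le this.le, abs_of_neg (by linarith)]; ring
  · by_contra hcon
    push Not at hcon
    obtain ⟨hc0, hc1, hc2, hc3, hc4⟩ := hcon
    have ha' : a ∈ Ioo α β := ⟨lt_of_le_of_ne hab'.1 (Ne.symm hc1), hab.trans_le hab'.2⟩
    have hb' : b ∈ Ioo α β := ⟨hab'.1.trans_lt hab, lt_of_le_of_ne hab'.2 hc2⟩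
    have hq : ∀ y, y ∈ Ioo α β → y ∉ Ioo α β ∩ S.O 1 → deriv S.g y ≠ 0 → S.g y ∈ S.Q := by
      intro y hy hyn hyd
      by_contra hyq
      apply hyn
      refine ⟨hy, (h0 hy).1, ?_, ?_⟩
      · intro i hi
        interval_cases i
        · exact (h0 hy).2.1 0 le_rfl
        · exact hyq
      · intro i hi
        interval_cases i
        exact hyd
    have hqa := hq a ha' ha hc3
    have hqb := hq b hb' hb hc4
    apply hc0
    refine ⟨hx, ?_⟩
    rw [hg2]
    rcases hmono with h | h
    · rw [h.2] at hgab ⊢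
      exact S.isCell (h.1 (left_mem_Icc.2 hab.le) (right_mem_Icc.2 hab.le) hab) hqa hqb
        (fun y hy => (hgab y hy).1) (fun y hy => (hgab y hy).2)
    · rw [h.2] at hgab ⊢
      exact S.isCell (h.1 (left_mem_Icc.2 hab.le) (right_mem_Icc.2 hab.le) hab) hqb hqa
        (fun y hy => (hgab y hy).1) (fun y hy => (hgab y hy).2)

lemma Pc_disj {n : ℕ} {x y : ℝ} (h : S.Pc n x ≠ S.Pc n y) : Disjoint (S.Pc n x) (S.Pc n y) := by
  rw [Set.disjoint_left]
  intro z hz hz'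
  exact h ((S.Pc_eq hz).trans (S.Pc_eq hz').symm)

/-- subpieces of a common parent have disjoint images -/
lemma img_disj {n j : ℕ} {x y : ℝ} (hx : x ∈ S.O (n + j)) (hy : y ∈ S.O (n + j))
    (hP : S.Pc n x = S.Pc n y) (h : S.Pc (n + j) x ≠ S.Pc (n + j) y) :
    Disjoint (S.g^[n] '' S.Pc (n + j) x) (S.g^[n] '' S.Pc (n + j) y) := by
  have hxs := (S.O_add n j x).1 hx
  have hys := (S.O_add n j y).1 hy
  rw [Set.disjoint_left]
  rintro _ ⟨z, hz, rfl⟩ ⟨w, hw, hwz⟩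
  have h1 := S.Pc_anti (Nat.le_add_right n j) x hz
  have h2 := S.Pc_anti (Nat.le_add_right n j) y hw
  rw [← hP] at h2
  have := S.inj_Pc hxs.1 h2 h1 hwz
  subst this
  exact Set.disjoint_left.1 (S.Pc_disj h) hz hw

/-- the bad-piece estimate -/
theorem bad_sum (A : Fin S.d) : ∀ (n : ℕ) (F : Finset (Set ℝ)),
    (∀ C ∈ F, ∃ x ∈ S.cell A, S.Bd n x ∧ C = S.Pc n x) →
    ∑ C ∈ F, volume.real (S.g^[n] '' C) ^ S.sig ≤ S.Gam ^ n := by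
  classical
  intro n
  have hd := S.d0
  induction n with
  | zero =>
    intro F hF
    have hsub : F ⊆ {S.cell A} := by
      intro C hC
      obtain ⟨x, hx, -, rfl⟩ := hF C hC
      rw [Finset.mem_singleton, S.Pc_zero hx]
    refine (Finset.sum_le_sum_of_subset_of_nonneg hsub (fun _ _ _ => by positivity)).trans ?_
    rw [Finset.sum_singleton, pow_zero]
    apply Real.rpow_le_one measureReal_nonneg _ S.hsig0.le
    rw [Function.iterate_zero, image_id, cell, Real.volume_real_Ioo_of_le (by gcongr; linarith)]
    have : ((A:ℕ) + 1) / (S.d:ℝ) - (A:ℕ) / (S.d:ℝ) = 1 / S.d := by field_simp; ring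
    rw [this, div_le_one hd]
    exact_mod_cast S.hd
  | succ n ih =>
    intro F hF
    choose! pt hpt using hF
    set par : Set ℝ → Set ℝ := fun C => S.Pc n (pt C) with hpar
    have hmaps : ∀ C ∈ F, par C ∈ F.image par := fun C hC => Finset.mem_image_of_mem _ hC
    have hbd : ∀ C ∈ F, S.Bd n (pt C) := by
      intro C hC
      have h := (hpt C hC).2.1
      exact ⟨S.O_anti (Nat.le_succ n) h.1, fun s hs hs' => h.2 s hs (by omega)⟩
    have hpsum := ih (F.image par) (by
      intro P hP
      obtain ⟨C, hC, rfl⟩ := Finset.mem_image.1 hP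
      exact ⟨pt C, (hpt C hC).1, hbd C hC, rfl⟩)
    rw [← Finset.sum_fiberwise_of_maps_to hmaps]
    have hstep : ∀ P ∈ F.image par, ∑ C ∈ F.filter (fun C => par C = P),
        volume.real (S.g^[n+1] '' C) ^ S.sig ≤ S.Gam * volume.real (S.g^[n] '' P) ^ S.sig := by
      intro P hP
      obtain ⟨C0, hC0, hP0⟩ := Finset.mem_image.1 hP
      obtain ⟨α, β, hI, hαβ, hα, hβ, hl, -⟩ := S.img_Ioo (hbd C0 hC0).1
      have hI' : S.g^[n] '' P = Ioo α β := by rw [← hP0]; exact hI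
      have hex : ∀ C ∈ F.filter (fun C => par C = P), ∃ p : ℝ × ℝ,
          S.g^[n] '' C = Ioo p.1 p.2 ∧ α ≤ p.1 ∧ p.1 < p.2 ∧ p.2 ≤ β ∧
          volume.real (S.g^[n + 1] '' C) = |S.g p.2 - S.g p.1| ∧
          (p.1 = α ∨ p.2 = β ∨ deriv S.g p.1 = 0 ∨ deriv S.g p.2 = 0) := by
        intro C hC
        obtain ⟨hCF, hCP⟩ := Finset.mem_filter.1 hC
        obtain ⟨hxA, hxB, hCe⟩ := hpt C hCF
        have hCP' : S.Pc n (pt C) = P := hCP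
        obtain ⟨p, h1, h2, h3, h4, h5, h6⟩ := S.one_comp (x := pt C) (n := n) hxB.1
          (α := α) (β := β) (by rw [hCP', hI'])
        rw [← hCe] at h1 h5
        refine ⟨p, h1, h2, h3, h4, h5, h6.resolve_left ?_⟩
        exact hxB.2 (n+1) (by omega) le_rfl
      choose! e he using hex
      have hdisj : ∀ C ∈ F.filter (fun C => par C = P), ∀ C' ∈ F.filter (fun C => par C = P),
          C ≠ C' → Disjoint (Ioo (e C).1 (e C).2) (Ioo (e C').1 (e C').2) := by
        intro C hC C' hC' hne
        rw [← (he C hC).1, ← (he C' hC').1]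
        obtain ⟨hCF, hCP⟩ := Finset.mem_filter.1 hC
        obtain ⟨hCF', hCP'⟩ := Finset.mem_filter.1 hC'
        obtain ⟨-, hxB, hCe⟩ := hpt C hCF
        obtain ⟨-, hxB', hCe'⟩ := hpt C' hCF'
        have := S.img_disj (n := n) (j := 1) hxB.1 hxB'.1 (hCP.trans hCP'.symm) (by rw [← hCe, ← hCe']; exact hne)
        rwa [← hCe, ← hCe'] at this
      have hinj : InjOn e (F.filter (fun C => par C = P)) := by
        intro C hC C' hC' hee
        by_contra hne
        have := hdisj C hC C' hC' hne
        rw [hee, disjoint_self] at this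
        exact (nonempty_Ioo.2 (he C' hC').2.2.1).ne_empty this
      have := S.hstep α β hαβ hα hβ hl ((F.filter (fun C => par C = P)).image e)
        (by
          intro p hp
          obtain ⟨C, hC, rfl⟩ := Finset.mem_image.1 hp
          exact ⟨(he C hC).2.1, (he C hC).2.2.1, (he C hC).2.2.2.1⟩)
        (by
          intro p hp p' hp' hne
          obtain ⟨C, hC, rfl⟩ := Finset.mem_image.1 hp
          obtain ⟨C', hC', rfl⟩ := Finset.mem_image.1 hp'
          exact hdisj C hC C' hC' (fun h => hne (by rw [h])))
        (by
          intro p hp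
          obtain ⟨C, hC, rfl⟩ := Finset.mem_image.1 hp
          exact (he C hC).2.2.2.2.2)
      rw [Finset.sum_image hinj] at this
      rw [hI', Real.volume_real_Ioo_of_le hαβ.le]
      refine le_trans (le_of_eq ?_) this
      apply Finset.sum_congr rfl
      intro C hC
      rw [(he C hC).2.2.2.2.1]
    calc _ ≤ ∑ P ∈ F.image par, S.Gam * volume.real (S.g^[n] '' P) ^ S.sig := Finset.sum_le_sum hstep
      _ = S.Gam * ∑ P ∈ F.image par, volume.real (S.g^[n] '' P) ^ S.sig := by rw [Finset.mul_sum]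
      _ ≤ S.Gam * S.Gam ^ n := mul_le_mul_of_nonneg_left hpsum (by linarith [S.hGam])
      _ = _ := by ring

/-- disjoint measurable sets inside an interval -/
lemma sum_vol_le {ι : Type*} (G : Finset ι) (D : ι → Set ℝ) (hm : ∀ i ∈ G, MeasurableSet (D i))
    (hd : ∀ i ∈ G, ∀ j ∈ G, i ≠ j → Disjoint (D i) (D j)) (E : Set ℝ) (hE : volume E ≠ ⊤)
    (hs : ∀ i ∈ G, D i ⊆ E) : ∑ i ∈ G, volume.real (D i) ≤ volume.real E := by
  rw [← measureReal_biUnion_finset (fun i hi j hj hij => hd i hi j hj hij) hm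
    (fun i hi => measure_ne_top_of_subset (hs i hi) hE)]
  exact measureReal_mono (iUnion₂_subset hs) hE

lemma lip (x y : ℝ) (hx : x ∈ Icc (0:ℝ) 1) (hy : y ∈ Icc (0:ℝ) 1) :
    |S.g x - S.g y| ≤ S.Lam * |x - y| := by
  have hd' : Differentiable ℝ S.g := S.hg.differentiable (by simp)
  have hmv := (convex_Icc (0:ℝ) 1).norm_image_sub_le_of_norm_deriv_le (f := S.g)
        (fun y _ => hd' y) (fun y hy => by simpa [Real.norm_eq_abs] using S.hLam y hy)
        hy hx
  simpa [Real.norm_eq_abs] using hmv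

theorem prime_card (A : Fin S.d) (n : ℕ) (F : Finset (Set ℝ))
    (hF : ∀ C ∈ F, ∃ x ∈ S.cell A, S.Prime (n + 1) x ∧ C = S.Pc (n + 1) x) :
    (F.card : ℝ) ≤ S.d * S.Lam * S.Gam ^ n := by
  classical
  have hd := S.d0
  choose! pt hpt using hF
  set par : Set ℝ → Set ℝ := fun C => S.Pc n (pt C) with hpar
  have hmaps : ∀ C ∈ F, par C ∈ F.image par := fun C hC => Finset.mem_image_of_mem _ hC
  have hbd : ∀ C ∈ F, S.Bd n (pt C) := by
    intro C hC
    have h := (hpt C hC).2.1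
    exact ⟨S.O_anti (Nat.le_succ n) h.2.1.1, fun s hs hs' => h.2.2 s hs (by omega)⟩
  have hpsum := S.bad_sum A n (F.image par) (by
    intro P hP
    obtain ⟨C, hC, rfl⟩ := Finset.mem_image.1 hP
    exact ⟨pt C, (hpt C hC).1, hbd C hC, rfl⟩)
  have hL0 : 0 < S.Lam := by linarith [S.hLam1]
  have hstep : ∀ P ∈ F.image par, ((F.filter (fun C => par C = P)).card : ℝ) ≤
      S.d * S.Lam * volume.real (S.g^[n] '' P) ^ S.sig := by
    intro P hP
    obtain ⟨C0, hC0, hP0⟩ := Finset.mem_image.1 hP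
    obtain ⟨α, β, hI, hαβ, hα, hβ, hl, -⟩ := S.img_Ioo (hbd C0 hC0).1
    have hI' : S.g^[n] '' P = Ioo α β := by rw [← hP0]; exact hI
    have hex : ∀ C ∈ F.filter (fun C => par C = P), ∃ p : ℝ × ℝ,
          S.g^[n] '' C = Ioo p.1 p.2 ∧ α ≤ p.1 ∧ p.1 < p.2 ∧ p.2 ≤ β ∧
          volume.real (S.g^[n + 1] '' C) = |S.g p.2 - S.g p.1| := by
      intro C hC
      obtain ⟨hCF, hCP⟩ := Finset.mem_filter.1 hC
      obtain ⟨hxA, hxB, hCe⟩ := hpt C hCF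
      have hCP' : S.Pc n (pt C) = P := hCP
      obtain ⟨p, h1, h2, h3, h4, h5, h6⟩ := S.one_comp (x := pt C) (n := n) hxB.2.1.1
          (α := α) (β := β) (by rw [hCP', hI'])
      rw [← hCe] at h1 h5
      exact ⟨p, h1, h2, h3, h4, h5⟩
    choose! e he using hex
    have hdisj : ∀ C ∈ F.filter (fun C => par C = P), ∀ C' ∈ F.filter (fun C => par C = P),
          C ≠ C' → Disjoint (Ioo (e C).1 (e C).2) (Ioo (e C').1 (e C').2) := by
      intro C hC C' hC' hne
      rw [← (he C hC).1, ← (he C' hC').1]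
      obtain ⟨hCF, hCP⟩ := Finset.mem_filter.1 hC
      obtain ⟨hCF', hCP'⟩ := Finset.mem_filter.1 hC'
      obtain ⟨-, hxB, hCe⟩ := hpt C hCF
      obtain ⟨-, hxB', hCe'⟩ := hpt C' hCF'
      have := S.img_disj (n := n) (j := 1) hxB.2.1.1 hxB'.2.1.1 (hCP.trans hCP'.symm) (by rw [← hCe, ← hCe']; exact hne)
      rwa [← hCe, ← hCe'] at this
    have hsum := sum_vol_le (F.filter (fun C => par C = P)) (fun C => Ioo (e C).1 (e C).2)
      (fun _ _ => measurableSet_Ioo) hdisj (Ioo α β) (by simp)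
      (fun C hC => Ioo_subset_Ioo (he C hC).2.1 (he C hC).2.2.2.1)
    have hlow : ∀ C ∈ F.filter (fun C => par C = P), 1 / (S.d * S.Lam) ≤ volume.real (Ioo (e C).1 (e C).2) := by
      intro C hC
      obtain ⟨hCF, hCP⟩ := Finset.mem_filter.1 hC
      obtain ⟨hxA, hxB, hCe⟩ := hpt C hCF
      obtain ⟨h1, h2, h3, h4, h5⟩ := he C hC
      obtain ⟨B, hB⟩ := hxB.2.1.2
      rw [← hCe] at hB
      rw [hB, cell, Real.volume_real_Ioo_of_le (by gcongr; linarith)] at h5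
      have e1 : ((B:ℕ) + 1) / (S.d:ℝ) - (B:ℕ) / (S.d:ℝ) = 1 / S.d := by field_simp; ring
      rw [e1] at h5
      have hl := S.lip (e C).2 (e C).1 ⟨by linarith, by linarith⟩ ⟨by linarith, by linarith⟩
      rw [Real.volume_real_Ioo_of_le h3.le, ← abs_of_pos (show 0 < (e C).2 - (e C).1 by linarith)]
      rw [← h5] at hl
      rw [← div_div, div_le_iff₀ hL0]
      linarith
    have h2 := Finset.card_nsmul_le_sum _ _ _ hlow
    rw [nsmul_eq_mul] at h2
    have h3 := h2.trans hsum
    rw [hI']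
    have h4 : volume.real (Ioo α β) ≤ volume.real (Ioo α β) ^ S.sig := by
      rw [Real.volume_real_Ioo_of_le hαβ.le]
      have := Real.rpow_le_rpow_of_exponent_ge (show 0 < β - α by linarith)
        (show β - α ≤ 1 by linarith) S.hsig1
      simpa using this
    have h5 := h3.trans h4
    rw [mul_one_div, div_le_iff₀ (by positivity)] at h5
    linarith
  rw [Finset.card_eq_sum_card_fiberwise hmaps]
  push_cast
  calc _ ≤ ∑ P ∈ F.image par, S.d * S.Lam * volume.real (S.g^[n] '' P) ^ S.sig := Finset.sum_le_sum hstep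
    _ = S.d * S.Lam * ∑ P ∈ F.image par, volume.real (S.g^[n] '' P) ^ S.sig := by rw [Finset.mul_sum]
    _ ≤ _ := mul_le_mul_of_nonneg_left hpsum (by positivity)

end Sys
end IntervalEnt

namespace IntervalEnt

lemma countable_regular_fiber (φ : ℝ → ℝ) (hφ : Differentiable ℝ φ) (c : ℝ) :
    {x | φ x = c ∧ deriv φ x ≠ 0}.Countable := by
  set s := {x | φ x = c ∧ deriv φ x ≠ 0} with hs
  refine (countable_setOfPred_isolated_right_within (s := s)).mono ?_
  rintro x ⟨hx, hx'⟩
  refine ⟨⟨hx, hx'⟩, ?_⟩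
  have h := (hφ x).hasDerivAt.eventually_ne (c := c) hx'
  rw [eventually_nhdsWithin_iff] at h
  rw [← empty_mem_iff_bot, mem_nhdsWithin_iff_eventually]
  filter_upwards [h] with z hz hz2
  exact absurd hz2.1.1 (hz (ne_of_gt hz2.2))

namespace Sys

variable (S : Sys)

def U (m : ℕ) : Set ℝ := {x | ∃ s, 0 < s ∧ s ≤ m ∧ S.Gd s x}

lemma isOpen_U (m : ℕ) : IsOpen (S.U m) := by
  rw [isOpen_iff_mem_nhds]
  rintro x ⟨s, h1, h2, h3⟩
  refine mem_of_superset ((S.isOpen_Pc s x).mem_nhds (S.mem_Pc h3.1)) ?_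
  intro y hy
  exact ⟨s, h1, h2, (S.Gd_congr le_rfl hy).1 h3⟩

lemma deriv_it_add (i j : ℕ) (x : ℝ) :
    deriv S.g^[i + j] x = deriv S.g^[j] (S.g^[i] x) * deriv S.g^[i] x := by
  have hdi : Differentiable ℝ S.g^[i] := (S.contDiff_it i).differentiable (by simp)
  have hdn : Differentiable ℝ S.g^[j] := (S.contDiff_it j).differentiable (by simp)
  rw [add_comm i j, Function.iterate_add, deriv_comp x (hdn _) (hdi x)]

lemma countable_off (i : ℕ) : {x | x ∈ Ioo (0:ℝ) 1 ∧ x ∉ S.O i ∧ deriv S.g^[i] x ≠ 0}.Countable := by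
  have hQ : S.Q.Countable := by
    refine (countable_range (fun k : ℤ => (k:ℝ) / S.d)).mono ?_
    rintro x ⟨k, rfl⟩; exact ⟨k, rfl⟩
  have hc : (⋃ j : ℕ, ⋃ q ∈ S.Q, {x | S.g^[j] x = q ∧ deriv S.g^[j] x ≠ 0}).Countable :=
    countable_iUnion fun j => hQ.biUnion fun q _ =>
      countable_regular_fiber _ ((S.contDiff_it j).differentiable (by simp)) q
  refine hc.mono ?_
  rintro x ⟨hx, hO, hne⟩
  have h1 : ∀ j < i, deriv S.g (S.g^[j] x) ≠ 0 := by
    intro j hj h0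
    apply hne
    obtain ⟨k, rfl⟩ := Nat.exists_eq_add_of_lt hj
    rw [show j + k + 1 = j + (1 + k) by ring, S.deriv_it_add j, S.deriv_it_add 1]
    simp [h0]
  have h2 : ∃ j ≤ i, S.g^[j] x ∈ S.Q := by
    by_contra hcon
    push Not at hcon
    exact hO ⟨hx, hcon, h1⟩
  obtain ⟨j, hj, hjQ⟩ := h2
  simp only [mem_iUnion]
  refine ⟨j, _, hjQ, rfl, ?_⟩
  intro h0
  obtain ⟨k, rfl⟩ := Nat.exists_eq_add_of_le hj
  apply hne
  rw [S.deriv_it_add, h0, mul_zero]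

lemma bad_int (A : Fin S.d) (i m : ℕ) (him : i ≤ m) :
    ∫⁻ x in S.cell A \ S.U m, ENNReal.ofReal |deriv S.g^[i] x| ≤ ENNReal.ofReal (S.Gam ^ i) := by
  classical
  have hdi : Differentiable ℝ S.g^[i] := (S.contDiff_it i).differentiable (by simp)
  set W : Set (Set ℝ) := {C | ∃ x ∈ S.cell A, S.Bd i x ∧ C = S.Pc i x} with hW
  have hWd : W.PairwiseDisjoint id := by
    rintro C ⟨x, hx, hb, rfl⟩ D ⟨y, hy, hb', rfl⟩ hne
    exact S.Pc_disj hne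
  have hWc : W.Countable := by
    refine hWd.countable_of_isOpen ?_ ?_
    · rintro C ⟨x, hx, hb, rfl⟩; exact S.isOpen_Pc _ _
    · rintro C ⟨x, hx, hb, rfl⟩; exact ⟨x, S.mem_Pc hb.1⟩
  set E := {x | x ∈ Ioo (0:ℝ) 1 ∧ x ∉ S.O i ∧ deriv S.g^[i] x ≠ 0} with hE
  have hsub : S.cell A \ S.U m ⊆ (⋃ C ∈ W, id C) ∪ ((S.cell A) \ S.O i) := by
    rintro x ⟨hx, hxU⟩
    by_cases h : x ∈ S.O i
    · left
      refine mem_biUnion (x := S.Pc i x) ⟨x, hx, ⟨h, ?_⟩, rfl⟩ (S.mem_Pc h)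
      intro s hs hsi hg
      exact hxU ⟨s, hs, hsi.trans him, hg⟩
    · right; exact ⟨hx, h⟩
  refine (lintegral_mono_set hsub).trans ((lintegral_union_le _ _ _).trans ?_)
  have h0 : ∫⁻ x in S.cell A \ S.O i, ENNReal.ofReal |deriv S.g^[i] x| = 0 := by
    rw [lintegral_eq_zero_iff (by fun_prop)]
    rw [Filter.EventuallyEq, ae_restrict_iff' ((show MeasurableSet (S.cell A) from measurableSet_Ioo).diff
      (S.isOpen_O i).measurableSet)]
    have : ∀ᵐ x, x ∉ E := by
      exact (S.countable_off i).ae_notMem volume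
    filter_upwards [this] with x hx hx2
    by_contra hne
    refine hx ⟨(S.cell_sub_O A hx2.1).1, hx2.2, ?_⟩
    intro h; simp [h] at hne
  rw [h0, add_zero, lintegral_biUnion hWc _ hWd]
  swap
  · rintro C ⟨x, hx, hb, rfl⟩; exact (S.isOpen_Pc _ _).measurableSet
  have h1 : ∀ C : W, ∫⁻ x in id (C : Set ℝ), ENNReal.ofReal |deriv S.g^[i] x| =
      ENNReal.ofReal (volume.real (S.g^[i] '' C)) := by
    rintro ⟨C, x, hx, hb, rfl⟩
    have := lintegral_image_eq_lintegral_abs_deriv_mul (S.isOpen_Pc i x).measurableSet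
      (fun y _ => (hdi y).hasDerivAt.hasDerivWithinAt) (S.inj_Pc hb.1) (fun _ => 1)
    simp only [mul_one, lintegral_const, MeasurableSet.univ, Measure.restrict_apply, univ_inter,
      one_mul] at this
    rw [id, ← this]
    obtain ⟨α, β, e, -⟩ := S.img_Ioo hb.1
    rw [e]
    simp [Real.volume_Ioo, Measure.real]
  simp_rw [h1]
  rw [ENNReal.tsum_eq_iSup_sum]
  refine iSup_le fun F => ?_
  rw [← ENNReal.ofReal_sum_of_nonneg (fun _ _ => measureReal_nonneg)]
  apply ENNReal.ofReal_le_ofReal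
  have h2 := S.bad_sum A i (F.map ⟨Subtype.val, Subtype.val_injective⟩) (by
    intro C hC
    simp only [Finset.mem_map, Function.Embedding.coeFn_mk] at hC
    obtain ⟨C', _, rfl⟩ := hC
    exact C'.2)
  rw [Finset.sum_map] at h2
  refine le_trans (Finset.sum_le_sum ?_) h2
  rintro ⟨C, x, hx, hb, rfl⟩ _
  obtain ⟨α, β, e, e1, e2, e3, -⟩ := S.img_Ioo hb.1
  simp only [Function.Embedding.coeFn_mk]
  rw [e, Real.volume_real_Ioo_of_le e1.le]
  have := Real.rpow_le_rpow_of_exponent_ge (x := β - α) (by linarith) (by linarith) S.hsig1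
  simpa using this

lemma finite_of_bound {α : Type*} (s : Set α) (K : ℝ)
    (h : ∀ F : Finset α, (∀ c ∈ F, c ∈ s) → (F.card : ℝ) ≤ K) : s.Finite ∧ (s.ncard : ℝ) ≤ K := by
  have hf : s.Finite := by
    by_contra hinf
    obtain ⟨F, hF, hc⟩ := Set.Infinite.exists_subset_card_eq (s := s) hinf (⌊K⌋₊ + 1)
    have := h F (fun c hc => hF hc)
    rw [hc] at this
    have h2 := Nat.lt_floor_add_one K
    push_cast at this
    linarith
  refine ⟨hf, ?_⟩
  rw [Set.ncard_eq_toFinset_card s hf]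
  exact h _ (by simp)

/-- prime pieces of levels `1..m` in the cell `A` -/
def PP (A : Fin S.d) (m : ℕ) : Set (Set ℝ) :=
  {C | ∃ s ∈ Finset.range m, ∃ x ∈ S.cell A, S.Prime (s + 1) x ∧ C = S.Pc (s + 1) x}

lemma PP_finite (A : Fin S.d) (m : ℕ) :
    (S.PP A m).Finite ∧ ((S.PP A m).ncard : ℝ) ≤ m * (S.d * S.Lam * S.Gam ^ m) := by
  classical
  have h1 : ∀ s, {C | ∃ x ∈ S.cell A, S.Prime (s + 1) x ∧ C = S.Pc (s + 1) x}.Finite ∧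
      (({C | ∃ x ∈ S.cell A, S.Prime (s + 1) x ∧ C = S.Pc (s + 1) x}.ncard : ℕ) : ℝ) ≤
        S.d * S.Lam * S.Gam ^ s := fun s => finite_of_bound _ _ (fun F hF => S.prime_card A s F hF)
  have he : S.PP A m = ⋃ s ∈ Finset.range m,
      {C | ∃ x ∈ S.cell A, S.Prime (s + 1) x ∧ C = S.Pc (s + 1) x} := by
    ext C; simp only [PP, mem_iUnion, Set.mem_ofPred_eq, exists_prop]
  rw [he]
  refine ⟨Set.Finite.biUnion (Finset.finite_toSet _) fun s _ => (h1 s).1, ?_⟩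
  have h2 := Finset.set_ncard_biUnion_le (Finset.range m)
    (fun s => {C | ∃ x ∈ S.cell A, S.Prime (s + 1) x ∧ C = S.Pc (s + 1) x})
  have h3 : ((⋃ s ∈ Finset.range m,
      {C | ∃ x ∈ S.cell A, S.Prime (s + 1) x ∧ C = S.Pc (s + 1) x}).ncard : ℝ) ≤
      ∑ s ∈ Finset.range m,
      (({C | ∃ x ∈ S.cell A, S.Prime (s + 1) x ∧ C = S.Pc (s + 1) x}.ncard : ℕ) : ℝ) := by
    exact_mod_cast h2
  refine h3.trans ((Finset.sum_le_card_nsmul _ _ (S.d * S.Lam * S.Gam ^ m) ?_).trans (by simp))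
  intro s hs
  refine (h1 s).2.trans ?_
  have := S.hLam1
  have := S.d0
  have : S.Gam ^ s ≤ S.Gam ^ m := pow_le_pow_right₀ S.hGam (Finset.mem_range.1 hs).le
  gcongr

lemma var_le (φ : ℝ → ℝ) (hφ : ContDiff ℝ (⊤ : ℕ∞) φ) {x y : ℝ} (hxy : x ≤ y) :
    ENNReal.ofReal |φ y - φ x| ≤ ∫⁻ z in Ioc x y, ENNReal.ofReal |deriv φ z| := by
  have hc : Continuous (deriv φ) := hφ.continuous_deriv (by simp)
  have h := intervalIntegral.integral_deriv_eq_sub (f := φ) (a := x) (b := y)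
    (fun z _ => hφ.differentiable (by simp) z) (hc.intervalIntegrable _ _)
  rw [intervalIntegral.integral_of_le hxy] at h
  rw [← h, ← Real.norm_eq_abs, ofReal_norm]
  refine (enorm_integral_le_lintegral_enorm _).trans (le_of_eq ?_)
  refine lintegral_congr fun z => ?_
  rw [← ofReal_norm, Real.norm_eq_abs]

theorem bad_labels (ε : ℝ) (hε : 0 < ε) : ∃ K : ℝ, 0 < K ∧ ∀ m : ℕ, ∃ κ : Fin S.d → ℝ → ℕ,
    (∀ A, Measurable (κ A)) ∧ (∀ A x, (κ A x : ℝ) ≤ K * (m + 1) * S.Gam ^ m) ∧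
    ∀ A x y, x ∈ S.cell A → y ∈ S.cell A → x ∉ S.U m → y ∉ S.U m → κ A x = κ A y →
      ∀ i ≤ m, |S.g^[i] x - S.g^[i] y| ≤ ε := by
  classical
  have hd0 := S.d0
  have hL := S.hLam1
  have hG := S.hGam
  refine ⟨1 / ε + S.d * S.Lam, by positivity, fun m => ?_⟩
  set V : Fin S.d → Set ℝ := fun A => S.cell A \ S.U m with hV
  set M : Fin S.d → ℕ → ℝ → ℝ := fun A i x =>
    (∫⁻ z in V A ∩ Iic x, ENNReal.ofReal |deriv S.g^[i] z|).toReal with hM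
  set cnt : Fin S.d → ℝ → ℕ := fun A x => {C ∈ S.PP A m | C ⊆ Iio x}.ncard with hcnt
  set u : Fin S.d → ℝ → ℝ := fun A x =>
    (1 / ε) * ∑ i ∈ Finset.range (m + 1), M A i x + cnt A x with hu
  have hle : ∀ A i x, i ≤ m → ∫⁻ z in V A ∩ Iic x, ENNReal.ofReal |deriv S.g^[i] z| ≤
      ENNReal.ofReal (S.Gam ^ i) := fun A i x hi =>
    (lintegral_mono_set inter_subset_left).trans (S.bad_int A i m hi)
  have hMmono : ∀ A i, i ≤ m → Monotone (M A i) := by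
    intro A i hi x y hxy
    apply ENNReal.toReal_mono ((hle A i y hi).trans_lt ENNReal.ofReal_lt_top).ne
    exact lintegral_mono_set (inter_subset_inter_right _ (Iic_subset_Iic.2 hxy))
  have hfin : ∀ A x, {C ∈ S.PP A m | C ⊆ Iio x}.Finite := fun A x =>
    (S.PP_finite A m).1.subset (fun C hC => hC.1)
  have hcmono : ∀ A, Monotone (cnt A) := by
    intro A x y hxy
    exact Set.ncard_le_ncard (fun C hC => ⟨hC.1, hC.2.trans (Iio_subset_Iio hxy)⟩) (hfin A y)
  have hM0 : ∀ A i x, 0 ≤ M A i x := fun A i x => ENNReal.toReal_nonneg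
  have humono : ∀ A, Monotone (u A) := by
    intro A x y hxy
    have h1 : ∑ i ∈ Finset.range (m + 1), M A i x ≤ ∑ i ∈ Finset.range (m + 1), M A i y :=
      Finset.sum_le_sum fun i hi => hMmono A i (by simpa [Nat.lt_succ_iff] using hi) hxy
    have h2 : (cnt A x : ℝ) ≤ cnt A y := by exact_mod_cast hcmono A hxy
    have h3 : 0 ≤ 1 / ε := by positivity
    simp only [hu]
    have := mul_le_mul_of_nonneg_left h1 h3
    linarith
  have hu0 : ∀ A x, 0 ≤ u A x := by
    intro A x
    have := Finset.sum_nonneg fun i (_ : i ∈ Finset.range (m + 1)) => hM0 A i x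
    positivity
  refine ⟨fun A x => ⌊u A x⌋₊, ?_, ?_, ?_⟩
  · intro A
    exact Nat.measurable_floor.comp (humono A).measurable
  · intro A x
    refine (Nat.floor_le (hu0 A x)).trans ?_
    have hGm : 0 < S.Gam ^ m := by positivity
    have h1 : ∑ i ∈ Finset.range (m + 1), M A i x ≤ (m + 1) * S.Gam ^ m := by
      refine (Finset.sum_le_card_nsmul _ _ (S.Gam ^ m) ?_).trans (by simp)
      intro i hi
      have hi' : i ≤ m := by simpa [Nat.lt_succ_iff] using hi
      refine (ENNReal.toReal_le_of_le_ofReal (by positivity) (hle A i x hi')).trans ?_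
      exact pow_le_pow_right₀ hG hi'
    have h2 : (cnt A x : ℝ) ≤ m * (S.d * S.Lam * S.Gam ^ m) := by
      refine le_trans ?_ (S.PP_finite A m).2
      have hs : {C ∈ S.PP A m | C ⊆ Iio x} ⊆ S.PP A m := fun C hC => hC.1
      exact_mod_cast Set.ncard_le_ncard hs (S.PP_finite A m).1
    have h4 := mul_le_mul_of_nonneg_left h1 (show 0 ≤ 1 / ε by positivity)
    have h5 : 0 ≤ S.d * S.Lam * S.Gam ^ m := by positivity
    simp only [hu]
    nlinarith
  · have key : ∀ A x y, x ∈ S.cell A → y ∈ S.cell A → x ∉ S.U m → y ∉ S.U m →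
        ⌊u A x⌋₊ = ⌊u A y⌋₊ → x ≤ y → ∀ i ≤ m, |S.g^[i] x - S.g^[i] y| ≤ ε := by
      intro A x y hx hy hxU hyU huu hxy i hi
      have hlt : u A y - u A x < 1 := by
        have h1 := Nat.lt_floor_add_one (u A y)
        have h2 := Nat.floor_le (hu0 A x)
        rw [huu] at h2
        linarith
      have hsum : ∀ i ∈ Finset.range (m + 1), M A i x ≤ M A i y := fun i hi =>
        hMmono A i (by simpa [Nat.lt_succ_iff] using hi) hxy
      have hc := hcmono A hxy
      have hce : cnt A x = cnt A y := by
        by_contra hne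
        have h1 : (cnt A x : ℝ) + 1 ≤ cnt A y := by exact_mod_cast lt_of_le_of_ne hc hne
        have h2 := mul_le_mul_of_nonneg_left (Finset.sum_le_sum hsum)
          (show 0 ≤ 1 / ε by positivity)
        simp only [hu] at hlt
        linarith
      have hMlt : M A i y - M A i x ≤ ε := by
        have h1 : M A i y - M A i x ≤
            ∑ i ∈ Finset.range (m + 1), (M A i y - M A i x) :=
          Finset.single_le_sum (f := fun i => M A i y - M A i x)
            (fun j hj => sub_nonneg.2 (hsum j hj)) (by simp; omega)
        rw [Finset.sum_sub_distrib] at h1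
        simp only [hu, hce] at hlt
        have h2 : (1 / ε) * (∑ i ∈ Finset.range (m + 1), M A i y -
          ∑ i ∈ Finset.range (m + 1), M A i x) < 1 := by linarith
        rw [one_div, inv_mul_lt_iff₀ hε] at h2
        linarith
      have hVsub : Ioc x y ⊆ V A := by
        intro z hz
        refine ⟨⟨hx.1.trans hz.1, hz.2.trans_lt hy.2⟩, ?_⟩
        rintro hzU
        have hzU' : ∃ s, 0 < s ∧ s ≤ m ∧ S.Gd s z := hzU
        have hs := Nat.find_spec hzU'
        set s := Nat.find hzU' with hsdef
        have hmin : ∀ s', 0 < s' → s' < s → ¬ S.Gd s' z := by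
          intro s' h1 h2 h3
          exact Nat.find_min hzU' h2 ⟨h1, by omega, h3⟩
        have hzc : z ∈ S.cell A := ⟨hx.1.trans hz.1, hz.2.trans_lt hy.2⟩
        have hoc : OrdConnected (S.Pc s z) :=
          isPreconnected_iff_ordConnected.1 isPreconnected_connectedComponentIn
        have hnot : ∀ w, w ∉ S.U m → w ∉ S.Pc s z := by
          intro w hw hw'
          exact hw ⟨s, hs.1, hs.2.1, (S.Gd_congr le_rfl hw').1 hs.2.2⟩
        have hzm := S.mem_Pc hs.2.2.1
        have hzy : z < y := lt_of_le_of_ne hz.2 (fun h => hnot y hyU (h ▸ hzm))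
        have hCy : S.Pc s z ⊆ Iio y := by
          intro w hw
          by_contra hcon
          exact hnot y hyU (hoc.out hzm hw ⟨hzy.le, not_lt.1 hcon⟩)
        have hCx : ¬ S.Pc s z ⊆ Iio x := fun h => absurd (h hzm) (not_lt.2 hz.1.le)
        have hmem : S.Pc s z ∈ S.PP A m := by
          refine ⟨s - 1, Finset.mem_range.2 (by omega), z, hzc, ?_⟩
          rw [Nat.sub_add_cancel hs.1]
          exact ⟨⟨hs.1, hs.2.2, hmin⟩, rfl⟩
        have : cnt A x < cnt A y := by
          apply Set.ncard_lt_ncard _ (hfin A y)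
          refine ⟨fun C hC => ⟨hC.1, hC.2.trans (Iio_subset_Iio hxy)⟩, ?_⟩
          intro hsub
          exact hCx (hsub ⟨hmem, hCy⟩).2
        omega
      have hun : V A ∩ Iic y = (V A ∩ Iic x) ∪ Ioc x y := by
        ext z
        constructor
        · rintro ⟨h1, h2⟩
          rcases le_or_gt z x with h | h
          · exact Or.inl ⟨h1, h⟩
          · exact Or.inr ⟨h, h2⟩
        · rintro (⟨h1, h2⟩ | h)
          · exact ⟨h1, le_trans h2 hxy⟩
          · exact ⟨hVsub h, h.2⟩
      have hadd : M A i y = M A i x +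
          (∫⁻ z in Ioc x y, ENNReal.ofReal |deriv S.g^[i] z|).toReal := by
        have hne1 := ((hle A i x hi).trans_lt ENNReal.ofReal_lt_top).ne
        have hne2 : ∫⁻ z in Ioc x y, ENNReal.ofReal |deriv S.g^[i] z| ≠ ⊤ :=
          ((lintegral_mono_set (fun z hz => (⟨hVsub hz, hz.2⟩ : z ∈ V A ∩ Iic y))).trans_lt
            ((hle A i y hi).trans_lt ENNReal.ofReal_lt_top)).ne
        simp only [hM]
        rw [hun, lintegral_union measurableSet_Ioc, ENNReal.toReal_add hne1 hne2]
        rw [Set.disjoint_left]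
        rintro z ⟨_, h1⟩ h2
        exact absurd h2.1 (not_lt.2 h1)
      have hne2 : ∫⁻ z in Ioc x y, ENNReal.ofReal |deriv S.g^[i] z| ≠ ⊤ :=
          ((lintegral_mono_set (fun z hz => (⟨hVsub hz, hz.2⟩ : z ∈ V A ∩ Iic y))).trans_lt
            ((hle A i y hi).trans_lt ENNReal.ofReal_lt_top)).ne
      have hvar := var_le S.g^[i] (S.contDiff_it i) hxy
      rw [ENNReal.ofReal_le_iff_le_toReal hne2] at hvar
      rw [abs_sub_comm]
      linarith
    intro A x y hx hy hxU hyU huu i hi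
    rcases le_total x y with h | h
    · exact key A x y hx hy hxU hyU huu h i hi
    · rw [abs_sub_comm]
      exact key A y x hy hx hyU hxU huu.symm h i hi

end Sys
end IntervalEnt

namespace IntervalEnt
namespace Sys

variable (S : Sys)

open Classical in
noncomputable def tl (n : ℕ) (x : ℝ) : ℕ := Nat.findGreatest (fun s => S.Gd s x) n

lemma tl_le (n : ℕ) (x : ℝ) : S.tl n x ≤ n := by
  classical
  exact Nat.findGreatest_le n

lemma tl_Gd (n : ℕ) {x : ℝ} (hx : S.Gd 0 x) : S.Gd (S.tl n x) x := by
  classical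
  exact Nat.findGreatest_spec (P := fun s => S.Gd s x) (Nat.zero_le n) hx

lemma tl_max (n : ℕ) (x : ℝ) (s : ℕ) (h1 : S.tl n x < s) (h2 : s ≤ n) : ¬ S.Gd s x := by
  classical
  exact Nat.findGreatest_is_greatest h1 h2

lemma tl_eq {n t : ℕ} {x : ℝ} (h1 : t ≤ n) (h2 : S.Gd t x)
    (h3 : ∀ s, t < s → s ≤ n → ¬ S.Gd s x) : S.tl n x = t := by
  classical
  rcases lt_trichotomy (S.tl n x) t with h | h | h
  · exact absurd h2 (S.tl_max n x t h h1)
  · exact h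
  · have h0 : S.Gd (S.tl n x) x := Nat.findGreatest_spec (P := fun s => S.Gd s x) h1 h2
    exact absurd h0 (h3 _ h (S.tl_le n x))

lemma isOpen_Gd (s : ℕ) : IsOpen {x | S.Gd s x} := by
  rw [isOpen_iff_mem_nhds]
  intro x h3
  refine mem_of_superset ((S.isOpen_Pc s x).mem_nhds (S.mem_Pc h3.1)) ?_
  intro y hy
  exact (S.Gd_congr le_rfl hy).1 h3

lemma isOpen_GdPc (s : ℕ) (J : Set ℝ) : IsOpen {x | S.Gd s x ∧ S.Pc s x = J} := by
  rw [isOpen_iff_mem_nhds]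
  rintro x ⟨h3, rfl⟩
  refine mem_of_superset ((S.isOpen_Pc s x).mem_nhds (S.mem_Pc h3.1)) ?_
  intro y hy
  exact ⟨(S.Gd_congr le_rfl hy).1 h3, (S.Pc_eq hy).symm⟩

/-- variation count along a good piece -/
noncomputable def kv (ε : ℝ) (t : ℕ) (J : Set ℝ) (x : ℝ) : ℝ :=
  (1 / ε) * ∑ i ∈ Finset.range t, |S.g^[i] x - S.g^[i] (sInf J)|

lemma kv_sep (ε : ℝ) (hε : 0 < ε) {t : ℕ} {x y : ℝ} (hx : x ∈ S.O t) (hy : y ∈ S.Pc t x)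
    (h : ⌊S.kv ε t (S.Pc t x) x⌋₊ = ⌊S.kv ε t (S.Pc t x) y⌋₊) (hxy : x ≤ y) (i : ℕ) (hi : i < t) :
    |S.g^[i] x - S.g^[i] y| ≤ ε := by
  obtain ⟨a, b, h1, -, -, h2, h3, -, -, h4⟩ := S.Pc_Ioo hx
  have hinf : sInf (S.Pc t x) = a := by rw [h1]; exact csInf_Ioo (h2.trans h3)
  rw [h1] at hy
  have hmono : ∀ j < t, |S.g^[j] x - S.g^[j] a| + |S.g^[j] x - S.g^[j] y| ≤
      |S.g^[j] y - S.g^[j] a| := by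
    intro j hj
    have ha : a ∈ Icc a b := ⟨le_rfl, (h2.trans h3).le⟩
    have hx' : x ∈ Icc a b := ⟨h2.le, h3.le⟩
    have hy' : y ∈ Icc a b := ⟨hy.1.le, hy.2.le⟩
    rcases deriv_ne_mono S.g^[j] (S.contDiff_it j) a b (h2.trans h3)
      (fun y hy => S.deriv_it_ne j y (S.O_anti hj.le (h4 hy))) with h | h
    · have e1 := h.1.monotoneOn ha hx' h2.le
      have e2 := h.1.monotoneOn hx' hy' hxy
      rw [abs_of_nonneg (by linarith), abs_of_nonpos (by linarith), abs_of_nonneg (by linarith)]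
      linarith
    · have e1 := h.1.antitoneOn ha hx' h2.le
      have e2 := h.1.antitoneOn hx' hy' hxy
      rw [abs_of_nonpos (by linarith), abs_of_nonneg (by linarith), abs_of_nonpos (by linarith)]
      linarith
  have h0 : 0 ≤ S.kv ε t (S.Pc t x) x := by unfold kv; positivity
  have hlt : S.kv ε t (S.Pc t x) y - S.kv ε t (S.Pc t x) x < 1 := by
    have e1 := Nat.lt_floor_add_one (S.kv ε t (S.Pc t x) y)
    have e2 := Nat.floor_le h0
    rw [h] at e2
    linarith
  unfold kv at hlt
  rw [hinf, ← mul_sub, ← Finset.sum_sub_distrib, one_div, inv_mul_lt_iff₀ hε, mul_one] at hlt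
  have hs : |S.g^[i] x - S.g^[i] y| ≤
      ∑ j ∈ Finset.range t, (|S.g^[j] y - S.g^[j] a| - |S.g^[j] x - S.g^[j] a|) := by
    refine le_trans ?_ (Finset.single_le_sum
      (f := fun j => |S.g^[j] y - S.g^[j] a| - |S.g^[j] x - S.g^[j] a|) ?_ (Finset.mem_range.2 hi))
    · have := hmono i hi
      linarith
    · intro j hj
      have := hmono j (Finset.mem_range.1 hj)
      have := abs_nonneg (S.g^[j] x - S.g^[j] y)
      simp only [sub_nonneg]
      linarith
  linarith

theorem central_labels (ε : ℝ) (hε : 0 < ε) : ∃ K : ℕ, 0 < K ∧ ∀ n : ℕ,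
    ∃ ℓ : ℝ → ℕ × Set ℝ × ℕ × ℕ,
    (∀ x ∈ Icc (0:ℝ) 1, x ∉ S.Q → (ℓ x).1 ≤ n ∧ S.Gd (ℓ x).1 x ∧ (ℓ x).2.1 = S.Pc (ℓ x).1 x ∧
      (∀ s, (ℓ x).1 < s → s ≤ n → ¬ S.Gd s x) ∧ (ℓ x).2.2.1 ≤ K * (n + 1) ∧
      ((ℓ x).2.2.2 : ℝ) ≤ K * (n + 1) * S.Gam ^ (n - (ℓ x).1)) ∧
    (∀ x ∈ S.Q, ℓ x = (0, {x}, 0, 0)) ∧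
    (∀ x ∈ Icc (0:ℝ) 1, ∀ y ∈ Icc (0:ℝ) 1, ℓ x = ℓ y → ∀ i ≤ n, |S.g^[i] x - S.g^[i] y| ≤ ε) ∧
    (∀ c, MeasurableSet {x | x ∈ Icc (0:ℝ) 1 ∧ ℓ x = c}) := by
  classical
  obtain ⟨K0, hK0, hκ⟩ := S.bad_labels ε hε
  choose κ hκm hκb hκs using hκ
  have hG := S.hGam
  set K : ℕ := ⌈K0⌉₊ + ⌈1 / ε⌉₊ + 1 with hK
  have hKa : K0 ≤ K := (Nat.le_ceil _).trans (by exact_mod_cast (by omega))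
  have hKb : 1 / ε ≤ K := (Nat.le_ceil _).trans (by exact_mod_cast (by omega))
  have hd : 0 < S.d := S.hd
  set cl : ℝ → Fin S.d := fun x => if h : ∃ A, x ∈ S.cell A then h.choose else ⟨0, hd⟩ with hcl
  have hcl' : ∀ {A x}, x ∈ S.cell A → cl x = A := by
    intro A x hx
    have h : ∃ A, x ∈ S.cell A := ⟨A, hx⟩
    simp only [hcl, dif_pos h]
    exact S.cell_disj h.choose_spec hx
  refine ⟨K, by omega, fun n => ?_⟩
  have hGd0 : ∀ x ∈ Icc (0:ℝ) 1, x ∉ S.Q → S.Gd 0 x := by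
    intro x hx hxQ
    obtain ⟨A, hA⟩ := S.exists_cell hx hxQ
    exact S.Gd_zero hA
  set ℓ : ℝ → ℕ × Set ℝ × ℕ × ℕ := fun x => if x ∈ S.Q then (0, {x}, 0, 0) else
    (S.tl n x, S.Pc (S.tl n x) x, ⌊S.kv ε (S.tl n x) (S.Pc (S.tl n x) x) x⌋₊,
      κ (n - S.tl n x) (cl (S.g^[S.tl n x] x)) (S.g^[S.tl n x] x)) with hℓ
  have hℓQ : ∀ x ∈ S.Q, ℓ x = (0, {x}, 0, 0) := fun x hx => by simp only [hℓ, if_pos hx]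
  have hℓn : ∀ x ∉ S.Q, ℓ x = (S.tl n x, S.Pc (S.tl n x) x,
      ⌊S.kv ε (S.tl n x) (S.Pc (S.tl n x) x) x⌋₊,
      κ (n - S.tl n x) (cl (S.g^[S.tl n x] x)) (S.g^[S.tl n x] x)) :=
    fun x hx => by simp only [hℓ, if_neg hx]
  have hUn : ∀ x, S.Gd (S.tl n x) x → S.g^[S.tl n x] x ∉ S.U (n - S.tl n x) := by
    rintro x hx ⟨s, h1, h2, h3⟩
    exact S.tl_max n x (S.tl n x + s) (by omega) (by have := S.tl_le n x; omega)
      (S.Gd_concat hx h3)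
  refine ⟨ℓ, ?_, hℓQ, ?_, ?_⟩
  · intro x hx hxQ
    have h0 := hGd0 x hx hxQ
    rw [hℓn x hxQ]
    refine ⟨S.tl_le n x, S.tl_Gd n h0, rfl, S.tl_max n x, ?_, ?_⟩
    · have h1 : S.kv ε (S.tl n x) (S.Pc (S.tl n x) x) x ≤ ((K * (n + 1) : ℕ) : ℝ) := by
        unfold kv
        have hO := (S.tl_Gd n h0).1
        obtain ⟨a, b, e1, -, -, e2, e3, e4, e5, -⟩ := S.Pc_Ioo hO
        have hinf : sInf (S.Pc (S.tl n x) x) = a := by rw [e1]; exact csInf_Ioo (e2.trans e3)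
        have ha : a ∈ Icc (0:ℝ) 1 := ⟨e4, by linarith [hx.2]⟩
        rw [hinf]
        have hsum : ∑ i ∈ Finset.range (S.tl n x), |S.g^[i] x - S.g^[i] a| ≤ n + 1 := by
          refine (Finset.sum_le_card_nsmul _ _ 1 ?_).trans ?_
          · intro i _
            have f1 := S.maps_it i hx
            have f2 := S.maps_it i ha
            rw [abs_le]; constructor <;> linarith [f1.1, f1.2, f2.1, f2.2]
          · have : ((S.tl n x : ℕ) : ℝ) ≤ n := by exact_mod_cast S.tl_le n x
            simp; linarith
        push_cast
        exact mul_le_mul hKb hsum (Finset.sum_nonneg fun _ _ => abs_nonneg _) (by positivity)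
      exact Nat.floor_le_of_le h1
    · refine (hκb _ _ _).trans ?_
      have : ((n - S.tl n x : ℕ) : ℝ) ≤ n := by exact_mod_cast Nat.sub_le _ _
      dsimp only
      gcongr
  · intro x hx y hy hxy i hi
    by_cases hxQ : x ∈ S.Q
    · by_cases hyQ : y ∈ S.Q
      · rw [hℓQ x hxQ, hℓQ y hyQ] at hxy
        simp only [Prod.mk.injEq, singleton_eq_singleton_iff, and_true, true_and] at hxy
        simp [hxy, hε.le]
      · rw [hℓQ x hxQ, hℓn y hyQ] at hxy
        have h1 : {x} = S.Pc (S.tl n y) y := congrArg (fun z => z.2.1) hxy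
        have h2 : y ∈ ({x} : Set ℝ) := h1 ▸ S.mem_Pc (S.tl_Gd n (hGd0 y hy hyQ)).1
        exact absurd (mem_singleton_iff.1 h2 ▸ hxQ) hyQ
    · by_cases hyQ : y ∈ S.Q
      · rw [hℓQ y hyQ, hℓn x hxQ] at hxy
        have h1 : S.Pc (S.tl n x) x = {y} := congrArg (fun z => z.2.1) hxy
        have h2 : x ∈ ({y} : Set ℝ) := h1 ▸ S.mem_Pc (S.tl_Gd n (hGd0 x hx hxQ)).1
        exact absurd (mem_singleton_iff.1 h2 ▸ hyQ) hxQ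
      · rw [hℓn x hxQ, hℓn y hyQ] at hxy
        have e1 : S.tl n x = S.tl n y := congrArg (fun z => z.1) hxy
        simp only [Prod.mk.injEq, ← e1, true_and] at hxy
        obtain ⟨e2, e3, e4⟩ := hxy
        have gx := S.tl_Gd n (hGd0 x hx hxQ)
        have gy := S.tl_Gd n (hGd0 y hy hyQ)
        have ux := hUn x gx
        have uy := hUn y gy
        rw [← e1] at gy uy
        set t := S.tl n x
        have htn : t ≤ n := S.tl_le n x
        have hyx : y ∈ S.Pc t x := e2 ▸ S.mem_Pc gy.1
        have hxy' : x ∈ S.Pc t y := e2 ▸ S.mem_Pc gx.1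
        rcases lt_or_ge i t with hit | hit
        · rcases le_total x y with h | h
          · refine S.kv_sep ε hε gx.1 hyx ?_ h i hit
            rw [e3, e2]
          · rw [abs_sub_comm]
            refine S.kv_sep ε hε gy.1 hxy' ?_ h i hit
            rw [← e3, e2]
        · obtain ⟨B, hB⟩ := S.Gd_cell gx
          have himg := S.Gd_img gx hB
          have hB' : S.g^[t] y ∈ S.cell B := himg ▸ mem_image_of_mem _ hyx
          rw [hcl' hB, hcl' hB'] at e4
          obtain ⟨j, rfl⟩ := Nat.exists_eq_add_of_le' hit
          have := hκs (n - t) B _ _ hB hB' ux uy e4 j (by omega)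
          rwa [← Function.iterate_add_apply, ← Function.iterate_add_apply] at this
  · rintro ⟨t, J, k1, k2⟩
    have hQm : MeasurableSet {x | x ∈ S.Q ∧ x ∈ Icc (0:ℝ) 1 ∧
        ((0, {x}, 0, 0) : ℕ × Set ℝ × ℕ × ℕ) = (t, J, k1, k2)} := by
      apply Set.Subsingleton.measurableSet
      rintro x ⟨_, _, h1⟩ y ⟨_, _, h2⟩
      have h3 : ({x} : Set ℝ) = J := congrArg (fun z => z.2.1) h1
      have h4 : ({y} : Set ℝ) = J := congrArg (fun z => z.2.1) h2
      exact singleton_eq_singleton_iff.1 (h3.trans h4.symm)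
    have heq : {x | x ∈ Icc (0:ℝ) 1 ∧ ℓ x = (t, J, k1, k2)} =
        {x | x ∈ S.Q ∧ x ∈ Icc (0:ℝ) 1 ∧
          ((0, {x}, 0, 0) : ℕ × Set ℝ × ℕ × ℕ) = (t, J, k1, k2)} ∪
        ((S.Qᶜ ∩ Icc 0 1 ∩ {x | S.Gd t x ∧ S.Pc t x = J} ∩ {_x | t ≤ n} ∩
          (⋂ s ∈ Finset.Ioc t n, {x | S.Gd s x}ᶜ)) ∩
          ({x | ⌊S.kv ε t J x⌋₊ = k1} ∩ ⋃ B, {x | S.g^[t] x ∈ S.cell B ∧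
            κ (n - t) B (S.g^[t] x) = k2})) := by
      ext x
      constructor
      · rintro ⟨hx, he⟩
        by_cases hxQ : x ∈ S.Q
        · left
          rw [hℓQ x hxQ] at he
          exact ⟨hxQ, hx, he⟩
        · right
          rw [hℓn x hxQ] at he
          simp only [Prod.mk.injEq] at he
          obtain ⟨e1, e2, e3, e4⟩ := he
          have gx := S.tl_Gd n (hGd0 x hx hxQ)
          have htn := S.tl_le n x
          have hmax := S.tl_max n x
          rw [e1] at e2 e3 e4 gx htn hmax
          rw [e2] at e3
          obtain ⟨B, hB⟩ := S.Gd_cell gx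
          rw [hcl' hB] at e4
          refine ⟨⟨⟨⟨⟨hxQ, hx⟩, gx, e2⟩, htn⟩, ?_⟩, e3, ?_⟩
          · simp only [mem_iInter]
            intro s hs
            rw [Finset.mem_Ioc] at hs
            exact hmax s hs.1 hs.2
          · exact mem_iUnion.2 ⟨B, hB, e4⟩
      · rintro (⟨hxQ, hx, he⟩ | ⟨⟨⟨⟨⟨hxQ, hx⟩, gx, e2⟩, htn⟩, hmax⟩, e3, e4⟩)
        · exact ⟨hx, by rw [hℓQ x hxQ, he]⟩
        · refine ⟨hx, ?_⟩
          simp only [mem_iInter] at hmax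
          have htl : S.tl n x = t := S.tl_eq htn gx
            (fun s h1 h2 => hmax s (Finset.mem_Ioc.2 ⟨h1, h2⟩))
          obtain ⟨B, hB, e5⟩ := mem_iUnion.1 e4
          rw [hℓn x hxQ, htl, e2, hcl' hB, e5]
          simp only [Prod.mk.injEq, true_and, and_true]
          exact e3
    rw [heq]
    refine hQm.union (MeasurableSet.inter ?_ (MeasurableSet.inter ?_ ?_))
    · refine MeasurableSet.inter (MeasurableSet.inter (MeasurableSet.inter (MeasurableSet.inter
        S.isClosed_Q.measurableSet.compl measurableSet_Icc) (S.isOpen_GdPc t J).measurableSet)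
        (MeasurableSet.const _)) ?_
      exact Finset.measurableSet_biInter _ fun s _ => (S.isOpen_Gd s).measurableSet.compl
    · have hm : Measurable (fun x => ⌊S.kv ε t J x⌋₊) := by
        apply Nat.measurable_floor.comp
        unfold kv
        apply Continuous.measurable
        have := S.cont_it
        fun_prop
      exact hm (measurableSet_singleton k1)
    · refine MeasurableSet.iUnion fun B => ?_
      refine MeasurableSet.inter ((S.cont_it t).measurable measurableSet_Ioo) ?_
      exact ((hκm (n - t) B).comp (S.cont_it t).measurable) (measurableSet_singleton k2)

end Sys
end IntervalEnt

namespace IntervalEnt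
namespace Sys

variable (S : Sys)

/-- good pieces of level `t` from cell `A` over cell `B` -/
def GP (t : ℕ) (A B : Fin S.d) : Set (Set ℝ) :=
  {C | ∃ x ∈ S.cell A, S.Gd t x ∧ S.g^[t] x ∈ S.cell B ∧ C = S.Pc t x}

lemma lip_it (n : ℕ) (x y : ℝ) (hx : x ∈ Icc (0:ℝ) 1) (hy : y ∈ Icc (0:ℝ) 1) :
    |S.g^[n] x - S.g^[n] y| ≤ S.Lam ^ n * |x - y| := by
  induction n with
  | zero => simp
  | succ n ih =>
    rw [Function.iterate_succ_apply', Function.iterate_succ_apply', pow_succ', mul_assoc]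
    refine (S.lip _ _ (S.maps_it n hx) (S.maps_it n hy)).trans ?_
    exact mul_le_mul_of_nonneg_left ih (by linarith [S.hLam1])

lemma GP_vol {t : ℕ} {A B : Fin S.d} {C : Set ℝ} (hC : C ∈ S.GP t A B) :
    1 / (S.d * S.Lam ^ t) ≤ volume.real C := by
  obtain ⟨x, hx, hg, hB, rfl⟩ := hC
  have hd := S.d0
  have hL : 0 < S.Lam ^ t := pow_pos (by linarith [S.hLam1]) t
  obtain ⟨a, b, h1, -, -, h2, h3, h5, h6, h4⟩ := S.Pc_Ioo hg.1
  have himg := S.Gd_img hg hB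
  rw [h1] at himg ⊢
  rw [Real.volume_real_Ioo_of_le (h2.trans h3).le]
  have hl := S.lip_it t a b ⟨h5, by linarith⟩ ⟨by linarith, h6⟩
  have hlen : |S.g^[t] a - S.g^[t] b| = 1 / S.d := by
    have hab := h2.trans h3
    have hce : S.cell B = Ioo (((B:ℕ):ℝ) / S.d) ((((B:ℕ):ℝ) + 1) / S.d) := rfl
    have hBlt : ((B:ℕ):ℝ) / S.d < (((B:ℕ):ℝ) + 1) / S.d := by gcongr; linarith
    rcases deriv_ne_mono S.g^[t] (S.contDiff_it t) a b hab
      (fun y hy => S.deriv_it_ne t y (h4 hy)) with h | h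
    · have hlt := h.1 (left_mem_Icc.2 hab.le) (right_mem_Icc.2 hab.le) hab
      rw [himg, hce] at h
      have e := congrArg volume.real h.2
      rw [Real.volume_real_Ioo_of_le hBlt.le, Real.volume_real_Ioo_of_le hlt.le] at e
      rw [abs_sub_comm, abs_of_nonneg (by linarith), ← e]
      field_simp; ring
    · have hlt := h.1 (left_mem_Icc.2 hab.le) (right_mem_Icc.2 hab.le) hab
      rw [himg, hce] at h
      have e := congrArg volume.real h.2
      rw [Real.volume_real_Ioo_of_le hBlt.le, Real.volume_real_Ioo_of_le hlt.le] at e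
      rw [abs_of_nonneg (by linarith), ← e]
      field_simp; ring
  rw [hlen, abs_sub_comm, abs_of_nonneg (by linarith)] at hl
  rw [div_le_iff₀ (by positivity)]
  rw [div_le_iff₀ hd] at hl
  linarith

lemma GP_disj {t : ℕ} {A B A' B' : Fin S.d} {C C' : Set ℝ} (hC : C ∈ S.GP t A B)
    (hC' : C' ∈ S.GP t A' B') {x : ℝ} (hx : x ∈ C) (hx' : x ∈ C') : C = C' := by
  obtain ⟨y, -, -, -, rfl⟩ := hC
  obtain ⟨y', -, -, -, rfl⟩ := hC'
  rw [S.Pc_eq hx, S.Pc_eq hx']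

lemma GP_mem {t : ℕ} {A B : Fin S.d} {C : Set ℝ} (hC : C ∈ S.GP t A B) {x : ℝ} (hx : x ∈ C) :
    x ∈ S.cell A ∧ S.Gd t x ∧ S.g^[t] x ∈ S.cell B ∧ C = S.Pc t x := by
  obtain ⟨y, h1, h2, h3, rfl⟩ := hC
  refine ⟨S.Pc_sub_cell h2.1 h1 hx, (S.Gd_congr le_rfl hx).1 h2, ?_, S.Pc_eq hx⟩
  exact S.Gd_img h2 h3 ▸ mem_image_of_mem _ hx

lemma GP_nonempty {t : ℕ} {A B : Fin S.d} {C : Set ℝ} (hC : C ∈ S.GP t A B) : C.Nonempty := by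
  obtain ⟨y, h1, h2, h3, rfl⟩ := hC
  exact ⟨y, S.mem_Pc h2.1⟩

lemma GP_sub {t : ℕ} {A B : Fin S.d} {C : Set ℝ} (hC : C ∈ S.GP t A B) : C ⊆ S.cell A :=
  fun _ hx => (S.GP_mem hC hx).1

lemma GP_img {t : ℕ} {A B : Fin S.d} {C : Set ℝ} (hC : C ∈ S.GP t A B) : S.g^[t] '' C = S.cell B := by
  obtain ⟨y, h1, h2, h3, rfl⟩ := hC
  exact S.Gd_img h2 h3

lemma GP_isOpen {t : ℕ} {A B : Fin S.d} {C : Set ℝ} (hC : C ∈ S.GP t A B) : IsOpen C := by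
  obtain ⟨y, h1, h2, h3, rfl⟩ := hC
  exact S.isOpen_Pc _ _

lemma GP_finite (t : ℕ) (A B : Fin S.d) : (S.GP t A B).Finite := by
  classical
  have hd := S.d0
  have hL : 0 < S.Lam ^ t := pow_pos (by linarith [S.hLam1]) t
  refine (finite_of_bound _ (S.d * S.Lam ^ t) fun F hF => ?_).1
  have h1 := sum_vol_le F id (fun C hC => (S.GP_isOpen (hF C hC)).measurableSet)
    (fun C hC C' hC' hne => Set.disjoint_left.2 fun x hx hx' =>
      hne (S.GP_disj (hF C hC) (hF C' hC') hx hx')) (Icc (0:ℝ) 1) (by simp)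
    (fun C hC => (S.GP_sub (hF C hC)).trans (S.cell_sub_Icc A))
  have h2 := Finset.card_nsmul_le_sum F (fun C => volume.real (id C)) (1 / (S.d * S.Lam ^ t))
    (fun C hC => S.GP_vol (hF C hC))
  simp only [Real.volume_real_Icc, sub_zero, nsmul_eq_mul] at h1 h2
  have h3 := h2.trans h1
  rw [mul_one_div, div_le_iff₀ (by positivity)] at h3
  simpa using h3

noncomputable def Gf (t : ℕ) (A B : Fin S.d) : Finset (Set ℝ) := (S.GP_finite t A B).toFinset

@[simp] lemma mem_Gf {t : ℕ} {A B : Fin S.d} {C : Set ℝ} : C ∈ S.Gf t A B ↔ C ∈ S.GP t A B := by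
  simp [Gf]

/-- pieces at the first positive time with property `P` -/
def FP (P : ℕ → ℝ → Prop) (t : ℕ) (A B : Fin S.d) : Set (Set ℝ) :=
  {C | ∃ x ∈ S.cell A, (0 < t ∧ P t x ∧ ∀ s, 0 < s → s < t → ¬ P s x) ∧ S.Gd t x ∧
    S.g^[t] x ∈ S.cell B ∧ C = S.Pc t x}

lemma FP_sub (P : ℕ → ℝ → Prop) (t : ℕ) (A B : Fin S.d) : S.FP P t A B ⊆ S.GP t A B := by
  rintro C ⟨x, h1, h2, h3, h4, rfl⟩
  exact ⟨x, h1, h3, h4, rfl⟩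

noncomputable def Ff (P : ℕ → ℝ → Prop) (t : ℕ) (A B : Fin S.d) : Finset (Set ℝ) :=
  ((S.GP_finite t A B).subset (S.FP_sub P t A B)).toFinset

@[simp] lemma mem_Ff {P : ℕ → ℝ → Prop} {t : ℕ} {A B : Fin S.d} {C : Set ℝ} :
    C ∈ S.Ff P t A B ↔ C ∈ S.FP P t A B := by
  simp [Ff]

lemma Ff_sub (P : ℕ → ℝ → Prop) (t : ℕ) (A B : Fin S.d) : S.Ff P t A B ⊆ S.Gf t A B := by
  intro C hC
  rw [mem_Gf]; rw [mem_Ff] at hC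
  exact S.FP_sub P t A B hC

def cat (s : ℕ) (J D : Set ℝ) : Set ℝ := J ∩ S.g^[s] ⁻¹' D

lemma cat_eq {s t : ℕ} {x : ℝ} (h : S.Gd s x) (h2 : S.g^[s] x ∈ S.O t) :
    S.Pc (s + t) x = S.cat s (S.Pc s x) (S.Pc t (S.g^[s] x)) := by
  have hx : x ∈ S.O (s + t) := (S.O_add s t x).2 ⟨h.1, h2⟩
  rw [S.Pc_recover hx, S.transfer_good h h2]; rfl

lemma cat_nonempty {s : ℕ} {A B : Fin S.d} {J D : Set ℝ} (hJ : J ∈ S.GP s A B)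
    (hD : D ⊆ S.cell B) (hne : D.Nonempty) : (S.cat s J D).Nonempty := by
  obtain ⟨y, hy⟩ := hne
  have := hD hy
  rw [← S.GP_img hJ] at this
  obtain ⟨x, hx, rfl⟩ := this
  exact ⟨x, hx, hy⟩

lemma cat_mem {s t : ℕ} {A B C : Fin S.d} {J D : Set ℝ} (hJ : J ∈ S.GP s A B)
    (hD : D ∈ S.GP t B C) : S.cat s J D ∈ S.GP (s + t) A C := by
  obtain ⟨x, hxJ, hxD⟩ := S.cat_nonempty hJ (S.GP_sub hD) (S.GP_nonempty hD)
  obtain ⟨a1, a2, a3, a4⟩ := S.GP_mem hJ hxJ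
  obtain ⟨b1, b2, b3, b4⟩ := S.GP_mem hD hxD
  refine ⟨x, a1, S.Gd_concat a2 b2, ?_, ?_⟩
  · rwa [add_comm, Function.iterate_add_apply]
  · rw [S.cat_eq a2 b2.1, ← a4, ← b4]

lemma cat_inj {s t : ℕ} {A B C B' C' : Fin S.d} {J D J' D' : Set ℝ} (hJ : J ∈ S.GP s A B)
    (hD : D ∈ S.GP t B C) (hJ' : J' ∈ S.GP s A B') (hD' : D' ∈ S.GP t B' C')
    (h : S.cat s J D = S.cat s J' D') : J = J' ∧ D = D' ∧ B = B' := by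
  obtain ⟨x, hxJ, hxD⟩ := S.cat_nonempty hJ (S.GP_sub hD) (S.GP_nonempty hD)
  have hx' : x ∈ S.cat s J' D' := h ▸ ⟨hxJ, hxD⟩
  exact ⟨S.GP_disj hJ hJ' hxJ hx'.1, S.GP_disj hD hD' hxD hx'.2,
    S.cell_disj (S.GP_mem hJ hxJ).2.2.1 (S.GP_mem hJ' hx'.1).2.2.1⟩

lemma FP_mem {P : ℕ → ℝ → Prop} (hP : ∀ s x y, y ∈ S.Pc s x → (P s x ↔ P s y))
    {t : ℕ} {A B : Fin S.d} {C : Set ℝ} (hC : C ∈ S.FP P t A B) {x : ℝ} (hx : x ∈ C) :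
    0 < t ∧ P t x ∧ ∀ s, 0 < s → s < t → ¬ P s x := by
  obtain ⟨y, h1, h2, h3, h4, rfl⟩ := hC
  exact ⟨h2.1, (hP t y x hx).1 h2.2.1, fun s hs hst hp =>
    h2.2.2 s hs hst ((hP s y x (S.Pc_anti hst.le y hx)).2 hp)⟩

open Classical in
/-- decomposition of a sum over good pieces at the first time of property `P`. -/
theorem decomp_sum (P : ℕ → ℝ → Prop) (hP : ∀ s x y, y ∈ S.Pc s x → (P s x ↔ P s y))
    (hPG : ∀ s x, P s x → S.Gd s x) (n : ℕ) (A B : Fin S.d) (W : Set ℝ → ℝ) :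
    ∑ E ∈ (S.Gf n A B).filter (fun E => ∃ x ∈ E, ∃ s, 0 < s ∧ s ≤ n ∧ P s x), W E =
      ∑ m ∈ Finset.Icc 1 n, ∑ C, ∑ J ∈ S.Ff P m A C, ∑ D ∈ S.Gf (n - m) C B, W (S.cat m J D) := by
  have e1 : ∀ m C, ∑ J ∈ S.Ff P m A C, ∑ D ∈ S.Gf (n - m) C B, W (S.cat m J D) =
      ∑ p ∈ S.Ff P m A C ×ˢ S.Gf (n - m) C B, W (S.cat m p.1 p.2) := by
    intro m C
    rw [Finset.sum_product]
  simp_rw [e1]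
  rw [Finset.sum_sigma', Finset.sum_sigma']
  symm
  refine Finset.sum_bij (fun q _ => S.cat q.1.1 q.2.1 q.2.2) ?_ ?_ ?_ ?_
  · rintro ⟨⟨m, C⟩, ⟨J, D⟩⟩ h
    simp only [Finset.mem_sigma, Finset.mem_Icc, Finset.mem_univ, Finset.mem_product, mem_Ff,
      mem_Gf, and_true] at h
    obtain ⟨⟨hm1, hmn⟩, hJ, hD⟩ := h
    have hJ' := S.FP_sub _ _ _ _ hJ
    have hmem := S.cat_mem hJ' hD
    rw [Nat.add_sub_cancel' hmn] at hmem
    obtain ⟨x, hx⟩ := S.cat_nonempty hJ' (S.GP_sub hD) (S.GP_nonempty hD)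
    simp only [Finset.mem_filter, mem_Gf]
    exact ⟨hmem, x, hx, m, hm1, hmn, (S.FP_mem hP hJ hx.1).2.1⟩
  · rintro ⟨⟨m, C⟩, ⟨J, D⟩⟩ h ⟨⟨m', C'⟩, ⟨J', D'⟩⟩ h' heq
    simp only [Finset.mem_sigma, Finset.mem_Icc, Finset.mem_univ, Finset.mem_product, mem_Ff,
      mem_Gf, and_true] at h h'
    obtain ⟨⟨hm1, hmn⟩, hJ, hD⟩ := h
    obtain ⟨⟨hm1', hmn'⟩, hJ', hD'⟩ := h'
    have hGJ := S.FP_sub _ _ _ _ hJ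
    have hGJ' := S.FP_sub _ _ _ _ hJ'
    obtain ⟨x, hx⟩ := S.cat_nonempty hGJ (S.GP_sub hD) (S.GP_nonempty hD)
    dsimp only at heq
    have hx' : x ∈ S.cat m' J' D' := heq ▸ hx
    have f1 := S.FP_mem hP hJ hx.1
    have f2 := S.FP_mem hP hJ' hx'.1
    have hmm : m = m' := by
      rcases lt_trichotomy m m' with h | h | h
      · exact absurd f1.2.1 (f2.2.2 m f1.1 h)
      · exact h
      · exact absurd f2.2.1 (f1.2.2 m' f2.1 h)
    subst hmm
    obtain ⟨rfl, rfl, rfl⟩ := S.cat_inj hGJ hD hGJ' hD' heq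
    rfl
  · intro E hE
    simp only [Finset.mem_filter, mem_Gf] at hE
    obtain ⟨hE, x, hx, hs⟩ := hE
    have hm := Nat.find_spec hs
    set m := Nat.find hs with hmdef
    obtain ⟨hm0, hmn, hPm⟩ := hm
    obtain ⟨a1, a2, a3, a4⟩ := S.GP_mem hE hx
    have hg := hPG m x hPm
    obtain ⟨C, hC⟩ := S.Gd_cell hg
    have hmin : ∀ s, 0 < s → s < m → ¬ P s x := fun s h1 h2 h3 =>
      Nat.find_min hs h2 ⟨h1, by omega, h3⟩
    have hg2 : S.Gd (n - m) (S.g^[m] x) := by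
      apply S.Gd_restrict
      rwa [Nat.add_sub_cancel' hmn]
    refine ⟨⟨⟨m, C⟩, ⟨S.Pc m x, S.Pc (n - m) (S.g^[m] x)⟩⟩, ?_, ?_⟩
    · simp only [Finset.mem_sigma, Finset.mem_Icc, Finset.mem_univ, Finset.mem_product, mem_Ff,
        mem_Gf, and_true]
      refine ⟨⟨hm0, hmn⟩, ⟨x, a1, ⟨hm0, hPm, hmin⟩, hg, hC, rfl⟩,
        ⟨S.g^[m] x, hC, hg2, ?_, rfl⟩⟩
      rw [← Function.iterate_add_apply, Nat.sub_add_cancel hmn]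
      exact a3
    · dsimp only
      rw [← S.cat_eq hg hg2.1, Nat.add_sub_cancel' hmn, a4]
  · intros; rfl

/-- number of good pieces -/
noncomputable def N (n : ℕ) (A B : Fin S.d) : ℝ := (S.Gf n A B).card

/-- number of prime pieces -/
noncomputable def phi (n : ℕ) (A B : Fin S.d) : ℝ := (S.Ff S.Gd n A B).card

lemma N_nonneg (n : ℕ) (A B : Fin S.d) : 0 ≤ S.N n A B := Nat.cast_nonneg _
lemma phi_nonneg (n : ℕ) (A B : Fin S.d) : 0 ≤ S.phi n A B := Nat.cast_nonneg _

theorem N_renewal (n : ℕ) (hn : 1 ≤ n) (A B : Fin S.d) :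
    S.N n A B = ∑ m ∈ Finset.Icc 1 n, ∑ C, S.phi m A C * S.N (n - m) C B := by
  classical
  have h := S.decomp_sum S.Gd (fun s x y hy => S.Gd_congr le_rfl hy) (fun _ _ h => h) n A B
    (fun _ => 1)
  have hf : (S.Gf n A B).filter (fun E => ∃ x ∈ E, ∃ s, 0 < s ∧ s ≤ n ∧ S.Gd s x) =
      S.Gf n A B := by
    apply Finset.filter_true_of_mem
    intro E hE
    rw [mem_Gf] at hE
    obtain ⟨x, hx⟩ := S.GP_nonempty hE
    exact ⟨x, hx, n, by omega, le_rfl, (S.GP_mem hE hx).2.1⟩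
  rw [hf] at h
  simpa [N, phi] using h

theorem N_zero (A B : Fin S.d) : S.N 0 A B = if A = B then 1 else 0 := by
  split_ifs with h
  · subst h
    have : S.Gf 0 A A = {S.cell A} := by
      ext C
      rw [mem_Gf, Finset.mem_singleton]
      constructor
      · rintro ⟨x, h1, h2, h3, rfl⟩
        exact S.Pc_zero h1
      · rintro rfl
        obtain ⟨x, hx⟩ := S.cell_nonempty A
        exact ⟨x, hx, S.Gd_zero hx, hx, (S.Pc_zero hx).symm⟩
    simp [N, this]
  · have : S.Gf 0 A B = ∅ := by
      ext C
      rw [mem_Gf]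
      simp only [Finset.notMem_empty, iff_false]
      rintro ⟨x, h1, h2, h3, rfl⟩
      exact h (S.cell_disj h1 h3)
    simp [N, this]

theorem phi_le (n : ℕ) (A B : Fin S.d) : S.phi n A B ≤ S.d * S.Lam * S.Gam ^ n := by
  have hd := S.d0
  have hL := S.hLam1
  have hG := S.hGam
  rcases Nat.eq_zero_or_pos n with rfl | hn
  · have : S.Ff S.Gd 0 A B = ∅ := by
      ext C
      rw [mem_Ff]
      simp only [Finset.notMem_empty, iff_false]
      rintro ⟨x, h1, h2, _⟩
      exact absurd h2.1 (lt_irrefl 0)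
    simp only [phi, this, Finset.card_empty, Nat.cast_zero]
    positivity
  · obtain ⟨k, rfl⟩ := Nat.exists_eq_add_of_le' hn
    refine (S.prime_card A k (S.Ff S.Gd (k + 1) A B) ?_).trans ?_
    · intro C hC
      rw [mem_Ff] at hC
      obtain ⟨x, h1, h2, h3, h4, rfl⟩ := hC
      exact ⟨x, h1, h2, rfl⟩
    · have := pow_le_pow_right₀ hG (Nat.le_succ k)
      gcongr

lemma N_mul_le (s t : ℕ) (A B C : Fin S.d) : S.N s A B * S.N t B C ≤ S.N (s + t) A C := by
  classical
  unfold N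
  rw [← Nat.cast_mul, ← Finset.card_product]
  norm_cast
  refine Finset.card_le_card_of_injOn (fun p => S.cat s p.1 p.2) ?_ ?_
  · rintro ⟨J, D⟩ h
    simp only [Finset.coe_product, Set.mem_prod, Finset.mem_coe, mem_Gf] at h ⊢
    exact S.cat_mem h.1 h.2
  · rintro ⟨J, D⟩ h ⟨J', D'⟩ h' heq
    simp only [Finset.coe_product, Set.mem_prod, Finset.mem_coe, mem_Gf] at h h' heq
    obtain ⟨rfl, rfl, -⟩ := S.cat_inj h.1 h.2 h'.1 h'.2 heq
    rfl

end Sys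
end IntervalEnt

namespace IntervalEnt

/-- Renewal pair. -/
structure Ren (v g : ℕ → ℝ) : Prop where
  g_nonneg : ∀ n, 0 ≤ g n
  g_zero : g 0 = 0
  v_zero : v 0 = 1
  ren : ∀ n, v (n + 1) = ∑ j ∈ Finset.range (n + 1), g (j + 1) * v (n - j)

namespace Ren
variable {v g : ℕ → ℝ}

lemma v_nonneg (h : Ren v g) : ∀ n, 0 ≤ v n := by
  intro n
  induction n using Nat.strong_induction_on with
  | _ n ih =>
    rcases n with _ | n
    · rw [h.v_zero]; norm_num
    · rw [h.ren]
      exact Finset.sum_nonneg fun j _ => mul_nonneg (h.g_nonneg _) (ih _ (by omega))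

lemma ren' (h : Ren v g) (n : ℕ) (hn : 1 ≤ n) :
    v n = ∑ j ∈ Finset.range (n + 1), g j * v (n - j) := by
  obtain ⟨n, rfl⟩ : ∃ m, n = m + 1 := ⟨n - 1, by omega⟩
  rw [Finset.sum_range_succ', h.ren, h.g_zero, zero_mul, add_zero]
  refine Finset.sum_congr rfl fun j _ => ?_
  congr 2
  omega

lemma sum_le (h : Ren v g) (m T : ℕ) :
    (∑ j ∈ Finset.range (m + 1), g j) * (∑ i ∈ Finset.range T, v i) ≤
      ∑ n ∈ Finset.range (T + m), v n := by
  have h1 : ∑ n ∈ Finset.range (T + m), ∑ j ∈ Finset.range (n + 1), g j * v (n - j)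
      ≤ ∑ n ∈ Finset.range (T + m), v n := by
    refine Finset.sum_le_sum fun n _ => ?_
    rcases n with _ | n
    · simp [h.g_zero, h.v_zero]
    · rw [← h.ren' (n+1) (by omega)]
  refine le_trans ?_ h1
  rcases Nat.eq_zero_or_pos T with rfl | hT
  · simp
    refine Finset.sum_nonneg fun n _ => Finset.sum_nonneg fun j _ =>
      mul_nonneg (h.g_nonneg _) (h.v_nonneg _)
  rw [Finset.sum_range_diag_flip (T + m) (fun j i => g j * v i), Finset.sum_mul]
  refine le_trans (Finset.sum_le_sum fun j hj => ?_)
    (Finset.sum_le_sum_of_subset_of_nonneg (Finset.range_mono (by omega : m + 1 ≤ T + m)) ?_)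
  · rw [Finset.mul_sum]
    rw [Finset.mem_range] at hj
    refine Finset.sum_le_sum_of_subset_of_nonneg (Finset.range_mono (by omega)) ?_
    intro i _ _
    exact mul_nonneg (h.g_nonneg _) (h.v_nonneg _)
  · intro j _ _
    exact Finset.sum_nonneg fun i _ => mul_nonneg (h.g_nonneg _) (h.v_nonneg _)

theorem kraft (h : Ren v g) (hv : ∀ n, v n ≤ 1) (m : ℕ) :
    ∑ j ∈ Finset.range m, g j ≤ 1 := by
  by_contra hcon
  push Not at hcon
  rcases m with _ | m
  · simp at hcon; linarith
  set F := ∑ j ∈ Finset.range (m + 1), g j with hF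
  have hk : ∀ k : ℕ, F ^ k ≤ ∑ n ∈ Finset.range (1 + m * k), v n := by
    intro k
    induction k with
    | zero => simp [h.v_zero]
    | succ k ih =>
      calc F ^ (k + 1) = F * F ^ k := by ring
        _ ≤ F * ∑ n ∈ Finset.range (1 + m * k), v n := by gcongr
        _ ≤ _ := by
          have := h.sum_le m (1 + m * k)
          rw [show 1 + m * (k + 1) = 1 + m * k + m by ring]
          exact this
  have hk2 : ∀ k : ℕ, F ^ k ≤ 1 + m * k := by
    intro k
    refine (hk k).trans ?_
    refine (Finset.sum_le_sum fun n _ => hv n).trans ?_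
    simp
  -- exponential beats linear
  have ht : Tendsto (fun n : ℕ => (n:ℝ) ^ 1 / F ^ n) atTop (𝓝 0) :=
    tendsto_pow_const_div_const_pow_of_one_lt 1 hcon
  have ht2 : Tendsto (fun n : ℕ => (1:ℝ) / F ^ n) atTop (𝓝 0) := by
    simpa using tendsto_pow_const_div_const_pow_of_one_lt 0 hcon
  have ht3 : Tendsto (fun n : ℕ => (1:ℝ) / F ^ n + m * ((n:ℝ) ^ 1 / F ^ n)) atTop (𝓝 (0 + m * 0)) :=
    ht2.add (ht.const_mul _)
  rw [mul_zero, add_zero] at ht3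
  obtain ⟨k, hk3⟩ := (ht3.eventually (gt_mem_nhds (show (0:ℝ) < 1 by norm_num))).exists
  have hpos : 0 < F ^ k := by positivity
  have : (1:ℝ) / F ^ k + m * ((k:ℝ) ^ 1 / F ^ k) = (1 + m * k) / F ^ k := by
    rw [pow_one]; ring
  rw [this, div_lt_one hpos] at hk3
  linarith [hk2 k]

lemma supermul (h : Ren v g) (n m : ℕ) : v n * v m ≤ v (n + m) := by
  induction n using Nat.strong_induction_on with
  | _ n ih =>
    rcases n with _ | n
    · simp [h.v_zero]
    · rw [h.ren n, show n + 1 + m = (n + m) + 1 by ring, h.ren (n + m), Finset.sum_mul]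
      refine le_trans (Finset.sum_le_sum fun j hj => ?_)
        (Finset.sum_le_sum_of_subset_of_nonneg
          (Finset.range_mono (by omega : n + 1 ≤ n + m + 1)) ?_)
      · rw [Finset.mem_range] at hj
        rw [mul_assoc, show n + m - j = n - j + m by omega]
        exact mul_le_mul_of_nonneg_left (ih _ (by omega)) (h.g_nonneg _)
      · intro j _ _
        exact mul_nonneg (h.g_nonneg _) (h.v_nonneg _)

lemma ident (h : Ren v g) (n : ℕ) :
    ∑ k ∈ Finset.range (n + 1), v (n - k) * (1 - ∑ j ∈ Finset.range (k + 1), g j) = 1 := by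
  induction n with
  | zero => simp [h.v_zero, h.g_zero]
  | succ n ih =>
    rw [Finset.sum_range_succ']
    have : ∀ k ∈ Finset.range (n + 1), v (n + 1 - (k + 1)) * (1 - ∑ j ∈ Finset.range (k + 1 + 1), g j)
        = v (n - k) * (1 - ∑ j ∈ Finset.range (k + 1), g j) - g (k + 1) * v (n - k) := by
      intro k _
      rw [Finset.sum_range_succ _ (k + 1), show n + 1 - (k + 1) = n - k by omega]
      ring
    rw [Finset.sum_congr rfl this, Finset.sum_sub_distrib, ih, ← h.ren]
    simp [h.g_zero]

theorem lower (h : Ren v g) (hv : ∀ n, v n ≤ 1) (C r : ℝ) (hr0 : 0 ≤ r) (hr : r < 1)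
    (hg : ∀ n, g n ≤ C * r ^ n) (hsum : HasSum g 1) :
    ∃ p : ℕ, 1 ≤ p ∧ ∃ c : ℝ, 0 < c ∧ ∃ n0 : ℕ, ∀ n ≥ n0, p ∣ n → c ≤ v n := by
  set T : ℕ → ℝ := fun k => 1 - ∑ j ∈ Finset.range (k + 1), g j with hT
  have hT0 : ∀ k, 0 ≤ T k := fun k => by
    have := h.kraft hv (k + 1)
    simp only [hT]; linarith
  have hT1 : ∀ k, T k ≤ 1 := fun k => by
    have : 0 ≤ ∑ j ∈ Finset.range (k + 1), g j := Finset.sum_nonneg fun j _ => h.g_nonneg j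
    simp only [hT]; linarith
  have hTs : Summable T := by
    have hb : ∀ k, T k ≤ (C * r * (1 - r)⁻¹) * r ^ k := by
      intro k
      have h1 : HasSum (fun j => g (j + (k + 1))) (T k) := by
        have := (hasSum_nat_add_iff' (k + 1)).2 hsum
        exact this
      have h2 : HasSum (fun j => C * r ^ (k + 1) * r ^ j) (C * r ^ (k + 1) * (1 - r)⁻¹) :=
        (hasSum_geometric_of_lt_one hr0 hr).mul_left _
      have := hasSum_le (fun j => ?_) h1 h2
      · calc T k ≤ _ := this
          _ = _ := by ring
      · refine (hg _).trans (le_of_eq ?_)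
        ring
    exact Summable.of_nonneg_of_le hT0 hb ((summable_geometric_of_lt_one hr0 hr).mul_left _)
  obtain ⟨K, hK⟩ : ∃ K : ℕ, ∑' k, T (k + K) < 1 / 2 := by
    have := tendsto_sum_nat_add T
    exact (this.eventually (gt_mem_nhds (by norm_num : (0:ℝ) < 1/2))).exists
  have hwin : ∀ n, K ≤ n → ∃ k < K, 1 / (2 * (K:ℝ) + 1) ≤ v (n - k) := by
    intro n hn
    by_contra hcon
    push Not at hcon
    have hid := h.ident n
    have hKn : n + 1 = K + (n + 1 - K) := by omega
    rw [hKn, Finset.sum_range_add] at hid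
    have h1 : ∑ k ∈ Finset.range K, v (n - k) * (1 - ∑ j ∈ Finset.range (k + 1), g j) ≤
        ∑ k ∈ Finset.range K, 1 / (2 * (K:ℝ) + 1) := by
      refine Finset.sum_le_sum fun k hk => ?_
      have := hcon k (Finset.mem_range.1 hk)
      calc _ ≤ v (n - k) * 1 := mul_le_mul_of_nonneg_left (hT1 k) (h.v_nonneg _)
        _ ≤ _ := by linarith
    have h2 : ∑ k ∈ Finset.range (n + 1 - K), v (n - (K + k)) * (1 - ∑ j ∈ Finset.range (K + k + 1), g j)
        ≤ ∑' k, T (k + K) := by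
      refine le_trans (Finset.sum_le_sum fun k _ => ?_)
        (Summable.sum_le_tsum (Finset.range (n + 1 - K)) (fun k _ => hT0 (k + K))
          ((summable_nat_add_iff K).2 hTs))
      calc _ ≤ 1 * T (K + k) := mul_le_mul_of_nonneg_right (hv _) (hT0 (K + k))
        _ = _ := by rw [one_mul, add_comm]
    have h3 : ∑ k ∈ Finset.range K, 1 / (2 * (K:ℝ) + 1) < 1 / 2 := by
      rw [Finset.sum_const, Finset.card_range, nsmul_eq_mul, mul_one_div,
        div_lt_div_iff₀ (by positivity) (by norm_num)]
      linarith
    linarith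
  set D : AddSubmonoid ℕ :=
    { carrier := {n | 0 < v n}
      zero_mem' := by
        show 0 < v 0
        rw [h.v_zero]; norm_num
      add_mem' := by
        intro a b ha hb
        exact lt_of_lt_of_le (mul_pos ha hb) (h.supermul a b) } with hD
  have hDm : ∀ n, n ∈ D ↔ 0 < v n := fun n => Iff.rfl
  set p := Nat.setGcd (D : Set ℕ) with hp
  have hc0 : 0 < 1 / (2 * (K:ℝ) + 1) := by positivity
  have hp1 : 1 ≤ p := by
    obtain ⟨k, hk, hk2⟩ := hwin (2 * K) (by omega)
    have hm : 2 * K - k ∈ D := (hDm _).2 (lt_of_lt_of_le hc0 hk2)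
    have hdv : p ∣ 2 * K - k := Nat.setGcd_dvd_of_mem hm
    exact Nat.pos_of_dvd_of_pos hdv (by omega)
  obtain ⟨n1, hn1⟩ := Nat.exists_mem_closure_of_ge (D : Set ℕ)
  rw [AddSubmonoid.closure_eq] at hn1
  obtain ⟨c1, hc1, hc1'⟩ : ∃ c1 : ℝ, 0 < c1 ∧ ∀ m ∈ Finset.range (n1 + K), 0 < v m → c1 ≤ v m := by
    by_cases hne : ((Finset.range (n1 + K)).filter fun m => 0 < v m).Nonempty
    · obtain ⟨m, hm, hm2⟩ := Finset.exists_min_image _ v hne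
      refine ⟨v m, (Finset.mem_filter.1 hm).2, fun m' h' h'' => hm2 m' (Finset.mem_filter.2 ⟨h', h''⟩)⟩
    · refine ⟨1, one_pos, fun m hm hm2 => ?_⟩
      exact absurd ⟨m, Finset.mem_filter.2 ⟨hm, hm2⟩⟩ hne
  refine ⟨p, hp1, 1 / (2 * (K:ℝ) + 1) * c1, mul_pos hc0 hc1, n1 + K, fun n hn hpn => ?_⟩
  obtain ⟨k, hk, hk2⟩ := hwin (n - n1) (by omega)
  have hm : n - n1 - k ∈ D := (hDm _).2 (lt_of_lt_of_le hc0 hk2)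
  have hdv : p ∣ n - n1 - k := Nat.setGcd_dvd_of_mem hm
  have hdv2 : p ∣ n1 + k := by
    have : n1 + k = n - (n - n1 - k) := by omega
    rw [this]; exact Nat.dvd_sub hpn hdv
  have hv2 := (hDm _).1 (hn1 (n1 + k) (by omega) hdv2)
  have := h.supermul (n - n1 - k) (n1 + k)
  rw [show n - n1 - k + (n1 + k) = n by omega] at this
  refine le_trans ?_ this
  exact mul_le_mul hk2 (hc1' _ (Finset.mem_range.2 (by omega)) hv2) hc1.le (h.v_nonneg _)

end Ren
end IntervalEnt

namespace IntervalEnt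

/-- Exponential bound at rate `R`. -/
def EB (u : ℕ → ℝ) (R : ℝ) : Prop := ∃ C : ℝ, 0 ≤ C ∧ ∀ n, u n ≤ C * R ^ n

lemma EB.mono {u : ℕ → ℝ} {R R' : ℝ} (h : EB u R) (h0 : 0 ≤ R) (hR : R ≤ R') : EB u R' := by
  obtain ⟨C, hC, hb⟩ := h
  refine ⟨C, hC, fun n => (hb n).trans ?_⟩
  gcongr

lemma EB.conv {u w : ℕ → ℝ} {R R' : ℝ} (hu : EB u R) (hw : EB w R') (_hu0 : ∀ n, 0 ≤ u n)
    (hw0 : ∀ n, 0 ≤ w n)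
    (h0 : 0 ≤ R) (hR : R < R') :
    EB (fun n => ∑ j ∈ Finset.range (n + 1), u j * w (n - j)) R' := by
  obtain ⟨C, hC, hb⟩ := hu
  obtain ⟨C', hC', hb'⟩ := hw
  have hR' : 0 < R' := lt_of_le_of_lt h0 hR
  have hq0 : 0 ≤ R / R' := by positivity
  have hq1 : R / R' < 1 := (div_lt_one hR').2 hR
  refine ⟨C * C' * (1 - R / R')⁻¹, ?_, fun n => ?_⟩
  · have : 0 ≤ (1 - R / R')⁻¹ := inv_nonneg.2 (by linarith)
    positivity
  have h1 : ∀ j ∈ Finset.range (n + 1), u j * w (n - j) ≤ C * C' * R' ^ n * (R / R') ^ j := by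
    intro j hj
    rw [Finset.mem_range] at hj
    calc u j * w (n - j) ≤ (C * R ^ j) * (C' * R' ^ (n - j)) :=
          mul_le_mul (hb j) (hb' _) (hw0 _) (by positivity)
      _ = C * C' * R' ^ n * (R / R') ^ j := by
          rw [div_pow, ← pow_sub_mul_pow R' (show j ≤ n by omega)]
          field_simp
  refine (Finset.sum_le_sum h1).trans ?_
  rw [← Finset.mul_sum]
  have h2 : ∑ j ∈ Finset.range (n + 1), (R / R') ^ j ≤ (1 - R / R')⁻¹ := by
    rw [← tsum_geometric_of_lt_one hq0 hq1]
    exact Summable.sum_le_tsum _ (fun j _ => by positivity) (summable_geometric_of_lt_one hq0 hq1)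
  calc _ ≤ C * C' * R' ^ n * (1 - R / R')⁻¹ := by gcongr
    _ = _ := by ring

lemma EB.sum {ι : Type*} (s : Finset ι) {u : ι → ℕ → ℝ} {R : ℝ} (h : ∀ i ∈ s, EB (u i) R) :
    EB (fun n => ∑ i ∈ s, u i n) R := by
  classical
  induction s using Finset.induction_on with
  | empty => exact ⟨0, le_rfl, fun n => by simp⟩
  | insert a s ha ih =>
    obtain ⟨C, hC, hb⟩ := ih fun i hi => h i (Finset.mem_insert_of_mem hi)
    obtain ⟨C', hC', hb'⟩ := h a (Finset.mem_insert_self _ _)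
    refine ⟨C' + C, by positivity, fun n => ?_⟩
    show ∑ i ∈ insert a s, u i n ≤ _
    rw [Finset.sum_insert ha, add_mul]
    exact add_le_add (hb' n) (hb n)

lemma EB.add {u w : ℕ → ℝ} {R : ℝ} (hu : EB u R) (hw : EB w R) : EB (fun n => u n + w n) R := by
  obtain ⟨C, hC, hb⟩ := hu
  obtain ⟨C', hC', hb'⟩ := hw
  refine ⟨C + C', by positivity, fun n => ?_⟩
  rw [add_mul]
  exact add_le_add (hb n) (hb' n)

lemma EB.congr {u w : ℕ → ℝ} {R : ℝ} (hu : EB u R) (h : ∀ n, w n = u n) : EB w R := by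
  obtain ⟨C, hC, hb⟩ := hu
  exact ⟨C, hC, fun n => (h n).trans_le (hb n)⟩

lemma EB.ren {t f v : ℕ → ℝ} {R s : ℝ} (hR : 0 < R) (ht : EB t R) (hf0 : ∀ n, 0 ≤ f n)
    (hf : f 0 = 0) (hs : s < 1)
    (hfs : ∀ m, ∑ j ∈ Finset.range m, f j * R⁻¹ ^ j ≤ s)
    (hv : ∀ n, v n = t n + ∑ j ∈ Finset.range (n + 1), f j * v (n - j)) : EB v R := by
  obtain ⟨C, hC, hb⟩ := ht
  have hC2 : 0 ≤ C / (1 - s) := div_nonneg hC (by linarith)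
  refine ⟨C / (1 - s), hC2, fun n => ?_⟩
  induction n using Nat.strong_induction_on with
  | _ n ih =>
    rw [hv n]
    have h1 : ∑ j ∈ Finset.range (n + 1), f j * v (n - j) ≤
        ∑ j ∈ Finset.range (n + 1), (C / (1 - s) * R ^ n) * (f j * R⁻¹ ^ j) := by
      refine Finset.sum_le_sum fun j hj => ?_
      rw [Finset.mem_range] at hj
      rcases Nat.eq_zero_or_pos j with rfl | hj0
      · simp [hf]
      · refine (mul_le_mul_of_nonneg_left (ih (n - j) (by omega)) (hf0 j)).trans (le_of_eq ?_)
        rw [← pow_sub_mul_pow R (show j ≤ n by omega), inv_pow]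
        field_simp
    rw [← Finset.mul_sum] at h1
    have h2 : (C / (1 - s) * R ^ n) * ∑ j ∈ Finset.range (n + 1), (f j * R⁻¹ ^ j) ≤
        (C / (1 - s) * R ^ n) * s := mul_le_mul_of_nonneg_left (hfs _) (by positivity)
    calc _ ≤ C * R ^ n + (C / (1 - s) * R ^ n) * s := by linarith [hb n]
      _ = _ := by
        have : 1 - s ≠ 0 := by linarith
        field_simp
        ring

lemma exists_rate {f : ℕ → ℝ} {ρ : ℝ} (hρ0 : 0 < ρ) (hρ : ρ < 1) (hf : EB f ρ) (hf0 : ∀ n, 0 ≤ f n)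
    (hlt : ∑' j, f j < 1) :
    ∃ R, ρ < R ∧ R < 1 ∧ ∃ s < 1, ∀ m, ∑ j ∈ Finset.range m, f j * R⁻¹ ^ j ≤ s := by
  obtain ⟨C, hC, hb⟩ := hf
  set ρ1 := (ρ + 1) / 2 with hρ1
  have h1 : ρ < ρ1 := by simp only [hρ1]; linarith
  have h2 : ρ1 < 1 := by simp only [hρ1]; linarith
  have h3 : 0 < ρ1 := by linarith
  have hle : ∀ j, f j * ρ1⁻¹ ^ j ≤ C * (ρ / ρ1) ^ j := by
    intro j
    calc _ ≤ C * ρ ^ j * ρ1⁻¹ ^ j := by gcongr; exact hb j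
      _ = _ := by rw [div_eq_mul_inv, mul_pow]; ring
  have hsm : Summable fun j => f j * ρ1⁻¹ ^ j := by
    refine Summable.of_nonneg_of_le (fun j => mul_nonneg (hf0 j) (by positivity)) hle ?_
    exact (summable_geometric_of_lt_one (by positivity) ((div_lt_one h3).2 h1)).mul_left _
  have ht : Tendsto (fun R : ℝ => ∑' j, f j * R⁻¹ ^ j) (𝓝[<] 1) (𝓝 (∑' j, f j)) := by
    refine tendsto_tsum_of_dominated_convergence hsm ?_ ?_
    · intro j
      have : Tendsto (fun R : ℝ => f j * R⁻¹ ^ j) (𝓝 1) (𝓝 (f j * (1:ℝ)⁻¹ ^ j)) := by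
        refine Tendsto.const_mul _ (Tendsto.pow ?_ _)
        exact tendsto_inv₀ one_ne_zero
      simp only [inv_one, one_pow, mul_one] at this
      exact this.mono_left nhdsWithin_le_nhds
    · have : ∀ᶠ R : ℝ in 𝓝[<] 1, ρ1 < R :=
        nhdsWithin_le_nhds (lt_mem_nhds h2)
      filter_upwards [this] with R hR j
      have hR0 : 0 < R := h3.trans hR
      rw [Real.norm_of_nonneg (mul_nonneg (hf0 j) (by positivity))]
      refine mul_le_mul_of_nonneg_left ?_ (hf0 j)
      gcongr
  have hev := ht.eventually (gt_mem_nhds hlt)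
  have hev2 : ∀ᶠ R : ℝ in 𝓝[<] 1, ρ1 < R := nhdsWithin_le_nhds (lt_mem_nhds h2)
  have hev3 : ∀ᶠ R : ℝ in 𝓝[<] 1, R < 1 := self_mem_nhdsWithin
  obtain ⟨R, hR1, hR2, hR3⟩ := (hev.and (hev2.and hev3)).exists
  have hR0 : 0 < R := h3.trans hR2
  refine ⟨R, h1.trans hR2, hR3, _, hR1, fun m => ?_⟩
  refine Summable.sum_le_tsum _ (fun j _ => mul_nonneg (hf0 j) (by positivity)) ?_
  refine Summable.of_nonneg_of_le (fun j => mul_nonneg (hf0 j) (by positivity)) (fun j => ?_) hsm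
  refine mul_le_mul_of_nonneg_left ?_ (hf0 j)
  gcongr

section Mat
variable {ι : Type*} [Fintype ι] [DecidableEq ι]

/-- Power series of matrices with only the columns in `s`. -/
noncomputable def colPS (φ : ℕ → ι → ι → ℝ) (s : Finset ι) : PowerSeries (Matrix ι ι ℝ) :=
  PowerSeries.mk fun n => Matrix.of fun A B => if B ∈ s then φ n A B else 0

/-- Taboo resolvent. -/
noncomputable def resPS (φ : ℕ → ι → ι → ℝ) (s : Finset ι) : PowerSeries (Matrix ι ι ℝ) :=
  PowerSeries.invOfUnit (1 - colPS φ s) 1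

noncomputable def res (φ : ℕ → ι → ι → ℝ) (s : Finset ι) (n : ℕ) (A B : ι) : ℝ :=
  (PowerSeries.coeff n (resPS φ s)) A B

/-- First passage to `a` avoiding everything outside `s`. -/
noncomputable def fp (φ : ℕ → ι → ι → ℝ) (s : Finset ι) (a : ι) (n : ℕ) (A : ι) : ℝ :=
  (PowerSeries.coeff n (resPS φ s * colPS φ {a})) A a

variable {φ : ℕ → ι → ι → ℝ}

lemma resPS_mul (h0 : ∀ A B, φ 0 A B = 0) (s : Finset ι) : resPS φ s * (1 - colPS φ s) = 1 := by
  refine PowerSeries.invOfUnit_mul _ _ ?_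
  simp [colPS]
  ext A B
  simp [h0]

lemma mul_resPS (h0 : ∀ A B, φ 0 A B = 0) (s : Finset ι) : (1 - colPS φ s) * resPS φ s = 1 := by
  refine PowerSeries.mul_invOfUnit _ _ ?_
  simp [colPS]
  ext A B
  simp [h0]

lemma res_zero (_h0 : ∀ A B, φ 0 A B = 0) (s : Finset ι) (A B : ι) :
    res φ s 0 A B = if A = B then 1 else 0 := by
  simp [res, resPS, Matrix.one_apply]

lemma coeff_mul_apply (X Y : PowerSeries (Matrix ι ι ℝ)) (n : ℕ) (A B : ι) :
    (PowerSeries.coeff n (X * Y)) A B =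
      ∑ j ∈ Finset.range (n + 1), ∑ C, (PowerSeries.coeff j X) A C * (PowerSeries.coeff (n - j) Y) C B := by
  rw [PowerSeries.coeff_mul, Finset.Nat.sum_antidiagonal_eq_sum_range_succ_mk, Matrix.sum_apply]
  simp only [Matrix.mul_apply]

lemma res_left (h0 : ∀ A B, φ 0 A B = 0) (s : Finset ι) (n : ℕ) (A B : ι) :
    res φ s n A B = (if n = 0 ∧ A = B then 1 else 0) +
      ∑ j ∈ Finset.range (n + 1), ∑ C ∈ s, φ j A C * res φ s (n - j) C B := by
  have h := mul_resPS h0 s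
  rw [sub_mul, one_mul, sub_eq_iff_eq_add] at h
  unfold res
  nth_rw 1 [h]
  rw [map_add, Matrix.add_apply, coeff_mul_apply]
  congr 1
  · rw [PowerSeries.coeff_one]
    by_cases hn : n = 0 <;> simp [hn, Matrix.one_apply]
  · refine Finset.sum_congr rfl fun j _ => ?_
    simp only [colPS, PowerSeries.coeff_mk, Matrix.of_apply, ite_mul, zero_mul]
    rw [← Finset.sum_filter]
    simp

lemma res_col (h0 : ∀ A B, φ 0 A B = 0) (s : Finset ι) (a : ι) (ha : a ∉ s) (n : ℕ) (A : ι) :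
    res φ s n A a = if n = 0 ∧ A = a then 1 else 0 := by
  have h := resPS_mul h0 s
  rw [mul_sub, mul_one, sub_eq_iff_eq_add] at h
  unfold res
  nth_rw 1 [h]
  rw [map_add, Matrix.add_apply, coeff_mul_apply]
  have : ∀ j ∈ Finset.range (n + 1), ∑ C, (PowerSeries.coeff j (resPS φ s)) A C *
      (PowerSeries.coeff (n - j) (colPS φ s)) C a = 0 := by
    intro j _
    simp [colPS, ha]
  rw [Finset.sum_eq_zero this, add_zero, PowerSeries.coeff_one]
  by_cases hn : n = 0 <;> simp [hn, Matrix.one_apply]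

lemma res_nonneg (h0 : ∀ A B, φ 0 A B = 0) (hφ : ∀ n A B, 0 ≤ φ n A B) (s : Finset ι) (n : ℕ)
    (A B : ι) : 0 ≤ res φ s n A B := by
  induction n using Nat.strong_induction_on generalizing A B with
  | _ n ih =>
    rw [res_left h0]
    refine add_nonneg (by split_ifs <;> norm_num) (Finset.sum_nonneg fun j _ =>
      Finset.sum_nonneg fun C _ => ?_)
    rcases Nat.eq_zero_or_pos j with rfl | hj
    · rw [h0]; simp
    · rcases Nat.eq_zero_or_pos n with rfl | hn
      · rw [show 0 - j = 0 by omega, res_zero h0]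
        exact mul_nonneg (hφ _ _ _) (by split_ifs <;> norm_num)
      · exact mul_nonneg (hφ _ _ _) (ih _ (by omega) _ _)

lemma fp_eq (s : Finset ι) (a : ι) (n : ℕ) (A : ι) :
    fp φ s a n A = ∑ C, ∑ j ∈ Finset.range (n + 1), res φ s j A C * φ (n - j) C a := by
  unfold fp
  rw [coeff_mul_apply, Finset.sum_comm]
  refine Finset.sum_congr rfl fun C _ => Finset.sum_congr rfl fun j _ => ?_
  simp [colPS, res]

lemma res_insert (h0 : ∀ A B, φ 0 A B = 0) (s : Finset ι) (a : ι) (ha : a ∉ s) (n : ℕ) (A B : ι) :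
    res φ (insert a s) n A B = res φ s n A B +
      ∑ j ∈ Finset.range (n + 1), fp φ s a j A * res φ (insert a s) (n - j) a B := by
  have hc : colPS φ (insert a s) = colPS φ s + colPS φ {a} := by
    ext n A B
    simp only [colPS, map_add, PowerSeries.coeff_mk, Matrix.add_apply, Matrix.of_apply]
    by_cases hB : B = a
    · subst hB; simp [ha]
    · simp [hB]
  have h1 := mul_resPS h0 (insert a s)
  have h2 := resPS_mul h0 s
  have h3 : resPS φ (insert a s) = resPS φ s + (resPS φ s * colPS φ {a}) * resPS φ (insert a s) := by
    have : resPS φ s * ((1 - colPS φ (insert a s)) * resPS φ (insert a s)) =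
        (resPS φ s * (1 - colPS φ s)) * resPS φ (insert a s)
          - (resPS φ s * colPS φ {a}) * resPS φ (insert a s) := by
      rw [hc]; noncomm_ring
    rw [h1, h2, mul_one, one_mul] at this
    exact (sub_eq_iff_eq_add.1 this.symm)
  unfold res
  nth_rw 1 [h3]
  rw [map_add, Matrix.add_apply, coeff_mul_apply]
  congr 1
  refine Finset.sum_congr rfl fun j _ => ?_
  rw [Finset.sum_eq_single a]
  · rfl
  · intro C _ hC
    rw [coeff_mul_apply, Finset.sum_eq_zero, zero_mul]
    intro i _
    simp [colPS, hC]
  · simp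

lemma fp_nonneg (h0 : ∀ A B, φ 0 A B = 0) (hφ : ∀ n A B, 0 ≤ φ n A B) (s : Finset ι) (a : ι)
    (n : ℕ) (A : ι) : 0 ≤ fp φ s a n A := by
  rw [fp_eq]
  exact Finset.sum_nonneg fun C _ => Finset.sum_nonneg fun j _ =>
    mul_nonneg (res_nonneg h0 hφ _ _ _ _) (hφ _ _ _)

lemma fp_zero (h0 : ∀ A B, φ 0 A B = 0) (s : Finset ι) (a : ι) (A : ι) : fp φ s a 0 A = 0 := by
  rw [fp_eq]
  simp [h0]

lemma res_mono (h0 : ∀ A B, φ 0 A B = 0) (hφ : ∀ n A B, 0 ≤ φ n A B) {s t : Finset ι} (hst : s ⊆ t)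
    (n : ℕ) (A B : ι) : res φ s n A B ≤ res φ t n A B := by
  induction n using Nat.strong_induction_on generalizing A B with
  | _ n ihn =>
    rw [res_left h0 s, res_left h0 t]
    refine add_le_add le_rfl (Finset.sum_le_sum fun j _ => ?_)
    refine le_trans (Finset.sum_le_sum fun C _ => ?_)
      (Finset.sum_le_sum_of_subset_of_nonneg hst fun C _ _ =>
        mul_nonneg (hφ _ _ _) (res_nonneg h0 hφ _ _ _ _))
    rcases Nat.eq_zero_or_pos j with rfl | hj
    · simp [h0]
    · refine mul_le_mul_of_nonneg_left ?_ (hφ _ _ _)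
      rcases Nat.eq_zero_or_pos n with rfl | hn
      · rw [show 0 - j = 0 by omega, res_zero h0, res_zero h0]
      · exact ihn _ (by omega) _ _

lemma ren_fp (h0 : ∀ A B, φ 0 A B = 0) (hφ : ∀ n A B, 0 ≤ φ n A B) (s : Finset ι) (a : ι)
    (ha : a ∉ s) : Ren (fun n => res φ (insert a s) n a a) (fun n => fp φ s a n a) where
  g_nonneg := fun n => fp_nonneg h0 hφ _ _ _ _
  g_zero := fp_zero h0 _ _ _
  v_zero := by simp [res_zero h0]
  ren := fun n => by
    rw [res_insert h0 s a ha (n + 1), res_col h0 s a ha, Finset.sum_range_succ', fp_zero h0]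
    simp

lemma fp_EB (h0 : ∀ A B, φ 0 A B = 0) (hφ : ∀ n A B, 0 ≤ φ n A B) {θ R : ℝ}
    (hθ : 0 ≤ θ) (hφb : ∀ A B, EB (fun n => φ n A B) θ) (hR : θ < R) (s : Finset ι)
    (hs : ∀ A B, EB (fun n => res φ s n A B) R) (a A : ι) : EB (fun n => fp φ s a n A) R := by
  refine EB.congr (EB.sum Finset.univ (u := fun C n => ∑ j ∈ Finset.range (n + 1),
    φ j C a * res φ s (n - j) A C) fun C _ => ?_) ?_
  · exact EB.conv (hφb C a) (hs A C) (fun n => hφ _ _ _) (fun n => res_nonneg h0 hφ _ _ _ _) hθ hR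
  · intro n
    rw [fp_eq]
    refine Finset.sum_congr rfl fun C _ => ?_
    rw [← Finset.sum_range_reflect]
    refine Finset.sum_congr rfl fun j hj => ?_
    rw [Finset.mem_range] at hj
    rw [show n + 1 - 1 - j = n - j by omega, show n - (n - j) = j by omega, mul_comm]

lemma insert_EB (h0 : ∀ A B, φ 0 A B = 0) (hφ : ∀ n A B, 0 ≤ φ n A B) {R' R t : ℝ}
    (s : Finset ι) (a : ι) (ha : a ∉ s) (hR'0 : 0 < R') (hR : R' < R)
    (hs : ∀ A B, EB (fun n => res φ s n A B) R') (hfp : ∀ A, EB (fun n => fp φ s a n A) R')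
    (ht : t < 1) (hfs : ∀ m, ∑ j ∈ Finset.range m, fp φ s a j a * R⁻¹ ^ j ≤ t) (A B : ι) :
    EB (fun n => res φ (insert a s) n A B) R := by
  have h1 : EB (fun n => res φ (insert a s) n a B) R := by
    refine EB.ren (hR'0.trans hR) ((hs a B).mono hR'0.le hR.le) (fun n => fp_nonneg h0 hφ s a n a)
      (fp_zero h0 _ _ _) ht hfs fun n => ?_
    exact res_insert h0 s a ha n a B
  refine EB.congr (EB.add ((hs A B).mono hR'0.le hR.le) (EB.conv (hfp A) h1
    (fun n => fp_nonneg h0 hφ s a n A) (fun n => res_nonneg h0 hφ _ _ _ _) hR'0.le hR)) fun n => ?_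
  exact res_insert h0 s a ha n A B

theorem res_dichotomy (h0 : ∀ A B, φ 0 A B = 0) (hφ : ∀ n A B, 0 ≤ φ n A B) {θ : ℝ}
    (hθ : 0 < θ) (hθ1 : θ < 1) (hφb : ∀ A B, EB (fun n => φ n A B) θ)
    (hN : ∀ n A, res φ Finset.univ n A A ≤ 1) (s : Finset ι) :
    (∀ R, 1 < R → ∀ A B, EB (fun n => res φ s n A B) R) ∧
    ((∃ ρ, 0 < ρ ∧ ρ < 1 ∧ ∀ A B, EB (fun n => res φ s n A B) ρ) ∨
      ∃ A, ∃ p : ℕ, 1 ≤ p ∧ ∃ c : ℝ, 0 < c ∧ ∃ n0 : ℕ, ∀ n ≥ n0, p ∣ n → c ≤ res φ s n A A) := by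
  induction s using Finset.induction_on with
  | empty =>
    have hb : ∀ R : ℝ, 0 < R → ∀ A B : ι, EB (fun n => res φ ∅ n A B) R := by
      intro R hR A B
      refine ⟨1, zero_le_one, fun n => ?_⟩
      show res φ ∅ n A B ≤ _
      rw [res_col h0 ∅ B (by simp)]
      split_ifs with h
      · rw [h.1]; simp
      · positivity
    exact ⟨fun R hR => hb R (by linarith), Or.inl ⟨1/2, by norm_num, by norm_num, hb _ (by norm_num)⟩⟩
  | insert a s ha ih =>
    obtain ⟨ih1, ih2⟩ := ih
    have hren := ren_fp h0 hφ s a ha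
    have hv1 : ∀ n, res φ (insert a s) n a a ≤ 1 := fun n =>
      (res_mono h0 hφ (Finset.subset_univ _) n a a).trans (hN n a)
    have hk := hren.kraft hv1
    constructor
    · intro R hR A B
      set R' := (1 + R) / 2 with hR'
      have h1 : 1 < R' := by simp only [hR']; linarith
      have h2 : R' < R := by simp only [hR']; linarith
      refine insert_EB h0 hφ s a ha (by linarith) h2 (ih1 R' h1)
        (fun A => fp_EB h0 hφ hθ.le hφb (by linarith) s (ih1 R' h1) a A)
        (t := R⁻¹) (inv_lt_one_of_one_lt₀ hR) ?_ A B
      intro m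
      calc ∑ j ∈ Finset.range m, fp φ s a j a * R⁻¹ ^ j
          ≤ ∑ j ∈ Finset.range m, fp φ s a j a * R⁻¹ := by
            refine Finset.sum_le_sum fun j _ => ?_
            rcases Nat.eq_zero_or_pos j with rfl | hj
            · simp [fp_zero h0]
            · refine mul_le_mul_of_nonneg_left ?_ (fp_nonneg h0 hφ _ _ _ _)
              exact pow_le_of_le_one (by positivity) (inv_le_one_of_one_le₀ hR.le) (by omega)
        _ = (∑ j ∈ Finset.range m, fp φ s a j a) * R⁻¹ := by rw [Finset.sum_mul]
        _ ≤ 1 * R⁻¹ := mul_le_mul_of_nonneg_right (hk m) (by positivity)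
        _ = R⁻¹ := one_mul _
    · rcases ih2 with ⟨ρ, hρ0, hρ1, hρ⟩ | ⟨A, p, hp, c, hc, n0, h⟩
      · set ρ' := max ρ ((1 + θ) / 2) with hρ'
        have hl1 : ρ' < 1 := max_lt hρ1 (by linarith)
        have hl2 : θ < ρ' := lt_of_lt_of_le (by linarith) (le_max_right _ _)
        have hl3 : ∀ A B, EB (fun n => res φ s n A B) ρ' := fun A B =>
          (hρ A B).mono hρ0.le (le_max_left _ _)
        have hfp := fp_EB h0 hφ hθ.le hφb hl2 s hl3 a
        have hsum : Summable fun n => fp φ s a n a :=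
          summable_of_sum_range_le (fun n => fp_nonneg h0 hφ _ _ _ _) hk
        have hle : ∑' n, fp φ s a n a ≤ 1 := Summable.tsum_le_of_sum_range_le hsum hk
        rcases hle.lt_or_eq with hlt | heq
        · left
          obtain ⟨R, hR1, hR2, t, ht, hfs⟩ := exists_rate (by linarith) hl1 (hfp a)
            (fun n => fp_nonneg h0 hφ _ _ _ _) hlt
          exact ⟨R, by linarith, hR2, insert_EB h0 hφ s a ha (by linarith) hR1 hl3 hfp ht hfs⟩
        · right
          obtain ⟨C, hC, hCb⟩ := hfp a
          refine ⟨a, hren.lower hv1 C ρ' (by linarith) hl1 hCb ?_⟩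
          rw [← heq]; exact hsum.hasSum
      · right
        exact ⟨A, p, hp, c, hc, n0, fun n hn hpn => (h n hn hpn).trans
          (res_mono h0 hφ (Finset.subset_insert _ _) n A A)⟩

end Mat
end IntervalEnt

namespace IntervalEnt

theorem growth {ι : Type*} [Fintype ι] [DecidableEq ι] (N φ : ℕ → ι → ι → ℝ)
    (hφ : ∀ n A B, 0 ≤ φ n A B) (hN0 : ∀ A B, N 0 A B = if A = B then 1 else 0)
    (hren : ∀ n, 1 ≤ n → ∀ A B, N n A B = ∑ m ∈ Finset.Icc 1 n, ∑ C, φ m A C * N (n - m) C B)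
    (K G H : ℝ) (hK : 0 ≤ K) (hG : 0 < G) (hGH : G < Real.exp H)
    (hφb : ∀ n A B, φ n A B ≤ K * G ^ n) (hN : ∀ n A, N n A A ≤ Real.exp (n * H)) :
    (∀ η, 0 < η → ∃ C, 0 ≤ C ∧ ∀ n A B, N n A B ≤ C * Real.exp (n * (H + η))) ∧
    ((∃ δ, 0 < δ ∧ ∃ C, 0 ≤ C ∧ ∀ n A B, N n A B ≤ C * Real.exp (n * (H - δ))) ∨
      ∃ A, ∃ p : ℕ, 1 ≤ p ∧ ∃ c : ℝ, 0 < c ∧ ∃ n0 : ℕ, ∀ n ≥ n0, p ∣ n →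
        c * Real.exp (n * H) ≤ N n A A) := by
  set φ' : ℕ → ι → ι → ℝ := fun n A B => if n = 0 then 0 else φ n A B * Real.exp (-(n * H)) with hφ'
  have h0 : ∀ A B, φ' 0 A B = 0 := fun A B => by simp [hφ']
  have hnn : ∀ n A B, 0 ≤ φ' n A B := fun n A B => by
    simp only [hφ']; split_ifs
    · exact le_rfl
    · exact mul_nonneg (hφ _ _ _) (Real.exp_pos _).le
  have hres : ∀ n A B, res φ' Finset.univ n A B = N n A B * Real.exp (-(n * H)) := by
    intro n
    induction n using Nat.strong_induction_on with
    | _ n ih =>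
      intro A B
      rcases Nat.eq_zero_or_pos n with rfl | hn
      · rw [res_zero h0, hN0]; simp
      · rw [res_left h0, hren n hn, if_neg (by omega), zero_add, Finset.range_eq_Ico,
          Finset.sum_eq_sum_Ico_succ_bot (by omega), zero_add]
        simp only [h0, zero_mul, Finset.sum_const_zero, zero_add]
        rw [Finset.sum_mul]
        have : Finset.Ico 1 (n + 1) = Finset.Icc 1 n := by
          ext; simp only [Finset.mem_Ico, Finset.mem_Icc]; omega
        rw [this]
        refine Finset.sum_congr rfl fun m hm => ?_
        rw [Finset.mem_Icc] at hm
        rw [Finset.sum_mul]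
        refine Finset.sum_congr rfl fun C _ => ?_
        rw [ih (n - m) (by omega)]
        simp only [hφ', if_neg (show m ≠ 0 by omega)]
        rw [Nat.cast_sub hm.2]
        have : Real.exp (-(n * H)) = Real.exp (-(m * H)) * Real.exp (-(((n:ℝ) - m) * H)) := by
          rw [← Real.exp_add]; congr 1; ring
        rw [this]; ring
  have hθ0 : 0 < G * Real.exp (-H) := by positivity
  have hθ1 : G * Real.exp (-H) < 1 := by
    rw [Real.exp_neg, ← div_eq_mul_inv, div_lt_one (Real.exp_pos _)]; exact hGH
  have hEB : ∀ A B, EB (fun n => φ' n A B) (G * Real.exp (-H)) := by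
    intro A B
    refine ⟨K, hK, fun n => ?_⟩
    simp only [hφ']
    split_ifs
    · positivity
    · rw [mul_pow, ← Real.exp_nat_mul, mul_neg, ← mul_assoc]
      exact mul_le_mul_of_nonneg_right (hφb n A B) (Real.exp_pos _).le
  have hone : ∀ n A, res φ' Finset.univ n A A ≤ 1 := by
    intro n A
    rw [hres, Real.exp_neg, ← div_eq_mul_inv, div_le_one (Real.exp_pos _)]
    exact hN n A
  -- uniform bounds
  have huni : ∀ R : ℝ, 0 < R → (∀ A B, EB (fun n => res φ' Finset.univ n A B) R) →
      ∃ C, 0 ≤ C ∧ ∀ n A B, N n A B ≤ C * Real.exp (n * (H + Real.log R)) := by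
    intro R hR h
    choose C hC hb using h
    refine ⟨∑ A, ∑ B, C A B, Finset.sum_nonneg fun A _ => Finset.sum_nonneg fun B _ => hC A B, ?_⟩
    intro n A B
    have h1 : C A B ≤ ∑ A, ∑ B, C A B :=
      (Finset.single_le_sum (fun B _ => hC A B) (Finset.mem_univ B)).trans
        (Finset.single_le_sum (f := fun A => ∑ B, C A B)
          (fun A _ => Finset.sum_nonneg fun B _ => hC A B) (Finset.mem_univ A))
    have h2 := hb A B n
    simp only [hres] at h2
    have h3 : Real.exp (n * (H + Real.log R)) = R ^ n * Real.exp (n * H) := by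
      rw [mul_add, add_comm, Real.exp_add, Real.exp_nat_mul, Real.exp_log hR]
    rw [h3]
    rw [Real.exp_neg, ← div_eq_mul_inv, div_le_iff₀ (Real.exp_pos _)] at h2
    calc _ ≤ _ := h2
      _ = C A B * (R ^ n * Real.exp (n * H)) := by ring
      _ ≤ _ := by gcongr
  obtain ⟨hd1, hd2⟩ := res_dichotomy h0 hnn hθ0 hθ1 hEB hone Finset.univ
  constructor
  · intro η hη
    obtain ⟨C, hC, hb⟩ := huni (Real.exp η) (Real.exp_pos _) (hd1 _ (Real.one_lt_exp_iff.2 hη))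
    rw [Real.log_exp] at hb
    exact ⟨C, hC, hb⟩
  · rcases hd2 with ⟨ρ, hρ0, hρ1, hb⟩ | ⟨A, p, hp, c, hc, n0, hb⟩
    · left
      obtain ⟨C, hC, hb⟩ := huni ρ hρ0 hb
      refine ⟨-Real.log ρ, by linarith [Real.log_neg hρ0 hρ1], C, hC, ?_⟩
      simpa only [sub_neg_eq_add] using hb
    · right
      refine ⟨A, p, hp, c, hc, n0, fun n hn hpn => ?_⟩
      have := hb n hn hpn
      rwa [hres, Real.exp_neg, ← div_eq_mul_inv, le_div_iff₀ (Real.exp_pos _)] at this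

end IntervalEnt

namespace IntervalEnt

lemma gibbs {ι : Type*} (s : Finset ι) (p q : ι → ℝ) (hp : ∀ i ∈ s, 0 ≤ p i) (hq : ∀ i ∈ s, 0 ≤ q i)
    (hpq : ∀ i ∈ s, q i = 0 → p i = 0) (hs : ∑ i ∈ s, q i ≤ ∑ i ∈ s, p i) :
    ∑ i ∈ s, Real.negMulLog (p i) ≤ ∑ i ∈ s, -(p i * Real.log (q i)) := by
  have h1 : ∀ i ∈ s, Real.negMulLog (p i) + p i * Real.log (q i) ≤ q i - p i := by
    intro i hi
    rcases (hp i hi).eq_or_lt with h | h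
    · rw [← h]; simp [hq i hi]
    · have hq' : 0 < q i := lt_of_le_of_ne (hq i hi) fun h' => h.ne' (hpq i hi h'.symm)
      have := Real.log_le_sub_one_of_pos (div_pos hq' h)
      rw [Real.log_div hq'.ne' h.ne'] at this
      have h2 := mul_le_mul_of_nonneg_left this h.le
      have h3 : p i * (q i / p i - 1) = q i - p i := by field_simp
      rw [h3] at h2
      rw [Real.negMulLog]
      linarith
  have h2 := Finset.sum_le_sum h1
  rw [Finset.sum_add_distrib, Finset.sum_sub_distrib] at h2
  rw [Finset.sum_neg_distrib]
  linarith

lemma negMulLog_add_le {x y : ℝ} (hx : 0 ≤ x) (hy : 0 ≤ y) :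
    Real.negMulLog (x + y) ≤ Real.negMulLog x + Real.negMulLog y := by
  rcases hx.eq_or_lt with h | h
  · simp [← h]
  rcases hy.eq_or_lt with h' | h'
  · simp [← h']
  have h1 : Real.log x ≤ Real.log (x + y) := Real.log_le_log h (by linarith)
  have h2 : Real.log y ≤ Real.log (x + y) := Real.log_le_log h' (by linarith)
  simp only [Real.negMulLog]
  nlinarith [mul_le_mul_of_nonneg_left h1 hx, mul_le_mul_of_nonneg_left h2 hy]

lemma negMulLog_sum_le {ι : Type*} (s : Finset ι) (x : ι → ℝ) (hx : ∀ i ∈ s, 0 ≤ x i) :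
    Real.negMulLog (∑ i ∈ s, x i) ≤ ∑ i ∈ s, Real.negMulLog (x i) := by
  classical
  induction s using Finset.induction_on with
  | empty => simp
  | insert a s ha ih =>
    rw [Finset.sum_insert ha, Finset.sum_insert ha]
    have h1 := ih fun i hi => hx i (Finset.mem_insert_of_mem hi)
    have h2 := negMulLog_add_le (hx a (Finset.mem_insert_self _ _))
      (Finset.sum_nonneg fun i hi => hx i (Finset.mem_insert_of_mem hi))
    linarith

section Hf
variable {X : Type*} [MeasurableSpace X]

/-- Entropy of a finite-valued observable. -/
noncomputable def Hf {ι : Type*} [Fintype ι] (μ : Measure X) (ξ : X → ι) : ℝ :=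
  ∑ i, Real.negMulLog (μ.real (ξ ⁻¹' {i}))

/-- Measurability of finite-valued observables (all fibres measurable). -/
def FM {ι : Type*} (ξ : X → ι) : Prop := ∀ i, MeasurableSet (ξ ⁻¹' {i})

lemma FM.pre {ι : Type*} [Finite ι] {ξ : X → ι} (h : FM ξ) (s : Set ι) : MeasurableSet (ξ ⁻¹' s) := by
  have : ξ ⁻¹' s = ⋃ i ∈ s, ξ ⁻¹' {i} := by ext; simp
  rw [this]
  exact MeasurableSet.biUnion s.to_countable fun i _ => h i

lemma FM.comp {ι κ : Type*} [Finite ι] {ξ : X → ι} (h : FM ξ) (g : ι → κ) : FM (fun x => g (ξ x)) := by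
  intro k
  exact h.pre (g ⁻¹' {k})

lemma FM.pair {ι κ : Type*} {ξ : X → ι} {η : X → κ} (h : FM ξ) (h' : FM η) :
    FM (fun x => (ξ x, η x)) := by
  rintro ⟨i, k⟩
  have : (fun x => (ξ x, η x)) ⁻¹' {(i, k)} = ξ ⁻¹' {i} ∩ η ⁻¹' {k} := by ext; simp
  rw [this]
  exact (h i).inter (h' k)

lemma FM.pi {n : ℕ} {κ : Type*} {ξ : Fin n → X → κ} (h : ∀ i, FM (ξ i)) :
    FM (fun x i => ξ i x) := by
  intro a
  have : (fun x i => ξ i x) ⁻¹' {a} = ⋂ i, ξ i ⁻¹' {a i} := by ext; simp [funext_iff]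
  rw [this]
  exact MeasurableSet.iInter fun i => h i _

lemma real_pre {ι : Type*} [Fintype ι] {μ : Measure X} [IsFiniteMeasure μ] {ξ : X → ι}
    (h : FM ξ) {A : Set X} (hA : MeasurableSet A) : ∑ i, μ.real (ξ ⁻¹' {i} ∩ A) = μ.real A := by
  classical
  rw [← measureReal_biUnion_finset]
  · congr 1; ext; simp
  · intro i _ j _ hij
    refine Set.disjoint_left.2 fun x hx hx' => hij ?_
    have h1 := hx.1; have h2 := hx'.1
    simp only [mem_preimage, mem_singleton_iff] at h1 h2
    rw [← h1, ← h2]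
  · exact fun i _ => (h i).inter hA

lemma Hf_comp_le {ι κ : Type*} [Fintype ι] [Fintype κ] {μ : Measure X} [IsFiniteMeasure μ]
    {ξ : X → ι} (h : FM ξ) (g : ι → κ) : Hf μ (fun x => g (ξ x)) ≤ Hf μ ξ := by
  classical
  unfold Hf
  have h1 : ∀ k, μ.real ((fun x => g (ξ x)) ⁻¹' {k}) =
      ∑ i ∈ Finset.univ.filter (fun i => g i = k), μ.real (ξ ⁻¹' {i}) := by
    intro k
    rw [← measureReal_biUnion_finset]
    · congr 1; ext; simp
    · intro i _ j _ hij
      refine Set.disjoint_left.2 fun x hx hx' => hij ?_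
      simp only [mem_preimage, mem_singleton_iff] at hx hx'
      rw [← hx, ← hx']
    · exact fun i _ => h i
  calc _ = ∑ k, Real.negMulLog (∑ i ∈ Finset.univ.filter (fun i => g i = k), μ.real (ξ ⁻¹' {i})) := by
        simp only [h1]
    _ ≤ ∑ k, ∑ i ∈ Finset.univ.filter (fun i => g i = k), Real.negMulLog (μ.real (ξ ⁻¹' {i})) :=
        Finset.sum_le_sum fun k _ => negMulLog_sum_le _ _ fun i _ => measureReal_nonneg
    _ = _ := Finset.sum_fiberwise _ _ _

lemma Hf_pair_le {ι κ : Type*} [Fintype ι] [Fintype κ] {μ : Measure X} [IsProbabilityMeasure μ]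
    {ξ : X → ι} {η : X → κ} (h : FM ξ) (h' : FM η) :
    Hf μ (fun x => (ξ x, η x)) ≤ Hf μ ξ + Hf μ η := by
  classical
  have hset : ∀ i k, (fun x => (ξ x, η x)) ⁻¹' {(i, k)} = ξ ⁻¹' {i} ∩ η ⁻¹' {k} := by
    intro i k; ext; simp
  have hsum1 : ∑ i, μ.real (ξ ⁻¹' {i}) = 1 := by
    have := real_pre (μ := μ) h MeasurableSet.univ
    simpa using this
  have hsum2 : ∑ i, μ.real (η ⁻¹' {i}) = 1 := by
    have := real_pre (μ := μ) h' MeasurableSet.univ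
    simpa using this
  have hm1 : ∀ k, ∑ i, μ.real (ξ ⁻¹' {i} ∩ η ⁻¹' {k}) = μ.real (η ⁻¹' {k}) := fun k =>
    real_pre h (h' k)
  have hm2 : ∀ i, ∑ k, μ.real (ξ ⁻¹' {i} ∩ η ⁻¹' {k}) = μ.real (ξ ⁻¹' {i}) := fun i => by
    have := real_pre (μ := μ) h' (h i)
    simpa only [Set.inter_comm] using this
  have hg := gibbs (Finset.univ : Finset (ι × κ)) (fun z => μ.real (ξ ⁻¹' {z.1} ∩ η ⁻¹' {z.2}))
    (fun z => μ.real (ξ ⁻¹' {z.1}) * μ.real (η ⁻¹' {z.2})) (fun _ _ => measureReal_nonneg)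
    (fun _ _ => mul_nonneg measureReal_nonneg measureReal_nonneg) ?_ ?_
  · unfold Hf
    calc _ = ∑ z : ι × κ, Real.negMulLog (μ.real (ξ ⁻¹' {z.1} ∩ η ⁻¹' {z.2})) :=
          Finset.sum_congr rfl fun z _ => by rw [← hset]
      _ ≤ _ := hg
      _ = ∑ z : ι × κ, (-(μ.real (ξ ⁻¹' {z.1} ∩ η ⁻¹' {z.2}) * Real.log (μ.real (ξ ⁻¹' {z.1})))
          + -(μ.real (ξ ⁻¹' {z.1} ∩ η ⁻¹' {z.2}) * Real.log (μ.real (η ⁻¹' {z.2})))) := by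
          refine Finset.sum_congr rfl fun z _ => ?_
          by_cases h1 : μ.real (ξ ⁻¹' {z.1} ∩ η ⁻¹' {z.2}) = 0
          · rw [h1]; simp
          · have hp : 0 < μ.real (ξ ⁻¹' {z.1} ∩ η ⁻¹' {z.2}) :=
              lt_of_le_of_ne measureReal_nonneg (Ne.symm h1)
            have h2 : 0 < μ.real (ξ ⁻¹' {z.1}) :=
              hp.trans_le (measureReal_mono Set.inter_subset_left)
            have h3 : 0 < μ.real (η ⁻¹' {z.2}) :=
              hp.trans_le (measureReal_mono Set.inter_subset_right)
            rw [Real.log_mul h2.ne' h3.ne']; ring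
      _ = _ := by
          rw [Finset.sum_add_distrib, Fintype.sum_prod_type, Fintype.sum_prod_type_right]
          congr 1
          · refine Finset.sum_congr rfl fun i _ => ?_
            simp only [← neg_mul]
            rw [← Finset.sum_mul, Finset.sum_neg_distrib, hm2]; rfl
          · refine Finset.sum_congr rfl fun i _ => ?_
            simp only [← neg_mul]
            rw [← Finset.sum_mul, Finset.sum_neg_distrib, hm1]; rfl
  · intro z _ hz
    refine le_antisymm ?_ measureReal_nonneg
    rcases mul_eq_zero.1 hz with h1 | h1
    · rw [← h1]; exact measureReal_mono Set.inter_subset_left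
    · rw [← h1]; exact measureReal_mono Set.inter_subset_right
  · rw [Fintype.sum_prod_type, Fintype.sum_prod_type]
    simp only [hm2, ← Finset.mul_sum, hsum2, mul_one]
    exact le_rfl

/-- Itinerary. -/
def itin {N : ℕ} (f : X → X) (π : X → Fin N) (n : ℕ) (x : X) : Fin n → Fin N :=
  fun i => π (f^[(i:ℕ)] x)

lemma dynHn_eq {N : ℕ} (f : X → X) (μ : Measure X) (π : X → Fin N) (n : ℕ) :
    dynHn f μ (fun i => π ⁻¹' {i}) n = Hf μ (itin f π n) := by
  unfold dynHn Hf
  refine Finset.sum_congr rfl fun a _ => ?_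
  have : (⋂ i : Fin n, f^[(i : ℕ)] ⁻¹' (π ⁻¹' {a i})) = itin f π n ⁻¹' {a} := by
    ext; simp [itin, funext_iff]
  rw [this]; rfl

lemma exists_code {N : ℕ} {P : Fin N → Set X} (hP : IsMeasPartition P) :
    ∃ π : X → Fin N, FM π ∧ P = fun i => π ⁻¹' {i} := by
  obtain ⟨h1, h2, h3⟩ := hP
  have : ∀ x, ∃ i, x ∈ P i := fun x => by
    have : x ∈ ⋃ i, P i := by rw [h3]; trivial
    simpa using this
  choose π hπ using this
  have hP : P = fun i => π ⁻¹' {i} := by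
    funext i
    ext x
    constructor
    · intro hx
      by_contra hne
      exact Set.disjoint_left.1 (h2 (fun h => hne h : π x ≠ i)) (hπ x) hx
    · rintro rfl; exact hπ x
  refine ⟨π, fun i => ?_, hP⟩
  have := h1 i
  rwa [hP] at this

lemma code_part {N : ℕ} {π : X → Fin N} (h : FM π) : IsMeasPartition (fun i => π ⁻¹' {i}) := by
  refine ⟨h, ?_, ?_⟩
  · intro i j hij
    refine Set.disjoint_left.2 fun x hx hx' => hij ?_
    simp only [mem_preimage, mem_singleton_iff] at hx hx'
    rw [← hx, ← hx']
  · ext; simp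

lemma FM.meas {κ : Type*} {π : X → κ} (h : FM π) {f : X → X} (hf : Measurable f) :
    FM (fun x => π (f x)) := fun i => hf (h i)

lemma itin_FM {N : ℕ} {f : X → X} (hf : Measurable f) {π : X → Fin N} (h : FM π) (n : ℕ) :
    FM (itin f π n) := FM.pi fun i => h.meas (hf.iterate i)

lemma Hf_pres {ι : Type*} [Fintype ι] {μ : Measure X} {ξ : X → ι} (h : FM ξ) {f : X → X}
    (hf : MeasurePreserving f μ μ) : Hf μ (fun x => ξ (f x)) = Hf μ ξ := by
  unfold Hf
  refine Finset.sum_congr rfl fun i _ => ?_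
  have : (fun x => ξ (f x)) ⁻¹' {i} = f ⁻¹' (ξ ⁻¹' {i}) := rfl
  rw [this, measureReal_def, hf.measure_preimage (h i).nullMeasurableSet]; rfl

lemma itin_subadd {N : ℕ} {f : X → X} {μ : Measure X} [IsProbabilityMeasure μ]
    (hf : MeasurePreserving f μ μ) {π : X → Fin N} (h : FM π) (n m : ℕ) :
    Hf μ (itin f π (n + m)) ≤ Hf μ (itin f π n) + Hf μ (itin f π m) := by
  set ap : (Fin n → Fin N) × (Fin m → Fin N) → (Fin (n + m) → Fin N) :=
    fun z => Fin.append z.1 z.2 with hap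
  have h1 : itin f π (n + m) = fun x => ap (itin f π n x, itin f π m (f^[n] x)) := by
    funext x
    funext i
    refine Fin.addCases (fun j => ?_) (fun j => ?_) i
    · simp only [hap, itin, Fin.append_left, Fin.val_castAdd]
    · simp only [hap, itin, Fin.append_right, Fin.val_natAdd]
      rw [← Function.iterate_add_apply, add_comm]
  have hm := hf.measurable
  have hF1 := itin_FM hm h n
  have hF2 : FM (fun x => itin f π m (f^[n] x)) := (itin_FM hm h m).meas (hm.iterate n)
  have e1 : Hf μ (itin f π (n + m)) ≤ Hf μ (fun x => (itin f π n x, itin f π m (f^[n] x))) := by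
    rw [h1]
    exact Hf_comp_le (hF1.pair hF2) ap
  have e2 := Hf_pair_le (μ := μ) hF1 hF2
  have e3 : Hf μ (fun x => itin f π m (f^[n] x)) = Hf μ (itin f π m) :=
    Hf_pres (itin_FM hm h m) (hf.iterate n)
  rw [e3] at e2
  exact e1.trans e2

lemma itin_mul {N : ℕ} {f : X → X} {μ : Measure X} [IsProbabilityMeasure μ]
    (hf : MeasurePreserving f μ μ) {π : X → Fin N} (h : FM π) (n k : ℕ) (hk : 1 ≤ k) :
    Hf μ (itin f π (k * n)) ≤ k * Hf μ (itin f π n) := by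
  induction k, hk using Nat.le_induction with
  | base => rw [one_mul]; simp
  | succ k hk ih =>
    rw [show (k + 1) * n = k * n + n by ring]
    refine (itin_subadd hf h _ _).trans ?_
    push_cast
    linarith

lemma ks_ge {N : ℕ} {f : X → X} {μ : Measure X} [IsProbabilityMeasure μ]
    (hf : MeasurePreserving f μ μ) {π : X → Fin N} (h : FM π) (c D : ℝ)
    (hc : ∀ n : ℕ, c * n - D ≤ Hf μ (itin f π n)) : (c : EReal) ≤ ksEntropy f μ := by
  unfold ksEntropy
  refine le_iSup_of_le N (le_iSup_of_le (fun i => π ⁻¹' {i}) (le_iSup_of_le (code_part h) ?_))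
  rw [EReal.coe_le_coe_iff]
  have : Nonempty {n : ℕ // 0 < n} := ⟨⟨1, one_pos⟩⟩
  refine le_ciInf fun n => ?_
  obtain ⟨n, hn⟩ := n
  rw [dynHn_eq, le_div_iff₀ (by exact_mod_cast hn)]
  refine le_of_forall_pos_le_add fun e he => ?_
  obtain ⟨k, hk⟩ := exists_nat_gt (D / e)
  have h1 := hc ((k + 1) * n)
  have h2 := itin_mul hf h n (k + 1) (by omega)
  push_cast at h1 h2
  have hk' : D < e * (k + 1) := by
    rw [div_lt_iff₀ he] at hk; nlinarith
  have h3 : ((k:ℝ) + 1) * (c * n) ≤ ((k:ℝ) + 1) * (Hf μ (itin f π n) + e) := by nlinarith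
  exact le_of_mul_le_mul_left h3 (by positivity)

lemma ks_lt {f : X → X} {μ : Measure X} [IsProbabilityMeasure μ] {c : ℝ} (hc : (c : EReal) < ksEntropy f μ) :
    ∃ (N : ℕ) (π : X → Fin N), FM π ∧ ∀ n : ℕ, 0 < n → c * n ≤ Hf μ (itin f π n) := by
  unfold ksEntropy at hc
  rw [lt_iSup_iff] at hc
  obtain ⟨N, hc⟩ := hc
  rw [lt_iSup_iff] at hc
  obtain ⟨P, hc⟩ := hc
  rw [lt_iSup_iff] at hc
  obtain ⟨hP, hc⟩ := hc
  obtain ⟨π, hπ, rfl⟩ := exists_code hP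
  refine ⟨N, π, hπ, fun n hn => ?_⟩
  rw [EReal.coe_lt_coe_iff] at hc
  have : ∀ n : {n : ℕ // 0 < n}, c ≤ dynHn f μ (fun i => π ⁻¹' {i}) n / (n:ℕ) := by
    intro n
    refine hc.le.trans (ciInf_le ⟨0, ?_⟩ n)
    rintro _ ⟨m, rfl⟩
    refine div_nonneg (Finset.sum_nonneg fun a _ => Real.negMulLog_nonneg ENNReal.toReal_nonneg ?_)
      (Nat.cast_nonneg _)
    exact measureReal_le_one
  have := this ⟨n, hn⟩
  rwa [dynHn_eq, le_div_iff₀ (by exact_mod_cast hn)] at this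

end Hf
end IntervalEnt

namespace IntervalEnt

lemma le_elog {k : ℕ} (hk : 1 ≤ k) {m : ℕ∞} (h : (k : ℕ∞) ≤ m) : ((Real.log k : ℝ) : EReal) ≤ elog m := by
  induction m using ENat.recTopCoe with
  | top => exact le_top
  | coe m =>
    have h' : k ≤ m := by exact_mod_cast h
    show ((Real.log k : ℝ) : EReal) ≤ ((Real.log m : ℝ) : EReal)
    rw [EReal.coe_le_coe_iff]
    exact Real.log_le_log (by exact_mod_cast hk) (by exact_mod_cast h')

lemma elog_le {k : ℕ} {m : ℕ∞} (h : m ≤ (k : ℕ∞)) : elog m ≤ ((Real.log k : ℝ) : EReal) := by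
  induction m using ENat.recTopCoe with
  | top => exact absurd h (by simp)
  | coe m =>
    have h' : m ≤ k := by exact_mod_cast h
    show ((Real.log m : ℝ) : EReal) ≤ ((Real.log k : ℝ) : EReal)
    rw [EReal.coe_le_coe_iff]
    rcases Nat.eq_zero_or_pos m with rfl | hm
    · simp
      exact Real.log_natCast_nonneg k
    · exact Real.log_le_log (by exact_mod_cast hm) (by exact_mod_cast h')

structure HS {X : Type*} [MetricSpace X] (f : X → X) (p N : ℕ) (J : Fin N → Set X) : Prop where
  cpt : ∀ i, IsCompact (J i)
  ne : ∀ i, (J i).Nonempty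
  disj : ∀ i j, i ≠ j → Disjoint (J i) (J j)
  cov : ∀ i j, J j ⊆ f^[p] '' J i
  p1 : 1 ≤ p
  N1 : 1 ≤ N

namespace HS
variable {X : Type*} [MetricSpace X] {f : X → X} {p N : ℕ} {J : Fin N → Set X}

lemma shadow (h : HS f p N J) (n : ℕ) (w : ℕ → Fin N) :
    ∃ x ∈ J (w 0), ∀ i ≤ n, (f^[p])^[i] x ∈ J (w i) := by
  induction n generalizing w with
  | zero =>
    obtain ⟨x, hx⟩ := h.ne (w 0)
    refine ⟨x, hx, fun i hi => ?_⟩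
    obtain rfl : i = 0 := by omega
    exact hx
  | succ n ih =>
    obtain ⟨y, hy, hy2⟩ := ih (fun i => w (i + 1))
    obtain ⟨x, hx, rfl⟩ := h.cov (w 0) (w (0 + 1)) hy
    refine ⟨x, hx, fun i hi => ?_⟩
    rcases i with _ | i
    · exact hx
    · exact hy2 i (by omega)

lemma exists_pts (h : HS f p N J) (n : ℕ) : ∃ x : (Fin n → Fin N) → X,
    ∀ w : Fin n → Fin N, ∀ i : Fin n, (f^[p])^[(i:ℕ)] (x w) ∈ J (w i) := by
  have : ∀ w : Fin n → Fin N, ∃ x, ∀ i : Fin n, (f^[p])^[(i:ℕ)] x ∈ J (w i) := by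
    intro w
    obtain ⟨x, -, hx⟩ := h.shadow n (fun i => if hi : i < n then w ⟨i, hi⟩ else ⟨0, h.N1⟩)
    refine ⟨x, fun i => ?_⟩
    have := hx i i.2.le
    simpa using this
  choose x hx using this
  exact ⟨x, hx⟩

lemma sep (h : HS f p N J) : ∃ δ : ℝ, 0 < δ ∧ ∀ i j, i ≠ j → ∀ x ∈ J i, ∀ y ∈ J j, δ ≤ dist x y := by
  have h1 : ∀ᶠ δ : ℝ in 𝓝[>] 0, ∀ i j : Fin N, i ≠ j → ∀ x ∈ J i, ∀ y ∈ J j, δ ≤ dist x y := by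
    rw [eventually_all]; intro i
    rw [eventually_all]; intro j
    by_cases hij : i = j
    · exact Eventually.of_forall fun δ h => absurd hij h
    obtain ⟨δ, hδ, hd⟩ := (h.disj i j hij).exists_thickenings (h.cpt i) (h.cpt j).isClosed
    filter_upwards [Ioo_mem_nhdsGT hδ] with ε hε _ x hx y hy
    by_contra hlt
    push Not at hlt
    refine Set.disjoint_left.1 hd (Metric.self_subset_thickening hδ _ hx) ?_
    exact Metric.mem_thickening_iff.2 ⟨y, hy, hlt.trans hε.2⟩
  obtain ⟨δ, h2, h3⟩ := (h1.and self_mem_nhdsWithin).exists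
  exact ⟨δ, h3, h2⟩

theorem le_htop (h : HS f p N J) : ((Real.log N / p : ℝ) : EReal) ≤ htop f := by
  obtain ⟨δ, hδ, hsep⟩ := h.sep
  have hp : 0 < (p:ℝ) := by exact_mod_cast h.p1
  have key : ∀ n : ℕ, ((N ^ n : ℕ) : ℕ∞) ≤ coverNum f (δ / 2) (n * p) univ := by
    intro n
    refine le_sInf ?_
    rintro m ⟨F, -, hF, rfl⟩
    obtain ⟨x, hx⟩ := h.exists_pts n
    have h1 : ∀ w, ∃ c ∈ F, x w ∈ dynBall f (δ / 2) (n * p) c := by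
      intro w
      have := hF (mem_univ (x w))
      simpa using this
    choose c hc hcb using h1
    have hinj : Function.Injective c := by
      intro w w' hww
      funext i
      by_contra hne
      have h2 := hcb w (i * p) (Nat.mul_lt_mul_of_pos_right i.2 h.p1)
      have h3 := hcb w' (i * p) (Nat.mul_lt_mul_of_pos_right i.2 h.p1)
      rw [← hww] at h3
      have h4 := hsep (w i) (w' i) hne _ (hx w i) _ (hx w' i)
      rw [← Function.iterate_mul, mul_comm p] at h4
      have h5 := dist_triangle_right (f^[i * p] (x w)) (f^[i * p] (x w')) (f^[i * p] (c w))
      linarith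
    have := Finset.card_le_card_of_injOn (s := Finset.univ) (t := F) c (fun w _ => hc w) hinj.injOn
    simp only [Finset.card_univ, Fintype.card_fun, Fintype.card_fin] at this
    exact_mod_cast this
  refine le_iSup_of_le ⟨δ / 2, by positivity⟩ ?_
  refine le_limsup_of_frequently_le ?_
  rw [frequently_atTop]
  intro a
  refine ⟨(a + 1) * p, by nlinarith [h.p1], ?_⟩
  have h1 : ((Real.log N / p : ℝ) : EReal) =
      (((((a + 1) * p : ℕ):ℝ)⁻¹ : ℝ) : EReal) * ((Real.log ((N ^ (a + 1) : ℕ):ℝ) : ℝ) : EReal) := by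
    rw [← EReal.coe_mul]
    congr 1
    push_cast
    rw [Real.log_pow]
    push_cast
    have : (a:ℝ) + 1 ≠ 0 := by positivity
    field_simp
  rw [h1]
  refine mul_le_mul_of_nonneg_left (le_elog (Nat.one_le_pow _ _ h.N1) (key (a + 1))) ?_
  exact_mod_cast (by positivity : (0:ℝ) ≤ (((a + 1) * p : ℕ):ℝ)⁻¹)

end HS

section avg
variable {X : Type*} [MeasurableSpace X]

/-- Uniform measure on a finite family of points. -/
noncomputable def avg {I : Type*} [Fintype I] (y : I → X) : Measure X :=
  ((Fintype.card I : ℝ≥0∞)⁻¹) • ∑ i, Measure.dirac (y i)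

lemma avg_prob {I : Type*} [Fintype I] [Nonempty I] (y : I → X) : IsProbabilityMeasure (avg y) := by
  constructor
  simp only [avg, Measure.smul_apply, Measure.coe_finsetSum, Finset.sum_apply, measure_univ,
    Finset.sum_const, Finset.card_univ, nsmul_eq_mul, mul_one, smul_eq_mul]
  exact ENNReal.inv_mul_cancel (by simp) (by simp)

lemma avg_apply {I : Type*} [Fintype I] (y : I → X) {A : Set X} (hA : MeasurableSet A)
    [DecidablePred fun i => y i ∈ A] :
    avg y A = (Fintype.card I : ℝ≥0∞)⁻¹ * ((Finset.univ.filter fun i => y i ∈ A).card : ℝ≥0∞) := by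
  classical
  simp only [avg, Measure.smul_apply, Measure.coe_finsetSum, Finset.sum_apply, smul_eq_mul]
  congr 1
  rw [Finset.card_filter]
  push_cast
  refine Finset.sum_congr rfl fun i _ => ?_
  rw [Measure.dirac_apply' _ hA, indicator_apply]
  simp

lemma avg_integral {I : Type*} [Fintype I] [TopologicalSpace X] [OpensMeasurableSpace X]
    (y : I → X) (g : BoundedContinuousFunction X ℝ) :
    ∫ x, g x ∂(avg y) = (Fintype.card I : ℝ)⁻¹ * ∑ i, g (y i) := by
  unfold avg
  rw [integral_smul_measure, integral_finsetSum_measure]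
  · simp only [ENNReal.toReal_inv, ENNReal.toReal_natCast, smul_eq_mul]
    congr 1
    refine Finset.sum_congr rfl fun i _ => ?_
    exact integral_dirac' _ _ g.continuous.stronglyMeasurable
  · intro i _
    exact g.integrable _

end avg
end IntervalEnt

namespace IntervalEnt

lemma card_words {N n k m : ℕ} (hN : 1 ≤ N) (hk : k + m ≤ n) (a : Fin m → Fin N) :
    N ^ (n - m) ≤ (Finset.univ.filter fun w : Fin n → Fin N =>
      ∀ i : Fin m, w ⟨k + i, by omega⟩ = a i).card := by
  classical
  let b : Fin n → Finset (Fin N) := fun j =>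
    if h : k ≤ (j:ℕ) ∧ (j:ℕ) < k + m then {a ⟨j - k, by omega⟩} else Finset.univ
  have h1 : Fintype.piFinset b ⊆ Finset.univ.filter fun w : Fin n → Fin N =>
      ∀ i : Fin m, w ⟨k + i, by omega⟩ = a i := by
    intro w hw
    rw [Fintype.mem_piFinset] at hw
    refine Finset.mem_filter.2 ⟨Finset.mem_univ _, fun i => ?_⟩
    have := hw ⟨k + i, by omega⟩
    simp only [b] at this
    rw [dif_pos ⟨by simp, by simp⟩] at this
    simpa using this
  refine le_trans ?_ (Finset.card_le_card h1)
  rw [Fintype.card_piFinset]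
  have h2 : ∀ j : Fin n, (b j).card = if k ≤ (j:ℕ) ∧ (j:ℕ) < k + m then 1 else N := by
    intro j
    simp only [b]
    split_ifs <;> simp
  simp only [h2]
  rw [Finset.prod_ite]
  simp only [Finset.prod_const_one, Finset.prod_const, one_mul]
  refine Nat.pow_le_pow_right hN ?_
  have h3 : (Finset.univ.filter fun j : Fin n => k ≤ (j:ℕ) ∧ (j:ℕ) < k + m).card ≤ m := by
    have := Finset.card_le_card_of_injOn (s := Finset.univ.filter fun j : Fin n => k ≤ (j:ℕ) ∧ (j:ℕ) < k + m)
      (t := Finset.Ico k (k + m)) (fun j => (j:ℕ)) (by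
        intro j hj
        simpa using hj) (Fin.val_injective.injOn)
    simpa using this
  have h4 := Finset.card_filter_add_card_filter_not (s := (Finset.univ : Finset (Fin n)))
    (fun j : Fin n => k ≤ (j:ℕ) ∧ (j:ℕ) < k + m)
  rw [Finset.card_univ, Fintype.card_fin] at h4
  omega

namespace HS
variable {X : Type*} [MetricSpace X] [CompactSpace X] [MeasurableSpace X] [BorelSpace X]
  {f : X → X} {p N : ℕ} {J : Fin N → Set X}

theorem exists_T_measure (h : HS f p N J) (hf : Continuous f) :
    ∃ ν : Measure X, IsProbabilityMeasure ν ∧ MeasurePreserving (f^[p]) ν ν ∧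
      ∀ (m : ℕ) (a : Fin m → Fin N),
        ν.real (⋂ i : Fin m, (f^[p])^[(i:ℕ)] ⁻¹' J (a i)) = ((N:ℝ) ^ m)⁻¹ := by
  classical
  set T := f^[p] with hT
  have hTc : Continuous T := hf.iterate p
  have hNpos : 0 < (N:ℝ) := by exact_mod_cast h.N1
  haveI : Nonempty (Fin N) := ⟨⟨0, h.N1⟩⟩
  have hpts := fun n => h.exists_pts (n + 1)
  choose x hx using hpts
  let y : ∀ n : ℕ, (Fin (n + 1) → Fin N) × Fin (n + 1) → X := fun n z => T^[(z.2:ℕ)] (x n z.1)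
  have hprob : ∀ n, IsProbabilityMeasure (avg (y n)) := fun n => avg_prob _
  let M : ℕ → ProbabilityMeasure X := fun n => ⟨avg (y n), hprob n⟩
  let U : Ultrafilter ℕ := hyperfilter ℕ
  have hU : (U : Filter ℕ) ≤ atTop := by
    rw [← Nat.cofinite_eq_atTop]; exact hyperfilter_le_cofinite
  obtain ⟨ν, -, hν⟩ := (isCompact_univ (X := ProbabilityMeasure X)).ultrafilter_le_nhds (U.map M) (by simp)
  have hlim : Tendsto M (U : Filter ℕ) (𝓝 ν) := hν
  have hcard : ∀ n, Fintype.card ((Fin (n + 1) → Fin N) × Fin (n + 1)) = N ^ (n + 1) * (n + 1) := by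
    intro n; simp
  refine ⟨ν, inferInstance, ⟨hTc.measurable, ?_⟩, ?_⟩
  · -- invariance
    haveI : IsProbabilityMeasure (Measure.map T (ν : Measure X)) :=
      Measure.isProbabilityMeasure_map hTc.measurable.aemeasurable
    refine ext_of_forall_integral_eq_of_IsFiniteMeasure fun g => ?_
    rw [integral_map hTc.measurable.aemeasurable g.continuous.aestronglyMeasurable]
    have h1 := (ProbabilityMeasure.tendsto_iff_forall_integral_tendsto.1 hlim) g
    let gT : BoundedContinuousFunction X ℝ := g.compContinuous ⟨T, hTc⟩
    have h2 := (ProbabilityMeasure.tendsto_iff_forall_integral_tendsto.1 hlim) gT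
    have h3 : Tendsto (fun n => (∫ z, gT z ∂(M n : Measure X)) - ∫ z, g z ∂(M n : Measure X))
        (U : Filter ℕ) (𝓝 0) := by
      have hb : Tendsto (fun n : ℕ => 2 * ‖g‖ * (1 / ((n:ℝ) + 1))) (U : Filter ℕ) (𝓝 0) := by
        have := (tendsto_one_div_add_atTop_nhds_zero_nat (𝕜 := ℝ)).const_mul (2 * ‖g‖)
        rw [mul_zero] at this
        exact this.mono_left hU
      refine squeeze_zero_norm (fun n => ?_) hb
      have e1 : ∫ z, gT z ∂(M n : Measure X) = _ := avg_integral (y n) gT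
      have e2 : ∫ z, g z ∂(M n : Measure X) = _ := avg_integral (y n) g
      rw [e1, e2, ← mul_sub, ← Finset.sum_sub_distrib, Fintype.sum_prod_type, hcard]
      have e3 : ∀ w : Fin (n + 1) → Fin N, ∑ k : Fin (n + 1), (gT (y n (w, k)) - g (y n (w, k)))
          = g (T^[n + 1] (x n w)) - g (x n w) := by
        intro w
        have : ∀ k : Fin (n + 1), gT (y n (w, k)) - g (y n (w, k)) =
            (fun k : ℕ => g (T^[k + 1] (x n w)) - g (T^[k] (x n w))) k := by
          intro k
          simp only [y, gT, BoundedContinuousFunction.compContinuous_apply, ContinuousMap.coe_mk]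
          rw [← Function.iterate_succ_apply' T]
        rw [Finset.sum_congr rfl fun k _ => this k, Fin.sum_univ_eq_sum_range
          (fun k : ℕ => g (T^[k + 1] (x n w)) - g (T^[k] (x n w))), Finset.sum_range_sub
          (fun k => g (T^[k] (x n w)))]
        rfl
      rw [Finset.sum_congr rfl fun w _ => e3 w, norm_mul]
      have e4 : ‖∑ w : Fin (n + 1) → Fin N, (g (T^[n + 1] (x n w)) - g (x n w))‖ ≤
          (N:ℝ) ^ (n + 1) * (2 * ‖g‖) := by
        refine (norm_sum_le _ _).trans ((Finset.sum_le_sum fun w _ =>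
          (norm_sub_le _ _).trans (add_le_add (g.norm_coe_le_norm _) (g.norm_coe_le_norm _))).trans ?_)
        simp
        apply le_of_eq; ring
      refine (mul_le_mul_of_nonneg_left e4 (norm_nonneg _)).trans (le_of_eq ?_)
      push_cast
      rw [Real.norm_of_nonneg (by positivity)]
      field_simp
    have h4 := h2.sub h1
    have h5 := tendsto_nhds_unique h3 h4
    have h6 : ∫ z, gT z ∂(ν : Measure X) = ∫ z, g z ∂(ν : Measure X) := by linarith
    exact h6
  · -- cylinders
    intro m a
    let C : (Fin m → Fin N) → Set X := fun a => ⋂ i : Fin m, T^[(i:ℕ)] ⁻¹' J (a i)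
    have hCc : ∀ a, IsClosed (C a) := fun a =>
      isClosed_iInter fun i => (h.cpt (a i)).isClosed.preimage (hTc.iterate i)
    have hlow : ∀ a, ((N:ℝ) ^ m)⁻¹ ≤ (ν : Measure X).real (C a) := by
      intro a
      have hp := ProbabilityMeasure.limsup_measure_closed_le_of_tendsto hlim (hCc a)
      have hl : ∀ᶠ n : ℕ in (U : Filter ℕ), ENNReal.ofReal (((N:ℝ) ^ m)⁻¹ * (1 - m * (1 / ((n:ℝ) + 1)))) ≤
          (M n : Measure X) (C a) := by
        filter_upwards [hU (eventually_ge_atTop m)] with n hn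
        show _ ≤ avg (y n) (C a)
        rw [avg_apply (y n) (hCc a).measurableSet]
        have hcnt : N ^ (n + 1 - m) * (n + 1 - m) ≤
            (Finset.univ.filter fun z => y n z ∈ C a).card := by
          have hsub : ((Finset.univ.filter fun k : Fin (n + 1) => (k:ℕ) + m ≤ n + 1).sigma fun k =>
              Finset.univ.filter fun w : Fin (n + 1) → Fin N =>
                ∀ i : Fin m, ∀ hi : (k:ℕ) + i < n + 1, w ⟨k + i, hi⟩ = a i).card ≤
              (Finset.univ.filter fun z => y n z ∈ C a).card := by
            refine Finset.card_le_card_of_injOn (fun s => (s.2, s.1)) ?_ ?_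
            · rintro ⟨k, w⟩ hs
              simp only [Finset.coe_sigma, Finset.coe_filter, Finset.mem_univ, true_and] at hs
              obtain ⟨hk, hw⟩ := hs
              simp only [Set.mem_ofPred_eq] at hk hw
              simp only [Finset.coe_filter, Finset.mem_univ, true_and, Set.mem_ofPred_eq, C, mem_iInter,
                mem_preimage, y]
              intro i
              rw [← Function.iterate_add_apply, add_comm (i:ℕ), ← hw i (by omega)]
              exact hx n w ⟨k + i, by omega⟩
            · rintro ⟨k, w⟩ _ ⟨k', w'⟩ _ heq
              simp only [Prod.mk.injEq] at heq
              obtain ⟨rfl, rfl⟩ := heq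
              rfl
          refine le_trans ?_ hsub
          rw [Finset.card_sigma]
          have hk : ∀ k ∈ Finset.univ.filter fun k : Fin (n + 1) => (k:ℕ) + m ≤ n + 1,
              N ^ (n + 1 - m) ≤ (Finset.univ.filter fun w : Fin (n + 1) → Fin N =>
                ∀ i : Fin m, ∀ hi : (k:ℕ) + i < n + 1, w ⟨k + i, hi⟩ = a i).card := by
            intro k hk
            have hk' := (Finset.mem_filter.1 hk).2
            refine (card_words h.N1 hk' a).trans (Finset.card_le_card fun w hw => ?_)
            rw [Finset.mem_filter] at hw ⊢
            exact ⟨hw.1, fun i hi => hw.2 i⟩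
          refine le_trans ?_ (Finset.card_nsmul_le_sum _ _ _ hk)
          rw [smul_eq_mul, mul_comm]
          refine Nat.mul_le_mul_right _ ?_
          have : (Finset.univ : Finset (Fin (n + 1 - m))).card ≤
              (Finset.univ.filter fun k : Fin (n + 1) => (k:ℕ) + m ≤ n + 1).card := by
            refine Finset.card_le_card_of_injOn (fun j => ⟨j, by omega⟩) ?_ ?_
            · intro j _
              simp only [Finset.coe_filter, Finset.mem_univ, true_and, Set.mem_ofPred_eq]
              omega
            · intro j _ j' _ hjj
              simpa [Fin.ext_iff] using hjj
          simpa using this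
        rw [hcard]
        have e1 : ENNReal.ofReal (((N:ℝ) ^ m)⁻¹ * (1 - m * (1 / ((n:ℝ) + 1)))) =
            ((N ^ (n + 1) * (n + 1) : ℕ) : ℝ≥0∞)⁻¹ * ((N ^ (n + 1 - m) * (n + 1 - m) : ℕ) : ℝ≥0∞) := by
          rw [← ENNReal.ofReal_natCast, ← ENNReal.ofReal_natCast (N ^ (n + 1 - m) * (n + 1 - m)),
            ← ENNReal.ofReal_inv_of_pos (by
              have : 0 < N ^ (n + 1) * (n + 1) := Nat.mul_pos (pow_pos h.N1 _) (by omega)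
              exact_mod_cast this), ← ENNReal.ofReal_mul (by positivity)]
          congr 1
          have e2 : (N:ℝ) ^ (n + 1) = N ^ (n + 1 - m) * N ^ m := by
            rw [← pow_add]; congr 1; omega
          push_cast
          rw [Nat.cast_sub (by omega)]
          rw [e2]
          push_cast
          have : (n:ℝ) + 1 ≠ 0 := by positivity
          field_simp
        rw [e1]
        gcongr
      have ht : Tendsto (fun n : ℕ => ENNReal.ofReal (((N:ℝ) ^ m)⁻¹ * (1 - m * (1 / ((n:ℝ) + 1)))))
          (U : Filter ℕ) (𝓝 (ENNReal.ofReal (((N:ℝ) ^ m)⁻¹ * (1 - m * 0)))) := by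
        refine ENNReal.tendsto_ofReal (Tendsto.const_mul _ (tendsto_const_nhds.sub
          (Tendsto.const_mul _ ?_)))
        exact (tendsto_one_div_add_atTop_nhds_zero_nat (𝕜 := ℝ)).mono_left hU
      have h1 := limsup_le_limsup hl
      rw [ht.limsup_eq] at h1
      have h2 := h1.trans hp
      rw [mul_zero, sub_zero, mul_one] at h2
      rw [measureReal_def]
      exact (ENNReal.ofReal_le_iff_le_toReal (measure_ne_top _ _)).1 h2
    have hsum : ∑ a, (ν : Measure X).real (C a) ≤ 1 := by
      rw [← measureReal_biUnion_finset]
      · exact measureReal_le_one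
      · intro b _ b' _ hne
        refine Set.disjoint_left.2 fun z hz hz' => hne ?_
        funext i
        by_contra hi
        exact Set.disjoint_left.1 (h.disj _ _ hi) (mem_iInter.1 hz i) (mem_iInter.1 hz' i)
      · exact fun b _ => (hCc b).measurableSet
    refine le_antisymm ?_ (hlow a)
    by_contra hcon
    push Not at hcon
    have h1 : ∑ b : Fin m → Fin N, ((N:ℝ) ^ m)⁻¹ < ∑ b, (ν : Measure X).real (C b) :=
      Finset.sum_lt_sum (fun b _ => hlow b) ⟨a, Finset.mem_univ _, hcon⟩
    rw [Finset.sum_const, Finset.card_univ, Fintype.card_fun, Fintype.card_fin, Fintype.card_fin,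
      nsmul_eq_mul] at h1
    push_cast at h1
    have hN0 : (0:ℝ) < N := by exact_mod_cast h.N1
    rw [mul_inv_cancel₀ (by positivity)] at h1
    linarith

end HS
end IntervalEnt

namespace IntervalEnt

lemma Hf_avg {X ι : Type*} [MeasurableSpace X] [Fintype ι] (p : ℕ) (hp : 1 ≤ p) (M : ℕ → Measure X)
    [∀ j, IsProbabilityMeasure (M j)] (ξ : X → ι) (c : ℝ) (hc : ∀ j < p, c ≤ Hf (M j) ξ) :
    c ≤ Hf ((p:ℝ≥0∞)⁻¹ • ∑ j ∈ Finset.range p, M j) ξ := by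
  have hp0 : (0:ℝ) < p := by exact_mod_cast hp
  have h1 : ∀ i, ((p:ℝ≥0∞)⁻¹ • ∑ j ∈ Finset.range p, M j).real (ξ ⁻¹' {i}) =
      ∑ j ∈ Finset.range p, (p:ℝ)⁻¹ • (M j).real (ξ ⁻¹' {i}) := by
    intro i
    rw [measureReal_def, Measure.smul_apply, Measure.finsetSum_apply, smul_eq_mul, ENNReal.toReal_mul,
      ENNReal.toReal_sum (fun j _ => measure_ne_top _ _), Finset.mul_sum]
    refine Finset.sum_congr rfl fun j _ => ?_
    simp [measureReal_def]
  have h2 : ∀ i, ∑ j ∈ Finset.range p, (p:ℝ)⁻¹ • Real.negMulLog ((M j).real (ξ ⁻¹' {i})) ≤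
      Real.negMulLog (((p:ℝ≥0∞)⁻¹ • ∑ j ∈ Finset.range p, M j).real (ξ ⁻¹' {i})) := by
    intro i
    rw [h1 i]
    refine Real.concaveOn_negMulLog.le_map_sum (fun j _ => by positivity) ?_ (fun j _ => ?_)
    · simp; field_simp
    · exact measureReal_nonneg
  unfold Hf
  refine le_trans ?_ (Finset.sum_le_sum fun i _ => h2 i)
  rw [Finset.sum_comm]
  have h3 : ∀ j ∈ Finset.range p, (p:ℝ)⁻¹ * c ≤ ∑ i, (p:ℝ)⁻¹ • Real.negMulLog ((M j).real (ξ ⁻¹' {i})) := by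
    intro j hj
    rw [← Finset.smul_sum, smul_eq_mul]
    exact mul_le_mul_of_nonneg_left (hc j (Finset.mem_range.1 hj)) (by positivity)
  refine le_trans ?_ (Finset.sum_le_sum h3)
  rw [Finset.sum_const, Finset.card_range, nsmul_eq_mul]
  apply le_of_eq; field_simp

namespace HS
variable {X : Type*} [MetricSpace X] [CompactSpace X] [MeasurableSpace X] [BorelSpace X]
  {f : X → X} {p N : ℕ} {J : Fin N → Set X}

lemma exists_measure (h : HS f p N J) (hf : Continuous f) :
    ∃ ν : Measure X, IsInvariantProb f ν ∧ ((Real.log N / p : ℝ) : EReal) ≤ ksEntropy f ν := by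
  classical
  obtain ⟨ν0, hν0, hinv, hcyl⟩ := h.exists_T_measure hf
  have hp0 : (0:ℝ) < p := by exact_mod_cast h.p1
  have hN0 : (0:ℝ) < N := by exact_mod_cast h.N1
  set T := f^[p] with hT
  let π : X → Fin (N + 1) := fun x => if hx : ∃ i, x ∈ J i then (hx.choose).castSucc else Fin.last N
  have hπ : ∀ i, π ⁻¹' {Fin.castSucc i} = J i := by
    intro i
    ext x
    simp only [mem_preimage, mem_singleton_iff, π]
    constructor
    · intro hx
      split_ifs at hx with h1
      · rw [Fin.castSucc_inj] at hx
        rw [← hx]; exact h1.choose_spec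
      · exact absurd hx (Fin.castSucc_lt_last i).ne'
    · intro hx
      have h1 : ∃ i, x ∈ J i := ⟨i, hx⟩
      rw [dif_pos h1, Fin.castSucc_inj]
      by_contra hne
      exact Set.disjoint_left.1 (h.disj _ _ hne) h1.choose_spec hx
  have hπl : π ⁻¹' {Fin.last N} = (⋃ i, J i)ᶜ := by
    ext x
    simp only [mem_preimage, mem_singleton_iff, π, mem_compl_iff, mem_iUnion]
    split_ifs with h1
    · simp [h1, (Fin.castSucc_lt_last _).ne]
    · simp [h1]
  have hFM : FM π := by
    intro i
    refine Fin.lastCases ?_ (fun i => ?_) i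
    · rw [hπl]
      exact (MeasurableSet.iUnion fun i => (h.cpt i).isClosed.measurableSet).compl
    · rw [hπ]; exact (h.cpt i).isClosed.measurableSet
  have hH : ∀ m : ℕ, m * Real.log N ≤ Hf ν0 (itin T π m) := by
    intro m
    let e : (Fin m → Fin N) ↪ (Fin m → Fin (N + 1)) :=
      ⟨fun a i => (a i).castSucc, fun a b hab => by
        funext i
        have := congrFun hab i
        simpa using this⟩
    unfold Hf
    refine le_trans ?_ (Finset.sum_le_sum_of_subset_of_nonneg (Finset.subset_univ (Finset.univ.map e))
      fun i _ _ => Real.negMulLog_nonneg measureReal_nonneg measureReal_le_one)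
    rw [Finset.sum_map]
    have e1 : ∀ a : Fin m → Fin N, Real.negMulLog (ν0.real (itin T π m ⁻¹' {e a})) =
        ((N:ℝ)^m)⁻¹ * (m * Real.log N) := by
      intro a
      have : itin T π m ⁻¹' {e a} = ⋂ i : Fin m, T^[(i:ℕ)] ⁻¹' J (a i) := by
        ext x
        simp only [mem_preimage, mem_singleton_iff, funext_iff, mem_iInter, ← hπ]
        rfl
      rw [this, hcyl, Real.negMulLog, Real.log_inv, Real.log_pow]
      ring
    rw [Finset.sum_congr rfl fun a _ => e1 a, Finset.sum_const, Finset.card_univ, Fintype.card_fun,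
      Fintype.card_fin, Fintype.card_fin, nsmul_eq_mul]
    push_cast
    rw [← mul_assoc, mul_inv_cancel₀ (by positivity), one_mul]
  let M : ℕ → Measure X := fun j => ν0.map (f^[j])
  have hm : ∀ j, Measurable (f^[j]) := fun j => (hf.iterate j).measurable
  have hMp : ∀ j, IsProbabilityMeasure (M j) := fun j =>
    Measure.isProbabilityMeasure_map (hm j).aemeasurable
  let ν := (p:ℝ≥0∞)⁻¹ • ∑ j ∈ Finset.range p, M j
  have hpn : (p:ℝ≥0∞) ≠ 0 := by exact_mod_cast (by have := h.p1; omega : p ≠ 0)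
  have hνp : IsProbabilityMeasure ν := by
    constructor
    show ((p:ℝ≥0∞)⁻¹ • ∑ j ∈ Finset.range p, M j) univ = 1
    rw [Measure.smul_apply, Measure.finsetSum_apply]
    simp only [measure_univ, Finset.sum_const, Finset.card_range, nsmul_eq_mul, mul_one, smul_eq_mul]
    exact ENNReal.inv_mul_cancel hpn (by simp)
  have hMs : ∀ j, (M j).map f = M (j + 1) := by
    intro j
    show (ν0.map (f^[j])).map f = ν0.map (f^[j+1])
    rw [Measure.map_map hf.measurable (hm j), Function.iterate_succ']
  have hMpp : M p = M 0 := by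
    show ν0.map (f^[p]) = ν0.map (f^[0])
    rw [Function.iterate_zero, Measure.map_id]
    exact hinv.map_eq
  have hνi : MeasurePreserving f ν ν := by
    refine ⟨hf.measurable, ?_⟩
    show ((p:ℝ≥0∞)⁻¹ • ∑ j ∈ Finset.range p, M j).map f = (p:ℝ≥0∞)⁻¹ • ∑ j ∈ Finset.range p, M j
    rw [Measure.map_smul]
    congr 1
    have : (∑ j ∈ Finset.range p, M j).map f = ∑ j ∈ Finset.range p, M (j + 1) := by
      rw [← Measure.mapₗ_apply_of_measurable hf.measurable, map_sum]
      refine Finset.sum_congr rfl fun j _ => ?_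
      rw [Measure.mapₗ_apply_of_measurable hf.measurable, hMs]
    rw [this]
    obtain ⟨k, hk⟩ : ∃ k, p = k + 1 := ⟨p - 1, by have := h.p1; omega⟩
    have h1 := Finset.sum_range_succ M k
    have h2 := Finset.sum_range_succ' M k
    rw [hk, h2, Finset.sum_range_succ, ← hk, hMpp]
  refine ⟨ν, ⟨hνp, hνi⟩, ks_ge hνi hFM _ (Real.log N) fun n => ?_⟩
  have hlog : 0 ≤ Real.log N := Real.log_natCast_nonneg N
  set m := (n - 1) / p with hmdef
  have hmp : m * p ≤ n - 1 := Nat.div_mul_le_self _ _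
  have hmn : n ≤ m * p + p := by
    have := Nat.lt_div_mul_add (a := n - 1) (show 0 < p from h.p1)
    rw [← hmdef] at this
    omega
  refine Hf_avg p h.p1 M _ _ fun j hj => ?_
  have e1 : Hf (M j) (itin f π n) = Hf ν0 (fun x => itin f π n (f^[j] x)) := by
    unfold Hf
    refine Finset.sum_congr rfl fun a _ => ?_
    congr 1
    rw [measureReal_def, measureReal_def, Measure.map_apply (hm j) (itin_FM hf.measurable hFM n a)]
    rfl
  have hidx : ∀ k : Fin m, (k + 1) * p - j < n := by
    intro k
    have : (k + 1) * p ≤ m * p := Nat.mul_le_mul_right _ k.2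
    have h0 : 0 < n ∨ n = 0 := by omega
    rcases h0 with h0 | h0
    · omega
    · exfalso
      have hk := k.2
      have : m = 0 := by rw [hmdef, h0]; simp
      omega
  let G : (Fin n → Fin (N + 1)) → (Fin m → Fin (N + 1)) := fun b k => b ⟨(k + 1) * p - j, hidx k⟩
  have hFMj : FM (fun x => itin f π n (f^[j] x)) := (itin_FM hf.measurable hFM n).meas (hm j)
  have e2 := Hf_comp_le (μ := ν0) hFMj G
  have e3 : (fun x => G (itin f π n (f^[j] x))) = fun x => itin T π m (T x) := by
    funext x k
    show π (f^[(k + 1) * p - j] (f^[j] x)) = π (T^[(k:ℕ)] (T x))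
    have : p ≤ (k + 1) * p := Nat.le_mul_of_pos_left _ (by omega)
    rw [← Function.iterate_add_apply, Nat.sub_add_cancel (by omega), ← Function.iterate_succ_apply T,
      hT, ← Function.iterate_mul, mul_comm]
  rw [e3, Hf_pres (itin_FM (hm p) hFM m) hinv, ← e1] at e2
  refine le_trans ?_ ((hH m).trans e2)
  have h4 : (n:ℝ) ≤ m * p + p := by exact_mod_cast hmn
  have h5 : (n:ℝ) / p ≤ m + 1 := by rw [div_le_iff₀ hp0]; linarith
  have h6 := mul_le_mul_of_nonneg_right h5 hlog
  have h7 : Real.log N / p * n = n / p * Real.log N := by ring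
  linarith

end HS
end IntervalEnt

namespace IntervalEnt
namespace Sys

variable (S : Sys)

lemma GP_ord {t : ℕ} {A B : Fin S.d} {C : Set ℝ} (hC : C ∈ S.GP t A B) : OrdConnected C := by
  obtain ⟨y, h1, h2, h3, rfl⟩ := hC
  obtain ⟨a, b, h, -⟩ := S.Pc_Ioo h2.1
  rw [h]; exact ordConnected_Ioo

lemma GP_mono {t : ℕ} {A B : Fin S.d} {C : Set ℝ} (hC : C ∈ S.GP t A B) :
    StrictMonoOn S.g^[t] C ∨ StrictAntiOn S.g^[t] C := by
  obtain ⟨y, h1, h2, h3, rfl⟩ := hC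
  exact S.mono_Pc h2.1

/-- compact horseshoe data inside a cell -/
theorem horse (t : ℕ) (A : Fin S.d) (hK : 3 ≤ (S.Gf t A A).card) :
    ∃ (E : Finset (Set ℝ)) (J : Set ℝ → Set ℝ), E ⊆ S.Gf t A A ∧ (S.Gf t A A).card ≤ E.card + 2 ∧
      (∀ C ∈ E, IsCompact (J C) ∧ J C ⊆ C ∧ (∃ x ∈ J C, S.g^[t] x = x)) ∧
      ∀ C ∈ E, ∀ D ∈ E, J D ⊆ S.g^[t] '' J C := by
  classical
  have hne : ∀ C : Set ℝ, ∃ x, C ∈ S.Gf t A A → x ∈ C := by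
    intro C
    by_cases h : C ∈ S.Gf t A A
    · obtain ⟨x, hx⟩ := S.GP_nonempty (S.mem_Gf.1 h)
      exact ⟨x, fun _ => hx⟩
    · exact ⟨0, fun h' => absurd h' h⟩
  choose pt hpt using hne
  have hnonempty : (S.Gf t A A).Nonempty := Finset.card_pos.1 (by omega)
  obtain ⟨C1, hC1, hmin⟩ := Finset.exists_min_image (S.Gf t A A) pt hnonempty
  obtain ⟨C2, hC2, hmax⟩ := Finset.exists_max_image (S.Gf t A A) pt hnonempty
  set R := Icc (pt C1) (pt C2) with hR
  have hRA : R ⊆ S.cell A := (ordConnected_Ioo).out (S.GP_sub (S.mem_Gf.1 hC1) (hpt _ hC1))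
    (S.GP_sub (S.mem_Gf.1 hC2) (hpt _ hC2))
  set E := ((S.Gf t A A).erase C1).erase C2 with hE
  have hEG : E ⊆ S.Gf t A A := (Finset.erase_subset _ _).trans (Finset.erase_subset _ _)
  have hER : ∀ C ∈ E, C ⊆ R := by
    intro C hC x hx
    have hCG := hEG hC
    have hor := S.GP_ord (S.mem_Gf.1 hCG)
    have n2 : C ≠ C2 := (Finset.mem_erase.1 hC).1
    have n1 : C ≠ C1 := (Finset.mem_erase.1 (Finset.mem_erase.1 hC).2).1
    have nm1 : pt C1 ∉ C := fun h => n1 (S.GP_disj (S.mem_Gf.1 hCG) (S.mem_Gf.1 hC1) h (hpt _ hC1))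
    have nm2 : pt C2 ∉ C := fun h => n2 (S.GP_disj (S.mem_Gf.1 hCG) (S.mem_Gf.1 hC2) h (hpt _ hC2))
    constructor
    · by_contra hlt
      push Not at hlt
      exact nm1 (hor.out hx (hpt _ hCG) ⟨hlt.le, hmin _ hCG⟩)
    · by_contra hlt
      push Not at hlt
      exact nm2 (hor.out (hpt _ hCG) hx ⟨hmax _ hCG, hlt.le⟩)
  refine ⟨E, fun C => C ∩ S.g^[t] ⁻¹' R, hEG, ?_, ?_, ?_⟩
  · have := Finset.pred_card_le_card_erase (s := S.Gf t A A) (a := C1)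
    have := Finset.pred_card_le_card_erase (s := (S.Gf t A A).erase C1) (a := C2)
    rw [← hE] at this
    omega
  · intro C hC
    have hCG := S.mem_Gf.1 (hEG hC)
    have him := S.GP_img hCG
    have hle : pt C1 ≤ pt C2 := hmin _ hC2
    obtain ⟨u, hu, hu'⟩ : pt C1 ∈ S.g^[t] '' C := him ▸ hRA (left_mem_Icc.2 hle)
    obtain ⟨v, hv, hv'⟩ : pt C2 ∈ S.g^[t] '' C := him ▸ hRA (right_mem_Icc.2 hle)
    have huv : uIcc u v ⊆ C := (S.GP_ord hCG).uIcc_subset hu hv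
    have heq : C ∩ S.g^[t] ⁻¹' R = uIcc u v ∩ S.g^[t] ⁻¹' R := by
      refine Subset.antisymm (fun y hy => ⟨?_, hy.2⟩) (inter_subset_inter_left _ huv)
      obtain ⟨hy1, hy2, hy3⟩ := hy
      rw [← hu'] at hy2; rw [← hv'] at hy3
      rcases S.GP_mono hCG with hm | hm
      · exact mem_uIcc_of_le ((hm.le_iff_le hu hy1).1 hy2) ((hm.le_iff_le hy1 hv).1 hy3)
      · exact mem_uIcc_of_ge ((hm.le_iff_ge hy1 hv).1 hy3) ((hm.le_iff_ge hu hy1).1 hy2)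
    refine ⟨?_, inter_subset_left, ?_⟩
    · show IsCompact (C ∩ S.g^[t] ⁻¹' R)
      rw [heq]
      exact isCompact_uIcc.inter_right (isClosed_Icc.preimage (S.cont_it t))
    · have hcont : ContinuousOn (fun x => S.g^[t] x - x) (uIcc u v) :=
        ((S.cont_it t).sub continuous_id).continuousOn
      have hiv := intermediate_value_uIcc hcont
      have h0 : (0:ℝ) ∈ uIcc (S.g^[t] u - u) (S.g^[t] v - v) := by
        refine mem_uIcc_of_le ?_ ?_
        · rw [hu']; linarith [(hER C hC hu).1]
        · rw [hv']; linarith [(hER C hC hv).2]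
      obtain ⟨x, hx, hx0⟩ := hiv h0
      have hx1 : S.g^[t] x = x := by simpa [sub_eq_zero] using hx0
      refine ⟨x, ⟨huv hx, ?_⟩, hx1⟩
      show S.g^[t] x ∈ R
      rw [hx1]; exact hER C hC (huv hx)
  · intro C hC D hD z hz
    have hzR := hER D hD hz.1
    obtain ⟨y, hy, rfl⟩ : z ∈ S.g^[t] '' C := S.GP_img (S.mem_Gf.1 (hEG hC)) ▸ hRA hzR
    exact ⟨y, ⟨hy, hzR⟩, rfl⟩

section conj
variable (f : Icc (0:ℝ) 1 → Icc (0:ℝ) 1) (q : ℕ)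

lemma conj_it (hfg : ∀ x, ((f^[q] x : Icc (0:ℝ) 1) : ℝ) = S.g x)
    (t : ℕ) (x : Icc (0:ℝ) 1) : ((f^[q * t] x : Icc (0:ℝ) 1) : ℝ) = S.g^[t] x := by
  induction t generalizing x with
  | zero => simp
  | succ t ih =>
    rw [mul_add, mul_one, Function.iterate_add_apply, ih, hfg, Function.iterate_succ_apply]

theorem HS_of (hfg : ∀ x, ((f^[q] x : Icc (0:ℝ) 1) : ℝ) = S.g x)
    (hq : 1 ≤ q) (t : ℕ) (ht : 1 ≤ t) (A : Fin S.d) (hK : 3 ≤ (S.Gf t A A).card) :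
    ∃ (M : ℕ) (J : Fin M → Set (Icc (0:ℝ) 1)), (S.Gf t A A).card ≤ M + 2 ∧ HS f (q * t) M J ∧
      (M : ℕ∞) ≤ periodicCount f (q * t) := by
  classical
  obtain ⟨E, J, hEG, hcard, hJ, hcov⟩ := S.horse t A hK
  let e : Fin E.card ≃ E := (Finset.equivFinOfCardEq rfl).symm
  have hin : ∀ C ∈ E, C ⊆ Icc (0:ℝ) 1 := fun C hC =>
    (S.GP_sub (S.mem_Gf.1 (hEG hC))).trans (S.cell_sub_Icc A)
  have hdisj : ∀ C ∈ E, ∀ D ∈ E, ∀ x, x ∈ J C → x ∈ J D → C = D := fun C hC D hD x hx hx' =>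
    S.GP_disj (S.mem_Gf.1 (hEG hC)) (S.mem_Gf.1 (hEG hD)) ((hJ C hC).2.1 hx) ((hJ D hD).2.1 hx')
  refine ⟨E.card, fun i => Subtype.val ⁻¹' J (e i), hcard, ⟨?_, ?_, ?_, ?_, ?_, ?_⟩, ?_⟩
  · intro i
    exact ((hJ _ (e i).2).1.isClosed.preimage continuous_subtype_val).isCompact
  · intro i
    obtain ⟨x, hx, -⟩ := (hJ _ (e i).2).2.2
    exact ⟨⟨x, hin _ (e i).2 ((hJ _ (e i).2).2.1 hx)⟩, hx⟩
  · intro i j hij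
    refine Set.disjoint_left.2 fun x hx hx' => hij ?_
    exact e.injective (Subtype.ext (hdisj _ (e i).2 _ (e j).2 _ hx hx'))
  · intro i j x hx
    obtain ⟨y, hy, hy'⟩ := hcov _ (e i).2 _ (e j).2 hx
    refine ⟨⟨y, hin _ (e i).2 ((hJ _ (e i).2).2.1 hy)⟩, hy, Subtype.ext ?_⟩
    rw [S.conj_it f q hfg]; exact hy'
  · exact Nat.mul_pos hq ht
  · omega
  · have hfix : ∀ i : Fin E.card, ∃ x : Icc (0:ℝ) 1, f^[q * t] x = x ∧ (x:ℝ) ∈ J (e i) := by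
      intro i
      obtain ⟨x, hx, hfx⟩ := (hJ _ (e i).2).2.2
      refine ⟨⟨x, hin _ (e i).2 ((hJ _ (e i).2).2.1 hx)⟩, Subtype.ext ?_, hx⟩
      rw [S.conj_it f q hfg]; exact hfx
    choose x hx hxJ using hfix
    have : Function.Injective (fun i => (⟨x i, hx i⟩ : {x // f^[q * t] x = x})) := by
      intro i j hij
      have h1 : x i = x j := congrArg Subtype.val hij
      refine e.injective (Subtype.ext (hdisj _ (e i).2 _ (e j).2 _ (hxJ i) (h1 ▸ hxJ j)))
    have := ENat.card_le_card_of_injective this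
    simpa [periodicCount] using this

lemma N_le (hfg : ∀ x, ((f^[q] x : Icc (0:ℝ) 1) : ℝ) = S.g x)
    (hq : 1 ≤ q) (htop' : htop f ≠ ⊤) (t : ℕ) (A : Fin S.d) :
    S.N t A A ≤ Real.exp (t * (q * (htop f).toReal)) := by
  have hpow : ∀ k : ℕ, S.N t A A ^ k ≤ S.N (t * k) A A := by
    intro k
    induction k with
    | zero => simp [S.N_zero]
    | succ k ih =>
      rw [pow_succ, mul_add, mul_one]
      exact (mul_le_mul_of_nonneg_right ih (S.N_nonneg _ _ _)).trans (S.N_mul_le _ _ _ _ _)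
  rcases Nat.eq_zero_or_pos t with rfl | ht
  · simp [S.N_zero]
  by_contra hcon
  push Not at hcon
  set h := (htop f).toReal with hh
  set n := S.N t A A with hn
  have hn0 : 0 < n := (Real.exp_pos _).trans hcon
  have hlog : t * (q * h) < Real.log n := (Real.lt_log_iff_exp_lt hn0).2 hcon
  have hqt : (0:ℝ) < q * t := by exact_mod_cast Nat.mul_pos hq ht
  -- every power
  have key : ∀ M : ℕ, ∀ s : ℕ, 1 ≤ s → 3 ≤ (S.Gf s A A).card →
      Real.log (S.N s A A) ≤ Real.log 3 + s * (q * h) := by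
    intro _ s hs h3
    obtain ⟨M, J, hM, hHS, -⟩ := S.HS_of f q hfg hq s hs A h3
    have h1 := hHS.le_htop
    have hqs : (0:ℝ) < q * s := by exact_mod_cast Nat.mul_pos hq hs
    have hbot : htop f ≠ ⊥ := fun hb => by rw [hb] at h1; exact absurd h1 (by simp)
    rw [← EReal.coe_toReal htop' hbot, EReal.coe_le_coe_iff] at h1
    push_cast at h1
    rw [div_le_iff₀ hqs] at h1
    have hM1 : 1 ≤ M := by omega
    have h2 : S.N s A A ≤ 3 * M := by
      have : (S.Gf s A A).card ≤ 3 * M := by omega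
      unfold Sys.N
      exact_mod_cast this
    have h4 : 0 < S.N s A A := by unfold Sys.N; exact_mod_cast (by omega : 0 < (S.Gf s A A).card)
    have h5 := Real.log_le_log h4 h2
    rw [Real.log_mul (by norm_num) (by positivity)] at h5
    have : h * (q * s) = s * (q * h) := by ring
    linarith
  have hn1 : 1 < n := by
    have h0 : 0 ≤ h := by
      by_contra hneg
      push Not at hneg
      have hb : (0:EReal) ≤ htop f := by
        unfold htop entSet
        refine le_iSup_of_le ⟨1, one_pos⟩ ?_
        refine le_limsup_of_frequently_le (Frequently.of_forall fun m => ?_) (by isBoundedDefault)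
        refine mul_nonneg (by exact_mod_cast (by positivity : (0:ℝ) ≤ (m:ℝ)⁻¹)) ?_
        generalize coverNum f _ m univ = c
        induction c using ENat.recTopCoe with
        | top => exact le_top
        | coe k => exact EReal.coe_nonneg.2 (Real.log_natCast_nonneg k)
      exact absurd (EReal.toReal_nonneg hb) (not_le.2 hneg)
    have : (1:ℝ) ≤ Real.exp (t * (q * h)) := Real.one_le_exp (by positivity)
    linarith
  set δ := Real.log n - t * (q * h) with hδ
  have hδ0 : 0 < δ := by linarith
  obtain ⟨k, hk⟩ := exists_nat_gt (Real.log 3 / δ)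
  obtain ⟨k', hk'⟩ := pow_unbounded_of_one_lt 3 hn1
  set K := max (max k k') 1 with hK
  have hKk : (k:ℝ) ≤ K := by exact_mod_cast (le_max_left _ _).trans (le_max_left _ _)
  have h3 : (3:ℝ) ≤ S.N (t * K) A A := by
    refine le_trans ?_ (hpow K)
    refine hk'.le.trans (pow_le_pow_right₀ hn1.le ((le_max_right _ _).trans (le_max_left _ _)))
  have h3' : 3 ≤ (S.Gf (t * K) A A).card := by
    unfold Sys.N at h3; exact_mod_cast h3
  have h4 := key 0 (t * K) (Nat.mul_pos ht (by omega)) h3'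
  have h5 := Real.log_le_log (by positivity) (hpow K)
  rw [Real.log_pow] at h5
  rw [div_lt_iff₀ hδ0] at hk
  have h6 : (k:ℝ) * δ ≤ K * δ := mul_le_mul_of_nonneg_right hKk hδ0.le
  have h7 : (K:ℝ) * δ = K * Real.log n - K * (t * (q * h)) := by rw [hδ]; ring
  push_cast at h4
  have h8 : (t:ℝ) * K * (q * h) = K * (t * (q * h)) := by ring
  linarith

end conj
end Sys
end IntervalEnt

namespace IntervalEnt

lemma cover_of_labels {X T : Type*} [MetricSpace X] (f : X → X) (ℓ : X → T) (E : Finset T) (ε : ℝ) (n : ℕ)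
    (hE : ∀ x, ℓ x ∈ E) (h : ∀ x y, ℓ x = ℓ y → ∀ i < n, dist (f^[i] x) (f^[i] y) < ε) :
    coverNum f ε n univ ≤ (E.card : ℕ∞) := by
  classical
  rcases isEmpty_or_nonempty X with he | ⟨⟨x0⟩⟩
  · refine le_trans (b := ((∅ : Finset X).card : ℕ∞)) (sInf_le ⟨∅, by simp, ?_, rfl⟩) (by simp)
    intro x; exact (he.false x).elim
  let pt : T → X := fun e => if he : ∃ x, ℓ x = e then he.choose else x0
  have hpt : ∀ x, ℓ (pt (ℓ x)) = ℓ x := by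
    intro x
    have he : ∃ y, ℓ y = ℓ x := ⟨x, rfl⟩
    simp only [pt, dif_pos he]
    exact he.choose_spec
  refine le_trans (b := ((E.image pt).card : ℕ∞)) (sInf_le ⟨E.image pt, by simp, ?_, rfl⟩)
    (by exact_mod_cast Finset.card_image_le)
  intro x _
  rw [mem_iUnion₂]
  exact ⟨pt (ℓ x), Finset.mem_image_of_mem _ (hE x), fun i hi => h x _ (hpt x).symm i hi⟩

lemma coverNum_mono {X : Type*} [MetricSpace X] (f : X → X) (ε : ℝ) {n m : ℕ} (h : n ≤ m) :
    coverNum f ε n univ ≤ coverNum f ε m univ := by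
  refine le_sInf ?_
  rintro k ⟨F, h1, h2, rfl⟩
  refine sInf_le ⟨F, h1, h2.trans (iUnion₂_mono fun x _ y hy i hi => hy i (hi.trans_le h)), rfl⟩

lemma htop_le {X : Type*} [MetricSpace X] [Nonempty X] (f : X → X) (q : ℕ) (hq : 1 ≤ q) (c : ℝ) (hc : 0 ≤ c)
    (h : ∀ ε : ℝ, 0 < ε → ∃ C : ℝ, 1 ≤ C ∧ ∀ n : ℕ, ∃ k : ℕ, coverNum f ε (q * n) univ ≤ (k : ℕ∞) ∧
      (k:ℝ) ≤ C * Real.exp (n * c)) : htop f ≤ ((c / q : ℝ) : EReal) := by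
  have hq0 : (0:ℝ) < q := by exact_mod_cast hq
  refine iSup_le ?_
  rintro ⟨ε, hε⟩
  obtain ⟨C, hC1, hC⟩ := h ε hε
  have hb : ∀ N : ℕ, 1 ≤ N → (((N:ℝ)⁻¹ : ℝ) : EReal) * elog (coverNum f ε N univ) ≤
      (((Real.log C + c) * (1 / (N:ℝ)) + c / q : ℝ) : EReal) := by
    intro N hN
    have hN0 : (0:ℝ) < N := by exact_mod_cast hN
    obtain ⟨k, hk, hk2⟩ := hC (N / q + 1)
    have h1 : N ≤ q * (N / q + 1) := (Nat.lt_mul_div_succ N hq).le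
    have h2 := elog_le ((coverNum_mono f ε h1).trans hk)
    have h3 : Real.log k ≤ Real.log C + c + (N / q) * c := by
      rcases Nat.eq_zero_or_pos k with rfl | hk0
      · simp only [Nat.cast_zero, Real.log_zero]
        have := Real.log_nonneg hC1
        positivity
      · refine (Real.log_le_log (by exact_mod_cast hk0) hk2).trans ?_
        rw [Real.log_mul (by positivity) (Real.exp_pos _).ne', Real.log_exp]
        have : ((N / q : ℕ):ℝ) ≤ N / q := Nat.cast_div_le
        push_cast
        nlinarith
    refine (mul_le_mul_of_nonneg_left h2 (by exact_mod_cast (by positivity : (0:ℝ) ≤ (N:ℝ)⁻¹))).trans ?_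
    rw [← EReal.coe_mul, EReal.coe_le_coe_iff]
    refine (mul_le_mul_of_nonneg_left h3 (by positivity)).trans (le_of_eq ?_)
    field_simp
  have ht : Tendsto (fun N : ℕ => (((Real.log C + c) * (1 / (N:ℝ)) + c / q : ℝ) : EReal)) atTop
      (𝓝 ((c / q : ℝ) : EReal)) := by
    rw [EReal.tendsto_coe]
    have := (tendsto_one_div_atTop_nhds_zero_nat (𝕜 := ℝ)).const_mul (Real.log C + c)
    have := this.add_const (c / q)
    simpa using this
  refine (limsup_le_limsup ?_).trans ht.limsup_eq.le
  filter_upwards [eventually_ge_atTop 1] with N hN using hb N hN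

lemma htop_lt_top (f : Icc (0:ℝ) 1 → Icc (0:ℝ) 1) (L : ℝ) (hL : 1 ≤ L)
    (hf : ∀ x y, dist (f x) (f y) ≤ L * dist x y) : htop f ≠ ⊤ := by
  have : Nonempty (Icc (0:ℝ) 1) := ⟨⟨0, by simp⟩⟩
  have hit : ∀ (i : ℕ) x y, dist (f^[i] x) (f^[i] y) ≤ L ^ i * dist x y := by
    intro i
    induction i with
    | zero => simp
    | succ i ih =>
      intro x y
      rw [Function.iterate_succ_apply', Function.iterate_succ_apply', pow_succ', mul_assoc]
      exact (hf _ _).trans (mul_le_mul_of_nonneg_left (ih x y) (by linarith))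
  have := htop_le f 1 le_rfl (Real.log L) (Real.log_nonneg hL) (fun ε hε => by
    refine ⟨max 1 (2 / ε + 2), le_max_left _ _, fun n => ?_⟩
    have hLn : (1:ℝ) ≤ L ^ n := one_le_pow₀ hL
    set a : ℝ := 2 * L ^ n / ε with ha
    have ha0 : 0 < a := by positivity
    refine ⟨⌊a⌋₊ + 1, ?_, ?_⟩
    · have := cover_of_labels f (fun x => ⌊(x:ℝ) * a⌋₊) (Finset.range (⌊a⌋₊ + 1)) ε (1 * n) ?_ ?_
      · simpa using this
      · intro x
        rw [Finset.mem_range, Nat.lt_succ_iff]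
        refine Nat.floor_le_floor ?_
        nlinarith [x.2.2]
      · intro x y hxy i hi
        have h1 := Nat.floor_le (mul_nonneg x.2.1 ha0.le)
        have h2 := Nat.floor_le (mul_nonneg y.2.1 ha0.le)
        have h3 := Nat.lt_floor_add_one ((x:ℝ) * a)
        have h4 := Nat.lt_floor_add_one ((y:ℝ) * a)
        have hxy' : (⌊(x:ℝ) * a⌋₊ : ℝ) = ⌊(y:ℝ) * a⌋₊ := by exact_mod_cast hxy
        have h5 : |(x:ℝ) - y| * a < 1 := by
          rw [← abs_of_pos ha0, ← abs_mul, sub_mul, abs_lt]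
          constructor <;> linarith
        have h6 : |(x:ℝ) - y| < 1 / a := by rwa [lt_div_iff₀ ha0]
        have h7 : dist x y < 1 / a := h6
        have h8 : L ^ i ≤ L ^ n := pow_le_pow_right₀ hL (by omega)
        have h9 : L ^ n * (1 / a) = ε / 2 := by rw [ha]; field_simp
        calc dist (f^[i] x) (f^[i] y) ≤ L ^ i * dist x y := hit i x y
          _ ≤ L ^ n * (1 / a) := mul_le_mul h8 h7.le dist_nonneg (by positivity)
          _ < ε := by rw [h9]; linarith
    · rw [mul_comm (n:ℝ), Real.exp_mul, Real.exp_log (by linarith), Real.rpow_natCast]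
      push_cast
      have h1 : (⌊a⌋₊:ℝ) ≤ a := Nat.floor_le ha0.le
      calc (⌊a⌋₊:ℝ) + 1 ≤ (2 / ε + 2) * L ^ n := by
            have : (2 / ε) * L ^ n = a := by rw [ha]; ring
            nlinarith
        _ ≤ _ := mul_le_mul_of_nonneg_right (le_max_right _ _) (by positivity))
  intro h
  rw [h] at this
  exact absurd this (by simp)

lemma sum_union_le' {ι : Type*} [DecidableEq ι] (s t : Finset ι) (w : ι → ℝ) (hw : ∀ i, 0 ≤ w i) :
    ∑ i ∈ s ∪ t, w i ≤ ∑ i ∈ s, w i + ∑ i ∈ t, w i := by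
  rw [← Finset.sum_union_inter]
  linarith [Finset.sum_nonneg fun i (_ : i ∈ s ∩ t) => hw i]

lemma sum_biUnion_le' {ι κ : Type*} [DecidableEq ι] (s : Finset κ) (t : κ → Finset ι) (w : ι → ℝ)
    (hw : ∀ i, 0 ≤ w i) : ∑ i ∈ s.biUnion t, w i ≤ ∑ k ∈ s, ∑ i ∈ t k, w i := by
  classical
  induction s using Finset.induction_on with
  | empty => simp
  | insert a s ha ih =>
    rw [Finset.biUnion_insert, Finset.sum_insert ha]
    exact (sum_union_le' _ _ w hw).trans (by linarith)

namespace Sys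
variable (S : Sys)

/-- grid points in the unit interval -/
noncomputable def Qf : Finset ℝ := (Finset.range (S.d + 1)).image fun k : ℕ => (k:ℝ) / S.d

lemma mem_Qf {x : ℝ} (hx : x ∈ Icc (0:ℝ) 1) (hQ : x ∈ S.Q) : x ∈ S.Qf := by
  obtain ⟨k, rfl⟩ := hQ
  have hd := S.d0
  have h0 : (0:ℝ) ≤ k := by
    by_contra hneg
    push Not at hneg
    exact absurd hx.1 (not_le.2 (div_neg_of_neg_of_pos hneg hd))
  have h1 : (k:ℝ) ≤ S.d := by rw [← div_le_one hd]; exact hx.2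
  lift k to ℕ using (by exact_mod_cast h0)
  refine Finset.mem_image.2 ⟨k, Finset.mem_range.2 ?_, by simp⟩
  have : k ≤ S.d := by exact_mod_cast h1
  omega

lemma Qf_card : S.Qf.card ≤ S.d + 1 := Finset.card_image_le.trans (by simp)

/-- all possible labels at level `n`. -/
noncomputable def lab (n K : ℕ) : Finset (ℕ × Set ℝ × ℕ × ℕ) := by
  classical
  exact (S.Qf.image fun x => (0, {x}, 0, 0)) ∪
    (Finset.range (n + 1)).biUnion fun t => Finset.univ.biUnion fun A => Finset.univ.biUnion fun B =>
      ({t} : Finset ℕ) ×ˢ (S.Gf t A B) ×ˢ (Finset.range (K * (n + 1) + 1)) ×ˢ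
        (Finset.range (⌊(K * (n + 1) : ℝ) * S.Gam ^ (n - t)⌋₊ + 1))

lemma mem_lab {n K : ℕ} {x : ℝ} {e : ℕ × Set ℝ × ℕ × ℕ} (hx : x ∈ Icc (0:ℝ) 1) (hQ : x ∉ S.Q)
    (h1 : e.1 ≤ n) (h2 : S.Gd e.1 x) (h3 : e.2.1 = S.Pc e.1 x) (h4 : e.2.2.1 ≤ K * (n + 1))
    (h5 : (e.2.2.2:ℝ) ≤ K * (n + 1) * S.Gam ^ (n - e.1)) : e ∈ S.lab n K := by
  classical
  obtain ⟨t, J, k1, k2⟩ := e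
  simp only at h1 h2 h3 h4 h5
  obtain ⟨A, hA⟩ := S.exists_cell hx hQ
  obtain ⟨B, hB⟩ := S.exists_cell (S.maps_it t hx) (h2.1.2.1 t le_rfl)
  unfold lab
  simp only [Finset.mem_union, Finset.mem_biUnion, Finset.mem_product, Finset.mem_singleton,
    Finset.mem_range, Finset.mem_univ, true_and, mem_Gf]
  right
  refine ⟨t, by omega, A, B, rfl, ⟨x, hA, h2, hB, h3⟩, by omega, ?_⟩
  rw [Nat.lt_succ_iff]
  exact Nat.le_floor h5

lemma mem_lab_Q {n K : ℕ} {x : ℝ} (hx : x ∈ Icc (0:ℝ) 1) (hQ : x ∈ S.Q) :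
    ((0, {x}, 0, 0) : ℕ × Set ℝ × ℕ × ℕ) ∈ S.lab n K := by
  classical
  unfold lab
  exact Finset.mem_union_left _ (Finset.mem_image_of_mem _ (S.mem_Qf hx hQ))

lemma lab_sum (n K : ℕ) (hK : 1 ≤ K) (W : ℕ → Set ℝ → ℝ) (hW : ∀ t J, 0 ≤ W t J) :
    ∑ e ∈ S.lab n K, W e.1 e.2.1 ≤ ∑ x ∈ S.Qf, W 0 {x} +
      ∑ t ∈ Finset.range (n + 1), ∑ A, ∑ B, ∑ J ∈ S.Gf t A B,
        (2 * K * (n + 1)) ^ 2 * S.Gam ^ (n - t) * W t J := by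
  classical
  unfold lab
  have hG := S.hGam
  have hK' : (1:ℝ) ≤ K := by exact_mod_cast hK
  have hn' : (1:ℝ) ≤ (n:ℝ) + 1 := by have : (0:ℝ) ≤ n := by positivity
                                     linarith
  have hw : ∀ e : ℕ × Set ℝ × ℕ × ℕ, 0 ≤ W e.1 e.2.1 := fun e => hW _ _
  refine (sum_union_le' _ _ _ hw).trans (add_le_add ?_ ?_)
  · rw [Finset.sum_image]
    intro x _ y _ hxy
    simpa using hxy
  · refine (sum_biUnion_le' _ _ _ hw).trans (Finset.sum_le_sum fun t _ => ?_)
    refine (sum_biUnion_le' _ _ _ hw).trans (Finset.sum_le_sum fun A _ => ?_)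
    refine (sum_biUnion_le' _ _ _ hw).trans (Finset.sum_le_sum fun B _ => ?_)
    rw [Finset.sum_product, Finset.sum_singleton, Finset.sum_product]
    refine Finset.sum_le_sum fun J _ => ?_
    dsimp only
    rw [Finset.sum_const, nsmul_eq_mul]
    refine mul_le_mul_of_nonneg_right ?_ (hW _ _)
    rw [Finset.card_product, Finset.card_range, Finset.card_range]
    push_cast
    have hGt : (1:ℝ) ≤ S.Gam ^ (n - t) := one_le_pow₀ hG
    have hKn : (1:ℝ) ≤ K * (n + 1) := by nlinarith
    have hfl : (⌊(K * (n + 1) : ℝ) * S.Gam ^ (n - t)⌋₊ : ℝ) ≤ (K * (n + 1) : ℝ) * S.Gam ^ (n - t) :=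
      Nat.floor_le (by positivity)
    have h1 : (K:ℝ) * (n + 1) + 1 ≤ 2 * K * (n + 1) := by linarith
    have h2 : (⌊(K * (n + 1) : ℝ) * S.Gam ^ (n - t)⌋₊ : ℝ) + 1 ≤ 2 * K * (n + 1) * S.Gam ^ (n - t) := by
      nlinarith
    calc ((K:ℝ) * (n + 1) + 1) * ((⌊(K * (n + 1) : ℝ) * S.Gam ^ (n - t)⌋₊ : ℝ) + 1)
        ≤ (2 * K * (n + 1)) * (2 * K * (n + 1) * S.Gam ^ (n - t)) :=
          mul_le_mul h1 h2 (by positivity) (by positivity)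
      _ = _ := by ring

end Sys
end IntervalEnt

namespace IntervalEnt

structure Ctx where
  S : Sys
  f : Icc (0:ℝ) 1 → Icc (0:ℝ) 1
  q : ℕ
  h : ℝ
  hfg : ∀ x, ((f^[q] x : Icc (0:ℝ) 1) : ℝ) = S.g x
  hq : 1 ≤ q
  hf : Continuous f
  hh : htop f = (h : EReal)
  hpos : 0 < h
  hGam : 2 * S.Gam < Real.exp (q * h / 2)

namespace Ctx
variable (c : Ctx)

noncomputable def H : ℝ := c.q * c.h

lemma q0 : (0:ℝ) < c.q := by exact_mod_cast c.hq
lemma H0 : 0 < c.H := mul_pos c.q0 c.hpos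
lemma toReal : (htop c.f).toReal = c.h := by rw [c.hh]; rfl

lemma GamH : 2 * c.S.Gam < Real.exp (c.H / 2) := c.hGam

lemma f_labels (ε : ℝ) (hε : 0 < ε) : ∃ K : ℕ, 1 ≤ K ∧ ∀ n : ℕ,
    ∃ ℓ : ℝ → ℕ × Set ℝ × ℕ × ℕ,
    (∀ x ∈ Icc (0:ℝ) 1, ℓ x ∈ c.S.lab n K) ∧
    (∀ x ∈ Icc (0:ℝ) 1, x ∉ c.S.Q → (ℓ x).1 ≤ n ∧ c.S.Gd (ℓ x).1 x ∧ (ℓ x).2.1 = c.S.Pc (ℓ x).1 x ∧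
      (∀ s, (ℓ x).1 < s → s ≤ n → ¬ c.S.Gd s x)) ∧
    (∀ x ∈ c.S.Q, ℓ x = (0, {x}, 0, 0)) ∧
    (∀ x y : Icc (0:ℝ) 1, ℓ x = ℓ y → ∀ i < c.q * n, dist (c.f^[i] x) (c.f^[i] y) < ε) ∧
    (∀ e, MeasurableSet {x : Icc (0:ℝ) 1 | ℓ x = e}) := by
  have huc : ∀ j : ℕ, ∃ δ : ℝ, 0 < δ ∧ ∀ x y : Icc (0:ℝ) 1, dist x y < δ →
      dist (c.f^[j] x) (c.f^[j] y) < ε := by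
    intro j
    have := CompactSpace.uniformContinuous_of_continuous (c.hf.iterate j)
    obtain ⟨δ, h1, h2⟩ := Metric.uniformContinuous_iff.1 this ε hε
    exact ⟨δ, h1, fun x y hxy => h2 hxy⟩
  choose δ hδ hδ' using huc
  obtain ⟨δ0, hδ0, hmin⟩ : ∃ δ0, 0 < δ0 ∧ ∀ j < c.q, δ0 ≤ δ j := by
    have hne : (Finset.range c.q).Nonempty := ⟨0, Finset.mem_range.2 c.hq⟩
    obtain ⟨j, -, hj⟩ := Finset.exists_min_image (Finset.range c.q) δ hne
    exact ⟨δ j, hδ j, fun i hi => hj i (Finset.mem_range.2 hi)⟩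
  obtain ⟨K, hK, hlab⟩ := c.S.central_labels (δ0 / 2) (by positivity)
  refine ⟨K, hK, fun n => ?_⟩
  obtain ⟨ℓ, h1, h2, h3, h4⟩ := hlab n
  refine ⟨ℓ, ?_, ?_, h2, ?_, ?_⟩
  · intro x hx
    by_cases hQ : x ∈ c.S.Q
    · rw [h2 x hQ]; exact c.S.mem_lab_Q hx hQ
    · obtain ⟨a1, a2, a3, a4, a5, a6⟩ := h1 x hx hQ
      exact c.S.mem_lab hx hQ a1 a2 a3 a5 a6
  · intro x hx hQ
    obtain ⟨a1, a2, a3, a4, a5, a6⟩ := h1 x hx hQ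
    exact ⟨a1, a2, a3, a4⟩
  · intro x y hxy i hi
    have hb : i % c.q < c.q := Nat.mod_lt _ c.hq
    have ha : i / c.q ≤ n := (Nat.div_lt_of_lt_mul hi).le
    rw [← Nat.mod_add_div i c.q, Function.iterate_add_apply, Function.iterate_add_apply]
    apply hδ'
    refine lt_of_lt_of_le ?_ (hmin _ hb)
    have := h3 x x.2 y y.2 hxy _ ha
    rw [Subtype.dist_eq, c.S.conj_it c.f c.q c.hfg, c.S.conj_it c.f c.q c.hfg, Real.dist_eq]
    linarith
  · intro e
    have := measurable_subtype_coe (p := fun x => x ∈ Icc (0:ℝ) 1) (h4 e)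
    convert this using 1
    ext x
    simp [x.2.1, x.2.2]

lemma poly_exp (k : ℕ) (δ : ℝ) (hδ : 0 < δ) : ∃ C : ℝ, 1 ≤ C ∧ ∀ n : ℕ, ((n:ℝ) + 1) ^ k ≤ C * Real.exp (n * δ) := by
  refine ⟨max 1 (k.factorial * Real.exp δ / δ ^ k), le_max_left _ _, fun n => ?_⟩
  have h1 := Real.pow_div_factorial_le_exp (((n:ℝ) + 1) * δ) (by positivity) k
  have hk : (0:ℝ) < k.factorial := by exact_mod_cast k.factorial_pos
  rw [div_le_iff₀ hk, mul_pow, add_mul, one_mul, Real.exp_add] at h1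
  refine le_trans ?_ (mul_le_mul_of_nonneg_right (le_max_right _ _) (Real.exp_pos _).le)
  rw [div_mul_eq_mul_div, le_div_iff₀ (by positivity)]
  linarith

theorem growth_app :
    (∀ η, 0 < η → ∃ C, 0 ≤ C ∧ ∀ n A B, c.S.N n A B ≤ C * Real.exp (n * (c.H + η))) ∧
      ∃ A, ∃ p : ℕ, 1 ≤ p ∧ ∃ b : ℝ, 0 < b ∧ ∃ n0 : ℕ, ∀ n ≥ n0, p ∣ n →
        b * Real.exp (n * c.H) ≤ c.S.N n A A := by
  have hG := c.S.hGam
  have hH := c.H0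
  have hGH2 : c.S.Gam < Real.exp (c.H / 2) := by linarith [c.GamH]
  have hL := c.S.hLam1
  obtain ⟨ha, hb⟩ := growth c.S.N c.S.phi c.S.phi_nonneg c.S.N_zero c.S.N_renewal
    (c.S.d * c.S.Lam) c.S.Gam c.H (mul_nonneg c.S.d0.le (by linarith)) (by linarith)
    (hGH2.trans (Real.exp_lt_exp.2 (by linarith))) c.S.phi_le (fun n A => by
      have := c.S.N_le c.f c.q c.hfg c.hq (by rw [c.hh]; simp) n A
      rwa [c.toReal] at this)
  refine ⟨ha, hb.resolve_left ?_⟩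
  rintro ⟨δ', hδ', C, hC, hN'⟩
  set δ := min δ' (c.H / 2) with hδdef
  have hδ : 0 < δ := lt_min hδ' (by linarith)
  have hδH : δ ≤ c.H / 2 := min_le_right _ _
  have hN : ∀ n A B, c.S.N n A B ≤ C * Real.exp (n * (c.H - δ)) := fun n A B =>
    (hN' n A B).trans (mul_le_mul_of_nonneg_left (Real.exp_le_exp.2 (mul_le_mul_of_nonneg_left
      (by linarith [min_le_left δ' (c.H / 2)]) (by positivity))) hC)
  have : Nonempty (Icc (0:ℝ) 1) := ⟨⟨0, by simp⟩⟩
  obtain ⟨C3, hC3, hpoly⟩ := poly_exp 3 (δ / 2) (by positivity)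
  have hle := htop_le c.f c.q c.hq (c.H - δ / 2) (by linarith) (fun ε hε => by
    obtain ⟨K, hK, hlab⟩ := c.f_labels ε hε
    have hd := c.S.d0
    refine ⟨(c.S.d + 1) + (2 * K) ^ 2 * c.S.d ^ 2 * C * C3, ?_, fun n => ?_⟩
    · have : 0 ≤ (2 * (K:ℝ)) ^ 2 * c.S.d ^ 2 * C * C3 := by positivity
      linarith
    obtain ⟨ℓ, h1, -, -, h4, -⟩ := hlab n
    refine ⟨(c.S.lab n K).card, cover_of_labels c.f (fun x => ℓ x) _ _ _ (fun x => h1 x x.2) h4, ?_⟩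
    have hs := c.S.lab_sum n K hK (fun _ _ => 1) (fun _ _ => zero_le_one)
    simp only [Finset.sum_const, nsmul_eq_mul, mul_one] at hs
    refine hs.trans ?_
    rw [add_mul]
    have hexp1 : 1 ≤ Real.exp (n * (c.H - δ / 2)) :=
      Real.one_le_exp (mul_nonneg (by positivity) (by linarith))
    refine add_le_add ?_ ?_
    · have : (c.S.Qf.card:ℝ) ≤ c.S.d + 1 := by exact_mod_cast c.S.Qf_card
      nlinarith
    · have hterm : ∀ t ∈ Finset.range (n + 1), ∀ A B, ((c.S.Gf t A B).card:ℝ) *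
          ((2 * K * (n + 1)) ^ 2 * c.S.Gam ^ (n - t)) ≤
          (2 * K * (n + 1)) ^ 2 * (C * Real.exp (n * (c.H - δ))) := by
        intro t ht A B
        have htn : t ≤ n := by rw [Finset.mem_range] at ht; omega
        have e1 : c.S.Gam ^ (n - t) ≤ Real.exp (((n - t : ℕ):ℝ) * (c.H - δ)) := by
          rw [mul_comm, Real.exp_mul, Real.rpow_natCast]
          exact pow_le_pow_left₀ (by linarith) (hGH2.le.trans (Real.exp_le_exp.2 (by linarith))) _
        have e2 := hN t A B
        have e3 : Real.exp (t * (c.H - δ)) * Real.exp (((n - t : ℕ):ℝ) * (c.H - δ)) =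
            Real.exp (n * (c.H - δ)) := by
          rw [← Real.exp_add, Nat.cast_sub htn]; congr 1; ring
        have e4 : c.S.N t A B * c.S.Gam ^ (n - t) ≤ C * Real.exp (n * (c.H - δ)) := by
          rw [← e3, ← mul_assoc]
          exact mul_le_mul e2 e1 (by positivity) (by positivity)
        have : ((c.S.Gf t A B).card:ℝ) = c.S.N t A B := rfl
        rw [this]
        nlinarith [sq_nonneg (2 * K * ((n:ℝ) + 1))]
      refine (Finset.sum_le_sum fun t ht => Finset.sum_le_sum fun A _ => Finset.sum_le_sum fun B _ =>
        hterm t ht A B).trans ?_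
      simp only [Finset.sum_const, Finset.card_univ, Finset.card_range, Fintype.card_fin, nsmul_eq_mul]
      push_cast
      have e5 := hpoly n
      have e6 : Real.exp (n * (δ / 2)) * Real.exp (n * (c.H - δ)) = Real.exp (n * (c.H - δ / 2)) := by
        rw [← Real.exp_add]; congr 1; ring
      rw [← e6]
      calc ((n:ℝ) + 1) * (c.S.d * (c.S.d * ((2 * K * (n + 1)) ^ 2 * (C * Real.exp (n * (c.H - δ))))))
          = ((2 * K) ^ 2 * c.S.d ^ 2 * C * Real.exp (n * (c.H - δ))) * (n + 1) ^ 3 := by ring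
        _ ≤ ((2 * K) ^ 2 * c.S.d ^ 2 * C * Real.exp (n * (c.H - δ))) * (C3 * Real.exp (n * (δ / 2))) :=
          mul_le_mul_of_nonneg_left e5 (by positivity)
        _ = _ := by ring)
  rw [c.hh, EReal.coe_le_coe_iff, le_div_iff₀ c.q0] at hle
  have : c.h * c.q = c.H := by rw [H]; ring
  linarith

theorem mult : MultLowerBound c.f := by
  obtain ⟨-, A, p, hp, b, hb, n0, hN⟩ := c.growth_app
  refine ⟨c.q * p, Nat.mul_pos c.hq hp, ?_⟩
  refine lt_of_lt_of_le (ENNReal.ofReal_pos.2 (show 0 < b / 3 by positivity)) ?_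
  refine le_liminf_of_le (by isBoundedDefault) ?_
  rw [eventually_inf_principal]
  obtain ⟨n1, hn1⟩ := exists_nat_gt (3 / b / c.H)
  filter_upwards [eventually_ge_atTop (c.q * (n0 + n1 + 1))] with n hn hdvd
  obtain ⟨k, rfl⟩ := hdvd
  set t := p * k with ht
  have hnt : c.q * p * k = c.q * t := by rw [ht, mul_assoc]
  rw [hnt] at hn ⊢
  have htn : n0 + n1 + 1 ≤ t := Nat.le_of_mul_le_mul_left hn c.hq
  have h1 := hN t (by omega) ⟨k, rfl⟩
  have hH := c.H0
  have h3 : (3:ℝ) ≤ b * Real.exp (t * c.H) := by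
    rw [div_div, div_lt_iff₀ (by positivity)] at hn1
    have : (t:ℝ) * c.H ≤ Real.exp (t * c.H) := by linarith [Real.add_one_le_exp (t * c.H)]
    have h4 : (n1:ℝ) ≤ t := by exact_mod_cast (by omega)
    have h5 : (n1:ℝ) * c.H ≤ t * c.H := mul_le_mul_of_nonneg_right h4 hH.le
    nlinarith
  have hc3 : 3 ≤ (c.S.Gf t A A).card := by
    have : (3:ℝ) ≤ c.S.N t A A := h3.trans h1
    unfold Sys.N at this; exact_mod_cast this
  obtain ⟨M, J, hM, -, hper⟩ := c.S.HS_of c.f c.q c.hfg c.hq t (by omega) A hc3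
  have h6 : c.S.N t A A ≤ 3 * M := by
    unfold Sys.N; exact_mod_cast (by omega : (c.S.Gf t A A).card ≤ 3 * M)
  have h7 : (M : ℝ≥0∞) ≤ (periodicCount c.f (c.q * t) : ℝ≥0∞) := by
    exact_mod_cast hper
  refine le_trans ?_ (mul_le_mul_right h7 _)
  rw [c.toReal, ← ENNReal.ofReal_natCast, ← ENNReal.ofReal_mul (Real.exp_pos _).le]
  refine ENNReal.ofReal_le_ofReal ?_
  have h8 : b * Real.exp (t * c.H) ≤ 3 * M := h1.trans h6
  have h9 : Real.exp (-((c.q * t : ℕ):ℝ) * c.h) * Real.exp (t * c.H) = 1 := by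
    rw [← Real.exp_add, H]; push_cast
    rw [show -((c.q:ℝ) * t) * c.h + t * (c.q * c.h) = 0 by ring, Real.exp_zero]
  have h10 := mul_le_mul_of_nonneg_left h8 (Real.exp_pos (-((c.q * t : ℕ):ℝ) * c.h)).le
  have h11 : Real.exp (-((c.q * t : ℕ):ℝ) * c.h) * (b * Real.exp (t * c.H)) = b := by
    rw [mul_left_comm, h9, mul_one]
  linarith

theorem max_ge (μ : Measure (Icc (0:ℝ) 1)) (hμ : IsMaxMeasure c.f μ) : (c.h : EReal) ≤ ksEntropy c.f μ := by
  obtain ⟨-, A, p, hp, b, hb, n0, hN⟩ := c.growth_app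
  have hH := c.H0
  by_contra hcon
  push Not at hcon
  obtain ⟨z, hz1, hz2⟩ := EReal.lt_iff_exists_real_btwn.1 hcon
  have hz : z < c.h := by exact_mod_cast hz2
  have hq := c.q0
  obtain ⟨n1, hn1⟩ := exists_nat_gt (3 / b / c.H)
  obtain ⟨n2, hn2⟩ := exists_nat_gt (-Real.log (b / 3) / (c.q * (c.h - z)))
  set t := p * (n0 + n1 + n2 + 1) with ht
  have htn : n0 + n1 + n2 + 1 ≤ t := Nat.le_mul_of_pos_left _ hp
  have h1 := hN t (by omega) ⟨_, rfl⟩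
  have h3 : (3:ℝ) ≤ b * Real.exp (t * c.H) := by
    rw [div_div, div_lt_iff₀ (by positivity)] at hn1
    have : (t:ℝ) * c.H ≤ Real.exp (t * c.H) := by linarith [Real.add_one_le_exp (t * c.H)]
    have h4 : (n1:ℝ) ≤ t := by exact_mod_cast (by omega)
    have h5 : (n1:ℝ) * c.H ≤ t * c.H := mul_le_mul_of_nonneg_right h4 hH.le
    nlinarith
  have hc3 : 3 ≤ (c.S.Gf t A A).card := by
    have : (3:ℝ) ≤ c.S.N t A A := h3.trans h1
    unfold Sys.N at this; exact_mod_cast this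
  obtain ⟨M, J, hM, hHS, -⟩ := c.S.HS_of c.f c.q c.hfg c.hq t (by omega) A hc3
  have h6 : c.S.N t A A ≤ 3 * M := by
    unfold Sys.N; exact_mod_cast (by omega : (c.S.Gf t A A).card ≤ 3 * M)
  obtain ⟨ν, hν, hks⟩ := hHS.exists_measure c.hf
  have h7 := (hks.trans (hμ.2.2 ν hν)).trans_lt hz1
  rw [EReal.coe_lt_coe_iff] at h7
  have ht0 : (0:ℝ) < t := by exact_mod_cast (by omega : 0 < t)
  push_cast at h7
  rw [div_lt_iff₀ (by positivity)] at h7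
  have hle : b / 3 * Real.exp (t * c.H) ≤ M := by linarith
  have h8 := Real.log_le_log (by positivity) hle
  rw [Real.log_mul (by positivity) (Real.exp_pos _).ne', Real.log_exp, H] at h8
  have hpos : 0 < (c.q:ℝ) * (c.h - z) := mul_pos hq (by linarith)
  rw [div_lt_iff₀ hpos] at hn2
  have h9 : (n2:ℝ) ≤ t := by exact_mod_cast (by omega)
  have h10 := mul_le_mul_of_nonneg_right h9 hpos.le
  nlinarith

end Ctx
end IntervalEnt

namespace IntervalEnt

section Coding
variable {X : Type*} [MeasurableSpace X]

lemma FM.integrable {ι : Type*} [Fintype ι] {μ : Measure X} [IsProbabilityMeasure μ] {ξ : X → ι}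
    (h : FM ξ) (φ : ι → ℝ) : Integrable (fun x => φ (ξ x)) μ := by
  have hm : Measurable (fun x => φ (ξ x)) := by
    intro s _
    exact h.pre (φ ⁻¹' s)
  refine Integrable.of_bound (C := ∑ i, |φ i|) hm.aestronglyMeasurable ?_
  refine Eventually.of_forall fun x => ?_
  rw [Real.norm_eq_abs]
  exact Finset.single_le_sum (f := fun i => |φ i|) (fun i _ => abs_nonneg _) (Finset.mem_univ (ξ x))

lemma FM.integral {ι : Type*} [Fintype ι] {μ : Measure X} [IsProbabilityMeasure μ] {ξ : X → ι}
    (h : FM ξ) (φ : ι → ℝ) : ∫ x, φ (ξ x) ∂μ = ∑ i, μ.real (ξ ⁻¹' {i}) * φ i := by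
  classical
  have h1 : (fun x => φ (ξ x)) = fun x => ∑ i, (ξ ⁻¹' {i}).indicator (fun _ => φ i) x := by
    funext x
    rw [Finset.sum_eq_single (ξ x)]
    · rw [indicator_of_mem]; rfl
    · intro i _ hi
      rw [indicator_of_notMem]
      simpa using hi.symm
    · simp
  rw [h1, integral_finsetSum]
  · refine Finset.sum_congr rfl fun i _ => ?_
    rw [integral_indicator_const _ (h i), smul_eq_mul]
  · exact fun i _ => (integrable_const _).indicator (h i)

end Coding

lemma coding {X : Type*} [MetricSpace X] [CompactSpace X] [MeasurableSpace X] [BorelSpace X]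
    (f : X → X) (hf : Continuous f) (μ : Measure X) (hμ : IsInvariantProb f μ) (h : ℝ)
    (hh : (h : EReal) ≤ ksEntropy f μ) (η : ℝ) (hη : 0 < η) :
    ∃ ε : ℝ, 0 < ε ∧ ∀ (n : ℕ) (T : Type) (ℓ : X → T) (E : Finset T) (w : T → ℝ),
      (∀ x, ℓ x ∈ E) → (∀ e, MeasurableSet {x | ℓ x = e}) →
      (∀ x y, ℓ x = ℓ y → ∀ i < n, dist (f^[i] x) (f^[i] y) < ε) →
      (∀ e ∈ E, 0 < w e) → ∑ e ∈ E, w e ≤ 1 →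
      Integrable (fun x => - Real.log (w (ℓ x))) μ ∧ n * (h - η) ≤ ∫ x, - Real.log (w (ℓ x)) ∂μ := by
  classical
  have hprob := hμ.1
  obtain ⟨N, π, hπ, hent⟩ := ks_lt (c := h - η / 2) (lt_of_lt_of_le
    (by exact_mod_cast (by linarith : h - η / 2 < h)) hh)
  -- γ
  obtain ⟨γ, hγ0, hγ1, hγ⟩ : ∃ γ : ℝ, 0 < γ ∧ γ < 1 ∧ - Real.log (1 - γ) ≤ η / 4 := by
    refine ⟨1 - Real.exp (-(η / 4)), ?_, ?_, ?_⟩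
    · have := Real.exp_lt_one_iff.2 (show -(η / 4) < 0 by linarith); linarith
    · have := Real.exp_pos (-(η / 4)); linarith
    · rw [sub_sub_cancel, Real.log_exp]; linarith
  set Lc : ℝ := |Real.log (γ / N)| with hLc
  have hLc0 : 0 ≤ Lc := abs_nonneg _
  set δ : ℝ := η / (4 * (Lc + 1) * (N + 1)) with hδdef
  have hδ : 0 < δ := by positivity
  have hK : ∀ j : Fin N, ∃ K ⊆ π ⁻¹' {j}, IsCompact K ∧ μ (π ⁻¹' {j} \ K) < ENNReal.ofReal δ := by
    intro j
    exact (hπ j).exists_isCompact_sdiff_lt (measure_ne_top _ _) (by simpa using hδ)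
  choose K hKs hKc hKμ using hK
  have hKd : ∀ᶠ ε in 𝓝[>] (0:ℝ), ∀ i j : Fin N, i ≠ j → ∀ x ∈ K i, ∀ y ∈ K j, ε ≤ dist x y := by
    refine eventually_all.2 fun i => eventually_all.2 fun j => ?_
    by_cases hij : i = j
    · exact Eventually.of_forall fun _ h => absurd hij h
    have hd : Disjoint (K i) (K j) := by
      refine Set.disjoint_left.2 fun x hx hx' => hij ?_
      have h1 := hKs _ hx; have h2 := hKs _ hx'
      simp only [mem_preimage, mem_singleton_iff] at h1 h2
      rw [← h1, ← h2]
    obtain ⟨r, hr0, hr⟩ := Metric.exists_pos_forall_lt_edist (hKc i) (hKc j).isClosed hd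
    filter_upwards [Ioo_mem_nhdsGT (show (0:ℝ) < r by exact_mod_cast hr0)] with ε hε _ x hx y hy
    have := hr x hx y hy
    rw [edist_nndist, ENNReal.coe_lt_coe] at this
    have h2 : (r:ℝ) < dist x y := by rw [← coe_nndist]; exact_mod_cast this
    linarith [hε.2]
  obtain ⟨ε, hε, hε0⟩ := (hKd.and self_mem_nhdsWithin).exists
  refine ⟨ε, hε0, ?_⟩
  intro n T ℓ E w hℓE hℓm hsmall hw hsum
  -- finite observable
  let ℓ' : X → E := fun x => ⟨ℓ x, hℓE x⟩
  have hℓ' : FM ℓ' := by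
    intro e
    have : ℓ' ⁻¹' {e} = {x | ℓ x = e} := by
      ext x; simp [ℓ', Subtype.ext_iff]
    rw [this]; exact hℓm e
  have hhi : Integrable (fun x => - Real.log (w (ℓ x))) μ :=
    hℓ'.integrable (fun e => - Real.log (w e))
  refine ⟨hhi, ?_⟩
  rcases Nat.eq_zero_or_pos n with hn | hn
  · subst hn
    simp only [Nat.cast_zero, zero_mul]
    refine integral_nonneg fun x => ?_
    have h1 : w (ℓ x) ≤ 1 := le_trans (Finset.single_le_sum (f := w) (fun e he => (hw e he).le) (hℓE x)) hsum
    have := Real.log_nonpos (hw _ (hℓE x)).le h1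
    simpa using this
  -- N positive
  obtain ⟨x0⟩ : Nonempty X := by
    by_contra hne
    rw [not_nonempty_iff] at hne
    have := hprob.measure_univ
    rw [Set.univ_eq_empty_iff.2 hne] at this
    simp at this
  have hN : 0 < N := lt_of_le_of_lt (Nat.zero_le _) (π x0).2
  have hNR : (0:ℝ) < N := by exact_mod_cast hN
  -- j_i(e)
  have hj : ∀ (i : Fin n) (e : E), ∃ j : Fin N, ∀ x, ℓ' x = e → ∀ j', f^[i] x ∈ K j' → j' = j := by
    intro i e
    by_cases hex : ∃ x, ℓ' x = e ∧ ∃ j', f^[i] x ∈ K j'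
    · obtain ⟨x, hx, j', hj'⟩ := hex
      refine ⟨j', fun y hy j'' hj'' => ?_⟩
      by_contra hne
      have h1 := hε j'' j' hne _ hj'' _ hj'
      have h2 := hsmall y x (by have := hy.trans hx.symm; simpa [ℓ', Subtype.ext_iff] using this) i i.2
      linarith
    · push Not at hex
      exact ⟨⟨0, hN⟩, fun x hx j' hj' => absurd hj' (hex x hx j')⟩
  choose jj hjj using hj
  let κ : Fin N → Fin N → ℝ := fun a j => (if a = j then 1 - γ else 0) + γ / N
  have hκ0 : ∀ a j, 0 < κ a j := by
    intro a j
    have : 0 < γ / N := by positivity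
    simp only [κ]; split_ifs <;> linarith
  have hκ1 : ∀ j, ∑ a, κ a j = 1 := by
    intro j
    simp only [κ, Finset.sum_add_distrib, Finset.sum_ite_eq', Finset.mem_univ, if_true, Finset.sum_const,
      Finset.card_univ, Fintype.card_fin, nsmul_eq_mul]
    field_simp; ring
  have hκl : ∀ a j, - Real.log (κ a j) ≤ η / 4 + if a = j then 0 else Lc := by
    intro a j
    by_cases haj : a = j
    · have : Real.log (1 - γ) ≤ Real.log (κ a j) := by
        apply Real.log_le_log (by linarith)
        have : 0 < γ / N := by positivity
        simp only [κ, haj, if_true]; linarith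
      simp only [haj, if_true] at this ⊢; linarith
    · have : κ a j = γ / N := by simp [κ, haj]
      rw [this]; simp only [haj, if_false]
      have := neg_abs_le (Real.log (γ / N)); linarith
  let ξ : X → (Fin n → Fin N) × E := fun x => (itin f π n x, ℓ' x)
  have hfm : Measurable f := hf.measurable
  have hξ : FM ξ := (itin_FM hfm hπ n).pair hℓ'
  let Qq : (Fin n → Fin N) × E → ℝ := fun p => w p.2 * ∏ i, κ (p.1 i) (jj i p.2)
  have hQpos : ∀ p, 0 < Qq p := fun p => mul_pos (hw _ p.2.2) (Finset.prod_pos fun i _ => hκ0 _ _)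
  have hQsum : ∑ p, Qq p ≤ 1 := by
    rw [Fintype.sum_prod_type_right]
    have : ∀ e : E, ∑ a : Fin n → Fin N, Qq (a, e) = w e := by
      intro e
      simp only [Qq]
      rw [← Finset.mul_sum]
      have := Finset.prod_univ_sum (fun _ : Fin n => (Finset.univ : Finset (Fin N))) (fun i a => κ a (jj i e))
      simp only [hκ1, Finset.prod_const_one, Fintype.piFinset_univ] at this
      rw [← this, mul_one]
    simp only [this]
    rw [Finset.sum_coe_sort E w]
    exact hsum
  have hpsum : ∑ p, μ.real (ξ ⁻¹' {p}) = 1 := by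
    have := real_pre (μ := μ) hξ MeasurableSet.univ
    simpa using this
  have hH1 : Hf μ (itin f π n) ≤ Hf μ ξ := Hf_comp_le (ξ := ξ) hξ Prod.fst
  have hH2 : Hf μ ξ ≤ ∑ p, -(μ.real (ξ ⁻¹' {p}) * Real.log (Qq p)) :=
    gibbs Finset.univ (fun p => μ.real (ξ ⁻¹' {p})) Qq (fun _ _ => measureReal_nonneg) (fun p _ => (hQpos p).le)
      (fun p _ h => absurd h (hQpos p).ne') (by rw [hpsum]; exact hQsum)
  have hH3 : ∑ p, -(μ.real (ξ ⁻¹' {p}) * Real.log (Qq p)) = ∫ x, - Real.log (Qq (ξ x)) ∂μ := by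
    rw [hξ.integral (fun p => - Real.log (Qq p))]
    exact Finset.sum_congr rfl fun p _ => by ring
  -- bad sets
  let Bd : Set X := (⋃ j, K j)ᶜ
  have hBm : MeasurableSet Bd := (MeasurableSet.iUnion fun j => (hKc j).isClosed.measurableSet).compl
  have hBμ : μ.real Bd ≤ N * δ := by
    have hsub : Bd ⊆ ⋃ j ∈ (Finset.univ : Finset (Fin N)), (π ⁻¹' {j} \ K j) := by
      intro x hx
      simp only [mem_iUnion]
      refine ⟨π x, Finset.mem_univ _, rfl, fun hK => hx (mem_iUnion.2 ⟨_, hK⟩)⟩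
    refine (measureReal_mono hsub (measure_ne_top _ _)).trans ((measureReal_biUnion_finset_le _ _).trans ?_)
    calc ∑ j : Fin N, μ.real (π ⁻¹' {j} \ K j) ≤ ∑ j : Fin N, δ := by
          refine Finset.sum_le_sum fun j _ => ?_
          exact ENNReal.toReal_le_of_le_ofReal hδ.le (hKμ j).le
      _ = N * δ := by simp
  have hpt : ∀ x, - Real.log (Qq (ξ x)) ≤ - Real.log (w (ℓ x)) +
      ∑ i : Fin n, (η / 4 + Lc * (f^[i] ⁻¹' Bd).indicator (fun _ => (1:ℝ)) x) := by
    intro x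
    have h1 : Real.log (Qq (ξ x)) = Real.log (w (ℓ x)) + ∑ i : Fin n, Real.log (κ (itin f π n x i) (jj i (ℓ' x))) := by
      simp only [Qq, ξ]
      rw [Real.log_mul (hw _ (hℓE x)).ne' (Finset.prod_pos fun i _ => hκ0 _ _).ne', Real.log_prod]
      exact fun i _ => (hκ0 _ _).ne'
    rw [h1, neg_add, ← Finset.sum_neg_distrib]
    gcongr with i
    refine (hκl _ _).trans ?_
    gcongr
    by_cases hb : f^[i] x ∈ Bd
    · rw [indicator_of_mem (by exact hb)]
      split_ifs <;> linarith
    · have hb' : f^[i] x ∈ ⋃ j, K j := by simpa [Bd] using hb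
      obtain ⟨j, hjm⟩ := mem_iUnion.1 hb'
      have e1 := hjj i (ℓ' x) x rfl j hjm
      have e2 : itin f π n x i = j := hKs j hjm
      rw [e2, e1, if_pos rfl]
      exact mul_nonneg hLc0 (indicator_nonneg (fun _ _ => zero_le_one) _)
  have hmi : ∀ i : Fin n, MeasurableSet (f^[i] ⁻¹' Bd) := fun i => (hfm.iterate i) hBm
  have hii : ∀ i : Fin n, Integrable (fun x => η / 4 + Lc * (f^[i] ⁻¹' Bd).indicator (fun _ => (1:ℝ)) x) μ :=
    fun i => (integrable_const _).add (((integrable_const _).indicator (hmi i)).const_mul _)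
  have hI : ∫ x, - Real.log (Qq (ξ x)) ∂μ ≤ ∫ x, - Real.log (w (ℓ x)) ∂μ + n * (η / 4 + Lc * (N * δ)) := by
    calc ∫ x, - Real.log (Qq (ξ x)) ∂μ ≤ ∫ x, (- Real.log (w (ℓ x)) +
      ∑ i : Fin n, (η / 4 + Lc * (f^[i] ⁻¹' Bd).indicator (fun _ => (1:ℝ)) x)) ∂μ := by
          refine integral_mono (hξ.integrable (fun p => - Real.log (Qq p))) ?_ hpt
          exact hhi.add (integrable_finsetSum _ fun i _ => hii i)
      _ = ∫ x, - Real.log (w (ℓ x)) ∂μ + ∑ i : Fin n, ∫ x, (η / 4 + Lc * (f^[i] ⁻¹' Bd).indicator (fun _ => (1:ℝ)) x) ∂μ := by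
          rw [integral_add hhi (integrable_finsetSum _ fun i _ => hii i), integral_finsetSum _ fun i _ => hii i]
      _ ≤ _ := by
          gcongr
          have : ∀ i : Fin n, ∫ x, (η / 4 + Lc * (f^[i] ⁻¹' Bd).indicator (fun _ => (1:ℝ)) x) ∂μ ≤ η / 4 + Lc * (N * δ) := by
            intro i
            rw [integral_add (integrable_const _) (((integrable_const _).indicator (hmi i)).const_mul _),
              integral_const_mul, integral_indicator_const _ (hmi i)]
            have e1 : μ.real (f^[i] ⁻¹' Bd) = μ.real Bd := (hμ.2.iterate i).measureReal_preimage hBm.nullMeasurableSet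
            rw [e1]
            simp only [integral_const, probReal_univ, smul_eq_mul, one_mul, mul_one]
            gcongr
          calc _ ≤ ∑ i : Fin n, (η / 4 + Lc * (N * δ)) := Finset.sum_le_sum fun i _ => this i
            _ = _ := by simp; ring
  have hLδ : Lc * (N * δ) ≤ η / 4 := by
    rw [hδdef]
    have : Lc * (N * (η / (4 * (Lc + 1) * (N + 1)))) = (η / 4) * ((Lc / (Lc + 1)) * (N / (N + 1))) := by
      field_simp
    rw [this]
    have h1 : Lc / (Lc + 1) ≤ 1 := by rw [div_le_one (by positivity)]; linarith
    have h2 : (N:ℝ) / (N + 1) ≤ 1 := by rw [div_le_one (by positivity)]; linarith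
    have h3 : (Lc / (Lc + 1)) * (N / (N + 1)) ≤ 1 := mul_le_one₀ h1 (by positivity) h2
    nlinarith
  have := hent n hn
  have hn' : (0:ℝ) < n := by exact_mod_cast hn
  nlinarith

end IntervalEnt

namespace IntervalEnt

/-- a chosen point of a set -/
noncomputable def pt (J : Set ℝ) : ℝ := by
  classical
  exact if h : J.Nonempty then h.some else 0

lemma pt_mem {J : Set ℝ} (h : J.Nonempty) : pt J ∈ J := by
  unfold pt
  rw [dif_pos h]
  exact h.some_mem

namespace Ctx
variable (c : Ctx)

structure MM (m : Measure ℝ) : Prop where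
  prob : IsProbabilityMeasure m
  inv : MeasurePreserving c.S.g m m
  supp : ∀ᵐ x ∂m, x ∈ Icc (0:ℝ) 1
  code : ∀ η : ℝ, 0 < η → ∃ C : ℝ, ∀ (n : ℕ) (w : ℕ → ℝ → ℝ) (Z : ℝ) (u : ℝ → ℝ),
    (∀ t x, 0 < w t x) → (∀ t x y, y ∈ c.S.Pc t x → w t x = w t y) → 0 < Z →
    ∑ t ∈ Finset.range (n + 1), ∑ A, ∑ B, ∑ J ∈ c.S.Gf t A B, c.S.Gam ^ (n - t) * w t (pt J) ≤ Z →
    Integrable u m →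
    (∀ x ∈ Icc (0:ℝ) 1, x ∉ c.S.Q → Real.log Z - Real.log (w (c.S.tl n x) x) ≤ u x) →
    (∀ x ∈ Icc (0:ℝ) 1, x ∈ c.S.Q → 0 ≤ u x) →
    n * (c.H - η) ≤ C + ∫ x, u x ∂m

lemma MM_of (μ : Measure (Icc (0:ℝ) 1)) (hμ : IsInvariantProb c.f μ)
    (hks : (c.h : EReal) ≤ ksEntropy c.f μ) : c.MM (μ.map Subtype.val) := by
  classical
  have hprob := hμ.1
  have hval : Measurable (Subtype.val : Icc (0:ℝ) 1 → ℝ) := measurable_subtype_coe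
  refine ⟨Measure.isProbabilityMeasure_map hval.aemeasurable, ?_, ?_, ?_⟩
  · refine ⟨c.S.cont.measurable, ?_⟩
    have h1 := hμ.2.iterate c.q
    rw [Measure.map_map c.S.cont.measurable hval]
    have : c.S.g ∘ Subtype.val = Subtype.val ∘ c.f^[c.q] := by
      funext x; exact (c.hfg x).symm
    rw [this, ← Measure.map_map hval h1.measurable, h1.map_eq]
  · refine (ae_map_iff (p := fun x => x ∈ Icc (0:ℝ) 1) hval.aemeasurable measurableSet_Icc).2 ?_
    exact Eventually.of_forall fun x => x.2
  intro η hη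
  have hq := c.q0
  obtain ⟨ε, hε, hcode⟩ := coding c.f c.hf μ hμ c.h hks (η / (2 * c.q)) (by positivity)
  obtain ⟨K, hK, hlab⟩ := c.f_labels ε hε
  obtain ⟨C1, hC1, hpoly⟩ := poly_exp 2 (η / 2) (by positivity)
  have hd := c.S.d0
  refine ⟨Real.log (1 + 4 * (K:ℝ) ^ 2) + Real.log C1 + Real.log (c.S.d + 1), ?_⟩
  intro n w Z u hw hwc hZ hsum hu h1 h2
  obtain ⟨ℓ, hl1, hl2, hl3, hl4, hl5⟩ := hlab n
  set Pn : ℝ := 1 + (2 * K * (n + 1)) ^ 2 with hPn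
  have hPn0 : 0 < Pn := by positivity
  let W : ℕ → Set ℝ → ℝ := fun t J => if t = 0 ∧ ∃ x ∈ c.S.Q, J = {x} then Z / (c.S.d + 1) else w t (pt J)
  have hW0 : ∀ t J, 0 < W t J := by
    intro t J
    simp only [W]
    split_ifs
    · positivity
    · exact hw _ _
  have hWG : ∀ t A B, ∀ J ∈ c.S.Gf t A B, W t J = w t (pt J) := by
    intro t A B J hJ
    simp only [W]
    rw [if_neg]
    rintro ⟨-, x, -, rfl⟩
    rw [c.S.mem_Gf] at hJ
    exact not_isOpen_singleton x (c.S.GP_isOpen hJ)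
  have hls := c.S.lab_sum n K hK W (fun t J => (hW0 t J).le)
  have hls1 : ∑ x ∈ c.S.Qf, W 0 {x} ≤ Z := by
    have : ∀ x ∈ c.S.Qf, W 0 {x} = Z / (c.S.d + 1) := by
      intro x hx
      have hxQ : x ∈ c.S.Q := by
        obtain ⟨k, -, rfl⟩ := Finset.mem_image.1 hx
        exact ⟨k, by push_cast; rfl⟩
      exact if_pos ⟨rfl, x, hxQ, rfl⟩
    rw [Finset.sum_congr rfl this, Finset.sum_const, nsmul_eq_mul]
    have h3 : (c.S.Qf.card : ℝ) ≤ c.S.d + 1 := by exact_mod_cast c.S.Qf_card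
    calc (c.S.Qf.card : ℝ) * (Z / (c.S.d + 1)) ≤ (c.S.d + 1) * (Z / (c.S.d + 1)) := by gcongr
      _ = Z := by field_simp
  have hls2 : ∑ t ∈ Finset.range (n + 1), ∑ A, ∑ B, ∑ J ∈ c.S.Gf t A B,
        (2 * K * (n + 1)) ^ 2 * c.S.Gam ^ (n - t) * W t J ≤ (2 * K * (n + 1)) ^ 2 * Z := by
    refine le_trans (le_of_eq ?_) (mul_le_mul_of_nonneg_left hsum (by positivity))
    simp only [Finset.mul_sum]
    refine Finset.sum_congr rfl fun t _ => Finset.sum_congr rfl fun A _ => Finset.sum_congr rfl fun B _ =>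
      Finset.sum_congr rfl fun J hJ => ?_
    rw [hWG t A B J hJ]; ring
  have htot : ∑ e ∈ c.S.lab n K, W e.1 e.2.1 ≤ Z * Pn := by
    refine hls.trans ?_
    rw [hPn]; linarith
  obtain ⟨hhi, hfin⟩ := hcode (c.q * n) _ (fun x => ℓ x) (c.S.lab n K) (fun e => W e.1 e.2.1 / (Z * Pn))
    (fun x => hl1 x x.2) hl5 hl4 (fun e _ => div_pos (hW0 _ _) (by positivity))
    (by rw [← Finset.sum_div, div_le_one (by positivity)]; exact htot)
  have hPl : Real.log Pn ≤ Real.log (1 + 4 * (K:ℝ) ^ 2) + Real.log C1 + n * (η / 2) := by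
    have : Pn ≤ (1 + 4 * (K:ℝ) ^ 2) * (C1 * Real.exp (n * (η / 2))) := by
      have e1 : Pn ≤ (1 + 4 * (K:ℝ) ^ 2) * ((n:ℝ) + 1) ^ 2 := by
        rw [hPn]
        have : (1:ℝ) ≤ ((n:ℝ) + 1) ^ 2 := one_le_pow₀ (by linarith [Nat.cast_nonneg (α := ℝ) n])
        nlinarith
      exact e1.trans (mul_le_mul_of_nonneg_left (hpoly n) (by positivity))
    have h3 := Real.log_le_log hPn0 this
    rw [Real.log_mul (by positivity) (by positivity), Real.log_mul (by positivity) (by positivity), Real.log_exp] at h3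
    linarith
  have hld : 0 ≤ Real.log (c.S.d + 1) := Real.log_nonneg (by linarith)
  have hpt : ∀ x : Icc (0:ℝ) 1, - Real.log (W (ℓ x).1 (ℓ x).2.1 / (Z * Pn)) ≤
      Real.log Pn + Real.log (c.S.d + 1) + u x := by
    intro x
    rw [Real.log_div (hW0 _ _).ne' (by positivity), Real.log_mul hZ.ne' hPn0.ne']
    by_cases hQ : (x:ℝ) ∈ c.S.Q
    · rw [hl3 x hQ]
      have : W 0 {(x:ℝ)} = Z / (c.S.d + 1) := if_pos ⟨rfl, x, hQ, rfl⟩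
      dsimp only
      rw [this, Real.log_div hZ.ne' (by positivity)]
      linarith [h2 x x.2 hQ]
    · obtain ⟨a1, a2, a3, a4⟩ := hl2 x x.2 hQ
      have ht := c.S.tl_eq a1 a2 a4
      rw [← ht] at a3 a2
      have hmem : (x:ℝ) ∈ c.S.Pc (c.S.tl n x) x := c.S.mem_Pc a2.1
      have : W (ℓ x).1 (ℓ x).2.1 = w (c.S.tl n x) x := by
        rw [← ht, a3]
        simp only [W]
        rw [if_neg]
        · exact (hwc _ _ _ (pt_mem ⟨_, hmem⟩)).symm
        · rintro ⟨-, y, -, hy⟩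
          have := c.S.isOpen_Pc (c.S.tl n x) x
          rw [hy] at this
          exact not_isOpen_singleton y this
      rw [this]
      linarith [h1 x x.2 hQ]
  have hu' : Integrable (fun x : Icc (0:ℝ) 1 => u x) μ := by
    exact hu.comp_measurable hval
  have hI := integral_mono hhi (((integrable_const (Real.log Pn + Real.log (c.S.d + 1))).add hu')) hpt
  have e3 : ∫ x : Icc (0:ℝ) 1, (Real.log Pn + Real.log (c.S.d + 1)) + u x ∂μ =
      (Real.log Pn + Real.log (c.S.d + 1)) + ∫ x : Icc (0:ℝ) 1, u x ∂μ := by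
    rw [integral_add (integrable_const _) hu']; simp
  have e4 : ∫ x, u x ∂(μ.map Subtype.val) = ∫ x : Icc (0:ℝ) 1, u x ∂μ :=
    integral_map hval.aemeasurable hu.aestronglyMeasurable
  rw [e4]
  have e5 : ((c.q * n : ℕ):ℝ) * (c.h - η / (2 * c.q)) = n * (c.H - η / 2) := by
    unfold H; push_cast; field_simp
  rw [e5] at hfin
  have hI' := hI.trans (le_of_eq e3)
  have : n * (c.H - η) = n * (c.H - η / 2) - n * (η / 2) := by ring
  rw [this]
  linarith

end Ctx
end IntervalEnt

namespace IntervalEnt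

/-- number of times `s ∈ [1,t]` with property `T s x` -/
noncomputable def cnt (T : ℕ → ℝ → Prop) (t : ℕ) (x : ℝ) : ℕ := by
  classical
  exact ∑ s ∈ Finset.range t, if T (s + 1) x then 1 else 0

lemma cnt_zero (T : ℕ → ℝ → Prop) (x : ℝ) : cnt T 0 x = 0 := by simp [cnt]

lemma cnt_congr {T : ℕ → ℝ → Prop} {t : ℕ} {x y : ℝ} (h : ∀ s, s ≤ t → (T s x ↔ T s y)) :
    cnt T t x = cnt T t y := by
  classical
  unfold cnt
  refine Finset.sum_congr rfl fun s hs => ?_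
  rw [Finset.mem_range] at hs
  simp only [h (s + 1) (by omega)]

lemma cnt_add {T : ℕ → ℝ → Prop} {m r : ℕ} {x y : ℝ} (h : ∀ s, (T (m + s) x ↔ T s y)) :
    cnt T (m + r) x = cnt T m x + cnt T r y := by
  classical
  unfold cnt
  rw [Finset.sum_range_add]
  congr 1
  refine Finset.sum_congr rfl fun s hs => ?_
  simp only [add_assoc, h (s + 1)]

lemma cnt_succ (T : ℕ → ℝ → Prop) (t : ℕ) (x : ℝ) [Decidable (T (t + 1) x)] :
    cnt T (t + 1) x = cnt T t x + if T (t + 1) x then 1 else 0 := by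
  classical
  unfold cnt
  rw [Finset.sum_range_succ]
  congr

lemma cnt_mono (T : ℕ → ℝ → Prop) (x : ℝ) : Monotone fun t => cnt T t x := by
  classical
  refine monotone_nat_of_le_succ fun t => ?_
  rw [cnt_succ]; omega

lemma cnt_le (T : ℕ → ℝ → Prop) (t : ℕ) (x : ℝ) : cnt T t x ≤ t := by
  classical
  induction t with
  | zero => simp [cnt_zero]
  | succ t ih => rw [cnt_succ]; split_ifs <;> omega

lemma cnt_eq_zero {T : ℕ → ℝ → Prop} {t : ℕ} {x : ℝ} (h : ∀ s, 0 < s → s ≤ t → ¬ T s x) : cnt T t x = 0 := by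
  classical
  unfold cnt
  refine Finset.sum_eq_zero fun s hs => ?_
  rw [Finset.mem_range] at hs
  rw [if_neg (h _ (by omega) (by omega))]

lemma cnt_const {T : ℕ → ℝ → Prop} {t n : ℕ} (htn : t ≤ n) {x : ℝ} (h : ∀ s, t < s → s ≤ n → ¬ T s x) :
    cnt T n x = cnt T t x := by
  classical
  induction n, htn using Nat.le_induction with
  | base => rfl
  | succ n hn ih =>
    rw [cnt_succ, if_neg (h _ (by omega) le_rfl), ih fun s h1 h2 => h s h1 (by omega)]; rfl

lemma cnt_int (T : ℕ → ℝ → Prop) (m : Measure ℝ) [IsProbabilityMeasure m] (hT : ∀ s, MeasurableSet {x | T s x})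
    (n : ℕ) : Integrable (fun x => (cnt T n x : ℝ)) m ∧
      ∫ x, (cnt T n x : ℝ) ∂m = ∑ s ∈ Finset.range n, m.real {x | T (s + 1) x} := by
  classical
  have h1 : (fun x => (cnt T n x : ℝ)) = fun x => ∑ s ∈ Finset.range n, {x | T (s + 1) x}.indicator (fun _ => (1:ℝ)) x := by
    funext x
    unfold cnt
    push_cast
    refine Finset.sum_congr rfl fun s _ => ?_
    simp [indicator_apply]
  rw [h1]
  have h2 : ∀ s ∈ Finset.range n, Integrable ({x | T (s + 1) x}.indicator (fun _ => (1:ℝ))) m :=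
    fun s _ => (integrable_const _).indicator (hT _)
  refine ⟨integrable_finsetSum _ h2, ?_⟩
  rw [integral_finsetSum _ h2]
  refine Finset.sum_congr rfl fun s _ => ?_
  rw [integral_indicator_const _ (hT _)]; simp

namespace Sys
variable (S : Sys)

def AG (A : Fin S.d) (s : ℕ) (x : ℝ) : Prop := S.Gd s x ∧ S.g^[s] x ∈ S.cell A

lemma Gd_shift {m : ℕ} {x : ℝ} (h : S.Gd m x) (s : ℕ) : S.Gd (m + s) x ↔ S.Gd s (S.g^[m] x) :=
  ⟨fun h' => S.Gd_restrict h', fun h' => S.Gd_concat h h'⟩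

lemma AG_shift {A : Fin S.d} {m : ℕ} {x : ℝ} (h : S.Gd m x) (s : ℕ) :
    S.AG A (m + s) x ↔ S.AG A s (S.g^[m] x) := by
  unfold AG
  rw [S.Gd_shift h, ← Function.iterate_add_apply, add_comm s m]

lemma AG_congr {A : Fin S.d} {n s : ℕ} (hs : s ≤ n) {x y : ℝ} (hy : y ∈ S.Pc n x) :
    S.AG A s x ↔ S.AG A s y := by
  have key : ∀ x y, y ∈ S.Pc n x → S.AG A s x → S.AG A s y := by
    intro x y hy h
    refine ⟨(S.Gd_congr hs hy).1 h.1, ?_⟩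
    exact S.Gd_img h.1 h.2 ▸ mem_image_of_mem _ (S.Pc_anti hs x hy)
  refine ⟨key x y hy, key y x ?_⟩
  have h1 := S.Pc_eq hy
  rw [← h1]
  by_contra hx
  have h2 : x ∉ S.O n := fun h => hx (S.mem_Pc h)
  have : S.Pc n x = ∅ := connectedComponentIn_eq_empty h2
  rw [this] at hy; exact hy

lemma AG_open (A : Fin S.d) (s : ℕ) : IsOpen {x | S.AG A s x} :=
  (S.isOpen_Gd s).inter (isOpen_Ioo.preimage (S.cont_it s))

lemma cat_pt {s t : ℕ} {A B C : Fin S.d} {J D : Set ℝ} (hJ : J ∈ S.GP s A B) (hD : D ∈ S.GP t B C) :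
    pt (S.cat s J D) ∈ J ∧ S.g^[s] (pt (S.cat s J D)) ∈ D ∧
      pt D ∈ S.Pc t (S.g^[s] (pt (S.cat s J D))) := by
  have h := pt_mem (S.cat_nonempty hJ (S.GP_sub hD) (S.GP_nonempty hD))
  refine ⟨h.1, h.2, ?_⟩
  have := (S.GP_mem hD h.2).2.2.2
  rw [← this]; exact pt_mem (S.GP_nonempty hD)

end Sys

namespace Ctx
variable (c : Ctx)

lemma A1_num (C K G : ℝ) (d m : ℕ) (hK : 0 < K) (hG : 0 < G) (h : d * C ≤ K) :
    (d : ℝ) * (C * G ^ m * (K⁻¹ * (2 * G)⁻¹ ^ m) * 1) ≤ (1/2) ^ m := by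
  have e : G ^ m * (2 * G)⁻¹ ^ m = (1/2 : ℝ) ^ m := by
    rw [← mul_pow]; congr 1; field_simp
  calc (d : ℝ) * (C * G ^ m * (K⁻¹ * (2 * G)⁻¹ ^ m) * 1) = (d * C) * K⁻¹ * (G ^ m * (2 * G)⁻¹ ^ m) := by ring
    _ ≤ K * K⁻¹ * (G ^ m * (2 * G)⁻¹ ^ m) := by
        refine mul_le_mul_of_nonneg_right (mul_le_mul_of_nonneg_right h (by positivity)) (by positivity)
    _ = _ := by rw [e, mul_inv_cancel₀ hK.ne', one_mul]

lemma A1_sum : ∃ K1 : ℝ, 1 ≤ K1 ∧ ∀ t A, ∑ B, ∑ J ∈ c.S.Gf t A B,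
    (K1⁻¹ ^ cnt c.S.Gd t (pt J) * (2 * c.S.Gam)⁻¹ ^ t) ≤ 1 := by
  classical
  obtain ⟨C0, hC00, hC0⟩ : ∃ C0 : ℝ, 0 ≤ C0 ∧ ∀ m A C, 1 ≤ m → c.S.phi m A C ≤ C0 * c.S.Gam ^ m := by
    have := c.S.hLam1
    exact ⟨c.S.d * c.S.Lam, by positivity, fun m A C _ => c.S.phi_le m A C⟩
  have hd := c.S.d0
  have hG : 0 < c.S.Gam := by linarith [c.S.hGam]
  set K1 : ℝ := c.S.d * C0 + 1 with hK1
  have hK11 : 1 ≤ K1 := by have : 0 ≤ c.S.d * C0 := by positivity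
                           linarith
  have hK0 : 0 < K1 := by linarith
  refine ⟨K1, hK11, fun t => ?_⟩
  induction t using Nat.strong_induction_on with
  | _ t ih =>
  intro A
  rcases Nat.eq_zero_or_pos t with ht | ht
  · subst ht
    simp only [cnt_zero, pow_zero, mul_one, Finset.sum_const, nsmul_eq_mul]
    have : ∀ B, ((c.S.Gf 0 A B).card : ℝ) = if A = B then 1 else 0 := fun B => c.S.N_zero A B
    simp [this]
  have hfil : ∀ B, (c.S.Gf t A B).filter (fun E => ∃ x ∈ E, ∃ s, 0 < s ∧ s ≤ t ∧ c.S.Gd s x) = c.S.Gf t A B := by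
    intro B
    refine Finset.filter_true_of_mem fun E hE => ?_
    rw [c.S.mem_Gf] at hE
    have h1 := pt_mem (c.S.GP_nonempty hE)
    exact ⟨_, h1, t, ht, le_rfl, (c.S.GP_mem hE h1).2.1⟩
  have hcongr : ∀ s x y, y ∈ c.S.Pc s x → (c.S.Gd s x ↔ c.S.Gd s y) := fun s x y h => c.S.Gd_congr le_rfl h
  have hdec : ∀ B, ∑ J ∈ c.S.Gf t A B, (K1⁻¹ ^ cnt c.S.Gd t (pt J) * (2 * c.S.Gam)⁻¹ ^ t) =
      ∑ m ∈ Finset.Icc 1 t, ∑ C, c.S.phi m A C * (K1⁻¹ * (2 * c.S.Gam)⁻¹ ^ m) * ∑ D ∈ c.S.Gf (t - m) C B,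
        (K1⁻¹ ^ cnt c.S.Gd (t - m) (pt D) * (2 * c.S.Gam)⁻¹ ^ (t - m)) := by
    intro B
    conv_lhs => rw [← hfil B]
    rw [c.S.decomp_sum c.S.Gd hcongr (fun s x h => h) t A B
      (fun E => K1⁻¹ ^ cnt c.S.Gd t (pt E) * (2 * c.S.Gam)⁻¹ ^ t)]
    refine Finset.sum_congr rfl fun m hm => Finset.sum_congr rfl fun C _ => ?_
    rw [Finset.mem_Icc] at hm
    unfold Sys.phi
    rw [mul_assoc, ← nsmul_eq_mul, ← Finset.sum_const]
    refine Finset.sum_congr rfl fun J hJ => ?_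
    rw [Finset.mul_sum]
    refine Finset.sum_congr rfl fun D hD => ?_
    rw [c.S.mem_Ff] at hJ
    rw [c.S.mem_Gf] at hD
    obtain ⟨a1, a2, a3⟩ := c.S.cat_pt (c.S.FP_sub _ _ _ _ hJ) hD
    obtain ⟨b1, b2, b3⟩ := c.S.FP_mem hcongr hJ a1
    have e1 : cnt c.S.Gd t (pt (c.S.cat m J D)) = 1 + cnt c.S.Gd (t - m) (pt D) := by
      obtain ⟨r, rfl⟩ := Nat.exists_eq_add_of_le hm.2
      rw [Nat.add_sub_cancel_left] at *
      rw [cnt_add (fun s => c.S.Gd_shift b2 s)]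
      congr 1
      · obtain ⟨m', rfl⟩ := Nat.exists_eq_add_of_le' b1
        rw [cnt_succ, if_pos b2, cnt_eq_zero fun s h1 h2 => b3 s h1 (by omega)]
      · exact cnt_congr fun s hs => c.S.Gd_congr hs a3
    rw [e1, pow_add, pow_one]
    have e2 : (2 * c.S.Gam)⁻¹ ^ t = (2 * c.S.Gam)⁻¹ ^ m * (2 * c.S.Gam)⁻¹ ^ (t - m) := by
      rw [← pow_add]; congr 1; omega
    rw [e2]; ring
  simp only [hdec]
  rw [Finset.sum_comm]
  calc _ ≤ ∑ m ∈ Finset.Icc 1 t, (1/2 : ℝ) ^ m := ?_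
    _ ≤ 1 := ?_
  · refine Finset.sum_le_sum fun m hm => ?_
    rw [Finset.mem_Icc] at hm
    rw [Finset.sum_comm]
    calc _ ≤ ∑ C : Fin c.S.d, C0 * c.S.Gam ^ m * (K1⁻¹ * (2 * c.S.Gam)⁻¹ ^ m) * 1 := by
          refine Finset.sum_le_sum fun C _ => ?_
          rw [← Finset.mul_sum]
          have h1 := hC0 m A C hm.1
          have h2 := ih (t - m) (by omega) C
          have h3 : 0 ≤ c.S.phi m A C := c.S.phi_nonneg m A C
          have h4 : 0 ≤ K1⁻¹ * (2 * c.S.Gam)⁻¹ ^ m := by positivity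
          exact mul_le_mul (mul_le_mul_of_nonneg_right h1 h4) h2
            (Finset.sum_nonneg fun B _ => Finset.sum_nonneg fun D _ => by positivity) (by positivity)
      _ ≤ _ := by
          rw [Finset.sum_const, Finset.card_univ, Fintype.card_fin, nsmul_eq_mul]
          exact A1_num C0 K1 c.S.Gam c.S.d m hK0 hG (by rw [hK1]; linarith)
  · have : ∀ t : ℕ, ∑ m ∈ Finset.Icc 1 t, (1/2 : ℝ) ^ m = 1 - (1/2) ^ t := by
      intro t
      induction t with
      | zero => simp
      | succ t ih => rw [Finset.sum_Icc_succ_top (by omega), ih, pow_succ]; ring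
    rw [this]
    have : (0:ℝ) < (1/2) ^ t := by positivity
    linarith

end Ctx
end IntervalEnt

namespace IntervalEnt

lemma lin_contra {a b : ℝ} (ha : 0 < a) (h : ∀ n : ℕ, n * a ≤ b) : False := by
  obtain ⟨n, hn⟩ := exists_nat_gt (b / a)
  rw [div_lt_iff₀ ha] at hn
  linarith [h n]

lemma antitone_sum {p : ℕ → ℝ} (hp : Antitone p) (hp1 : ∀ s, p s ≤ 1) (hp0 : ∀ s, 0 ≤ p s) (s n : ℕ) :
    ∑ j ∈ Finset.range n, p (j + 1) ≤ s + n * p s := by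
  induction n with
  | zero => simp
  | succ n ih =>
    rw [Finset.sum_range_succ]
    push_cast
    by_cases h : s ≤ n + 1
    · have := hp h
      linarith
    · have h1 : ∑ j ∈ Finset.range n, p (j + 1) ≤ n := by
        calc _ ≤ ∑ j ∈ Finset.range n, (1:ℝ) := Finset.sum_le_sum fun j _ => hp1 _
          _ = n := by simp
      have h2 : (n:ℝ) + 1 ≤ s := by exact_mod_cast (by omega : n + 1 ≤ s)
      have := hp1 (n + 1)
      have := hp0 s
      nlinarith

namespace Ctx
variable (c : Ctx)

lemma real_inv {m : Measure ℝ} (hm : c.MM m) {E F : Set ℝ} (hF : MeasurableSet F) (i : ℕ)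
    (h : ∀ x ∈ E, c.S.g^[i] x ∈ F) : m.real E ≤ m.real F := by
  have := hm.prob
  rw [← (hm.inv.iterate i).measureReal_preimage hF.nullMeasurableSet]
  exact measureReal_mono h

lemma Gd_anti {m : Measure ℝ} (hm : c.MM m) : Antitone fun s => m.real {x | c.S.Gd s x} := by
  intro s t hst
  obtain ⟨i, rfl⟩ := Nat.exists_eq_add_of_le' hst
  exact c.real_inv hm (c.S.isOpen_Gd s).measurableSet i fun x hx => c.S.Gd_restrict hx

lemma exists_Gd {m : Measure ℝ} (hm : c.MM m) : ∃ a : ℝ, 0 < a ∧ ∀ s, a ≤ m.real {x | c.S.Gd s x} := by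
  have := hm.prob
  obtain ⟨K1, hK1, hsum⟩ := c.A1_sum
  have hG1 := c.S.hGam
  have hG0 : 0 < c.S.Gam := by linarith
  have hd := c.S.d0
  set lG := Real.log c.S.Gam
  set l2 := Real.log (2 * c.S.Gam)
  set lK := Real.log K1
  have hlK : 0 ≤ lK := Real.log_nonneg hK1
  have hl2 : 0 ≤ l2 := Real.log_nonneg (by linarith)
  have hl2H : l2 < c.H / 2 := (Real.log_lt_iff_lt_exp (by linarith)).2 c.GamH
  have hlG : lG ≤ l2 := Real.log_le_log hG0 (by linarith)
  set e := c.H - lG - l2 with he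
  have he0 : 0 < e := by linarith
  refine ⟨e / (8 * (lK + 1)), by positivity, fun s => ?_⟩
  by_contra hs
  push Not at hs
  obtain ⟨C, hC⟩ := hm.code (e / 4) (by linarith)
  obtain ⟨C1, hC1, hpoly⟩ := poly_exp 1 (e / 4) (by linarith)
  refine lin_contra (a := e / 4) (b := C + Real.log C1 + Real.log c.S.d + lK * s) (by linarith) fun n => ?_
  have hhi := cnt_int c.S.Gd m (fun s => (c.S.isOpen_Gd s).measurableSet) n
  have hd' : (0:ℝ) < c.S.d := by exact_mod_cast hd
  have hw : ∀ t x, 0 < K1⁻¹ ^ cnt c.S.Gd t x * (2 * c.S.Gam)⁻¹ ^ t := fun t x => by positivity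
  have key := hC n (fun t x => K1⁻¹ ^ cnt c.S.Gd t x * (2 * c.S.Gam)⁻¹ ^ t) ((n + 1) * c.S.d * c.S.Gam ^ n)
    (fun x => Real.log ((n + 1) * c.S.d * c.S.Gam ^ n) + n * l2 + lK * cnt c.S.Gd n x) hw ?_ (by positivity) ?_ ?_ ?_ ?_
  · have hlog : Real.log ((n + 1) * c.S.d * c.S.Gam ^ n) ≤ Real.log C1 + n * (e / 4) + Real.log c.S.d + n * lG := by
      have h1 := hpoly n
      rw [pow_one] at h1
      rw [Real.log_mul (by positivity) (by positivity), Real.log_mul (by positivity) (by positivity), Real.log_pow]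
      have h2 := Real.log_le_log (by positivity) h1
      rw [Real.log_mul (by positivity) (Real.exp_pos _).ne', Real.log_exp] at h2
      linarith
    have hI : ∫ x, (Real.log ((n + 1) * c.S.d * c.S.Gam ^ n) + n * l2 + lK * cnt c.S.Gd n x) ∂m =
        Real.log ((n + 1) * c.S.d * c.S.Gam ^ n) + n * l2 + lK * ∑ s ∈ Finset.range n, m.real {x | c.S.Gd (s + 1) x} := by
      rw [integral_add (integrable_const _) (hhi.1.const_mul _), integral_const_mul, hhi.2]
      simp
    rw [hI] at key
    have h3 := antitone_sum (c.Gd_anti hm) (fun s => measureReal_le_one) (fun s => measureReal_nonneg) s n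
    have h4 : lK * ∑ j ∈ Finset.range n, m.real {x | c.S.Gd (j + 1) x} ≤ lK * s + n * (e / 8) := by
      have h5 := mul_le_mul_of_nonneg_left h3 hlK
      have h6 : lK * (e / (8 * (lK + 1))) ≤ e / 8 := by
        rw [mul_div_assoc', div_le_div_iff₀ (by positivity) (by positivity)]
        nlinarith
      have h7 : lK * m.real {x | c.S.Gd s x} ≤ e / 8 := (mul_le_mul_of_nonneg_left hs.le hlK).trans h6
      have h8 : (n:ℝ) * (lK * m.real {x | c.S.Gd s x}) ≤ n * (e / 8) := mul_le_mul_of_nonneg_left h7 (by positivity)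
      refine h5.trans (le_trans (le_of_eq ?_) (add_le_add_right h8 (lK * s)))
      ring
    have h9 : (0:ℝ) ≤ n * (e / 8) := by positivity
    have h10 : (n:ℝ) * c.H = n * e + n * lG + n * l2 := by rw [he]; ring
    nlinarith
  · intro t x y h
    rw [cnt_congr fun s hs => c.S.Gd_congr hs h]
  · calc _ ≤ ∑ t ∈ Finset.range (n + 1), ∑ A : Fin c.S.d, c.S.Gam ^ n * 1 := by
          refine Finset.sum_le_sum fun t _ => Finset.sum_le_sum fun A _ => ?_
          simp only [← Finset.mul_sum]
          refine mul_le_mul (pow_le_pow_right₀ hG1 (by omega)) (hsum t A)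
            (Finset.sum_nonneg fun B _ => Finset.sum_nonneg fun D _ => (hw _ _).le) (by positivity)
      _ = _ := by
          simp
          ring
  · exact (integrable_const _).add (hhi.1.const_mul _)
  · intro x _ _
    rw [Real.log_mul (x := K1⁻¹ ^ _) (by positivity) (by positivity), Real.log_pow, Real.log_pow, Real.log_inv,
      Real.log_inv]
    have h1 : (cnt c.S.Gd (c.S.tl n x) x : ℝ) ≤ cnt c.S.Gd n x := by
      exact_mod_cast cnt_mono c.S.Gd x (c.S.tl_le n x)
    have h2 : (c.S.tl n x : ℝ) ≤ n := by exact_mod_cast c.S.tl_le n x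
    have h3 := mul_le_mul_of_nonneg_right h1 hlK
    have h4 := mul_le_mul_of_nonneg_right h2 hl2
    simp only [lK, l2] at *
    linarith
  · intro x _ _
    have h1 : 0 ≤ Real.log ((n + 1) * c.S.d * c.S.Gam ^ n) := by
      refine Real.log_nonneg ?_
      have h1 : (1:ℝ) ≤ n + 1 := by linarith [(Nat.cast_nonneg n : (0:ℝ) ≤ n)]
      have h2 : (1:ℝ) ≤ c.S.d := by exact_mod_cast c.S.hd
      have h3 : 1 ≤ c.S.Gam ^ n := one_le_pow₀ hG1
      exact one_le_mul_of_one_le_of_one_le (one_le_mul_of_one_le_of_one_le h1 h2) h3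
    positivity

/-- set of points with good time `j` over `A`, landing in `E` -/
def AE (A : Fin c.S.d) (E : Set ℝ) (j : ℕ) : Set ℝ := {x | c.S.AG A j x ∧ c.S.g^[j] x ∈ E}

noncomputable def al (m : Measure ℝ) (A : Fin c.S.d) (E : Set ℝ) : ℝ := ⨅ j, m.real (c.AE A E j)

lemma AE_meas (A : Fin c.S.d) {E : Set ℝ} (hE : MeasurableSet E) (j : ℕ) : MeasurableSet (c.AE A E j) :=
  (c.S.AG_open A j).measurableSet.inter ((c.S.cont_it j).measurable hE)

lemma AE_anti {m : Measure ℝ} (hm : c.MM m) (A : Fin c.S.d) {E : Set ℝ} (hE : MeasurableSet E) :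
    Antitone fun j => m.real (c.AE A E j) := by
  intro s t hst
  obtain ⟨i, rfl⟩ := Nat.exists_eq_add_of_le' hst
  refine c.real_inv hm (c.AE_meas A hE s) i fun x hx => ?_
  obtain ⟨⟨h1, h2⟩, h3⟩ := hx
  have e : c.S.g^[s] (c.S.g^[i] x) = c.S.g^[i + s] x := by
    rw [← Function.iterate_add_apply, add_comm]
  exact ⟨⟨c.S.Gd_restrict h1, by rw [e]; exact h2⟩, by rw [e]; exact h3⟩

lemma al_bdd (m : Measure ℝ) (A : Fin c.S.d) (E : Set ℝ) : BddBelow (range fun j => m.real (c.AE A E j)) :=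
  ⟨0, by rintro _ ⟨j, rfl⟩; exact measureReal_nonneg⟩

lemma al_le (m : Measure ℝ) (A : Fin c.S.d) (E : Set ℝ) (j : ℕ) : c.al m A E ≤ m.real (c.AE A E j) :=
  ciInf_le (c.al_bdd m A E) j

lemma al_nonneg (m : Measure ℝ) (A : Fin c.S.d) (E : Set ℝ) : 0 ≤ c.al m A E :=
  le_ciInf fun _ => measureReal_nonneg

lemma al_tendsto {m : Measure ℝ} (hm : c.MM m) (A : Fin c.S.d) {E : Set ℝ} (hE : MeasurableSet E) :
    Tendsto (fun j => m.real (c.AE A E j)) atTop (𝓝 (c.al m A E)) :=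
  tendsto_atTop_ciInf (c.AE_anti hm A hE) (c.al_bdd m A E)

lemma al_le_real {m : Measure ℝ} (hm : c.MM m) (A : Fin c.S.d) {E : Set ℝ} (hE : MeasurableSet E) :
    c.al m A E ≤ m.real E :=
  (c.al_le m A E 0).trans (c.real_inv hm hE 0 fun _ hx => hx.2)

lemma al_sub {ι : Type*} (s : Finset ι) {m : Measure ℝ} (hm : c.MM m) (A : Fin c.S.d) {E : Set ℝ} (hE : MeasurableSet E)
    (F : ι → Set ℝ) (hF : ∀ i ∈ s, MeasurableSet (F i)) (h : ∀ x ∈ c.S.cell A, x ∈ E → ∃ i ∈ s, x ∈ F i) :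
    c.al m A E ≤ ∑ i ∈ s, c.al m A (F i) := by
  have := hm.prob
  refine le_of_tendsto_of_tendsto' (c.al_tendsto hm A hE)
    (tendsto_finsetSum s fun i hi => c.al_tendsto hm A (hF i hi)) fun j => ?_
  calc m.real (c.AE A E j) ≤ m.real (⋃ i ∈ s, c.AE A (F i) j) := by
        refine measureReal_mono (fun x hx => ?_) (measure_ne_top _ _)
        obtain ⟨i, hi, hx2⟩ := h _ hx.1.2 hx.2
        simp only [mem_iUnion]
        exact ⟨i, hi, hx.1, hx2⟩
    _ ≤ _ := measureReal_biUnion_finset_le _ _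

lemma exists_al {m : Measure ℝ} (hm : c.MM m) : ∃ A, 0 < c.al m A univ := by
  have := hm.prob
  obtain ⟨a, ha, h⟩ := c.exists_Gd hm
  by_contra hne
  push Not at hne
  have h1 : Tendsto (fun j => ∑ A, m.real (c.AE A univ j)) atTop (𝓝 (∑ A, c.al m A univ)) :=
    tendsto_finsetSum _ fun A _ => c.al_tendsto hm A MeasurableSet.univ
  have h2 : a ≤ ∑ A, c.al m A univ := by
    refine ge_of_tendsto' h1 fun j => (h j).trans ?_
    refine le_trans (measureReal_mono (fun x hx => ?_) (measure_ne_top _ _)) (measureReal_biUnion_finset_le Finset.univ (fun A => c.AE A univ j))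
    obtain ⟨A, hA⟩ := c.S.Gd_cell hx
    simp only [mem_iUnion]
    exact ⟨A, Finset.mem_univ _, ⟨hx, hA⟩, mem_univ _⟩
  have h3 : ∑ A, c.al m A univ ≤ 0 := Finset.sum_nonpos fun A _ => hne A
  linarith

end Ctx
end IntervalEnt

namespace IntervalEnt

lemma cnt_lt {T : ℕ → ℝ → Prop} {s t : ℕ} {x : ℝ} (hst : s < t) (h : T t x) : cnt T s x < cnt T t x := by
  classical
  obtain ⟨t', rfl⟩ : ∃ t', t = t' + 1 := ⟨t - 1, by omega⟩
  rw [cnt_succ, if_pos h]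
  have := cnt_mono T x (by omega : s ≤ t')
  dsimp only at this
  omega

lemma cnt_exists {T : ℕ → ℝ → Prop} {t k : ℕ} {x : ℝ} (hk : 1 ≤ k) (h : k ≤ cnt T t x) :
    ∃ s, 0 < s ∧ s ≤ t ∧ T s x ∧ cnt T s x = k := by
  classical
  induction t with
  | zero => rw [cnt_zero] at h; omega
  | succ t ih =>
    by_cases h1 : k ≤ cnt T t x
    · obtain ⟨s, h2, h3, h4⟩ := ih h1
      exact ⟨s, h2, by omega, h4⟩
    · have h2 := cnt_succ T t x
      by_cases h3 : T (t + 1) x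
      · rw [if_pos h3] at h2
        exact ⟨t + 1, by omega, le_rfl, h3, by omega⟩
      · rw [if_neg h3] at h2; omega

namespace Sys
variable (S : Sys)

/-- `s` is the `k`-th return to `A` -/
def PK (A : Fin S.d) (k s : ℕ) (x : ℝ) : Prop := S.AG A s x ∧ cnt (S.AG A) s x = k

variable {S}

lemma PK_congr {A : Fin S.d} {k : ℕ} : ∀ s x y, y ∈ S.Pc s x → (S.PK A k s x ↔ S.PK A k s y) := by
  intro s x y h
  unfold PK
  rw [S.AG_congr le_rfl h, cnt_congr fun i hi => S.AG_congr hi h]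

lemma PK_Gd {A : Fin S.d} {k : ℕ} : ∀ s x, S.PK A k s x → S.Gd s x := fun _ _ h => h.1.1

lemma PK_unique {A : Fin S.d} {k s t : ℕ} {x : ℝ} (h1 : S.PK A k s x) (h2 : S.PK A k t x) : s = t := by
  rcases lt_trichotomy s t with h | h | h
  · have := cnt_lt h h2.1; rw [h1.2, h2.2] at this; omega
  · exact h
  · have := cnt_lt h h1.1; rw [h1.2, h2.2] at this; omega

lemma PK_pos {A : Fin S.d} {k s : ℕ} {x : ℝ} (hk : 1 ≤ k) (h : S.PK A k s x) : 0 < s := by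
  by_contra h0
  have : s = 0 := by omega
  subst this
  have := h.2
  rw [cnt_zero] at this; omega

lemma idx_add {A : Fin S.d} {m : ℕ} {x : ℝ} (h : S.AG A m x) (r : ℕ) :
    cnt (S.AG A) (m + r) x = cnt (S.AG A) m x + cnt (S.AG A) r (S.g^[m] x) :=
  cnt_add fun s => S.AG_shift h.1 s

lemma Pc_map {s j : ℕ} {x y : ℝ} (h : y ∈ S.Pc (s + j) x) : S.g^[s] y ∈ S.Pc j (S.g^[s] x) := by
  have hx : x ∈ S.O (s + j) := by
    by_contra hx
    rw [show S.Pc (s + j) x = ∅ from connectedComponentIn_eq_empty hx] at h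
    exact h
  have h1 : S.g^[s] '' S.Pc (s + j) x ⊆ S.Pc j (S.g^[s] x) := by
    refine IsPreconnected.subset_connectedComponentIn ?_ (mem_image_of_mem _ (S.mem_Pc hx)) ?_
    · exact isPreconnected_connectedComponentIn.image _ (S.cont_it s).continuousOn
    · rintro _ ⟨z, hz, rfl⟩
      exact ((S.O_add s j z).1 (S.Pc_sub _ _ hz)).2
  exact h1 (mem_image_of_mem _ h)

variable (S) in
open Classical in
/-- single term of the block cocycle -/
noncomputable def gt (A : Fin S.d) (k : ℕ) (lam : ℝ → ℝ) (κ t s : ℕ) (x : ℝ) : ℝ :=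
  if S.AG A s x ∧ κ ≤ cnt (S.AG A) s x ∧ k ∣ cnt (S.AG A) s x - κ ∧ cnt (S.AG A) s x + k ≤ cnt (S.AG A) t x
    then lam (S.g^[s] x) else 0

variable (S) in
noncomputable def GG (A : Fin S.d) (k : ℕ) (lam : ℝ → ℝ) (κ t : ℕ) (x : ℝ) : ℝ :=
  ∑ s ∈ Finset.range (t + 1), S.gt A k lam κ t s x

variable {A : Fin S.d} {k : ℕ} {lam : ℝ → ℝ}

lemma exists_PK {t s : ℕ} {x : ℝ} (hk : 1 ≤ k) (hs : s ≤ t) (h : S.AG A s x)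
    (h2 : cnt (S.AG A) s x + k ≤ cnt (S.AG A) t x) :
    ∃ j, 0 < j ∧ s + j ≤ t ∧ S.PK A k j (S.g^[s] x) := by
  obtain ⟨r, rfl⟩ := Nat.exists_eq_add_of_le hs
  rw [idx_add h] at h2
  obtain ⟨j, h3, h4, h5⟩ := cnt_exists hk (by omega : k ≤ cnt (S.AG A) r (S.g^[s] x))
  exact ⟨j, h3, by omega, h5⟩

lemma GG_congr (hk : 1 ≤ k) (hlam : ∀ j x y, S.PK A k j x → y ∈ S.Pc j x → lam x = lam y)
    (κ t : ℕ) {x y : ℝ} (h : y ∈ S.Pc t x) : S.GG A k lam κ t x = S.GG A k lam κ t y := by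
  classical
  refine Finset.sum_congr rfl fun s hs => ?_
  rw [Finset.mem_range] at hs
  unfold gt
  have e1 : cnt (S.AG A) s x = cnt (S.AG A) s y := cnt_congr fun i hi => S.AG_congr (by omega) h
  have e2 : cnt (S.AG A) t x = cnt (S.AG A) t y := cnt_congr fun i hi => S.AG_congr hi h
  have e3 : S.AG A s x ↔ S.AG A s y := S.AG_congr (by omega) h
  by_cases hc : S.AG A s x ∧ κ ≤ cnt (S.AG A) s x ∧ k ∣ cnt (S.AG A) s x - κ ∧
      cnt (S.AG A) s x + k ≤ cnt (S.AG A) t x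
  · obtain ⟨j, -, hj, hP⟩ := exists_PK hk (by omega) hc.1 hc.2.2.2
    rw [if_pos hc, if_pos (by rw [← e1, ← e2, ← e3]; exact hc)]
    exact hlam j _ _ hP (Pc_map (S.Pc_anti hj x h))
  · rw [if_neg hc, if_neg (by rw [← e1, ← e2, ← e3]; exact hc)]

lemma gt_shift {m κ : ℕ} {x : ℝ} (h : S.AG A m x) (h1 : κ ≤ cnt (S.AG A) m x) (h2 : k ∣ cnt (S.AG A) m x - κ)
    (r s : ℕ) : S.gt A k lam κ (m + r) (m + s) x = S.gt A k lam 0 r s (S.g^[m] x) := by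
  classical
  unfold gt
  rw [idx_add h, idx_add h, S.AG_shift h.1, ← Function.iterate_add_apply, add_comm s m]
  congr 1
  have : k ∣ cnt (S.AG A) m x + cnt (S.AG A) s (S.g^[m] x) - κ ↔ k ∣ cnt (S.AG A) s (S.g^[m] x) - 0 := by
    rw [Nat.sub_zero, Nat.sub_add_comm h1, Nat.dvd_add_right h2]
  rw [this]
  refine propext (and_congr_right fun _ => ?_)
  constructor
  · rintro ⟨-, a, b⟩; exact ⟨by omega, a, by omega⟩
  · rintro ⟨-, a, b⟩; exact ⟨by omega, a, by omega⟩

lemma GG_split {m κ : ℕ} {x : ℝ} (h : S.AG A m x) (h1 : κ ≤ cnt (S.AG A) m x) (h2 : k ∣ cnt (S.AG A) m x - κ)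
    (r : ℕ) : S.GG A k lam κ (m + r) x =
      ∑ s ∈ Finset.range m, S.gt A k lam κ (m + r) s x + S.GG A k lam 0 r (S.g^[m] x) := by
  unfold GG
  rw [add_assoc, Finset.sum_range_add]
  congr 1
  exact Finset.sum_congr rfl fun s _ => gt_shift h h1 h2 r s

lemma GG_start {m κ : ℕ} {x : ℝ} (h : S.PK A κ m x) (r : ℕ) :
    S.GG A k lam κ (m + r) x = S.GG A k lam 0 r (S.g^[m] x) := by
  classical
  rw [GG_split h.1 h.2.ge (by rw [h.2]; simp), Finset.sum_eq_zero, zero_add]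
  intro s hs
  rw [Finset.mem_range] at hs
  have := cnt_lt hs h.1
  rw [h.2] at this
  unfold gt
  rw [if_neg]
  rintro ⟨-, a, -⟩; omega

lemma GG_block {m : ℕ} {x : ℝ} (hk : 1 ≤ k) (h0 : x ∈ S.cell A) (h : S.PK A k m x) (r : ℕ) :
    S.GG A k lam 0 (m + r) x = lam x + S.GG A k lam 0 r (S.g^[m] x) := by
  classical
  rw [GG_split h.1 (Nat.zero_le _) (by rw [h.2]; simp)]
  congr 1
  have hm := PK_pos hk h
  rw [Finset.sum_eq_single_of_mem 0 (by simpa using hm)]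
  · unfold gt
    rw [if_pos]
    · rfl
    · refine ⟨⟨S.Gd_zero h0, h0⟩, Nat.zero_le _, by simp [cnt_zero], ?_⟩
      have := cnt_mono (S.AG A) x (Nat.le_add_right m r)
      dsimp only at this
      rw [h.2] at this
      rw [cnt_zero]; omega
  · intro s hs hs0
    rw [Finset.mem_range] at hs
    unfold gt
    rw [if_neg]
    rintro ⟨a, -, b, -⟩
    have h1 := cnt_lt hs h.1
    rw [h.2] at h1
    have h2 := cnt_lt (Nat.pos_of_ne_zero hs0) a
    rw [cnt_zero] at h2
    have := Nat.le_of_dvd (by omega) b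
    omega

lemma GG_zero {κ t : ℕ} {x : ℝ} (h : cnt (S.AG A) t x < κ + k) : S.GG A k lam κ t x = 0 := by
  classical
  refine Finset.sum_eq_zero fun s hs => ?_
  unfold gt
  rw [if_neg]
  rintro ⟨-, a, -, b⟩; omega

lemma GG_Q {κ t : ℕ} {x : ℝ} (h : ∀ s, ¬ S.AG A s x) : S.GG A k lam κ t x = 0 := by
  classical
  refine Finset.sum_eq_zero fun s hs => ?_
  unfold gt
  rw [if_neg]
  rintro ⟨a, -⟩; exact h s a

lemma GG_const {κ t n : ℕ} (htn : t ≤ n) {x : ℝ} (h : ∀ s, t < s → s ≤ n → ¬ S.AG A s x) :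
    S.GG A k lam κ n x = S.GG A k lam κ t x := by
  classical
  unfold GG
  obtain ⟨r, rfl⟩ := Nat.exists_eq_add_of_le htn
  rw [show t + r + 1 = (t + 1) + r by ring, Finset.sum_range_add]
  rw [Finset.sum_eq_zero (s := Finset.range r), add_zero]
  · refine Finset.sum_congr rfl fun s _ => ?_
    unfold gt
    rw [cnt_const htn h]
  · intro s hs
    rw [Finset.mem_range] at hs
    unfold gt
    rw [if_neg]
    rintro ⟨a, -⟩; exact h _ (by omega) (by omega) a

end Sys
end IntervalEnt

namespace IntervalEnt

namespace Ctx
variable {c : Ctx} {A : Fin c.S.d} {k : ℕ} {lam : ℝ → ℝ}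

lemma Ff_empty {κ m : ℕ} {A' C : Fin c.S.d} (h : C ≠ A) : c.S.Ff (c.S.PK A κ) m A' C = ∅ := by
  rw [Finset.eq_empty_iff_forall_notMem]
  intro J hJ
  rw [c.S.mem_Ff] at hJ
  have hG := c.S.FP_sub _ _ _ _ hJ
  have hp := pt_mem (c.S.GP_nonempty hG)
  exact h (c.S.cell_disj (c.S.GP_mem hG hp).2.2.1 (c.S.FP_mem Sys.PK_congr hJ hp).2.1.1.2)

lemma split_sum {η C : ℝ} (hC : ∀ n A B, c.S.N n A B ≤ C * Real.exp (n * (c.H + η)))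
    {κ κ' : ℕ} (hκ : 1 ≤ κ') (hκ' : κ' ≤ κ + k) (t : ℕ) (A' B : Fin c.S.d) :
    ∑ E ∈ c.S.Gf t A' B, Real.exp (c.S.GG A k lam κ t (pt E)) * Real.exp (-(t * (c.H + η))) ≤
      C + ∑ m ∈ Finset.Icc 1 t, ∑ J ∈ c.S.Ff (c.S.PK A κ') m A' A, ∑ D ∈ c.S.Gf (t - m) A B,
        Real.exp (c.S.GG A k lam κ t (pt (c.S.cat m J D))) * Real.exp (-(t * (c.H + η))) := by
  classical
  have hdec := c.S.decomp_sum (c.S.PK A κ') Sys.PK_congr Sys.PK_Gd t A' B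
    (fun E => Real.exp (c.S.GG A k lam κ t (pt E)) * Real.exp (-(t * (c.H + η))))
  rw [← Finset.sum_filter_add_sum_filter_not (c.S.Gf t A' B) (fun E => ∃ x ∈ E, ∃ s, 0 < s ∧ s ≤ t ∧ c.S.PK A κ' s x),
    add_comm]
  refine add_le_add ?_ (le_of_eq ?_)
  · calc _ ≤ ∑ E ∈ c.S.Gf t A' B with ¬ ∃ x ∈ E, ∃ s, 0 < s ∧ s ≤ t ∧ c.S.PK A κ' s x, Real.exp (-(t * (c.H + η))) := by
          refine Finset.sum_le_sum fun E hE => le_of_eq ?_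
          rw [Finset.mem_filter, c.S.mem_Gf] at hE
          have hp := pt_mem (c.S.GP_nonempty hE.1)
          rw [Sys.GG_zero, Real.exp_zero, one_mul]
          by_contra hlt
          push Not at hlt
          obtain ⟨s, h1, h2, h3⟩ := cnt_exists hκ (hκ'.trans hlt)
          exact hE.2 ⟨_, hp, s, h1, h2, h3⟩
      _ ≤ ∑ E ∈ c.S.Gf t A' B, Real.exp (-(t * (c.H + η))) :=
          Finset.sum_le_sum_of_subset_of_nonneg (Finset.filter_subset _ _) fun _ _ _ => (Real.exp_pos _).le
      _ = c.S.N t A' B * Real.exp (-(t * (c.H + η))) := by rw [Finset.sum_const, nsmul_eq_mul]; rfl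
      _ ≤ C * Real.exp (t * (c.H + η)) * Real.exp (-(t * (c.H + η))) :=
          mul_le_mul_of_nonneg_right (hC t A' B) (Real.exp_pos _).le
      _ = C := by rw [mul_assoc, ← Real.exp_add]; simp
  · refine Eq.trans ?_ (hdec.trans ?_)
    · congr
    · refine Finset.sum_congr rfl fun m _ => ?_
      rw [Finset.sum_eq_single_of_mem A (Finset.mem_univ _)]
      intro C' _ hC'
      rw [Ff_empty hC', Finset.sum_empty]

lemma M0_sum (hk : 1 ≤ k) (hlam : ∀ j x y, c.S.PK A k j x → y ∈ c.S.Pc j x → lam x = lam y)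
    (hkr : ∀ n, ∑ m ∈ Finset.Icc 1 n, ∑ J ∈ c.S.Ff (c.S.PK A k) m A A, Real.exp (lam (pt J)) * Real.exp (-(m * c.H)) ≤ 1)
    {η C : ℝ} (hη : 0 < η) (hC0 : 0 ≤ C) (hC : ∀ n A B, c.S.N n A B ≤ C * Real.exp (n * (c.H + η))) (B : Fin c.S.d) (t : ℕ) :
    ∑ E ∈ c.S.Gf t A B, Real.exp (c.S.GG A k lam 0 t (pt E)) * Real.exp (-(t * (c.H + η))) ≤ C * (t + 1) := by
  induction t using Nat.strong_induction_on with
  | _ t ih =>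
  refine (split_sum hC hk (by omega) t A B).trans ?_
  have key : ∀ m ∈ Finset.Icc 1 t, ∀ J ∈ c.S.Ff (c.S.PK A k) m A A, ∑ D ∈ c.S.Gf (t - m) A B,
        Real.exp (c.S.GG A k lam 0 t (pt (c.S.cat m J D))) * Real.exp (-(t * (c.H + η))) ≤
        (Real.exp (lam (pt J)) * Real.exp (-(m * c.H))) * (C * t) := by
    intro m hm J hJ
    rw [Finset.mem_Icc] at hm
    rw [c.S.mem_Ff] at hJ
    have hG := c.S.FP_sub _ _ _ _ hJ
    calc _ ≤ ∑ D ∈ c.S.Gf (t - m) A B, (Real.exp (lam (pt J)) * Real.exp (-(m * c.H))) *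
          (Real.exp (c.S.GG A k lam 0 (t - m) (pt D)) * Real.exp (-(((t - m : ℕ):ℝ) * (c.H + η)))) := by
          refine Finset.sum_le_sum fun D hD => ?_
          rw [c.S.mem_Gf] at hD
          obtain ⟨a1, a2, a3⟩ := c.S.cat_pt hG hD
          have hP := (c.S.FP_mem Sys.PK_congr hJ a1).2.1
          have e1 : c.S.GG A k lam 0 t (pt (c.S.cat m J D)) = lam (pt J) + c.S.GG A k lam 0 (t - m) (pt D) := by
            conv_lhs => rw [← Nat.add_sub_cancel' hm.2]
            rw [Sys.GG_block hk (c.S.GP_mem hG a1).1 hP, Sys.GG_congr hk hlam 0 (t - m) a3]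
            congr 1
            refine hlam m _ _ hP ?_
            rw [← (c.S.GP_mem hG a1).2.2.2]
            exact pt_mem (c.S.GP_nonempty hG)
          rw [e1, ← Real.exp_add, ← Real.exp_add, ← Real.exp_add, ← Real.exp_add, Real.exp_le_exp]
          rw [Nat.cast_sub hm.2]
          have : (0:ℝ) ≤ m * η := by positivity
          linarith
      _ ≤ _ := by
          rw [← Finset.mul_sum]
          refine mul_le_mul_of_nonneg_left ((ih (t - m) (by omega)).trans ?_) (by positivity)
          refine mul_le_mul_of_nonneg_left ?_ hC0
          exact_mod_cast (by omega : t - m + 1 ≤ t)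
  calc _ ≤ C + ∑ m ∈ Finset.Icc 1 t, ∑ J ∈ c.S.Ff (c.S.PK A k) m A A,
        (Real.exp (lam (pt J)) * Real.exp (-(m * c.H))) * (C * t) := by
        exact add_le_add_right (Finset.sum_le_sum fun m hm => Finset.sum_le_sum fun J hJ => key m hm J hJ) C
    _ ≤ C + 1 * (C * t) := by
        have e : ∑ m ∈ Finset.Icc 1 t, ∑ J ∈ c.S.Ff (c.S.PK A k) m A A,
            (Real.exp (lam (pt J)) * Real.exp (-(m * c.H))) * (C * t) = (∑ m ∈ Finset.Icc 1 t,
            ∑ J ∈ c.S.Ff (c.S.PK A k) m A A, Real.exp (lam (pt J)) * Real.exp (-(m * c.H))) * (C * t) := by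
          rw [Finset.sum_mul]
          exact Finset.sum_congr rfl fun m _ => (Finset.sum_mul _ _ _).symm
        rw [e]
        exact add_le_add_right (mul_le_mul_of_nonneg_right (hkr t) (mul_nonneg hC0 (Nat.cast_nonneg t))) C
    _ = _ := by ring

lemma Mk_sum (hk : 1 ≤ k) (hlam : ∀ j x y, c.S.PK A k j x → y ∈ c.S.Pc j x → lam x = lam y)
    (hkr : ∀ n, ∑ m ∈ Finset.Icc 1 n, ∑ J ∈ c.S.Ff (c.S.PK A k) m A A, Real.exp (lam (pt J)) * Real.exp (-(m * c.H)) ≤ 1)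
    {η C : ℝ} (hη : 0 < η) (hC0 : 1 ≤ C) (hC : ∀ n A B, c.S.N n A B ≤ C * Real.exp (n * (c.H + η)))
    {κ : ℕ} (hκ : 1 ≤ κ) (A' B : Fin c.S.d) (t : ℕ) :
    ∑ E ∈ c.S.Gf t A' B, Real.exp (c.S.GG A k lam κ t (pt E)) * Real.exp (-(t * (c.H + η))) ≤ C ^ 2 * (t + 1) ^ 2 := by
  refine (split_sum hC hκ (by omega) t A' B).trans ?_
  have key : ∀ m ∈ Finset.Icc 1 t, ∑ J ∈ c.S.Ff (c.S.PK A κ) m A' A, ∑ D ∈ c.S.Gf (t - m) A B,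
        Real.exp (c.S.GG A k lam κ t (pt (c.S.cat m J D))) * Real.exp (-(t * (c.H + η))) ≤ C * (C * (t + 1)) := by
    intro m hm
    rw [Finset.mem_Icc] at hm
    have h1 : ∀ J ∈ c.S.Ff (c.S.PK A κ) m A' A, ∑ D ∈ c.S.Gf (t - m) A B,
        Real.exp (c.S.GG A k lam κ t (pt (c.S.cat m J D))) * Real.exp (-(t * (c.H + η))) ≤
          Real.exp (-(m * (c.H + η))) * (C * (t + 1)) := by
      intro J hJ
      rw [c.S.mem_Ff] at hJ
      have hG := c.S.FP_sub _ _ _ _ hJ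
      calc _ = ∑ D ∈ c.S.Gf (t - m) A B, Real.exp (-(m * (c.H + η))) *
            (Real.exp (c.S.GG A k lam 0 (t - m) (pt D)) * Real.exp (-(((t - m : ℕ):ℝ) * (c.H + η)))) := by
            refine Finset.sum_congr rfl fun D hD => ?_
            rw [c.S.mem_Gf] at hD
            obtain ⟨a1, a2, a3⟩ := c.S.cat_pt hG hD
            have hP := (c.S.FP_mem Sys.PK_congr hJ a1).2.1
            have e1 : c.S.GG A k lam κ t (pt (c.S.cat m J D)) = c.S.GG A k lam 0 (t - m) (pt D) := by
              conv_lhs => rw [← Nat.add_sub_cancel' hm.2]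
              rw [Sys.GG_start hP, Sys.GG_congr hk hlam 0 (t - m) a3]
            rw [e1, ← Real.exp_add, ← Real.exp_add, ← Real.exp_add, Nat.cast_sub hm.2]
            congr 1; ring
        _ ≤ _ := by
            rw [← Finset.mul_sum]
            refine mul_le_mul_of_nonneg_left ((M0_sum hk hlam hkr hη (by linarith) hC B (t - m)).trans ?_) (by positivity)
            refine mul_le_mul_of_nonneg_left ?_ (by linarith)
            exact_mod_cast (by omega : t - m + 1 ≤ t + 1)
    refine (Finset.sum_le_sum h1).trans ?_
    rw [Finset.sum_const, nsmul_eq_mul]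
    have h2 : ((c.S.Ff (c.S.PK A κ) m A' A).card : ℝ) ≤ C * Real.exp (m * (c.H + η)) := by
      refine le_trans ?_ (hC m A' A)
      unfold Sys.N
      exact_mod_cast Finset.card_le_card (c.S.Ff_sub _ _ _ _)
    calc _ ≤ C * Real.exp (m * (c.H + η)) * (Real.exp (-(m * (c.H + η))) * (C * (t + 1))) :=
          mul_le_mul_of_nonneg_right h2 (by positivity)
      _ = C * (Real.exp (m * (c.H + η)) * Real.exp (-(m * (c.H + η)))) * (C * (t + 1)) := by ring
      _ = _ := by rw [← Real.exp_add]; simp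
  refine (add_le_add_right (Finset.sum_le_sum key) C).trans ?_
  rw [Finset.sum_const, nsmul_eq_mul, Nat.card_Icc]
  have ht : (0:ℝ) ≤ t := by positivity
  simp only [Nat.add_sub_cancel]
  have h3 : C ≤ C ^ 2 := by nlinarith
  nlinarith [mul_nonneg ht (sq_nonneg C)]

end Ctx
end IntervalEnt

namespace IntervalEnt

lemma cnt_meas {T : ℕ → ℝ → Prop} (hT : ∀ s, MeasurableSet {x | T s x}) (n : ℕ) : Measurable (cnt T n) := by
  classical
  have : cnt T n = fun x => ∑ s ∈ Finset.range n, if T (s + 1) x then 1 else 0 := by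
    funext x; unfold cnt; rfl
  rw [this]
  exact Finset.measurable_fun_sum _ fun s _ => Measurable.ite (hT _) measurable_const measurable_const

lemma cnt_set {T : ℕ → ℝ → Prop} (hT : ∀ s, MeasurableSet {x | T s x}) (n n' : ℕ) (R : ℕ → ℕ → Prop) :
    MeasurableSet {x | R (cnt T n x) (cnt T n' x)} := by
  have h : Measurable fun x => (cnt T n x, cnt T n' x) := (cnt_meas hT n).prodMk (cnt_meas hT n')
  exact h (MeasurableSet.of_discrete (s := {p : ℕ × ℕ | R p.1 p.2}))

namespace Ctx
variable {c : Ctx} {A : Fin c.S.d} {k : ℕ} {lam : ℝ → ℝ}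

lemma AG_meas (s : ℕ) : MeasurableSet {x | c.S.AG A s x} := (c.S.AG_open A s).measurableSet

lemma gt_int (m : Measure ℝ) [IsProbabilityMeasure m] (hl : Measurable lam) {L : ℝ} (hL : ∀ x, |lam x| ≤ L) (κ t s : ℕ) :
    Integrable (c.S.gt A k lam κ t s) m := by
  classical
  have h1 : MeasurableSet {x | c.S.AG A s x ∧ κ ≤ cnt (c.S.AG A) s x ∧ k ∣ cnt (c.S.AG A) s x - κ ∧
      cnt (c.S.AG A) s x + k ≤ cnt (c.S.AG A) t x} :=
    (AG_meas s).inter (cnt_set AG_meas s t fun a b => κ ≤ a ∧ k ∣ a - κ ∧ a + k ≤ b)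
  have h2 : Measurable (c.S.gt A k lam κ t s) := by
    unfold Sys.gt
    exact Measurable.ite h1 (hl.comp (c.S.cont_it s).measurable) measurable_const
  refine Integrable.of_bound h2.aestronglyMeasurable L (Eventually.of_forall fun x => ?_)
  rw [Real.norm_eq_abs]
  unfold Sys.gt
  split_ifs
  · exact hL _
  · rw [abs_zero]; exact (abs_nonneg _).trans (hL 0)

lemma GG_int (m : Measure ℝ) [IsProbabilityMeasure m] (hl : Measurable lam) {L : ℝ} (hL : ∀ x, |lam x| ≤ L) (κ t : ℕ) :
    Integrable (c.S.GG A k lam κ t) m :=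
  integrable_finsetSum _ fun s _ => gt_int m hl hL κ t s

lemma GG_bound {m : Measure ℝ} (hm : c.MM m) (hk : 1 ≤ k)
    (hlam : ∀ j x y, c.S.PK A k j x → y ∈ c.S.Pc j x → lam x = lam y)
    (hkr : ∀ n, ∑ m ∈ Finset.Icc 1 n, ∑ J ∈ c.S.Ff (c.S.PK A k) m A A, Real.exp (lam (pt J)) * Real.exp (-(m * c.H)) ≤ 1)
    (hl : Measurable lam) {L : ℝ} (hL : ∀ x, |lam x| ≤ L) {η : ℝ} (hη : 0 < η) :
    ∃ C : ℝ, ∀ n : ℕ, ∀ κ, 1 ≤ κ → ∫ x, c.S.GG A k lam κ n x ∂m ≤ C + n * η := by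
  have := hm.prob
  obtain ⟨C2, hC20, hC2⟩ := c.growth_app.1 (η / 4) (by linarith)
  obtain ⟨C, hC⟩ := hm.code (η / 4) (by linarith)
  obtain ⟨C1, hC1, hpoly⟩ := poly_exp 3 (η / 4) (by linarith)
  set C3 := C2 + 1 with hC3
  have hC31 : 1 ≤ C3 := by linarith
  have hC3N : ∀ n A B, c.S.N n A B ≤ C3 * Real.exp (n * (c.H + η / 4)) := fun n A B =>
    (hC2 n A B).trans (mul_le_mul_of_nonneg_right (by linarith) (Real.exp_pos _).le)
  have hd1 : (1:ℝ) ≤ c.S.d := by exact_mod_cast c.S.hd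
  have hG1 := c.S.hGam
  have hG0 : 0 < c.S.Gam := by linarith
  have hlG : Real.log c.S.Gam ≤ c.H := by
    have h1 : Real.log c.S.Gam < c.H / 2 := (Real.log_lt_iff_lt_exp hG0).2 (lt_trans (by linarith) c.GamH)
    linarith [c.H0]
  set D : ℝ := c.S.d ^ 2 * C3 ^ 2 with hD
  have hD1 : 1 ≤ D := one_le_mul_of_one_le_of_one_le (one_le_pow₀ hd1) (one_le_pow₀ hC31)
  refine ⟨C + Real.log D + Real.log C1, fun n κ hκ => ?_⟩
  have hGi := GG_int (A := A) (k := k) m hl hL κ n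
  set Z : ℝ := D * (n + 1) ^ 3 with hZ
  have hn1 : (1:ℝ) ≤ n + 1 := by linarith [(Nat.cast_nonneg n : (0:ℝ) ≤ n)]
  have hZ1 : 1 ≤ Z := one_le_mul_of_one_le_of_one_le hD1 (one_le_pow₀ hn1)
  have hlZ : Real.log Z ≤ Real.log D + Real.log C1 + n * (η / 4) := by
    have h2 := Real.log_le_log (by positivity) (hpoly n)
    rw [Real.log_mul (by positivity) (Real.exp_pos _).ne', Real.log_exp] at h2
    rw [hZ, Real.log_mul (by positivity) (by positivity)]
    linarith
  have key := hC n (fun t x => c.S.Gam⁻¹ ^ (n - t) * (Real.exp (c.S.GG A k lam κ t x) * Real.exp (-(t * (c.H + η / 4))))) Z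
    (fun x => Real.log Z + n * (c.H + η / 4) - c.S.GG A k lam κ n x) (fun t x => by positivity) ?_ (by positivity) ?_ ?_ ?_ ?_
  · rw [integral_sub (integrable_const _) hGi] at key
    simp only [integral_const, probReal_univ, smul_eq_mul, one_mul] at key
    have h5 : (0:ℝ) ≤ n * η := by positivity
    nlinarith
  · intro t x y h
    rw [Sys.GG_congr hk hlam κ t h]
  · calc _ ≤ ∑ t ∈ Finset.range (n + 1), ∑ A : Fin c.S.d, ∑ B : Fin c.S.d, C3 ^ 2 * ((n:ℝ) + 1) ^ 2 := by
          refine Finset.sum_le_sum fun t ht => Finset.sum_le_sum fun A' _ => Finset.sum_le_sum fun B _ => ?_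
          rw [Finset.mem_range] at ht
          have e : ∀ y : ℝ, c.S.Gam ^ (n - t) * (c.S.Gam⁻¹ ^ (n - t) * y) = y := by
            intro y
            rw [← mul_assoc, ← mul_pow, mul_inv_cancel₀ hG0.ne', one_pow, one_mul]
          simp only [e]
          refine (Mk_sum hk hlam hkr (by linarith) hC31 hC3N hκ A' B t).trans ?_
          have : (t:ℝ) ≤ n := by exact_mod_cast (by omega : t ≤ n)
          gcongr
      _ = Z := by
          simp only [Finset.sum_const, Finset.card_range, Finset.card_univ, Fintype.card_fin, nsmul_eq_mul]
          push_cast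
          rw [hZ, hD]; ring
  · exact (integrable_const _).sub hGi
  · intro x hx hQ
    have htl := c.S.tl_le n x
    have e1 : c.S.GG A k lam κ n x = c.S.GG A k lam κ (c.S.tl n x) x :=
      Sys.GG_const htl fun s h1 h2 h3 => c.S.tl_max n x s h1 h2 h3.1
    rw [Real.log_mul (x := c.S.Gam⁻¹ ^ _) (by positivity) (by positivity), Real.log_mul (x := Real.exp _) (by positivity)
      (by positivity), Real.log_exp, Real.log_exp,
      Real.log_pow, Real.log_inv, e1, Nat.cast_sub htl]
    have h2 : (c.S.tl n x : ℝ) ≤ n := by exact_mod_cast htl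
    have h3 := mul_le_mul_of_nonneg_left hlG (sub_nonneg.2 h2)
    have h4 : (c.S.tl n x : ℝ) * (η / 4) ≤ n * (η / 4) := mul_le_mul_of_nonneg_right h2 (by linarith)
    nlinarith
  · intro x _ hQ
    have : c.S.GG A k lam κ n x = 0 := by
      refine Sys.GG_Q fun s hs => ?_
      have h0 : x ∈ c.S.O 0 := c.S.O_anti (Nat.zero_le s) hs.1.1
      exact absurd hQ (by simpa using h0.2.1 0 le_rfl)
    rw [this, sub_zero]
    have h1 := Real.log_nonneg hZ1
    have h2 := c.H0
    positivity

end Ctx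
end IntervalEnt

namespace IntervalEnt

lemma phase_sum {k : ℕ} (hk : 1 ≤ k) (i : ℕ) (hi : 1 ≤ i) (a : ℝ) :
    ∑ κ ∈ Finset.Icc 1 k, (if κ ≤ i ∧ k ∣ i - κ then a else 0) = a := by
  rw [Finset.sum_eq_single_of_mem ((i - 1) % k + 1)]
  · rw [if_pos]
    have h1 := Nat.mod_add_div (i - 1) k
    refine ⟨by have := Nat.mod_le (i - 1) k; omega, ⟨(i - 1) / k, by omega⟩⟩
  · rw [Finset.mem_Icc]
    have := Nat.mod_lt (i - 1) (by omega : k > 0)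
    omega
  · intro κ hκ hne
    rw [Finset.mem_Icc] at hκ
    rw [if_neg]
    rintro ⟨h1, q, hq⟩
    apply hne
    have h2 : i - 1 = (κ - 1) + k * q := by omega
    rw [h2, Nat.add_mul_mod_self_left, Nat.mod_eq_of_lt (by omega)]
    omega

open Classical in
lemma drop_card {T : ℕ → ℝ → Prop} (n k : ℕ) (x : ℝ) :
    ∑ s ∈ Finset.range n, (if T (s + 1) x ∧ cnt T n x < cnt T (s + 1) x + k then (1:ℝ) else 0) ≤ k := by
  rw [← Finset.sum_filter, Finset.sum_const, nsmul_eq_mul, mul_one]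
  have h : ((Finset.range n).filter fun s => T (s + 1) x ∧ cnt T n x < cnt T (s + 1) x + k).card ≤
      (Finset.Ioc (cnt T n x) (cnt T n x + k)).card := by
    refine Finset.card_le_card_of_injOn (fun s => cnt T (s + 1) x + k) ?_ ?_
    · intro s hs
      simp only [Finset.coe_filter, Finset.mem_range, mem_ofPred_eq] at hs
      have := cnt_mono T x (by omega : s + 1 ≤ n)
      dsimp only at this
      simp only [Finset.coe_Ioc, mem_Ioc]
      omega
    · intro s hs t ht hst
      simp only [Finset.coe_filter, Finset.mem_range, mem_ofPred_eq] at hs ht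
      dsimp only at hst
      rcases lt_trichotomy s t with h | h | h
      · have := cnt_lt (by omega : s + 1 < t + 1) ht.2.1; omega
      · exact h
      · have := cnt_lt (by omega : t + 1 < s + 1) hs.2.1; omega
  rw [Nat.card_Ioc, Nat.add_sub_cancel_left] at h
  exact_mod_cast h

namespace Ctx
variable {c : Ctx} {A : Fin c.S.d} {k : ℕ}

open Classical in
lemma phase_GG {lam : ℝ → ℝ} (hk : 1 ≤ k) (n : ℕ) (x : ℝ) : ∑ κ ∈ Finset.Icc 1 k, c.S.GG A k lam κ n x =
    ∑ s ∈ Finset.range n, (if c.S.AG A (s + 1) x ∧ cnt (c.S.AG A) (s + 1) x + k ≤ cnt (c.S.AG A) n x then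
      lam (c.S.g^[s + 1] x) else 0) := by
  unfold Sys.GG
  rw [Finset.sum_comm, Finset.sum_range_succ']
  have h0 : ∑ κ ∈ Finset.Icc 1 k, c.S.gt A k lam κ n 0 x = 0 := by
    refine Finset.sum_eq_zero fun κ hκ => ?_
    rw [Finset.mem_Icc] at hκ
    unfold Sys.gt
    rw [if_neg]
    rintro ⟨-, h, -⟩
    rw [cnt_zero] at h; omega
  rw [h0, add_zero]
  refine Finset.sum_congr rfl fun s _ => ?_
  by_cases h : c.S.AG A (s + 1) x ∧ cnt (c.S.AG A) (s + 1) x + k ≤ cnt (c.S.AG A) n x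
  · rw [if_pos h]
    have h1 := cnt_lt (Nat.succ_pos s) h.1
    rw [cnt_zero] at h1
    rw [← phase_sum hk (cnt (c.S.AG A) (s + 1) x) h1 (lam (c.S.g^[s + 1] x))]
    refine Finset.sum_congr rfl fun κ _ => ?_
    unfold Sys.gt
    congr 1
    exact propext ⟨fun a => ⟨a.2.1, a.2.2.1⟩, fun a => ⟨h.1, a.1, a.2, h.2⟩⟩
  · rw [if_neg h]
    refine Finset.sum_eq_zero fun κ hκ => ?_
    unfold Sys.gt
    rw [if_neg]
    rintro ⟨a, -, -, b⟩; exact h ⟨a, b⟩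

open Classical in
lemma A2 {m : Measure ℝ} (hm : c.MM m) (hk : 1 ≤ k)
    (hK : ∀ n, ∑ m ∈ Finset.Icc 1 n, ((c.S.Ff (c.S.PK A k) m A A).card : ℝ) * Real.exp (-(m * c.H)) ≤ 1)
    {V : Set ℝ} (hV : MeasurableSet V) (hsat : ∀ j x y, c.S.PK A k j x → y ∈ c.S.Pc j x → (x ∈ V ↔ y ∈ V))
    {b : ℝ} (hb : ∀ n, ∑ m ∈ Finset.Icc 1 n, (((c.S.Ff (c.S.PK A k) m A A).filter fun J => pt J ∈ V).card : ℝ) *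
      Real.exp (-(m * c.H)) ≤ b) : c.al m A V ≤ b * c.al m A univ := by
  have := hm.prob
  have hb0 : 0 ≤ b := by simpa using hb 0
  have hU := c.al_nonneg m A univ
  suffices hs : ∀ σ : ℝ, 0 < σ → Real.log (1 + σ) * c.al m A V ≤ Real.log (1 + σ * b) * c.al m A univ by
    have h1 : ∀ σ : ℝ, 0 < σ → c.al m A V ≤ (1 + σ) * (b * c.al m A univ) := by
      intro σ hσ
      have h2 := hs σ hσ
      have h3 : Real.log (1 + σ * b) ≤ σ * b := by
        have := Real.log_le_sub_one_of_pos (by positivity : 0 < 1 + σ * b); linarith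
      have h4 : σ / (1 + σ) ≤ Real.log (1 + σ) := by
        have := Real.one_sub_inv_le_log_of_pos (by positivity : 0 < 1 + σ)
        refine le_trans (le_of_eq ?_) this
        field_simp; ring
      have h5 : σ / (1 + σ) * c.al m A V ≤ σ * b * c.al m A univ :=
        (mul_le_mul_of_nonneg_right h4 (c.al_nonneg m A V)).trans (h2.trans (mul_le_mul_of_nonneg_right h3 hU))
      rw [div_mul_eq_mul_div, div_le_iff₀ (by positivity)] at h5
      have h6 : σ * c.al m A V ≤ σ * ((1 + σ) * (b * c.al m A univ)) := by linarith
      exact le_of_mul_le_mul_left h6 hσ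
    have h7 : Tendsto (fun σ : ℝ => (1 + σ) * (b * c.al m A univ)) (𝓝[>] 0) (𝓝 ((1 + 0) * (b * c.al m A univ))) := by
      refine Tendsto.mono_left ?_ nhdsWithin_le_nhds
      exact Continuous.tendsto (by fun_prop) 0
    have h8 := ge_of_tendsto h7 (eventually_mem_nhdsWithin.mono fun σ hσ => h1 σ hσ)
    linarith
  intro σ hσ
  set l1 := Real.log (1 + σ) with hl1
  set l := Real.log (1 + σ * b) with hl
  have hl10 : 0 ≤ l1 := Real.log_nonneg (by linarith)
  have hσb : 0 ≤ σ * b := by positivity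
  have hl0 : 0 ≤ l := Real.log_nonneg (by linarith)
  set lam : ℝ → ℝ := fun x => (if x ∈ V then l1 else 0) - l with hlam
  have hlm : Measurable lam := (Measurable.ite hV measurable_const measurable_const).sub measurable_const
  have hlb : ∀ x, |lam x| ≤ l1 + l := by
    intro x
    simp only [hlam]
    rw [abs_le]
    split_ifs <;> constructor <;> linarith
  have hls : ∀ j x y, c.S.PK A k j x → y ∈ c.S.Pc j x → lam x = lam y := by
    intro j x y h1 h2
    simp only [hlam, hsat j x y h1 h2]
  have hexp : ∀ x, Real.exp (lam x) = (1 + σ * (if x ∈ V then 1 else 0)) / (1 + σ * b) := by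
    intro x
    simp only [hlam]
    rw [Real.exp_sub, hl, Real.exp_log (by linarith)]
    congr 1
    split_ifs
    · rw [hl1, Real.exp_log (by linarith), mul_one]
    · simp
  have hkr : ∀ n, ∑ m ∈ Finset.Icc 1 n, ∑ J ∈ c.S.Ff (c.S.PK A k) m A A, Real.exp (lam (pt J)) * Real.exp (-(m * c.H)) ≤ 1 := by
    intro n
    have e : ∀ m ∈ Finset.Icc 1 n, ∑ J ∈ c.S.Ff (c.S.PK A k) m A A, Real.exp (lam (pt J)) * Real.exp (-(m * c.H)) =
        (((c.S.Ff (c.S.PK A k) m A A).card : ℝ) * Real.exp (-(m * c.H)) + σ *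
          ((((c.S.Ff (c.S.PK A k) m A A).filter fun J => pt J ∈ V).card : ℝ) * Real.exp (-(m * c.H)))) / (1 + σ * b) := by
      intro m _
      simp only [hexp]
      rw [← Finset.sum_mul, ← Finset.sum_div, Finset.sum_add_distrib, ← Finset.mul_sum, Finset.sum_ite]
      simp
      ring
    rw [Finset.sum_congr rfl e, ← Finset.sum_div, Finset.sum_add_distrib, ← Finset.mul_sum, div_le_one (by linarith)]
    exact add_le_add (hK n) (mul_le_mul_of_nonneg_left (hb n) hσ.le)
  have main : ∀ s0 : ℕ, ∀ η : ℝ, 0 < η → l1 * c.al m A V ≤ l * m.real (c.AE A univ s0) + k * η := by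
    intro s0 η hη
    by_contra hcon
    push Not at hcon
    obtain ⟨C, hC⟩ := GG_bound hm hk hls hkr hlm hlb hη
    refine lin_contra (sub_pos.2 hcon) (b := k * C + l1 * k + l * s0) fun n => ?_
    have hi1 := cnt_int (fun s x => c.S.AG A s x ∧ c.S.g^[s] x ∈ V) m (fun s => c.AE_meas A hV s) n
    have hi2 := cnt_int (fun s x => c.S.AG A s x ∧ c.S.g^[s] x ∈ univ) m (fun s => c.AE_meas A MeasurableSet.univ s) n
    have hpt : ∀ x, l1 * (cnt (fun s x => c.S.AG A s x ∧ c.S.g^[s] x ∈ V) n x : ℝ) -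
        l * (cnt (fun s x => c.S.AG A s x ∧ c.S.g^[s] x ∈ univ) n x : ℝ) - l1 * k ≤
        ∑ κ ∈ Finset.Icc 1 k, c.S.GG A k lam κ n x := by
      intro x
      rw [phase_GG hk]
      refine le_trans (sub_le_sub_left (mul_le_mul_of_nonneg_left (drop_card (T := c.S.AG A) n k x) hl10) _) ?_
      unfold cnt
      push_cast
      rw [Finset.mul_sum, Finset.mul_sum, Finset.mul_sum, ← Finset.sum_sub_distrib, ← Finset.sum_sub_distrib]
      refine Finset.sum_le_sum fun s _ => ?_
      by_cases h1 : c.S.AG A (s + 1) x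
      · by_cases h2 : cnt (c.S.AG A) (s + 1) x + k ≤ cnt (c.S.AG A) n x
        · have h3 : ¬ (cnt (c.S.AG A) n x < cnt (c.S.AG A) (s + 1) x + k) := by omega
          unfold cnt at h2 h3
          simp only [hlam, h1, h2, h3, true_and, and_true, mem_univ, if_true, if_false, mul_one, mul_zero, sub_zero, mul_ite]
          exact le_rfl
        · have h3 : (cnt (c.S.AG A) n x < cnt (c.S.AG A) (s + 1) x + k) := by omega
          unfold cnt at h2 h3
          simp only [h1, h2, h3, true_and, and_true, mem_univ, if_true, if_false, mul_one, and_false]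
          split_ifs <;> linarith
      · simp [h1]
    have hI := integral_mono (((hi1.1.const_mul l1).sub (hi2.1.const_mul l)).sub (integrable_const (l1 * (k:ℝ))))
      (integrable_finsetSum (Finset.Icc 1 k) fun κ _ => GG_int (A := A) (k := k) m hlm hlb κ n) hpt
    rw [integral_finsetSum _ fun κ _ => GG_int (A := A) (k := k) m hlm hlb κ n] at hI
    have hI2 : ∑ κ ∈ Finset.Icc 1 k, ∫ x, c.S.GG A k lam κ n x ∂m ≤ k * (C + n * η) := by
      calc _ ≤ ∑ κ ∈ Finset.Icc 1 k, (C + n * η) := by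
            refine Finset.sum_le_sum fun κ hκ => ?_
            exact hC n κ (Finset.mem_Icc.1 hκ).1
        _ = _ := by rw [Finset.sum_const, Nat.card_Icc, nsmul_eq_mul]; simp
    have hI3 := hI.trans hI2
    rw [integral_sub' ((hi1.1.const_mul l1).sub (hi2.1.const_mul l)) (integrable_const _),
      integral_sub' (hi1.1.const_mul l1) (hi2.1.const_mul l), integral_const_mul, integral_const_mul, hi1.2, hi2.2] at hI3
    simp only [integral_const, probReal_univ, smul_eq_mul, one_mul] at hI3
    have h5 := antitone_sum (c.AE_anti hm A MeasurableSet.univ) (fun s => measureReal_le_one) (fun s => measureReal_nonneg) s0 n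
    have h6 : n * c.al m A V ≤ ∑ s ∈ Finset.range n, m.real {x | c.S.AG A (s + 1) x ∧ c.S.g^[s + 1] x ∈ V} := by
      calc n * c.al m A V = ∑ s ∈ Finset.range n, c.al m A V := by simp
        _ ≤ _ := Finset.sum_le_sum fun s _ => c.al_le m A V (s + 1)
    have h7 := mul_le_mul_of_nonneg_left h6 hl10
    have h8 := mul_le_mul_of_nonneg_left h5 hl0
    have h9 : (∑ s ∈ Finset.range n, m.real (c.AE A univ (s + 1))) =
      ∑ s ∈ Finset.range n, m.real {x | c.S.AG A (s + 1) x ∧ c.S.g^[s + 1] x ∈ univ} := rfl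
    rw [h9] at h8
    linarith
  have main2 : ∀ s0 : ℕ, l1 * c.al m A V ≤ l * m.real (c.AE A univ s0) := by
    intro s0
    refine le_of_forall_pos_le_add fun ε hε => ?_
    have hk0 : (0:ℝ) < k := by exact_mod_cast hk
    have := main s0 (ε / k) (by positivity)
    rwa [mul_div_cancel₀ _ hk0.ne'] at this
  exact ge_of_tendsto' ((c.al_tendsto hm A MeasurableSet.univ).const_mul l) main2

end Ctx
end IntervalEnt

namespace IntervalEnt
namespace Ctx
variable {c : Ctx} {A : Fin c.S.d} {k : ℕ}

lemma few {m : Measure ℝ} (hm : c.MM m) (T : ℕ) :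
    T * c.al m A {y | cnt (c.S.AG A) T y < k} ≤ k := by
  classical
  have := hm.prob
  have hE : MeasurableSet {y | cnt (c.S.AG A) T y < k} := cnt_set AG_meas T T fun a _ => a < k
  have hi := cnt_int (fun s x => c.S.AG A s x ∧ c.S.g^[s] x ∈ {y | cnt (c.S.AG A) T y < k}) m
    (fun s => c.AE_meas A hE s) T
  calc T * c.al m A {y | cnt (c.S.AG A) T y < k} = ∑ s ∈ Finset.range T, c.al m A {y | cnt (c.S.AG A) T y < k} := by simp
    _ ≤ _ := Finset.sum_le_sum fun s _ => c.al_le m A _ (s + 1)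
    _ = _ := hi.2.symm
    _ ≤ ∫ x, (k:ℝ) ∂m := by
        refine integral_mono hi.1 (integrable_const _) fun x => ?_
        dsimp only
        refine le_trans ?_ (drop_card (T := c.S.AG A) T k x)
        rw [cnt]
        push_cast
        refine Finset.sum_le_sum fun s _ => ?_
        by_cases h : c.S.AG A (s + 1) x ∧ c.S.g^[s + 1] x ∈ {y | cnt (c.S.AG A) T y < k}
        · rw [if_pos h, if_pos]
          refine ⟨h.1, ?_⟩
          have h1 := h.2
          rw [mem_ofPred_eq] at h1
          have h2 := Sys.idx_add h.1 T
          have h3 := cnt_mono (c.S.AG A) x (by omega : T ≤ s + 1 + T)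
          dsimp only at h3
          omega
        · rw [if_neg h]; split_ifs <;> norm_num
    _ = k := by simp

lemma kraft_ren (hk : 1 ≤ k) : ∃ v : ℕ → ℝ, (∀ n, v n ≤ 1) ∧
    Ren v (fun m => ((c.S.Ff (c.S.PK A k) m A A).card : ℝ) * Real.exp (-(m * c.H))) := by
  classical
  let W : ℕ → Set ℝ → ℝ := fun n J => (if k ∣ cnt (c.S.AG A) n (pt J) then 1 else 0) * Real.exp (-(n * c.H))
  have hH0 := c.H0
  refine ⟨fun n => ∑ J ∈ c.S.Gf n A A, W n J, ?_, ?_, ?_, ?_, ?_⟩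
  · intro n
    have hN := c.S.N_le c.f c.q c.hfg c.hq (by rw [c.hh]; exact EReal.coe_ne_top _) n A
    rw [c.toReal] at hN
    calc _ ≤ ∑ J ∈ c.S.Gf n A A, Real.exp (-(n * c.H)) := by
          refine Finset.sum_le_sum fun J _ => ?_
          simp only [W]
          split_ifs
          · rw [one_mul]
          · rw [zero_mul]; positivity
      _ = c.S.N n A A * Real.exp (-(n * c.H)) := by rw [Finset.sum_const, nsmul_eq_mul]; rfl
      _ ≤ Real.exp (n * c.H) * Real.exp (-(n * c.H)) := mul_le_mul_of_nonneg_right hN (Real.exp_pos _).le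
      _ = 1 := by rw [← Real.exp_add]; simp
  · intro n; positivity
  · have : c.S.Ff (c.S.PK A k) 0 A A = ∅ := by
      rw [Finset.eq_empty_iff_forall_notMem]
      intro J hJ
      rw [c.S.mem_Ff] at hJ
      obtain ⟨x, -, h, -⟩ := hJ
      exact absurd h.1 (lt_irrefl 0)
    simp [this]
  · simp only [W, cnt_zero, dvd_zero, if_true, Finset.sum_const, nsmul_eq_mul]
    have := c.S.N_zero A A
    rw [if_pos rfl] at this
    unfold Sys.N at this
    rw [this]; simp
  · intro n
    have hfil : ∑ E ∈ c.S.Gf (n + 1) A A, W (n + 1) E =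
        ∑ E ∈ c.S.Gf (n + 1) A A with ∃ x ∈ E, ∃ s, 0 < s ∧ s ≤ n + 1 ∧ c.S.PK A k s x, W (n + 1) E := by
      rw [Finset.sum_filter]
      refine Finset.sum_congr rfl fun E hE => ?_
      split_ifs with h
      · rfl
      · rw [c.S.mem_Gf] at hE
        have hp := pt_mem (c.S.GP_nonempty hE)
        obtain ⟨-, h1, h2, -⟩ := c.S.GP_mem hE hp
        have h3 := cnt_lt (Nat.succ_pos n) (T := c.S.AG A) ⟨h1, h2⟩
        rw [cnt_zero] at h3
        simp only [W]
        rw [if_neg, zero_mul]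
        intro hdv
        obtain ⟨s, h4, h5, h6⟩ := cnt_exists hk (Nat.le_of_dvd h3 hdv)
        exact h ⟨_, hp, s, h4, h5, h6⟩
    rw [hfil]
    have hdec := c.S.decomp_sum (c.S.PK A k) Sys.PK_congr Sys.PK_Gd (n + 1) A A (W (n + 1))
    refine Eq.trans (by congr) (hdec.trans ?_)
    rw [Finset.range_eq_Ico, ← Finset.Ico_add_one_right_eq_Icc, ← Finset.sum_Ico_add' _ 0 (n + 1) 1]
    refine Finset.sum_congr rfl fun j hj => ?_
    rw [Finset.mem_Ico] at hj
    rw [Finset.sum_eq_single_of_mem A (Finset.mem_univ _)]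
    swap
    · intro C' _ hC'
      rw [Ff_empty hC', Finset.sum_empty]
    rw [mul_assoc, ← nsmul_eq_mul, ← Finset.sum_const]
    refine Finset.sum_congr rfl fun J hJ => ?_
    rw [Finset.mul_sum, show n + 1 - (j + 1) = n - j by omega]
    refine Finset.sum_congr rfl fun D hD => ?_
    rw [c.S.mem_Ff] at hJ
    rw [c.S.mem_Gf] at hD
    have hG := c.S.FP_sub _ _ _ _ hJ
    obtain ⟨a1, a2, a3⟩ := c.S.cat_pt hG hD
    have hP := (c.S.FP_mem Sys.PK_congr hJ a1).2.1
    have e1 : cnt (c.S.AG A) (n + 1) (pt (c.S.cat (j + 1) J D)) = k + cnt (c.S.AG A) (n - j) (pt D) := by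
      conv_lhs => rw [show n + 1 = (j + 1) + (n - j) by omega]
      rw [Sys.idx_add hP.1, hP.2]
      congr 1
      exact cnt_congr fun s hs => c.S.AG_congr hs a3
    simp only [W]
    simp only [e1, Nat.dvd_add_right (dvd_refl k)]
    have e2 : Real.exp (-(((n + 1 : ℕ):ℝ) * c.H)) = Real.exp (-(((j + 1 : ℕ):ℝ) * c.H)) * Real.exp (-(((n - j : ℕ):ℝ) * c.H)) := by
      rw [← Real.exp_add, Nat.cast_sub (by omega)]
      push_cast
      congr 1; ring
    rw [e2]; ring

lemma kraft (hk : 1 ≤ k) (n : ℕ) :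
    ∑ m ∈ Finset.Icc 1 n, ((c.S.Ff (c.S.PK A k) m A A).card : ℝ) * Real.exp (-(m * c.H)) ≤ 1 := by
  obtain ⟨v, hv, hR⟩ := kraft_ren (c := c) (A := A) hk
  refine le_trans ?_ (hR.kraft hv (n + 1))
  refine Finset.sum_le_sum_of_subset_of_nonneg ?_ fun i _ _ => hR.g_nonneg i
  intro i hi
  rw [Finset.mem_Icc] at hi
  rw [Finset.mem_range]; omega

end Ctx
end IntervalEnt

namespace IntervalEnt
namespace Ctx
variable {c : Ctx} {A : Fin c.S.d} {k T : ℕ}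

/-- points whose `k`-th return piece (before time `T`) satisfies `R` -/
def Vof (c : Ctx) (A : Fin c.S.d) (k T : ℕ) (R : Set ℝ → Prop) : Set ℝ :=
  {y | ∃ j, j ≤ T ∧ c.S.PK A k j y ∧ R (c.S.Pc j y)}

open Classical in
noncomputable def be (c : Ctx) (A : Fin c.S.d) (k T : ℕ) (R : Set ℝ → Prop) : ℝ :=
  ∑ m ∈ Finset.Icc 1 T, (((c.S.Ff (c.S.PK A k) m A A).filter R).card : ℝ) * Real.exp (-(m * c.H))

lemma Vof_iff {R : Set ℝ → Prop} {m : ℕ} {x : ℝ} (h : c.S.PK A k m x) :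
    x ∈ c.Vof A k T R ↔ m ≤ T ∧ R (c.S.Pc m x) := by
  constructor
  · rintro ⟨j, h1, h2, h3⟩
    obtain rfl := Sys.PK_unique h h2
    exact ⟨h1, h3⟩
  · rintro ⟨h1, h2⟩
    exact ⟨m, h1, h, h2⟩

lemma Vof_sat {R : Set ℝ → Prop} : ∀ j x y, c.S.PK A k j x → y ∈ c.S.Pc j x →
    (x ∈ c.Vof A k T R ↔ y ∈ c.Vof A k T R) := by
  intro j x y h1 h2
  rw [Vof_iff h1, Vof_iff ((Sys.PK_congr j x y h2).1 h1), c.S.Pc_eq h2]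

lemma Vof_open {R : Set ℝ → Prop} : IsOpen (c.Vof A k T R) := by
  rw [isOpen_iff_mem_nhds]
  rintro x ⟨j, h1, h2, h3⟩
  refine mem_of_superset ((c.S.isOpen_Pc j x).mem_nhds (c.S.mem_Pc h2.1.1.1)) fun y hy => ?_
  exact ⟨j, h1, (Sys.PK_congr j x y hy).1 h2, by rw [← c.S.Pc_eq hy]; exact h3⟩

lemma al_Vof {m : Measure ℝ} (hm : c.MM m) (hk : 1 ≤ k) (R : Set ℝ → Prop) :
    c.al m A (c.Vof A k T R) ≤ c.be A k T R * c.al m A univ := by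
  classical
  refine A2 hm hk (kraft hk) Vof_open.measurableSet Vof_sat fun n => ?_
  have key : ∀ m, ∀ J ∈ c.S.Ff (c.S.PK A k) m A A, (pt J ∈ c.Vof A k T R ↔ m ≤ T ∧ R J) := by
    intro m J hJ
    rw [c.S.mem_Ff] at hJ
    have hG := c.S.FP_sub _ _ _ _ hJ
    have hp := pt_mem (c.S.GP_nonempty hG)
    rw [Vof_iff (c.S.FP_mem Sys.PK_congr hJ hp).2.1, ← (c.S.GP_mem hG hp).2.2.2]
  calc _ ≤ ∑ m ∈ (Finset.Icc 1 n).filter (· ≤ T),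
        (((c.S.Ff (c.S.PK A k) m A A).filter R).card : ℝ) * Real.exp (-(m * c.H)) := by
        rw [Finset.sum_filter]
        refine Finset.sum_le_sum fun m _ => ?_
        rw [Finset.filter_congr (key m)]
        split_ifs with h
        · simp only [h, true_and]; exact le_rfl
        · simp only [h, false_and, Finset.filter_false]; simp
    _ ≤ _ := by
        unfold be
        refine Finset.sum_le_sum_of_subset_of_nonneg ?_ fun i _ _ => by positivity
        intro i hi
        rw [Finset.mem_filter, Finset.mem_Icc] at hi
        rw [Finset.mem_Icc]; omega

lemma be_add (hk : 1 ≤ k) {R1 R2 : Set ℝ → Prop} (h : ∀ J : Set ℝ, J.Nonempty → R1 J → ¬ R2 J) :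
    c.be A k T R1 + c.be A k T R2 ≤ 1 := by
  classical
  refine le_trans ?_ (kraft (c := c) (A := A) hk T)
  unfold be
  rw [← Finset.sum_add_distrib]
  refine Finset.sum_le_sum fun m _ => ?_
  rw [← add_mul]
  refine mul_le_mul_of_nonneg_right ?_ (Real.exp_pos _).le
  rw [← Nat.cast_add, ← Finset.card_union_of_disjoint]
  · exact_mod_cast Finset.card_le_card (Finset.union_subset (Finset.filter_subset _ _) (Finset.filter_subset _ _))
  · rw [Finset.disjoint_filter]
    intro J hJ
    rw [c.S.mem_Ff] at hJ
    exact h J (c.S.GP_nonempty (c.S.FP_sub _ _ _ _ hJ))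

lemma be_P (P : Finset ℝ) : c.be A k T (fun J => ∃ p ∈ P, p ∈ J) ≤ P.card * Real.exp (-(k * c.H)) := by
  classical
  have h1 : ∀ m ∈ Finset.Icc 1 T, (((c.S.Ff (c.S.PK A k) m A A).filter (fun J => ∃ p ∈ P, p ∈ J)).card : ℝ) *
      Real.exp (-(m * c.H)) ≤ ∑ p ∈ P, (if c.S.PK A k m p then Real.exp (-(k * c.H)) else 0) := by
    intro m _
    have hsub : ((c.S.Ff (c.S.PK A k) m A A).filter (fun J => ∃ p ∈ P, p ∈ J)) ⊆
        (P.filter fun p => c.S.PK A k m p).image (fun p => c.S.Pc m p) := by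
      intro J hJ
      rw [Finset.mem_filter, c.S.mem_Ff] at hJ
      obtain ⟨hJ, p, hp, hpJ⟩ := hJ
      rw [Finset.mem_image]
      exact ⟨p, Finset.mem_filter.2 ⟨hp, (c.S.FP_mem Sys.PK_congr hJ hpJ).2.1⟩,
        ((c.S.GP_mem (c.S.FP_sub _ _ _ _ hJ) hpJ).2.2.2).symm⟩
    have hcard := (Finset.card_le_card hsub).trans Finset.card_image_le
    rw [← Finset.sum_filter, Finset.sum_const, nsmul_eq_mul]
    rcases (P.filter fun p => c.S.PK A k m p).eq_empty_or_nonempty with he | ⟨p, hp⟩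
    · rw [he, Finset.card_empty] at hcard
      rw [Nat.le_zero.1 hcard, he]; simp
    · have h2 := (Finset.mem_filter.1 hp).2.2
      have h3 := cnt_le (c.S.AG A) m p
      have h4 : (k:ℝ) ≤ m := by exact_mod_cast (by omega : k ≤ m)
      refine mul_le_mul (by exact_mod_cast hcard) ?_ (by positivity) (by positivity)
      rw [Real.exp_le_exp]
      have := mul_le_mul_of_nonneg_right h4 c.H0.le
      linarith
  have h0 : c.be A k T (fun J => ∃ p ∈ P, p ∈ J) ≤
      ∑ m ∈ Finset.Icc 1 T, ∑ p ∈ P, (if c.S.PK A k m p then Real.exp (-(k * c.H)) else 0) := by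
    unfold be
    refine Finset.sum_le_sum fun m hm => le_trans (le_of_eq ?_) (h1 m hm)
    congr
  refine h0.trans ?_
  rw [Finset.sum_comm]
  calc _ ≤ ∑ p ∈ P, Real.exp (-(k * c.H)) := by
        refine Finset.sum_le_sum fun p _ => ?_
        rw [← Finset.sum_filter, Finset.sum_const, nsmul_eq_mul]
        have : ((Finset.Icc 1 T).filter fun m => c.S.PK A k m p).card ≤ 1 := by
          refine Finset.card_le_one.2 fun a ha b hb => ?_
          exact Sys.PK_unique (Finset.mem_filter.1 ha).2 (Finset.mem_filter.1 hb).2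
        have h' : (((Finset.Icc 1 T).filter fun m => c.S.PK A k m p).card : ℝ) ≤ 1 := by exact_mod_cast this
        nlinarith [Real.exp_pos (-(k * c.H))]
    _ = _ := by rw [Finset.sum_const, nsmul_eq_mul]

/-- separation by a finite union of intervals -/
lemma exists_U {m1 m2 : Measure ℝ} [IsProbabilityMeasure m1] [IsProbabilityMeasure m2] (h : m1 ⟂ₘ m2) {δ : ℝ} (hδ : 0 < δ) :
    ∃ (U : Set ℝ) (P : Finset ℝ), IsOpen U ∧ frontier U ⊆ P ∧ m1.real Uᶜ ≤ δ ∧ m2.real U ≤ δ := by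
  obtain ⟨S, hS, h1, h2⟩ := h
  have hδ' : ENNReal.ofReal δ ≠ 0 := by simpa using hδ
  obtain ⟨K, hKS, hK, hKm⟩ := hS.compl.exists_isCompact_sdiff_lt (measure_ne_top m1 _) hδ'
  obtain ⟨O', hSO, hO, hO1, hOm⟩ := hS.compl.exists_isOpen_sdiff_lt (measure_ne_top m2 _) hδ'
  have hcov : ∀ x ∈ K, ∃ r > 0, Metric.ball x r ⊆ O' := fun x hx => Metric.isOpen_iff.1 hO x (hSO (hKS hx))
  choose! r hr hrO using hcov
  obtain ⟨t, ht, hKt⟩ := hK.elim_nhds_subcover (fun x => Metric.ball x (r x)) fun x hx => Metric.ball_mem_nhds x (hr x hx)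
  refine ⟨⋃ x ∈ t, Metric.ball x (r x), t.image (fun x => x - r x) ∪ t.image (fun x => x + r x),
    isOpen_biUnion fun x _ => Metric.isOpen_ball, ?_, ?_, ?_⟩
  · intro y hy
    have hUo : IsOpen (⋃ x ∈ t, Metric.ball x (r x)) := isOpen_biUnion fun x _ => Metric.isOpen_ball
    rw [hUo.frontier_eq, Finset.closure_biUnion] at hy
    obtain ⟨hy1, hy2⟩ := hy
    simp only [mem_iUnion] at hy1 hy2
    obtain ⟨x, hx, hyx⟩ := hy1
    have h3 := Metric.closure_ball_subset_closedBall hyx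
    rw [Metric.mem_closedBall, Real.dist_eq] at h3
    have h4 : ¬ |y - x| < r x := fun h' => hy2 ⟨x, hx, by rw [Metric.mem_ball, Real.dist_eq]; exact h'⟩
    have h5 : |y - x| = r x := le_antisymm h3 (not_lt.1 h4)
    simp only [Finset.coe_union, Finset.coe_image, mem_union, mem_image]
    rcases abs_choice (y - x) with h6 | h6
    · right; exact ⟨x, hx, by linarith⟩
    · left; exact ⟨x, hx, by linarith⟩
  · have h3 : m1 (⋃ x ∈ t, Metric.ball x (r x))ᶜ ≤ ENNReal.ofReal δ := by
      calc m1 (⋃ x ∈ t, Metric.ball x (r x))ᶜ ≤ m1 (S ∪ Sᶜ \ K) := by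
            refine measure_mono fun x hx => ?_
            by_cases hxS : x ∈ S
            · exact Or.inl hxS
            · exact Or.inr ⟨hxS, fun hxK => hx (hKt hxK)⟩
        _ ≤ m1 S + m1 (Sᶜ \ K) := measure_union_le _ _
        _ ≤ _ := by rw [h1, zero_add]; exact hKm.le
    exact ENNReal.toReal_le_of_le_ofReal hδ.le h3
  · have h3 : m2 (⋃ x ∈ t, Metric.ball x (r x)) ≤ ENNReal.ofReal δ := by
      calc m2 (⋃ x ∈ t, Metric.ball x (r x)) ≤ m2 (Sᶜ ∪ O' \ Sᶜ) := by
            refine measure_mono fun x hx => ?_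
            simp only [mem_iUnion] at hx
            obtain ⟨y, hy, hxy⟩ := hx
            have := hrO y (ht y hy) hxy
            by_cases hxS : x ∈ Sᶜ
            · exact Or.inl hxS
            · exact Or.inr ⟨this, hxS⟩
        _ ≤ m2 Sᶜ + m2 (O' \ Sᶜ) := measure_union_le _ _
        _ ≤ _ := by rw [h2, zero_add]; exact hOm.le
    exact ENNReal.toReal_le_of_le_ofReal hδ.le h3

lemma frontier_meet {U J : Set ℝ} (hU : IsOpen U) (hJ : IsPreconnected J) (h1 : ¬ J ⊆ U) (h2 : ¬ Disjoint J U) : (J ∩ frontier U).Nonempty := by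
  by_contra hne
  rw [not_nonempty_iff_eq_empty] at hne
  have hcl : ∀ x ∈ J, x ∈ closure U → x ∈ U := by
    intro x hx hc
    by_contra hxU
    have : x ∈ J ∩ frontier U := ⟨hx, by rw [hU.frontier_eq]; exact ⟨hc, hxU⟩⟩
    rw [hne] at this
    exact this
  obtain ⟨x, hx, hxU⟩ := not_subset.1 h1
  obtain ⟨y, hy, hyU⟩ := not_disjoint_iff.1 h2
  obtain ⟨z, -, hz1, hz2⟩ := hJ U (closure U)ᶜ hU isClosed_closure.isOpen_compl
    (fun z hz => by
      by_cases hzc : z ∈ closure U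
      · exact Or.inl (hcl z hz hzc)
      · exact Or.inr hzc) ⟨y, hy, hyU⟩ ⟨x, hx, fun h => hxU (hcl x hx h)⟩
  exact hz2 (subset_closure hz1)

lemma sep {m1 m2 : Measure ℝ} (hm1 : c.MM m1) (hm2 : c.MM m2) (h : m1 ⟂ₘ m2) (ha1 : 0 < c.al m1 A univ)
    (ha2 : 0 < c.al m2 A univ) : False := by
  have := hm1.prob
  have := hm2.prob
  set a1 := c.al m1 A univ with ha1'
  set a2 := c.al m2 A univ with ha2'
  have ha11 : a1 ≤ 1 := (c.al_le m1 A univ 0).trans measureReal_le_one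
  have ha21 : a2 ≤ 1 := (c.al_le m2 A univ 0).trans measureReal_le_one
  set δ := min a1 a2 / 7 with hδ
  have hδ0 : 0 < δ := by have := lt_min ha1 ha2; positivity
  have hδ1 : 7 * δ ≤ a1 := by have := min_le_left a1 a2; rw [hδ]; linarith
  have hδ2 : 7 * δ ≤ a2 := by have := min_le_right a1 a2; rw [hδ]; linarith
  obtain ⟨U, P, hU, hP, hU1, hU2⟩ := exists_U h hδ0
  obtain ⟨k, hk1, hk⟩ : ∃ k : ℕ, 1 ≤ k ∧ P.card * Real.exp (-(k * c.H)) ≤ δ := by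
    obtain ⟨k, hk⟩ := exists_nat_gt (P.card / (δ * c.H))
    have hH0 := c.H0
    refine ⟨k + 1, by omega, ?_⟩
    rw [Real.exp_neg, ← div_eq_mul_inv, div_le_iff₀ (Real.exp_pos _)]
    rw [div_lt_iff₀ (by positivity)] at hk
    have h1 := Real.add_one_le_exp (((k + 1 : ℕ):ℝ) * c.H)
    have h2 := mul_le_mul_of_nonneg_left h1 hδ0.le
    push_cast at h2 ⊢
    have h3 : 0 < δ * c.H := by positivity
    nlinarith
  obtain ⟨T, hT⟩ := exists_nat_gt (k / δ)
  have hT0 : (0:ℝ) < T := lt_of_le_of_lt (by positivity) hT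
  rw [div_lt_iff₀ hδ0] at hT
  have hE : MeasurableSet {y | cnt (c.S.AG A) T y < k} := cnt_set AG_meas T T fun a _ => a < k
  have hfew : ∀ m : Measure ℝ, c.MM m → c.al m A {y | cnt (c.S.AG A) T y < k} ≤ δ := by
    intro m hm
    have := few (A := A) (k := k) hm T
    have h2 : T * c.al m A {y | cnt (c.S.AG A) T y < k} ≤ T * δ := by linarith
    exact le_of_mul_le_mul_left h2 hT0
  set V1 := c.Vof A k T (fun J => J ⊆ U) with hV1
  set V2 := c.Vof A k T (fun J => Disjoint J U) with hV2
  set V3 := c.Vof A k T (fun J => ∃ p ∈ P, p ∈ J) with hV3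
  have hcov : ∀ m : Measure ℝ, c.MM m → c.al m A univ ≤ c.al m A V1 + c.al m A V2 + c.al m A V3 + δ := by
    intro m hm
    have hs := c.al_sub Finset.univ hm A MeasurableSet.univ ![V1, V2, V3, {y | cnt (c.S.AG A) T y < k}] ?_ ?_
    · simp only [Fin.sum_univ_four] at hs
      have := hfew m hm
      refine hs.trans ?_
      exact add_le_add_right this _
    · intro i _
      fin_cases i
      · show MeasurableSet V1
        exact  Vof_open.measurableSet
      · show MeasurableSet V2
        exact  Vof_open.measurableSet
      · show MeasurableSet V3
        exact  Vof_open.measurableSet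
      · exact hE
    · intro x hx _
      by_cases hc : cnt (c.S.AG A) T x < k
      · exact ⟨3, Finset.mem_univ _, hc⟩
      obtain ⟨j, h1, h2, h3⟩ := cnt_exists hk1 (not_lt.1 hc)
      by_cases hc1 : c.S.Pc j x ⊆ U
      · exact ⟨0, Finset.mem_univ _, j, h2, h3, hc1⟩
      by_cases hc2 : Disjoint (c.S.Pc j x) U
      · exact ⟨1, Finset.mem_univ _, j, h2, h3, hc2⟩
      obtain ⟨p, hp1, hp2⟩ := frontier_meet hU isPreconnected_connectedComponentIn hc1 hc2
      exact ⟨2, Finset.mem_univ _, j, h2, h3, p, hP hp2, hp1⟩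
  have h3 : ∀ m : Measure ℝ, c.MM m → c.al m A V3 ≤ δ := by
    intro m hm
    have := hm.prob
    have h0 : c.al m A univ ≤ 1 := (c.al_le m A univ 0).trans measureReal_le_one
    have h1 := al_Vof (A := A) (k := k) (T := T) hm hk1 (fun J => ∃ p ∈ P, p ∈ J)
    have h2 := be_P (c := c) (A := A) (k := k) (T := T) P
    have h4 := c.al_nonneg m A univ
    have h5 := mul_le_mul_of_nonneg_right (h2.trans hk) h4
    nlinarith
  have hsub1 : V1 ⊆ U := by
    rintro y ⟨j, -, h2, h3⟩
    exact h3 (c.S.mem_Pc h2.1.1.1)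
  have hsub2 : V2 ⊆ Uᶜ := by
    rintro y ⟨j, -, h2, h3⟩
    exact fun hy => disjoint_left.1 h3 (c.S.mem_Pc h2.1.1.1) hy
  have e1 : c.al m1 A V2 ≤ δ :=
    (c.al_le_real hm1 A Vof_open.measurableSet).trans ((measureReal_mono hsub2).trans hU1)
  have e2 : c.al m2 A V1 ≤ δ :=
    (c.al_le_real hm2 A Vof_open.measurableSet).trans ((measureReal_mono hsub1).trans hU2)
  have b1 := al_Vof (A := A) (k := k) (T := T) hm1 hk1 (fun J => J ⊆ U)
  have b2 := al_Vof (A := A) (k := k) (T := T) hm2 hk1 (fun J => Disjoint J U)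
  have b3 : c.be A k T (fun J => J ⊆ U) + c.be A k T (fun J => Disjoint J U) ≤ 1 := by
    refine be_add hk1 fun J hJ h1 h2 => ?_
    obtain ⟨x, hx⟩ := hJ
    exact disjoint_left.1 h2 hx (h1 hx)
  have f1 := hcov m1 hm1
  have f2 := hcov m2 hm2
  have g1 := h3 m1 hm1
  have g2 := h3 m2 hm2
  rw [← ha1'] at b1 f1
  rw [← ha2'] at b2 f2
  set β1 := c.be A k T (fun J => J ⊆ U)
  set β2 := c.be A k T (fun J => Disjoint J U)
  have i1 : a1 * (1 - β1) ≤ a1 * (3 / 7) := by linarith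
  have i2 : a2 * (1 - β2) ≤ a2 * (3 / 7) := by linarith
  have j1 := le_of_mul_le_mul_left i1 ha1
  have j2 := le_of_mul_le_mul_left i2 ha2
  linarith

end Ctx
end IntervalEnt

namespace IntervalEnt

lemma ergodic_sing {X : Type*} [MeasurableSpace X] {f : X → X} {μ ν : Measure X} [IsProbabilityMeasure μ]
    [IsProbabilityMeasure ν] (hμ : Ergodic f μ) (hν : Ergodic f ν) (hne : μ ≠ ν) : μ ⟂ₘ ν := by
  have hmp : MeasurePreserving f (ν.withDensity (μ.rnDeriv ν)) (ν.withDensity (μ.rnDeriv ν)) :=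
    hμ.toMeasurePreserving.withDensity_rnDeriv hν.toMeasurePreserving
  have : IsFiniteMeasure (ν.withDensity (μ.rnDeriv ν)) :=
    isFiniteMeasure_withDensity (Measure.lintegral_rnDeriv_lt_top μ ν).ne
  obtain ⟨a, ha⟩ := hν.eq_smul_of_absolutelyContinuous hmp (withDensity_absolutelyContinuous _ _)
  by_cases h0 : a = 0
  · rw [h0, zero_smul] at ha
    have h1 := Measure.haveLebesgueDecomposition_add μ ν
    rw [ha, add_zero] at h1
    rw [h1]
    exact Measure.mutuallySingular_singularPart μ ν
  · exfalso
    refine hne (Ergodic.eq_of_absolutelyContinuous hμ hν.toMeasurePreserving ?_).symm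
    refine Measure.AbsolutelyContinuous.mk fun s _ hs => ?_
    have h1 : (ν.withDensity (μ.rnDeriv ν)) s ≤ μ s := Measure.withDensity_rnDeriv_le μ ν s
    rw [hs, ha, Measure.smul_apply, nonpos_iff_eq_zero, smul_eq_mul, mul_eq_zero] at h1
    exact h1.resolve_left h0

theorem Ctx.finite (c : Ctx) : {μ : Measure (Icc (0:ℝ) 1) | IsMaxMeasure c.f μ}.Finite := by
  have hMM : ∀ μ, IsMaxMeasure c.f μ → c.MM (μ.map Subtype.val) := fun μ hμ => c.MM_of μ hμ.1 (c.max_ge μ hμ)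
  have hex : ∀ μ : Measure (Icc (0:ℝ) 1), ∃ A, IsMaxMeasure c.f μ → 0 < c.al (μ.map Subtype.val) A univ := by
    intro μ
    by_cases hμ : IsMaxMeasure c.f μ
    · obtain ⟨A, hA⟩ := c.exists_al (hMM μ hμ)
      exact ⟨A, fun _ => hA⟩
    · exact ⟨⟨0, c.S.hd⟩, fun h => absurd h hμ⟩
  choose Φ hΦ using hex
  refine Set.Finite.of_finite_image (f := Φ) (Set.toFinite _) ?_
  intro μ hμ ν hν heq
  by_contra hne
  have := hμ.1.1
  have := hν.1.1
  have hs := ergodic_sing hμ.2.1 hν.2.1 hne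
  have hs' := (MeasurableEmbedding.subtype_coe (measurableSet_Icc (a := (0:ℝ)) (b := 1))).mutuallySingular_map hs
  exact sep (hMM μ hμ) (hMM ν hν) hs' (hΦ μ hμ) (heq ▸ hΦ ν hν)

end IntervalEnt

namespace IntervalEnt

lemma contDiff_iter {F : ℝ → ℝ} (hF : ContDiff ℝ (⊤ : ℕ∞) F) (n : ℕ) : ContDiff ℝ (⊤ : ℕ∞) F^[n] := by
  induction n with
  | zero => exact contDiff_id
  | succ n ih => rw [Function.iterate_succ]; exact ih.comp hF

lemma deriv_iter {F : ℝ → ℝ} (hF : ContDiff ℝ (⊤ : ℕ∞) F) (hmaps : MapsTo F (Icc (0:ℝ) 1) (Icc (0:ℝ) 1)) {L : ℝ}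
    (hL : ∀ x ∈ Icc (0:ℝ) 1, |deriv F x| ≤ L) (n : ℕ) : ∀ x ∈ Icc (0:ℝ) 1, |deriv F^[n] x| ≤ L ^ n := by
  induction n with
  | zero => intro x _; simp
  | succ n ih =>
    intro x hx
    rw [Function.iterate_succ, deriv_comp x ((contDiff_iter hF n).differentiable (by simp) _)
      (hF.differentiable (by simp) x), abs_mul, pow_succ]
    exact mul_le_mul (ih _ (hmaps hx)) (hL x hx) (abs_nonneg _) (pow_nonneg ((abs_nonneg _).trans (hL x hx)) _)

lemma exists_bound {φ : ℝ → ℝ} (hφ : Continuous φ) : ∃ B, 1 ≤ B ∧ ∀ x ∈ Icc (0:ℝ) 1, |φ x| ≤ B := by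
  obtain ⟨B, hB⟩ := (isCompact_Icc (a := (0:ℝ)) (b := 1)).exists_bound_of_continuousOn hφ.continuousOn
  exact ⟨max 1 B, le_max_left _ _, fun x hx => (hB x hx).trans (le_max_right _ _)⟩

lemma exists_Sys {F : ℝ → ℝ} (hF : ContDiff ℝ (⊤ : ℕ∞) F) (hmaps : MapsTo F (Icc (0:ℝ) 1) (Icc (0:ℝ) 1)) {L : ℝ}
    (hL1 : 1 ≤ L) (hL : ∀ x ∈ Icc (0:ℝ) 1, |deriv F x| ≤ L) (q : ℕ) (hq : 2 ≤ q) :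
    ∃ S : Sys, S.g = F^[q] ∧ S.Gam = (2 * q + 3) * L ^ 2 + 1 := by
  have hg := contDiff_iter hF q
  have hq0 : (2:ℝ) ≤ q := by exact_mod_cast hq
  obtain ⟨B, hB1, hB⟩ := exists_bound (hg.continuous_iteratedDeriv q (by exact_mod_cast le_top))
  set K := (2 * q * (2 * B) ^ (1 / (q:ℝ))) ^ 2 with hK
  have hK0 : 0 ≤ K := by positivity
  obtain ⟨d, hd⟩ := exists_nat_gt K
  have hdpos : (0:ℝ) < d := hK0.trans_lt hd
  have hsig0 : (0:ℝ) < 2 / q := by positivity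
  have hsig1 : (2:ℝ) / q ≤ 1 := by rw [div_le_one (by linarith)]; exact hq0
  refine ⟨{ g := F^[q], d := d, Lam := L ^ q, Gam := (2 * q + 3) * L ^ 2 + 1, sig := 2 / q
            hg := hg
            maps := hmaps.iterate q
            hd := by exact_mod_cast hdpos
            hLam1 := one_le_pow₀ hL1
            hLam := deriv_iter hF hmaps hL q
            hGam := by
              have : 0 ≤ (2 * (q:ℝ) + 3) * L ^ 2 := by positivity
              linarith
            hsig0 := hsig0
            hsig1 := hsig1
            hstep := ?_ }, rfl, rfl⟩
  intro α β hαβ hα hβ hl G h1 h2 h3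
  have hos := one_step F^[q] hg q (by omega) B (L ^ q) α β hαβ hα hβ (by linarith) hB
    (deriv_iter hF hmaps hL q) G h1 h2 h3
  refine hos.trans ?_
  have hl0 : 0 < β - α := by linarith
  have hl1 : β - α ≤ 1 := by linarith
  have hLp : (L ^ q) ^ (2 / (q:ℝ)) = L ^ 2 := by
    rw [← Real.rpow_natCast L q, ← Real.rpow_mul (by linarith), ← Real.rpow_natCast L 2]
    congr 1
    field_simp
    norm_num
  rw [Real.mul_rpow (by positivity) hl0.le, hLp]
  have hp : β - α ≤ (β - α) ^ (2 / (q:ℝ)) := by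
    have := Real.rpow_le_rpow_of_exponent_ge hl0 hl1 hsig1
    rwa [Real.rpow_one] at this
  have hKl : K * (β - α) ≤ 1 := by
    rw [le_div_iff₀ hdpos] at hl
    nlinarith
  have he : (2 * q * (β - α) * (2 * B) ^ (1 / (q:ℝ))) ^ 2 = K * (β - α) * (β - α) := by rw [hK]; ring
  rw [he]
  have : K * (β - α) * (β - α) ≤ 1 * (β - α) := mul_le_mul_of_nonneg_right hKl hl0.le
  nlinarith

lemma exists_q {h L : ℝ} (hh : 0 < h) (hL : 1 ≤ L) :
    ∃ q : ℕ, 2 ≤ q ∧ 2 * ((2 * q + 3) * L ^ 2 + 1) < Real.exp (q * h / 2) := by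
  obtain ⟨n, hn⟩ := exists_nat_gt (96 * L ^ 2 / h ^ 2)
  rw [div_lt_iff₀ (by positivity)] at hn
  refine ⟨n + 2, by omega, ?_⟩
  have h1 := Real.quadratic_le_exp_of_nonneg (x := ((n + 2 : ℕ) : ℝ) * h / 2) (by positivity)
  refine lt_of_lt_of_le ?_ h1
  set Q : ℝ := ((n + 2 : ℕ) : ℝ) with hQ
  have hQn : Q = n + 2 := by rw [hQ]; push_cast; ring
  have hn0 : (0:ℝ) ≤ n := Nat.cast_nonneg n
  have hQ1 : 2 ≤ Q := by linarith
  have hL2 : 1 ≤ L ^ 2 := one_le_pow₀ hL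
  have h2 : 96 * L ^ 2 ≤ Q * h ^ 2 := by nlinarith [sq_nonneg h]
  have h3 : Q * (96 * L ^ 2) ≤ Q * (Q * h ^ 2) := mul_le_mul_of_nonneg_left h2 (by linarith)
  have h4 : 2 * L ^ 2 ≤ Q * L ^ 2 := mul_le_mul_of_nonneg_right hQ1 (by linarith)
  have h5 : 0 ≤ Q * h / 2 := by positivity
  nlinarith

theorem exists_Ctx (F : ℝ → ℝ) (hF : ContDiff ℝ (⊤ : ℕ∞) F) (hmaps : MapsTo F (Icc (0:ℝ) 1) (Icc (0:ℝ) 1))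
    (f : Icc (0:ℝ) 1 → Icc (0:ℝ) 1) (hf : ∀ x, (f x : ℝ) = F x) (hpos : 0 < htop f) : ∃ c : Ctx, c.f = f := by
  obtain ⟨L, hL1, hL⟩ := exists_bound (hF.continuous_deriv (by simp))
  have hlip : ∀ x y, dist (f x) (f y) ≤ L * dist x y := by
    intro x y
    rw [Subtype.dist_eq, Subtype.dist_eq, hf, hf, dist_eq_norm, dist_eq_norm]
    exact (convex_Icc (0:ℝ) 1).norm_image_sub_le_of_norm_deriv_le
      (fun z _ => hF.differentiable (by simp) z) hL y.2 x.2
  have htop1 := htop_lt_top f L hL1 hlip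
  have hbot : htop f ≠ ⊥ := (bot_le.trans_lt hpos).ne'
  have hh : htop f = ((htop f).toReal : EReal) := (EReal.coe_toReal htop1 hbot).symm
  have hpos' : 0 < (htop f).toReal := by rw [hh] at hpos; exact_mod_cast hpos
  obtain ⟨q, hq, hG⟩ := exists_q hpos' hL1
  obtain ⟨S, hSg, hSG⟩ := exists_Sys hF hmaps hL1 hL q hq
  refine ⟨{ S := S, f := f, q := q, h := (htop f).toReal, hfg := ?_, hq := by omega, hf := ?_, hh := hh
            hpos := hpos', hGam := by rw [hSG]; exact hG }, rfl⟩
  · intro x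
    rw [hSg]
    have : Function.Semiconj (Subtype.val : Icc (0:ℝ) 1 → ℝ) f F := hf
    exact this.iterate_right q x
  · refine Continuous.subtype_mk (f := fun x => (f x : ℝ)) ?_ (fun x => (f x).2)
    simp_rw [hf]
    exact hF.continuous.comp continuous_subtype_val

end IntervalEnt

/-- A `C^∞` map `f : [0,1] → [0,1]` with `h_top(f) > 0` has finitely many
maximum measures, and its periodic points satisfy a multiplicative lower bound. -/
theorem stmt_0
    (F : ℝ → ℝ) (hF : ContDiff ℝ (⊤ : ℕ∞) F)
    (hmaps : Set.MapsTo F (Set.Icc (0:ℝ) 1) (Set.Icc (0:ℝ) 1))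
    (f : Set.Icc (0:ℝ) 1 → Set.Icc (0:ℝ) 1)
    (hf : ∀ x : Set.Icc (0:ℝ) 1, (f x : ℝ) = F (x : ℝ))
    (hpos : 0 < htop f) :
    {μ : Measure (Set.Icc (0:ℝ) 1) | IsMaxMeasure f μ}.Finite ∧ MultLowerBound f := by
  obtain ⟨c, rfl⟩ := IntervalEnt.exists_Ctx F hF hmaps f hf hpos
  exact ⟨c.finite, c.mult⟩
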